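/- For every integer n ≥ 0, writing N_i = N(i,11,11n) and M_i = M(i,11,11n), the following hold: N_0 + 2N_1 + M_1 ≥ 2N_2 + N_4 + M_0; N_0 + 2N_1 + 3N_2 + M_1 ≥ 3N_3 + 3N_5 + M_0; 2N_2 + N_3 + N_5 ≥ 4N_4; and N_2 + 5N_3 + 3N_4 + M_0 ≥ N_0 + 2N_1 + 6N_5 + M_1. -/

import Mathlib

/-- `p n`: the number of partitions of `n`. -/
def partitionCount (n : ℕ) : ℕ := Fintype.card (Nat.Partition n)

/-- The rank of a partition: its largest part minus its number of parts
(the empty partition has rank 0). -/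
def partitionRank {n : ℕ} (π : Nat.Partition n) : ℤ :=
  (π.parts.sup : ℤ) - (Multiset.card π.parts : ℤ)

/-- The crank of a partition `π`: if `π` has no parts equal to 1, it is the largest part;
otherwise it is (number of parts larger than the number of ones) − (number of ones). -/
def partitionCrank {n : ℕ} (π : Nat.Partition n) : ℤ :=
  if π.parts.count 1 = 0 then (π.parts.sup : ℤ)
  else ((π.parts.filter fun x => π.parts.count 1 < x).card : ℤ) - (π.parts.count 1 : ℤ)

/-- `rankCount a r n` = `N(a,r,n)`: the number of partitions of `n` whose rank is
congruent to `a` modulo `r`. -/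
def rankCount (a r : ℤ) (n : ℕ) : ℕ :=
  (Finset.univ.filter fun π : Nat.Partition n => partitionRank π % r = a % r).card

/-- `crankCount a n` = `M(a,11,n)`: for `n ≠ 1`, the number of partitions of `n` whose crank
is congruent to `a` modulo 11; at `n = 1` the standard convention `M(0,11,1) = −1`,
`M(1,11,1) = M(10,11,1) = 1`, and `M(a,11,1) = 0` otherwise. -/
def crankCount (a : ℤ) (n : ℕ) : ℤ :=
  if n = 1 then
    if a % 11 = 0 then -1
    else if a % 11 = 1 ∨ a % 11 = 10 then 1
    else 0
  else ((Finset.univ.filter fun π : Nat.Partition n => partitionCrank π % 11 = a % 11).card : ℤ)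

namespace RankCrank
open Filter Topology

/-- The infinite `q`-Pochhammer symbol `(z; p)_∞`. -/
noncomputable def qp (p z : ℂ) : ℂ := ∏' n : ℕ, (1 - z * p ^ n)

/-- The theta function `(z; p)_∞ (p / z; p)_∞ (p; p)_∞`. -/
noncomputable def jt (p z : ℂ) : ℂ := qp p z * qp p (p / z) * qp p p

section
variable {p : ℂ}

lemma qp_summable (hp : ‖p‖ < 1) (z : ℂ) : Summable fun n : ℕ => ‖-(z * p ^ n)‖ := by
  simp only [norm_neg, norm_mul, norm_pow]
  exact (summable_geometric_of_lt_one (norm_nonneg _) hp).mul_left _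

lemma qp_multipliable (hp : ‖p‖ < 1) (z : ℂ) : Multipliable fun n : ℕ => 1 - z * p ^ n := by
  simpa only [sub_eq_add_neg] using multipliable_one_add_of_summable (qp_summable hp z)

lemma qp_eq_mul (hp : ‖p‖ < 1) (z : ℂ) : qp p z = (1 - z) * qp p (z * p) := by
  have h := tprod_eq_zero_mul' (f := fun n : ℕ => 1 - z * p ^ n)
    (by simpa only [pow_succ', mul_assoc] using qp_multipliable hp (z * p))
  rw [qp, h, qp]
  simp only [pow_zero, mul_one, pow_succ', mul_assoc]

lemma qp_def' (p : ℂ) : qp p = fun z => ∏' n : ℕ, (1 - z * p ^ n) := rfl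

lemma qp_differentiable (hp : ‖p‖ < 1) : Differentiable ℂ (qp p) := by
  intro z
  have hd : DifferentiableOn ℂ (qp p) (Metric.ball 0 (‖z‖ + 1)) := by
    have hm : HasProdLocallyUniformlyOn (fun (n : ℕ) (w : ℂ) => 1 + -(w * p ^ n))
        (fun w => ∏' n : ℕ, (1 + -(w * p ^ n))) (Metric.ball 0 (‖z‖ + 1)) := by
      refine Summable.hasProdLocallyUniformlyOn_nat_one_add Metric.isOpen_ball
        ((summable_geometric_of_lt_one (norm_nonneg _) hp).mul_left (‖z‖ + 1))
        (Filter.Eventually.of_forall fun n w hw => ?_) (fun n => by fun_prop)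
      rw [norm_neg, norm_mul, norm_pow]
      have : ‖w‖ ≤ ‖z‖ + 1 := by simpa using (mem_ball_zero_iff.mp hw).le
      gcongr
    have := hm.differentiableOn (Filter.Eventually.of_forall fun s => by fun_prop) Metric.isOpen_ball
    simpa only [qp_def', sub_eq_add_neg] using this
  exact hd.differentiableAt (Metric.isOpen_ball.mem_nhds (by simp))

lemma qp_ne_zero (hp : ‖p‖ < 1) {z : ℂ} (h : ∀ n : ℕ, z * p ^ n ≠ 1) : qp p z ≠ 0 := by
  have := tprod_one_add_ne_zero_of_summable (f := fun n : ℕ => -(z * p ^ n))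
    (fun n => by rw [← sub_eq_add_neg]; exact sub_ne_zero.mpr (h n).symm)
    (by simpa using qp_summable hp z)
  simpa only [qp, sub_eq_add_neg] using this

lemma qp_self_ne_zero (hp : ‖p‖ < 1) : qp p p ≠ 0 := by
  refine qp_ne_zero hp fun n h => ?_
  have h1 : ‖p ^ (n + 1)‖ = 1 := by rw [pow_succ', h]; simp
  rw [norm_pow] at h1
  have := pow_lt_one₀ (norm_nonneg p) hp (Nat.succ_ne_zero n)
  exact absurd h1 this.ne

@[simp] lemma qp_one (p : ℂ) : qp p 1 = 0 := by
  refine tprod_of_exists_eq_zero ⟨0, by simp⟩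

lemma jt_mul_base (hp : ‖p‖ < 1) (hp0 : p ≠ 0) {z : ℂ} (hz : z ≠ 0) :
    jt p (z * p) = -z⁻¹ * jt p z := by
  have h1 := qp_eq_mul hp z
  have h2 := qp_eq_mul hp z⁻¹
  have e1 : p / (z * p) = z⁻¹ := by field_simp
  have e2 : z⁻¹ * p = p / z := by field_simp
  rw [e2] at h2
  simp only [jt, e1]
  rw [h1, h2]
  field_simp
  ring

lemma jt_inv (hp : ‖p‖ < 1) {z : ℂ} (hz : z ≠ 0) :
    jt p z⁻¹ = -z⁻¹ * jt p z := by
  have h1 := qp_eq_mul hp z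
  have h2 := qp_eq_mul hp z⁻¹
  have e2 : z⁻¹ * p = p / z := by field_simp
  have e3 : p / z⁻¹ = z * p := by field_simp
  rw [e2] at h2
  simp only [jt, e3]
  rw [h1, h2]
  field_simp
  ring

@[simp] lemma jt_one (p : ℂ) : jt p 1 = 0 := by simp [jt]

lemma jt_ne_zero (hp : ‖p‖ < 1) {z : ℂ} (hz : z ≠ 0) (h : ∀ n : ℤ, z ≠ p ^ n) :
    jt p z ≠ 0 := by
  refine mul_ne_zero (mul_ne_zero (qp_ne_zero hp fun n hn => ?_) (qp_ne_zero hp fun n hn => ?_))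
    (qp_self_ne_zero hp)
  · apply h (-n)
    rw [zpow_neg, zpow_natCast]
    exact eq_inv_of_mul_eq_one_left hn
  · apply h (n + 1)
    have : p ^ (n + 1) = z := by
      field_simp at hn
      rw [pow_succ']; exact hn
    rw [← this]; norm_cast

lemma jt_differentiableAt (hp : ‖p‖ < 1) {z : ℂ} (hz : z ≠ 0) : DifferentiableAt ℂ (jt p) z := by
  unfold jt
  have := qp_differentiable hp
  refine ((this z).mul ?_).mul_const _
  exact (this _).comp z (by fun_prop (disch := exact hz))

/-- The theta function with its zero at `1` divided out. -/
noncomputable def jg (p z : ℂ) : ℂ := qp p (z * p) * qp p (p / z) * qp p p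

lemma jt_eq_jg (hp : ‖p‖ < 1) (z : ℂ) : jt p z = (1 - z) * jg p z := by
  rw [jt, jg, qp_eq_mul hp z]; ring

@[simp] lemma jg_one (p : ℂ) : jg p 1 = qp p p ^ 3 := by simp [jg]; ring

lemma jg_inv (p z : ℂ) : jg p z⁻¹ = jg p z := by
  simp only [jg, div_eq_mul_inv, inv_inv, mul_comm p]; ring

lemma jg_differentiableAt (hp : ‖p‖ < 1) {z : ℂ} (hz : z ≠ 0) : DifferentiableAt ℂ (jg p) z := by
  unfold jg
  have := qp_differentiable hp
  refine (DifferentiableAt.mul ?_ ?_).mul_const _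
  · exact (this _).comp z (by fun_prop)
  · exact (this _).comp z (by fun_prop (disch := exact hz))

lemma jg_deriv_one (hp : ‖p‖ < 1) : HasDerivAt (jg p) 0 1 := by
  have h := (jg_differentiableAt hp one_ne_zero).hasDerivAt
  have h2 : HasDerivAt (fun z : ℂ => jg p z⁻¹) (deriv (jg p) 1 * (-(1 ^ 2)⁻¹)) 1 :=
    HasDerivAt.comp (h₂ := jg p) (1 : ℂ) (by simpa using h) (hasDerivAt_inv one_ne_zero)
  simp only [jg_inv] at h2
  have := h.unique h2
  have h0 : deriv (jg p) 1 = 0 := by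
    simp at this; exact self_eq_neg.mp this
  rwa [h0] at h

end
end RankCrank

namespace RankCrank
open Filter Topology

/-- `F` is differentiable on a punctured neighbourhood of `a`, with at most a simple pole at `a`,
and `(z - a) F z` tends to `r`. -/
def SimplePole (F : ℂ → ℂ) (a r : ℂ) : Prop :=
  (∀ᶠ z in 𝓝[≠] a, DifferentiableAt ℂ F z) ∧ Tendsto (fun z => (z - a) * F z) (𝓝[≠] a) (𝓝 r)

namespace SimplePole
variable {F G g : ℂ → ℂ} {a r t : ℂ}

lemma add (hF : SimplePole F a r) (hG : SimplePole G a t) :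
    SimplePole (fun z => F z + G z) a (r + t) :=
  ⟨(hF.1.and hG.1).mono fun _ h => h.1.add h.2, by simpa only [mul_add] using hF.2.add hG.2⟩

lemma sub (hF : SimplePole F a r) (hG : SimplePole G a t) :
    SimplePole (fun z => F z - G z) a (r - t) :=
  ⟨(hF.1.and hG.1).mono fun _ h => h.1.sub h.2, by simpa only [mul_sub] using hF.2.sub hG.2⟩

lemma mul_of_differentiable (hg : ∀ᶠ z in 𝓝 a, DifferentiableAt ℂ g z) (hF : SimplePole F a r) :
    SimplePole (fun z => g z * F z) a (g a * r) := by
  refine ⟨((hg.filter_mono nhdsWithin_le_nhds).and hF.1).mono fun _ h => h.1.mul h.2, ?_⟩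
  have h1 : Tendsto g (𝓝[≠] a) (𝓝 (g a)) :=
    hg.self_of_nhds.continuousAt.tendsto.mono_left nhdsWithin_le_nhds
  refine (h1.mul hF.2).congr fun z => by ring

lemma const_mul (c : ℂ) (hF : SimplePole F a r) : SimplePole (fun z => c * F z) a (c * r) :=
  mul_of_differentiable (g := fun _ => c) (Eventually.of_forall fun _ => by fun_prop) hF

lemma of_differentiable (hg : ∀ᶠ z in 𝓝 a, DifferentiableAt ℂ g z) : SimplePole g a 0 := by
  refine ⟨hg.filter_mono nhdsWithin_le_nhds, ?_⟩
  have h1 : Tendsto (fun z => (z - a) * g z) (𝓝 a) (𝓝 ((a - a) * g a)) :=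
    ((continuous_id.sub continuous_const).tendsto a).mul hg.self_of_nhds.continuousAt.tendsto
  simp only [sub_self, zero_mul] at h1
  exact h1.mono_left nhdsWithin_le_nhds

lemma congr (hF : SimplePole F a r) (h : ∀ᶠ z in 𝓝[≠] a, F z = G z) : SimplePole G a r := by
  refine ⟨?_, hF.2.congr' (h.mono fun z hz => by rw [hz])⟩
  have h' : ∀ᶠ z in 𝓝[≠] a, ∀ᶠ w in 𝓝 z, F w = G w := by
    obtain ⟨u, hu, hu', hs⟩ := mem_nhdsWithin.mp h
    refine mem_nhdsWithin.mpr ⟨u, hu, hu', fun z hz => ?_⟩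
    have : u ∩ {a}ᶜ ∈ 𝓝 z := (hu.inter isOpen_compl_singleton).mem_nhds hz
    exact Filter.mem_of_superset this fun w hw => hs hw
  exact (hF.1.and h').mono fun z hz => hz.1.congr_of_eventuallyEq (hz.2.mono fun w hw => hw.symm)

lemma inv (hg : ∀ᶠ z in 𝓝 a, DifferentiableAt ℂ g z) (h0 : g a = 0) {g' : ℂ}
    (hd : HasDerivAt g g' a) (h' : g' ≠ 0) : SimplePole (fun z => (g z)⁻¹) a g'⁻¹ := by
  have hne : ∀ᶠ z in 𝓝[≠] a, g z ≠ 0 := hd.eventually_ne h'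
  refine ⟨((hg.filter_mono nhdsWithin_le_nhds).and hne).mono fun z hz => hz.1.inv hz.2, ?_⟩
  have := (hasDerivAt_iff_tendsto_slope.mp hd).inv₀ h'
  refine this.congr fun z => ?_
  rw [slope_def_field, h0, sub_zero, inv_div]; rfl

lemma comp_const_mul {c : ℂ} (hc : c ≠ 0) (hF : SimplePole F (c * a) r) :
    SimplePole (fun z => F (c * z)) a (r / c) := by
  have ht : Tendsto (fun z => c * z) (𝓝[≠] a) (𝓝[≠] (c * a)) := by
    refine tendsto_nhdsWithin_of_tendsto_nhds_of_eventually_within _ ?_ ?_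
    · exact ((continuous_const.mul continuous_id).tendsto a).mono_left nhdsWithin_le_nhds
    · exact eventually_nhdsWithin_of_forall fun z hz h => hz (mul_left_cancel₀ hc h)
  refine ⟨(ht.eventually hF.1).mono fun z hz => DifferentiableAt.comp z hz (by fun_prop), ?_⟩
  have := (hF.2.comp ht).div_const c
  refine this.congr fun z => ?_
  simp only [Function.comp]; field_simp

/-- The removable singularity theorem for a simple pole with residue zero. -/
lemma exists_tendsto (hF : SimplePole F a 0) :
    Tendsto F (𝓝[≠] a) (𝓝 (limUnder (𝓝[≠] a) F)) ∧
      ∀ᶠ z in 𝓝 a, DifferentiableAt ℂ (Function.update F a (limUnder (𝓝[≠] a) F)) z := by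
  have ho : (fun z => F z - F a) =o[𝓝[≠] a] fun z => (z - a)⁻¹ := by
    rw [Asymptotics.isLittleO_iff_tendsto']
    · have h2 : Tendsto (fun z => (z - a) * F a) (𝓝[≠] a) (𝓝 0) := by
        have : Tendsto (fun z => (z - a) * F a) (𝓝 a) (𝓝 ((a - a) * F a)) :=
          Continuous.tendsto (by fun_prop) a
        simp only [sub_self, zero_mul] at this
        exact this.mono_left nhdsWithin_le_nhds
      have := hF.2.sub h2
      simp only [sub_self] at this
      refine this.congr fun z => ?_
      rw [div_inv_eq_mul]; ring
    · refine eventually_nhdsWithin_of_forall fun z hz h => ?_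
      exact absurd (inv_eq_zero.mp h) (sub_ne_zero.mpr hz)
  refine ⟨Complex.tendsto_limUnder_of_differentiable_on_punctured_nhds_of_isLittleO hF.1 ho, ?_⟩
  have hd := hF.1
  obtain ⟨u, hu, hau, hs⟩ := mem_nhdsWithin.mp hd
  have h3 := Complex.differentiableOn_update_limUnder_of_isLittleO (hu.mem_nhds hau)
    (fun z hz => DifferentiableAt.differentiableWithinAt (hs ⟨hz.1, hz.2⟩)) ho
  filter_upwards [hu.mem_nhds hau] with z hz
  exact h3.differentiableAt (hu.mem_nhds hz)

end SimplePole

/-- Removing all the singularities of a function on the punctured plane. -/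
lemma exists_extension {F : ℂ → ℂ} (hF : ∀ a, a ≠ 0 → SimplePole F a 0) :
    ∃ G : ℂ → ℂ, (∀ a, a ≠ 0 → DifferentiableAt ℂ G a) ∧
      ∀ a, a ≠ 0 → Tendsto F (𝓝[≠] a) (𝓝 (G a)) := by
  refine ⟨fun a => limUnder (𝓝[≠] a) F, fun a ha => ?_, fun a ha => (hF a ha).exists_tendsto.1⟩
  have h := (hF a ha).exists_tendsto.2.self_of_nhds
  refine h.congr_of_eventuallyEq ?_
  have hd := (hF a ha).1
  rw [eventually_nhdsWithin_iff] at hd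
  filter_upwards [hd] with z hz
  by_cases hza : z = a
  · subst hza; simp
  · rw [Function.update_of_ne hza]
    exact ((hz hza).continuousAt.tendsto.mono_left nhdsWithin_le_nhds).limUnder_eq

section
variable {p : ℂ} {G : ℂ → ℂ}

/-- A continuous function on the punctured plane is bounded when its values under multiplication
by `p` are controlled near zero and near infinity. -/
lemma bounded_of_quasiperiodic (hp : ‖p‖ < 1) (hp0 : p ≠ 0)
    (hG : ∀ a, a ≠ 0 → ContinuousAt G a) {r R K : ℝ} (hr : 0 < r)
    (h0 : ∀ z, z ≠ 0 → ‖z‖ ≤ r → ‖G (z * p)‖ ≤ max K ‖G z‖)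
    (h1 : ∀ z, z ≠ 0 → R ≤ ‖z‖ → ‖G z‖ ≤ max K ‖G (z * p)‖) :
    ∃ M, ∀ z, z ≠ 0 → ‖G z‖ ≤ M := by
  have hp' : 0 < ‖p‖ := norm_pos_iff.mpr hp0
  obtain ⟨R', hR', hRr⟩ : ∃ R', R ≤ R' ∧ r ≤ R' := ⟨max R r, le_max_left _ _, le_max_right _ _⟩
  have hR0 : 0 < R' := hr.trans_le hRr
  have hcomp : IsCompact {z : ℂ | r * ‖p‖ ≤ ‖z‖ ∧ ‖z‖ ≤ R'} := by
    refine (isCompact_closedBall (0 : ℂ) R').of_isClosed_subset ?_ fun z hz => by simpa using hz.2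
    exact (isClosed_le continuous_const continuous_norm).inter
      (isClosed_le continuous_norm continuous_const)
  obtain ⟨M, hM⟩ := hcomp.exists_bound_of_continuousOn (f := G) fun z hz =>
    (hG z (norm_pos_iff.mp (lt_of_lt_of_le (by positivity) hz.1))).continuousWithinAt
  have hlow : ∀ n : ℕ, ∀ z : ℂ, z ≠ 0 → ‖z‖ ≤ r → r * ‖p‖ ≤ ‖z‖ → ‖G (z * p ^ n)‖ ≤ max K M := by
    intro n z hz hzr hzl
    induction n with
    | zero => simpa using (hM z ⟨hzl, hzr.trans hRr⟩).trans (le_max_right _ _)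
    | succ n ih =>
      rw [pow_succ, ← mul_assoc]
      refine (h0 _ (by positivity) ?_).trans (max_le (le_max_left _ _) ih)
      rw [norm_mul, norm_pow]
      exact (mul_le_of_le_one_right (norm_nonneg _) (pow_le_one₀ hp'.le hp.le)).trans hzr
  have hhigh : ∀ n : ℕ, ∀ z : ℂ, z ≠ 0 → R' < ‖z‖ → ‖z‖ * ‖p‖ ^ n ≤ R' → ‖G z‖ ≤ max K M := by
    intro n
    induction n with
    | zero => intro z _ h2 h3; simp at h3; linarith
    | succ n ih =>
      intro z hz h2 h3
      refine (h1 z hz (hR'.trans h2.le)).trans (max_le (le_max_left _ _) ?_)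
      by_cases h4 : R' < ‖z * p‖
      · refine ih _ (by positivity) h4 ?_
        rw [norm_mul]; calc _ = ‖z‖ * ‖p‖ ^ (n + 1) := by ring
          _ ≤ _ := h3
      · refine (hM _ ⟨?_, not_lt.mp h4⟩).trans (le_max_right _ _)
        rw [norm_mul]; gcongr; linarith
  refine ⟨max K M, fun z hz => ?_⟩
  have hz' : 0 < ‖z‖ := norm_pos_iff.mpr hz
  rcases le_or_gt ‖z‖ r with h | h
  · obtain ⟨n, hn1, hn2⟩ := exists_nat_pow_near_of_lt_one (x := ‖z‖ / r) (y := ‖p‖) (by positivity)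
      ((div_le_one hr).mpr h) hp' hp
    have := hlow n (z / p ^ n) (by positivity) ?_ ?_
    · rwa [div_mul_cancel₀ _ (by positivity)] at this
    · rw [norm_div, norm_pow, div_le_iff₀ (by positivity)]
      rw [div_le_iff₀ hr] at hn2; linarith
    · rw [norm_div, norm_pow, le_div_iff₀ (by positivity)]
      rw [lt_div_iff₀ hr, pow_succ] at hn1; linarith
  · by_cases h4 : R' < ‖z‖
    · obtain ⟨n, hn⟩ := exists_pow_lt_of_lt_one (div_pos hR0 hz') hp
      exact hhigh n z hz h4 (by rw [lt_div_iff₀ hz'] at hn; linarith)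
    · refine (hM _ ⟨?_, not_lt.mp h4⟩).trans (le_max_right _ _)
      exact (mul_le_of_le_one_right hr.le hp.le).trans h.le

/-- Liouville's theorem on the punctured plane. -/
lemma const_of_bounded (hG : ∀ a, a ≠ 0 → DifferentiableAt ℂ G a) {M : ℝ}
    (hM : ∀ z, z ≠ 0 → ‖G z‖ ≤ M) : ∃ c, ∀ z, z ≠ 0 → G z = c := by
  have h1 : DifferentiableOn ℂ (Function.update G 0 (limUnder (𝓝[≠] 0) G)) Set.univ := by
    refine Complex.differentiableOn_update_limUnder_of_bddAbove Filter.univ_mem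
      (fun z hz => (hG z hz.2).differentiableWithinAt) ⟨M, ?_⟩
    rintro _ ⟨z, hz, rfl⟩
    exact hM z hz.2
  rw [differentiableOn_univ] at h1
  have hb : Bornology.IsBounded (Set.range (Function.update G 0 (limUnder (𝓝[≠] 0) G))) := by
    rw [isBounded_iff_forall_norm_le]
    refine ⟨max M ‖limUnder (𝓝[≠] 0) G‖, ?_⟩
    rintro _ ⟨z, rfl⟩
    by_cases hz : z = 0
    · subst hz; simp
    · rw [Function.update_of_ne hz]; exact (hM z hz).trans (le_max_left _ _)
  refine ⟨limUnder (𝓝[≠] 0) G, fun z hz => ?_⟩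
  have := h1.apply_eq_apply_of_bounded hb z 0
  rwa [Function.update_of_ne hz, Function.update_self] at this

end
end RankCrank

namespace RankCrank
open Filter Topology

section
variable {p : ℂ} {F κ : ℂ → ℂ} {C : ℂ} {k : ℕ}

lemma tendsto_mul_punctured {a c : ℂ} (hc : c ≠ 0) :
    Tendsto (fun z => z * c) (𝓝[≠] a) (𝓝[≠] (a * c)) := by
  refine tendsto_nhdsWithin_of_tendsto_nhds_of_eventually_within _ ?_ ?_
  · exact ((continuous_id.mul continuous_const).tendsto a).mono_left nhdsWithin_le_nhds
  · exact eventually_nhdsWithin_of_forall fun z hz h => hz (mul_right_cancel₀ hc h)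

/-- The relation `F (z p) = C z ^ k F z + κ z`, required generically. -/
def QuasiPeriodic (p : ℂ) (F : ℂ → ℂ) (C : ℂ) (k : ℕ) (κ : ℂ → ℂ) : Prop :=
  ∀ a, a ≠ 0 → ∀ᶠ z in 𝓝[≠] a, F (z * p) = C * z ^ k * F z + κ z

lemma QuasiPeriodic.simplePole_mul_iff (hq : QuasiPeriodic p F C k κ) (hp0 : p ≠ 0) (hC : C ≠ 0)
    (hκ : Differentiable ℂ κ) {a : ℂ} (ha : a ≠ 0) :
    SimplePole F (a * p) 0 ↔ SimplePole F a 0 := by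
  have hne : ∀ᶠ z in 𝓝 a, z ≠ 0 := isOpen_ne.mem_nhds ha
  have hκ' : SimplePole κ a 0 := .of_differentiable (Eventually.of_forall fun _ => hκ _)
  constructor
  · intro h
    have h1 : SimplePole (fun z => F (p * z)) a (0 / p) :=
      SimplePole.comp_const_mul hp0 (by rwa [mul_comm])
    have h2 := SimplePole.mul_of_differentiable (g := fun z => (C * z ^ k)⁻¹)
      (hne.mono fun z hz => by
        have : C * z ^ k ≠ 0 := by positivity
        fun_prop (disch := exact this)) (h1.sub hκ')
    simp only [zero_div, sub_zero, mul_zero] at h2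
    refine h2.congr ?_
    filter_upwards [hq a ha, hne.filter_mono nhdsWithin_le_nhds] with z hz hz0
    rw [mul_comm p z, hz, add_sub_cancel_right]
    have : C * z ^ k ≠ 0 := by positivity
    field_simp
  · intro h
    have h2 := (SimplePole.mul_of_differentiable (g := fun z => C * z ^ k)
      (Eventually.of_forall fun z => by fun_prop) h).add hκ'
    simp only [mul_zero, add_zero] at h2
    have h3 : SimplePole (fun z => F (z * p)) a 0 :=
      h2.congr ((hq a ha).mono fun z hz => hz.symm)
    have h4 : SimplePole (fun z => F (p⁻¹ * z * p)) (a * p) (0 / p⁻¹) :=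
      SimplePole.comp_const_mul (F := fun z => F (z * p)) (inv_ne_zero hp0)
        (by rwa [mul_comm a p, inv_mul_cancel_left₀ hp0])
    have : (fun z => F (p⁻¹ * z * p)) = F := by
      ext z; congr 1; field_simp
    rwa [this, zero_div] at h4

lemma QuasiPeriodic.simplePole_zpow_iff (hq : QuasiPeriodic p F C k κ) (hp0 : p ≠ 0) (hC : C ≠ 0)
    (hκ : Differentiable ℂ κ) {a : ℂ} (ha : a ≠ 0) (n : ℤ) :
    SimplePole F (a * p ^ n) 0 ↔ SimplePole F a 0 := by
  induction n using Int.induction_on with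
  | zero => simp
  | succ n ih =>
    rw [zpow_add_one₀ hp0, ← mul_assoc,
      hq.simplePole_mul_iff hp0 hC hκ (mul_ne_zero ha (zpow_ne_zero _ hp0)), ih]
  | pred n ih =>
    rw [← ih, ← hq.simplePole_mul_iff hp0 hC hκ (mul_ne_zero ha (zpow_ne_zero _ hp0)), mul_assoc,
      ← zpow_add_one₀ hp0, sub_add_cancel]

lemma QuasiPeriodic.extension (hq : QuasiPeriodic p F C k κ) (hp0 : p ≠ 0)
    (hκ : Differentiable ℂ κ) (hF : ∀ a, a ≠ 0 → SimplePole F a 0) :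
    ∃ G : ℂ → ℂ, (∀ a, a ≠ 0 → DifferentiableAt ℂ G a) ∧
      (∀ a, a ≠ 0 → Tendsto F (𝓝[≠] a) (𝓝 (G a))) ∧
      ∀ z, z ≠ 0 → G (z * p) = C * z ^ k * G z + κ z := by
  obtain ⟨G, hG, hFG⟩ := exists_extension hF
  refine ⟨G, hG, hFG, fun a ha => ?_⟩
  have h1 : Tendsto (fun z => F (z * p)) (𝓝[≠] a) (𝓝 (G (a * p))) :=
    (hFG _ (mul_ne_zero ha hp0)).comp (tendsto_mul_punctured hp0)
  have hpoly : Tendsto (fun z => C * z ^ k) (𝓝[≠] a) (𝓝 (C * a ^ k)) :=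
    (Continuous.tendsto (by fun_prop) a).mono_left nhdsWithin_le_nhds
  have h2 : Tendsto (fun z => C * z ^ k * F z + κ z) (𝓝[≠] a) (𝓝 (C * a ^ k * G a + κ a)) :=
    (hpoly.mul (hFG a ha)).add ((hκ.continuous.tendsto a).mono_left nhdsWithin_le_nhds)
  exact tendsto_nhds_unique (h1.congr' (hq a ha)) h2

/-- An elliptic function without poles is constant. -/
theorem QuasiPeriodic.exists_const (hq : QuasiPeriodic p F 1 0 fun _ => 0) (hp : ‖p‖ < 1)
    (hp0 : p ≠ 0) (hF : ∀ a, a ≠ 0 → SimplePole F a 0) :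
    ∃ c, ∀ a, a ≠ 0 → Tendsto F (𝓝[≠] a) (𝓝 c) := by
  obtain ⟨G, hG, hFG, hper⟩ := hq.extension hp0 (by fun_prop) hF
  simp only [pow_zero, mul_one, one_mul, add_zero] at hper
  obtain ⟨M, hM⟩ := bounded_of_quasiperiodic (K := 0) (R := 1) hp hp0
    (fun a ha => (hG a ha).continuousAt)
    one_pos (fun z hz _ => by rw [hper z hz]; exact le_max_right _ _)
    (fun z hz _ => by rw [hper z hz]; exact le_max_right _ _)
  obtain ⟨c, hc⟩ := const_of_bounded hG hM
  exact ⟨c, fun a ha => by rw [← hc a ha]; exact hFG a ha⟩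

/-- A function without poles satisfying `F (z p) = C z ^ k F z + κ z`, where `k > 0` and `κ` is of
degree less than `k`, vanishes; moreover `κ` vanishes. -/
theorem QuasiPeriodic.eq_zero (hq : QuasiPeriodic p F C k κ) (hp : ‖p‖ < 1)
    (hp0 : p ≠ 0) (hC : C ≠ 0) (hk : k ≠ 0) (hκ : Differentiable ℂ κ) {K : ℝ}
    (hK : ∀ z, ‖κ z‖ ≤ K * (1 + ‖z‖ ^ (k - 1))) (hF : ∀ a, a ≠ 0 → SimplePole F a 0) :
    (∀ a, a ≠ 0 → Tendsto F (𝓝[≠] a) (𝓝 0)) ∧ ∀ a, a ≠ 0 → κ a = 0 := by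
  obtain ⟨G, hG, hFG, hper⟩ := hq.extension hp0 hκ hF
  have hK0 : 0 ≤ K := by
    have h := (norm_nonneg _).trans (hK 0)
    by_contra! hneg
    have h1 : (0 : ℝ) ≤ ‖(0 : ℂ)‖ ^ (k - 1) := by positivity
    nlinarith
  have hc : 0 < ‖C‖ := norm_pos_iff.mpr hC
  have h0 : ∀ z, z ≠ 0 → ‖z‖ ≤ min 1 (1 / (2 * ‖C‖)) →
      ‖G (z * p)‖ ≤ max (4 * K + 4 * K / ‖C‖) ‖G z‖ := by
    intro z hz h
    rw [hper z hz]
    have hz1 : ‖z‖ ≤ 1 := h.trans (min_le_left _ _)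
    have hz2 : ‖z‖ ≤ 1 / (2 * ‖C‖) := h.trans (min_le_right _ _)
    have h1 : ‖C * z ^ k‖ ≤ 1 / 2 := by
      rw [norm_mul, norm_pow]
      calc ‖C‖ * ‖z‖ ^ k ≤ ‖C‖ * ‖z‖ := by gcongr; exact pow_le_of_le_one (norm_nonneg _) hz1 hk
        _ ≤ ‖C‖ * (1 / (2 * ‖C‖)) := by gcongr
        _ = 1 / 2 := by field_simp
    have h2 : ‖κ z‖ ≤ 2 * K := by
      have : ‖z‖ ^ (k - 1) ≤ 1 := pow_le_one₀ (norm_nonneg _) hz1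
      nlinarith [hK z]
    have h3 : ‖C * z ^ k * G z + κ z‖ ≤ 1 / 2 * ‖G z‖ + 2 * K := by
      refine (norm_add_le _ _).trans (add_le_add ?_ h2)
      rw [norm_mul]; gcongr
    have h4 : 0 ≤ 4 * K / ‖C‖ := by positivity
    rcases le_total ‖G z‖ (4 * K + 4 * K / ‖C‖) with h5 | h5
    · rw [max_eq_left h5]; linarith
    · rw [max_eq_right h5]; linarith
  have h1 : ∀ z, z ≠ 0 → max 1 (2 / ‖C‖) ≤ ‖z‖ →
      ‖G z‖ ≤ max (4 * K + 4 * K / ‖C‖) ‖G (z * p)‖ := by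
    intro z hz h
    have hz1 : 1 ≤ ‖z‖ := (le_max_left _ _).trans h
    have hz2 : 2 / ‖C‖ ≤ ‖z‖ := (le_max_right _ _).trans h
    obtain ⟨m, rfl⟩ := Nat.exists_eq_succ_of_ne_zero hk
    have hKz := hK z
    simp only [Nat.succ_eq_add_one, Nat.add_sub_cancel] at hKz hper
    have h1 : ‖C‖ * ‖z‖ ^ (m + 1) * ‖G z‖ ≤ ‖G (z * p)‖ + K * (1 + ‖z‖ ^ m) := by
      have h2 : C * z ^ (m + 1) * G z = G (z * p) - κ z := by rw [hper z hz]; ring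
      rw [← norm_pow, ← norm_mul, ← norm_mul, h2]
      exact (norm_sub_le _ _).trans (by linarith)
    have h6 : 1 ≤ ‖z‖ ^ m := one_le_pow₀ hz1
    have h7 : 2 ≤ ‖C‖ * ‖z‖ := by rw [div_le_iff₀ hc] at hz2; linarith
    have h8 : ‖z‖ ^ m * (2 * ‖G z‖) ≤ ‖z‖ ^ m * (‖G (z * p)‖ + 2 * K) := by
      have h9 : ‖z‖ ^ m * (2 * ‖G z‖) ≤ ‖z‖ ^ m * (‖C‖ * ‖z‖ * ‖G z‖) := by gcongr
      have h10 : ‖z‖ ^ m * (‖C‖ * ‖z‖ * ‖G z‖) = ‖C‖ * ‖z‖ ^ (m + 1) * ‖G z‖ := by ring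
      nlinarith [norm_nonneg (G (z * p))]
    have h11 := le_of_mul_le_mul_left h8 (by positivity)
    have h4 : 0 ≤ 4 * K / ‖C‖ := by positivity
    rcases le_total ‖G (z * p)‖ (4 * K + 4 * K / ‖C‖) with h5 | h5
    · rw [max_eq_left h5]; linarith
    · rw [max_eq_right h5]; linarith
  obtain ⟨M, hM⟩ := bounded_of_quasiperiodic hp hp0 (fun a ha => (hG a ha).continuousAt)
    (by positivity) h0 h1
  obtain ⟨c, hc'⟩ := const_of_bounded hG hM
  have key : ∀ z, z ≠ 0 → c = C * z ^ k * c + κ z := fun z hz => by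
    have := hper z hz
    rwa [hc' z hz, hc' _ (mul_ne_zero hz hp0)] at this
  have hc0 : c = 0 := by
    by_contra hne
    have hcpos : 0 < ‖c‖ := norm_pos_iff.mpr hne
    obtain ⟨t, ht⟩ := exists_gt (max 1 ((‖c‖ + 2 * K) / (‖C‖ * ‖c‖)))
    have ht1 : 1 < t := (le_max_left _ _).trans_lt ht
    have ht2 : (‖c‖ + 2 * K) / (‖C‖ * ‖c‖) < t := (le_max_right _ _).trans_lt ht
    rw [div_lt_iff₀ (by positivity)] at ht2
    have ht0 : (t : ℂ) ≠ 0 := by exact_mod_cast (by linarith : t ≠ 0)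
    have h1 := key t ht0
    have h2 : C * (t : ℂ) ^ k * c = c - κ t := by linear_combination -h1
    have h3 : ‖C‖ * t ^ k * ‖c‖ ≤ ‖c‖ + K * (1 + t ^ (k - 1)) := by
      have h4 := congrArg norm h2
      have h5 := hK (t : ℂ)
      have hn : ‖(t : ℂ)‖ = t := by simp; linarith
      rw [hn] at h5
      rw [norm_mul, norm_mul, norm_pow, hn] at h4
      rw [h4]; exact (norm_sub_le _ _).trans (by linarith)
    obtain ⟨m, rfl⟩ := Nat.exists_eq_succ_of_ne_zero hk
    simp only [Nat.succ_eq_add_one, Nat.add_sub_cancel] at h3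
    have h6 : 1 ≤ t ^ m := one_le_pow₀ ht1.le
    have h7 : ‖C‖ * t ^ (m + 1) * ‖c‖ = t ^ m * (t * (‖C‖ * ‖c‖)) := by ring
    rw [h7] at h3
    have h8 : t ^ m * (‖c‖ + 2 * K) < t ^ m * (t * (‖C‖ * ‖c‖)) := by gcongr
    nlinarith
  refine ⟨fun a ha => by have := hFG a ha; rwa [hc' a ha, hc0] at this, fun a ha => ?_⟩
  have := key a ha
  simpa [hc0] using this.symm

end
end RankCrank

namespace RankCrank
open Filter Topology

/-- The general term `w ^ n P ^ (n (n + 1) / 2)` of a bilateral theta series. -/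
noncomputable def thc (P w : ℂ) (n : ℤ) : ℂ := w ^ n * P ^ (n * (n + 1) / 2)

/-- The bilateral theta series with terms `thc P w n`. -/
noncomputable def ths (P w : ℂ) : ℂ := ∑' n : ℤ, thc P w n

/-- The Appell-Lerch type sum with coefficients `c`. -/
noncomputable def al (p : ℂ) (c : ℤ → ℂ) (z : ℂ) : ℂ := ∑' n : ℤ, c n / (1 - z * p ^ n)

section
variable {p P w z a : ℂ} {c : ℤ → ℂ}

lemma thc_add_one (hP : P ≠ 0) (hw : w ≠ 0) (n : ℤ) :
    thc P w (n + 1) = w * P ^ (n + 1) * thc P w n := by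
  have h : (n + 1) * (n + 1 + 1) / 2 = n * (n + 1) / 2 + (n + 1) := by
    rw [show (n + 1) * (n + 1 + 1) = n * (n + 1) + (n + 1) * 2 by ring,
      Int.add_mul_ediv_right _ _ two_ne_zero]
  rw [thc, thc, h, zpow_add_one₀ hw, zpow_add₀ hP]; ring

lemma thc_neg_add_one (hw : w ≠ 0) (n : ℤ) :
    thc P w (-(n + 1)) = w⁻¹ * thc P w⁻¹ n := by
  have h : -(n + 1) * (-(n + 1) + 1) / 2 = n * (n + 1) / 2 := by ring_nf
  rw [thc, thc, h, neg_add, ← sub_eq_add_neg, zpow_sub₀ hw, inv_zpow, zpow_neg, zpow_one]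
  field_simp

lemma thc_mul_zpow (n : ℤ) (t : ℂ) : thc P w n * t ^ n = thc P (w * t) n := by
  rw [thc, thc, mul_zpow]; ring

lemma thc_ne_zero (hP : P ≠ 0) (hw : w ≠ 0) (n : ℤ) : thc P w n ≠ 0 :=
  mul_ne_zero (zpow_ne_zero _ hw) (zpow_ne_zero _ hP)

@[simp] lemma thc_zero : thc P w 0 = 1 := by simp [thc]

lemma thc_summable_nat (hP : ‖P‖ < 1) (hP0 : P ≠ 0) (hw : w ≠ 0) :
    Summable fun n : ℕ => ‖thc P w n‖ := by
  refine summable_of_ratio_test_tendsto_lt_one zero_lt_one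
    (Eventually.of_forall fun n => norm_ne_zero_iff.mpr (thc_ne_zero hP0 hw _)) ?_
  have h : Tendsto (fun n : ℕ => ‖w‖ * ‖P‖ ^ (n + 1)) atTop (𝓝 (‖w‖ * 0)) :=
    ((tendsto_pow_atTop_nhds_zero_of_lt_one (norm_nonneg _) hP).comp
      (tendsto_add_atTop_nat 1)).const_mul _
  rw [mul_zero] at h
  refine h.congr fun n => ?_
  have h0 : ‖thc P w n‖ ≠ 0 := norm_ne_zero_iff.mpr (thc_ne_zero hP0 hw _)
  rw [norm_norm, norm_norm, Nat.cast_succ, thc_add_one hP0 hw, norm_mul, mul_div_assoc, div_self h0,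
    norm_mul, mul_one, norm_zpow]
  norm_cast

lemma thc_summable (hP : ‖P‖ < 1) (hP0 : P ≠ 0) (hw : w ≠ 0) :
    Summable fun n : ℤ => ‖thc P w n‖ := by
  refine Summable.of_nat_of_neg_add_one (thc_summable_nat hP hP0 hw) ?_
  simp only [thc_neg_add_one hw, norm_mul]
  exact (thc_summable_nat hP hP0 (inv_ne_zero hw)).mul_left _

/-- Near a non-zero point all but finitely many of the denominators are bounded below. -/
lemma exists_far (hp : ‖p‖ < 1) (hp0 : p ≠ 0) (ha : a ≠ 0) :
    ∃ T : Finset ℤ, ∃ U : Set ℂ, IsOpen U ∧ a ∈ U ∧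
      ∀ z ∈ U, z ≠ 0 ∧ ∀ n ∉ T, 1 / 2 ≤ ‖1 - z * p ^ n‖ := by
  have ha' : 0 < ‖a‖ := norm_pos_iff.mpr ha
  have hp' : 0 < ‖p‖ := norm_pos_iff.mpr hp0
  obtain ⟨N, hN⟩ := exists_pow_lt_of_lt_one (show 0 < min (1 / (4 * ‖a‖)) (‖a‖ / 4) by positivity) hp
  have hpow : ∀ n : ℕ, N ≤ n → ‖p‖ ^ n ≤ ‖p‖ ^ N := fun n hn => pow_le_pow_of_le_one hp'.le hp.le hn
  refine ⟨Finset.Icc (-N) N, {z | ‖a‖ / 2 < ‖z‖ ∧ ‖z‖ < 2 * ‖a‖},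
    (isOpen_lt continuous_const continuous_norm).inter (isOpen_lt continuous_norm continuous_const),
    ⟨by linarith, by linarith⟩, fun z hz => ⟨norm_pos_iff.mp (by linarith [hz.1]), fun n hn => ?_⟩⟩
  obtain ⟨hz1, hz2⟩ := hz
  rw [lt_min_iff, lt_div_iff₀ (by positivity)] at hN
  rcases le_or_gt 0 n with h | h
  · lift n to ℕ using h
    have hn' : N ≤ n := by
      by_contra hlt; exact hn (Finset.mem_Icc.mpr ⟨by omega, by omega⟩)
    have h1 : ‖z * p ^ (n : ℤ)‖ ≤ 1 / 2 := by
      rw [zpow_natCast, norm_mul, norm_pow]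
      have h3 : 0 ≤ ‖p‖ ^ n := by positivity
      nlinarith [hpow n hn', norm_nonneg z]
    have h2 := norm_sub_norm_le (1 : ℂ) (z * p ^ (n : ℤ))
    rw [norm_one] at h2; linarith
  · obtain ⟨m, rfl⟩ : ∃ m : ℕ, n = -m := ⟨n.natAbs, by omega⟩
    have hn' : N ≤ m := by
      by_contra hlt; exact hn (Finset.mem_Icc.mpr ⟨by omega, by omega⟩)
    have h1 : 2 ≤ ‖z * p ^ (-m : ℤ)‖ := by
      rw [zpow_neg, zpow_natCast, norm_mul, norm_inv, norm_pow, ← div_eq_mul_inv,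
        le_div_iff₀ (by positivity)]
      nlinarith [hpow m hn']
    have h2 := norm_sub_norm_le (z * p ^ (-m : ℤ)) 1
    rw [norm_one, norm_sub_rev] at h2; linarith

lemma eventually_mul_zpow_ne_one (hp : ‖p‖ < 1) (hp0 : p ≠ 0) (ha : a ≠ 0) :
    ∀ᶠ z in 𝓝[≠] a, ∀ n : ℤ, z * p ^ n ≠ 1 := by
  obtain ⟨T, U, hU, haU, h⟩ := exists_far hp hp0 ha
  have h1 : ∀ᶠ z in 𝓝[≠] a, ∀ n ∈ T, z * p ^ n ≠ 1 := by
    rw [Filter.eventually_all_finset]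
    intro n _
    have hd : HasDerivAt (fun z : ℂ => z * p ^ n) (p ^ n) a := by
      simpa using (hasDerivAt_id a).mul_const (p ^ n)
    exact hd.eventually_ne (zpow_ne_zero n hp0)
  filter_upwards [h1, mem_nhdsWithin_of_mem_nhds (hU.mem_nhds haU)] with z hz hzU n hn
  by_cases hnT : n ∈ T
  · exact hz n hnT hn
  · have := (h z hzU).2 n hnT
    rw [hn] at this; norm_num at this

lemma al_summable (hp : ‖p‖ < 1) (hp0 : p ≠ 0) (hc : Summable fun n => ‖c n‖) (hz : z ≠ 0) :
    Summable fun n => c n / (1 - z * p ^ n) := by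
  obtain ⟨T, U, hU, haU, h⟩ := exists_far hp hp0 hz
  refine (hc.mul_right 2).of_norm_bounded_eventually ?_
  refine (T.finite_toSet.subset fun n hn => ?_ : Set.Finite _)
  by_contra hnT
  apply hn
  have h1 := (h z haU).2 n hnT
  simp only [norm_div, Set.mem_ofPred_eq]
  rw [div_le_iff₀ (by linarith)]
  nlinarith [norm_nonneg (c n)]

lemma al_eventually_differentiableAt (hp : ‖p‖ < 1) (hp0 : p ≠ 0) (hc : Summable fun n => ‖c n‖)
    (ha : a ≠ 0) (h : ∀ n, c n ≠ 0 → a * p ^ n ≠ 1) :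
    ∀ᶠ z in 𝓝 a, DifferentiableAt ℂ (al p c) z := by
  obtain ⟨T, U, hU, haU, hfar⟩ := exists_far hp hp0 ha
  have h1 : ∀ᶠ z in 𝓝 a, ∀ n ∈ T, c n ≠ 0 → z * p ^ n ≠ 1 := by
    rw [Filter.eventually_all_finset]
    intro n _
    by_cases hcn : c n = 0
    · simp [hcn]
    · have hcont : ContinuousAt (fun z : ℂ => z * p ^ n) a := by fun_prop
      exact (hcont.eventually_ne (h n hcn)).mono fun z hz _ => hz
  have htail : DifferentiableOn ℂ (fun z => ∑' n : {n // n ∉ T}, c n / (1 - z * p ^ (n : ℤ))) U := by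
    refine Complex.differentiableOn_tsum_of_summable_norm (u := fun n => ‖c n‖ * 2)
      ((hc.mul_right 2).subtype _) (fun n => ?_) hU fun n z hz => ?_
    · intro z hz
      have h2 := (hfar z hz).2 n n.2
      have : 1 - z * p ^ (n : ℤ) ≠ 0 := norm_pos_iff.mp (by linarith)
      exact DifferentiableAt.differentiableWithinAt (by fun_prop (disch := exact this))
    · have h2 := (hfar z hz).2 n n.2
      rw [norm_div, div_le_iff₀ (by linarith)]
      nlinarith [norm_nonneg (c n)]
  have heq : ∀ z ∈ U, al p c z = ∑ n ∈ T, c n / (1 - z * p ^ n) +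
      ∑' n : {n // n ∉ T}, c n / (1 - z * p ^ (n : ℤ)) := fun z hz =>
    ((al_summable hp hp0 hc (hfar z hz).1).sum_add_tsum_subtype_compl T).symm
  filter_upwards [h1, hU.mem_nhds haU] with z hz hzU
  have hev : al p c =ᶠ[𝓝 z] fun z => ∑ n ∈ T, c n / (1 - z * p ^ n) +
      ∑' n : {n // n ∉ T}, c n / (1 - z * p ^ (n : ℤ)) :=
    Filter.eventually_of_mem (hU.mem_nhds hzU) heq
  refine DifferentiableAt.congr_of_eventuallyEq ?_ hev
  refine (DifferentiableAt.fun_sum fun n hn => ?_).add (htail.differentiableAt (hU.mem_nhds hzU))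
  by_cases hcn : c n = 0
  · simp [hcn]
  · have : 1 - z * p ^ n ≠ 0 := sub_ne_zero.mpr (hz n hn hcn).symm
    fun_prop (disch := exact this)

lemma al_eq_add_update (hp : ‖p‖ < 1) (hp0 : p ≠ 0) (hc : Summable fun n => ‖c n‖) (hz : z ≠ 0)
    (m : ℤ) : al p c z = c m / (1 - z * p ^ m) + al p (Function.update c m 0) z := by
  rw [al, (al_summable hp hp0 hc hz).tsum_eq_add_tsum_ite m, al]
  congr 1
  refine tsum_congr fun n => ?_
  by_cases h : n = m
  · subst h; simp
  · simp [h]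

lemma summable_update (hc : Summable fun n => ‖c n‖) (m : ℤ) :
    Summable fun n => ‖Function.update c m 0 n‖ := by
  refine hc.of_nonneg_of_le (fun n => norm_nonneg _) fun n => ?_
  by_cases h : n = m
  · subst h; simp
  · simp [Function.update_of_ne h]

lemma update_ne_one (hp : ‖p‖ < 1) (hp0 : p ≠ 0) {m : ℤ} (hm : a * p ^ m = 1) (n : ℤ)
    (h : Function.update c m 0 n ≠ 0) : a * p ^ n ≠ 1 := by
  intro hn
  have hnm : n ≠ m := by rintro rfl; simp at h
  apply hnm
  have ha : a ≠ 0 := left_ne_zero_of_mul (hm.trans_ne one_ne_zero)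
  have h1 : p ^ n = p ^ m := mul_left_cancel₀ ha (hn.trans hm.symm)
  refine zpow_right_injective₀ (norm_pos_iff.mpr hp0) hp.ne ?_
  simpa using congrArg norm h1

lemma al_simplePole_regular (hp : ‖p‖ < 1) (hp0 : p ≠ 0) (hc : Summable fun n => ‖c n‖)
    (ha : a ≠ 0) (h : ∀ n : ℤ, a * p ^ n ≠ 1) : SimplePole (al p c) a 0 :=
  .of_differentiable (al_eventually_differentiableAt hp hp0 hc ha fun n _ => h n)

lemma al_simplePole (hp : ‖p‖ < 1) (hp0 : p ≠ 0) (hc : Summable fun n => ‖c n‖)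
    {m : ℤ} (hm : a * p ^ m = 1) : SimplePole (al p c) a (-(c m * a)) := by
  have ha : a ≠ 0 := left_ne_zero_of_mul (hm.trans_ne one_ne_zero)
  have h1 : SimplePole (al p (Function.update c m 0)) a 0 := .of_differentiable
    (al_eventually_differentiableAt hp hp0 (summable_update hc m) ha (update_ne_one hp hp0 hm))
  have hd : HasDerivAt (fun z : ℂ => 1 - z * p ^ m) (-(p ^ m)) a := by
    simpa using ((hasDerivAt_id a).mul_const (p ^ m)).const_sub 1
  have h2 := (SimplePole.inv (Eventually.of_forall fun z => by fun_prop) (by rw [hm, sub_self]) hd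
    (neg_ne_zero.mpr (zpow_ne_zero m hp0))).const_mul (c m)
  have h3 := h2.add h1
  have hr : c m * (-p ^ m)⁻¹ + 0 = -(c m * a) := by
    have hpm := zpow_ne_zero m hp0
    rw [add_zero, inv_neg, ← eq_inv_of_mul_eq_one_left hm]; ring
  rw [hr] at h3
  refine h3.congr ?_
  have hne : ∀ᶠ z in 𝓝 a, z ≠ 0 := isOpen_ne.mem_nhds ha
  filter_upwards [hne.filter_mono nhdsWithin_le_nhds] with z hz
  rw [al_eq_add_update hp hp0 hc hz m, div_eq_mul_inv]

lemma al_update_self (hm : a * p ^ (m : ℤ) = 1) : al p (Function.update c m 0) a = al p c a := by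
  refine tsum_congr fun n => ?_
  by_cases h : n = m
  · subst h; simp [hm]
  · simp [Function.update_of_ne h]

lemma al_finite_part (hp : ‖p‖ < 1) (hp0 : p ≠ 0) (hc : Summable fun n => ‖c n‖)
    {m : ℤ} (hm : a * p ^ m = 1) :
    Tendsto (fun z => al p c z - c m / (1 - z * p ^ m)) (𝓝[≠] a) (𝓝 (al p c a)) := by
  have ha : a ≠ 0 := left_ne_zero_of_mul (hm.trans_ne one_ne_zero)
  have h1 := (al_eventually_differentiableAt hp hp0 (summable_update hc m) ha
    (update_ne_one hp hp0 hm)).self_of_nhds.continuousAt.tendsto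
  rw [al_update_self hm] at h1
  have hne : ∀ᶠ z in 𝓝 a, z ≠ 0 := isOpen_ne.mem_nhds ha
  refine (h1.mono_left nhdsWithin_le_nhds).congr' ?_
  filter_upwards [hne.filter_mono nhdsWithin_le_nhds] with z hz
  rw [al_eq_add_update hp hp0 hc hz m, add_sub_cancel_left]

/-- The shift relation of a level `l` Appell-Lerch sum. -/
lemma al_shift (hp : ‖p‖ < 1) (hp0 : p ≠ 0) (l : ℕ) (hl : l ≠ 0) (hw : w ≠ 0) (hz : z ≠ 0)
    (hz1 : ∀ n : ℤ, z * p ^ n ≠ 1) :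
    al p (thc (p ^ l) w) (z * p) = w⁻¹ * (z ^ l * al p (thc (p ^ l) w) z +
      ∑ i ∈ Finset.range l, z ^ i * ths (p ^ l) (w * p ^ ((i : ℤ) - l))) := by
  have hP0 : p ^ l ≠ 0 := pow_ne_zero _ hp0
  have hP : ‖p ^ l‖ < 1 := by rw [norm_pow]; exact pow_lt_one₀ (norm_nonneg _) hp hl
  have hs := al_summable hp hp0 (thc_summable hP hP0 hw) hz
  have hsi : ∀ i : ℕ, Summable fun n => z ^ i * thc (p ^ l) (w * p ^ ((i : ℤ) - l)) n := fun i =>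
    (thc_summable hP hP0 (mul_ne_zero hw (zpow_ne_zero _ hp0))).of_norm.mul_left _
  have hterm : ∀ n : ℤ, thc (p ^ l) w n / (1 - z * p * p ^ n) =
      w⁻¹ * (z ^ l * (thc (p ^ l) w (n + 1) / (1 - z * p ^ (n + 1))) +
        ∑ i ∈ Finset.range l, z ^ i * thc (p ^ l) (w * p ^ ((i : ℤ) - l)) (n + 1)) := by
    intro n
    have h1 : 1 - z * p ^ (n + 1) ≠ 0 := sub_ne_zero.mpr (hz1 _).symm
    have e1 : z * p * p ^ n = z * p ^ (n + 1) := by rw [zpow_add_one₀ hp0]; ring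
    have e2 : thc (p ^ l) w n = w⁻¹ * ((p ^ (n + 1)) ^ l)⁻¹ * thc (p ^ l) w (n + 1) := by
      rw [thc_add_one hP0 hw, ← zpow_natCast (p ^ (n + 1)), ← zpow_mul, ← zpow_natCast p l, ← zpow_mul,
        mul_comm (n + 1)]
      have := zpow_ne_zero ((l : ℤ) * (n + 1)) hp0
      field_simp
    have e3 : ∀ i : ℕ, thc (p ^ l) (w * p ^ ((i : ℤ) - l)) (n + 1) =
        thc (p ^ l) w (n + 1) * ((p ^ (n + 1)) ^ i * ((p ^ (n + 1)) ^ l)⁻¹) := by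
      intro i
      rw [← thc_mul_zpow, ← zpow_mul, mul_comm ((i : ℤ) - l), zpow_mul, zpow_sub₀ (zpow_ne_zero _ hp0),
        zpow_natCast, zpow_natCast]; ring
    have hg := mul_neg_geom_sum (z * p ^ (n + 1)) l
    rw [e1, e2]
    simp only [e3]
    set X := p ^ (n + 1)
    have hX : X ≠ 0 := zpow_ne_zero _ hp0
    have e4 : ∑ i ∈ Finset.range l, z ^ i * (thc (p ^ l) w (n + 1) * (X ^ i * (X ^ l)⁻¹)) =
        thc (p ^ l) w (n + 1) * (X ^ l)⁻¹ * ∑ i ∈ Finset.range l, (z * X) ^ i := by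
      rw [Finset.mul_sum]; exact Finset.sum_congr rfl fun i _ => by rw [mul_pow]; ring
    rw [e4]
    have e5 : ∑ i ∈ Finset.range l, (z * X) ^ i = (1 - (z * X) ^ l) / (1 - z * X) := by
      rw [eq_div_iff h1, ← hg]; ring
    rw [e5, mul_pow]
    field_simp
    ring
  rw [al]
  simp only [hterm]
  rw [tsum_mul_left]
  congr 1
  have hshift := (Equiv.addRight (1 : ℤ)).tsum_eq (fun n =>
    z ^ l * (thc (p ^ l) w n / (1 - z * p ^ n)) +
        ∑ i ∈ Finset.range l, z ^ i * thc (p ^ l) (w * p ^ ((i : ℤ) - l)) n)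
  simp only [Equiv.coe_addRight] at hshift
  rw [hshift, (hs.mul_left _).tsum_add (summable_sum fun i _ => hsi i), tsum_mul_left,
    Summable.tsum_finsetSum fun i _ => hsi i]
  simp only [tsum_mul_left]
  rfl

end
end RankCrank

namespace RankCrank
open Filter Topology

/-- `a` is not an integral power of `p`. -/
def Gen (p a : ℂ) : Prop := ∀ n : ℤ, a * p ^ n ≠ 1

section
variable {p a t z ζ : ℂ} {c : ℤ → ℂ}

lemma Gen.ne_zpow (hp0 : p ≠ 0) (h : Gen p a) (n : ℤ) : a ≠ p ^ n := by
  intro hn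
  apply h (-n)
  rw [hn, ← zpow_add₀ hp0]; simp

lemma Gen.jt_ne_zero (hp : ‖p‖ < 1) (hp0 : p ≠ 0) (ha : a ≠ 0) (h : Gen p a) : jt p a ≠ 0 :=
  RankCrank.jt_ne_zero hp ha (h.ne_zpow hp0)

lemma Gen.inv (h : Gen p a) : Gen p a⁻¹ := by
  intro n hn
  have := congrArg (·⁻¹) hn
  simp only [mul_inv, inv_inv, inv_one, ← zpow_neg] at this
  exact h (-n) this

lemma not_gen_iff : ¬ Gen p a ↔ ∃ n : ℤ, a * p ^ n = 1 := by simp [Gen]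

lemma SimplePole.of_eq {F : ℂ → ℂ} {r s : ℂ} (h : SimplePole F a r) (e : r = s) :
    SimplePole F a s := e ▸ h

lemma eventually_differentiableAt_comp_mul {G : ℂ → ℂ}
    (h : ∀ᶠ z in 𝓝 (t * a), DifferentiableAt ℂ G z) :
    ∀ᶠ z in 𝓝 a, DifferentiableAt ℂ (fun z => G (t * z)) z := by
  have hc : ContinuousAt (fun z => t * z) a := by fun_prop
  exact (hc.eventually h).mono fun z hz => DifferentiableAt.comp z hz (by fun_prop)

lemma eventually_differentiableAt_jt (hp : ‖p‖ < 1) (ha : a ≠ 0) :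
    ∀ᶠ z in 𝓝 a, DifferentiableAt ℂ (jt p) z :=
  Filter.eventually_of_mem (isOpen_ne.mem_nhds ha) fun _ hz => jt_differentiableAt hp hz

lemma eventually_differentiableAt_inv_jt (hp : ‖p‖ < 1) (hp0 : p ≠ 0) (ha : a ≠ 0) (h : Gen p a) :
    ∀ᶠ z in 𝓝 a, DifferentiableAt ℂ (fun z => (jt p z)⁻¹) z := by
  have h1 := (jt_differentiableAt hp ha).continuousAt.eventually_ne (h.jt_ne_zero hp hp0 ha)
  filter_upwards [h1, eventually_differentiableAt_jt hp ha] with z h1 h2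
  exact h2.inv h1

lemma jt_hasDerivAt_one (hp : ‖p‖ < 1) : HasDerivAt (jt p) (-qp p p ^ 3) 1 := by
  have h1 : HasDerivAt (fun z : ℂ => (1 - z) * jg p z) (-1 * jg p 1 + (1 - 1) * 0) 1 :=
    ((hasDerivAt_id (1 : ℂ)).const_sub 1).mul (jg_deriv_one hp)
  have h2 : jt p = fun z => (1 - z) * jg p z := funext fun z => jt_eq_jg hp z
  rw [h2]
  simpa using h1

lemma inv_jt_simplePole (hp : ‖p‖ < 1) : SimplePole (fun z => (jt p z)⁻¹) 1 (-(qp p p ^ 3)⁻¹) :=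
  (SimplePole.inv (eventually_differentiableAt_jt hp one_ne_zero) (jt_one p) (jt_hasDerivAt_one hp)
    (neg_ne_zero.mpr (pow_ne_zero 3 (qp_self_ne_zero hp)))).of_eq (inv_neg)

lemma inv_jt_mul_simplePole (hp : ‖p‖ < 1) (ht : t ≠ 0) (ha : t * a = 1) :
    SimplePole (fun z => (jt p (t * z))⁻¹) a (-((qp p p ^ 3)⁻¹ * a)) := by
  have h := inv_jt_simplePole hp
  rw [← ha] at h
  refine (h.comp_const_mul ht).of_eq ?_
  rw [eq_inv_of_mul_eq_one_right ha]; field_simp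

lemma al_mul_simplePole (hp : ‖p‖ < 1) (hp0 : p ≠ 0) (hc : Summable fun n => ‖c n‖) (ht : t ≠ 0)
    (ha : t * a = 1) : SimplePole (fun z => al p c (t * z)) a (-(c 0 * a)) := by
  have h := al_simplePole hp hp0 hc (a := t * a) (m := 0) (by simpa using ha)
  refine (h.comp_const_mul ht).of_eq ?_
  field_simp

lemma eq_of_tendsto {F : ℂ → ℂ} {L : ℂ} (h : Tendsto F (𝓝[≠] a) (𝓝 L)) (hF : ContinuousAt F a) :
    F a = L :=
  tendsto_nhds_unique (hF.tendsto.mono_left nhdsWithin_le_nhds) h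

lemma eventually_gen_mul (hp : ‖p‖ < 1) (hp0 : p ≠ 0) (ha : a ≠ 0) (ht : t ≠ 0) :
    ∀ᶠ z in 𝓝[≠] a, Gen p (t * z) := by
  have := tendsto_mul_punctured (a := a) ht
  refine (this.eventually (eventually_mul_zpow_ne_one hp hp0 (mul_ne_zero ha ht))).mono ?_
  intro z hz n hn
  exact hz n (by rw [mul_comm z t]; exact hn)

lemma eventually_ne_zero_punctured (ha : a ≠ 0) : ∀ᶠ z in 𝓝[≠] a, z ≠ 0 :=
  Filter.eventually_of_mem (nhdsWithin_le_nhds (isOpen_ne.mem_nhds ha)) fun _ hz => hz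

/-- The partial fraction expansion of the reciprocal of the theta function. -/
theorem al_one_eq (hp : ‖p‖ < 1) (hp0 : p ≠ 0) (hz : z ≠ 0) (hz1 : Gen p z) :
    al p (thc p (-1)) z = qp p p ^ 3 / jt p z := by
  have hs := thc_summable hp hp0 (neg_ne_zero.mpr (one_ne_zero (α := ℂ)))
  have hJ := qp_self_ne_zero hp
  have hq : QuasiPeriodic p (fun z => al p (thc p (-1)) z - qp p p ^ 3 * (jt p z)⁻¹) (-1) 1
      (fun _ => -ths (p ^ 1) (-1 * p ^ (-1 : ℤ))) := by
    intro a ha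
    filter_upwards [eventually_mul_zpow_ne_one hp hp0 ha, eventually_ne_zero_punctured ha] with z h1 h2
    have h := al_shift hp hp0 1 one_ne_zero (neg_ne_zero.mpr (one_ne_zero (α := ℂ))) h2 h1
    simp only [pow_one, Finset.range_one, Finset.sum_singleton, pow_zero, one_mul] at h ⊢
    rw [h, jt_mul_base hp hp0 h2]
    simp only [Nat.cast_zero, Nat.cast_one, zero_sub]
    have := Gen.jt_ne_zero hp hp0 h2 h1
    field_simp; ring
  have hreg : ∀ a, a ≠ 0 → Gen p a → ∀ᶠ z in 𝓝 a,
      DifferentiableAt ℂ (fun z => al p (thc p (-1)) z - qp p p ^ 3 * (jt p z)⁻¹) z := by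
    intro a ha hg
    filter_upwards [al_eventually_differentiableAt hp hp0 hs ha fun n _ => hg n,
      eventually_differentiableAt_inv_jt hp hp0 ha hg] with z h1 h2
    exact h1.sub (h2.const_mul _)
  have h := (hq.eq_zero hp hp0 (by norm_num) one_ne_zero (by fun_prop)
    (K := ‖ths (p ^ 1) (-1 * p ^ (-1 : ℤ))‖) (fun z => by simp; nlinarith [norm_nonneg (ths p (-p⁻¹))]) fun a ha => ?_).1 z hz
  · have := eq_of_tendsto h (hreg z hz hz1).self_of_nhds.continuousAt
    rw [div_eq_mul_inv]; exact sub_eq_zero.mp this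
  · by_cases hg : Gen p a
    · exact .of_differentiable (hreg a ha hg)
    · obtain ⟨n, hn⟩ := not_gen_iff.mp hg
      rw [← hq.simplePole_zpow_iff hp0 (by norm_num) (by fun_prop) ha n, hn]
      refine ((al_simplePole hp hp0 hs (m := 0) (by simp)).sub
        ((inv_jt_simplePole hp).const_mul _)).of_eq ?_
      rw [thc_zero]; field_simp; ring

end
end RankCrank

namespace RankCrank
open Filter Topology

section
variable {p a t z ζ : ℂ}

/-- The two-pole combination of Lambert series of level one. -/
theorem al_pair_eq (hp : ‖p‖ < 1) (hp0 : p ≠ 0) (hζ : ζ ≠ 0) (hg : Gen p ζ) (hg2 : Gen p (ζ ^ 2))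
    (hz : z ≠ 0) (h1 : Gen p (ζ * z)) (h2 : Gen p (ζ⁻¹ * z)) :
    ζ * al p (thc p (-ζ)) (ζ * z) + al p (thc p (-ζ⁻¹)) (ζ⁻¹ * z) =
      qp p p ^ 3 * jt p (ζ ^ 2) / jt p ζ * jt p z * ((jt p (ζ * z))⁻¹ * (jt p (ζ⁻¹ * z))⁻¹) := by
  have hζi := inv_ne_zero hζ
  have hs1 := thc_summable hp hp0 (neg_ne_zero.mpr hζ)
  have hs2 := thc_summable hp hp0 (neg_ne_zero.mpr hζi)
  have hJ := qp_self_ne_zero hp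
  have hj := hg.jt_ne_zero hp hp0 hζ
  have hj2 := hg2.jt_ne_zero hp hp0 (pow_ne_zero 2 hζ)
  have hji : jt p ζ⁻¹ = -ζ⁻¹ * jt p ζ := jt_inv hp hζ
  have hji2 : jt p (ζ ^ 2)⁻¹ = -(ζ ^ 2)⁻¹ * jt p (ζ ^ 2) := jt_inv hp (pow_ne_zero 2 hζ)
  set A := qp p p ^ 3 * jt p (ζ ^ 2) / jt p ζ with hA
  set F : ℂ → ℂ := fun z => ζ * al p (thc p (-ζ)) (ζ * z) + al p (thc p (-ζ⁻¹)) (ζ⁻¹ * z) -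
    A * jt p z * ((jt p (ζ * z))⁻¹ * (jt p (ζ⁻¹ * z))⁻¹) with hF
  have hq : QuasiPeriodic p F (-1) 1
      (fun _ => -ths (p ^ 1) (-ζ * p ^ (-1 : ℤ)) - ζ * ths (p ^ 1) (-ζ⁻¹ * p ^ (-1 : ℤ))) := by
    intro a ha
    filter_upwards [eventually_gen_mul hp hp0 ha hζ, eventually_gen_mul hp hp0 ha hζi,
      eventually_ne_zero_punctured ha] with z h1 h2 h3
    have e1 := al_shift hp hp0 1 one_ne_zero (neg_ne_zero.mpr hζ) (mul_ne_zero hζ h3) h1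
    have e2 := al_shift hp hp0 1 one_ne_zero (neg_ne_zero.mpr hζi) (mul_ne_zero hζi h3) h2
    simp only [pow_one, Finset.range_one, Finset.sum_singleton, pow_zero, one_mul,
      Nat.cast_zero, Nat.cast_one, zero_sub] at e1 e2
    simp only [hF, ← mul_assoc, pow_one]
    rw [e1, e2, jt_mul_base hp hp0 h3, jt_mul_base hp hp0 (mul_ne_zero hζ h3),
      jt_mul_base hp hp0 (mul_ne_zero hζi h3)]
    have := Gen.jt_ne_zero hp hp0 (mul_ne_zero hζ h3) h1
    have := Gen.jt_ne_zero hp hp0 (mul_ne_zero hζi h3) h2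
    field_simp; ring
  have hreg : ∀ a, a ≠ 0 → Gen p (ζ * a) → Gen p (ζ⁻¹ * a) →
      ∀ᶠ z in 𝓝 a, DifferentiableAt ℂ F z := by
    intro a ha h1 h2
    filter_upwards [
      eventually_differentiableAt_comp_mul (al_eventually_differentiableAt hp hp0 hs1
        (mul_ne_zero hζ ha) fun n _ => h1 n),
      eventually_differentiableAt_comp_mul (al_eventually_differentiableAt hp hp0 hs2
        (mul_ne_zero hζi ha) fun n _ => h2 n),
      eventually_differentiableAt_jt hp ha,
      eventually_differentiableAt_comp_mul
        (eventually_differentiableAt_inv_jt hp hp0 (mul_ne_zero hζ ha) h1),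
      eventually_differentiableAt_comp_mul
        (eventually_differentiableAt_inv_jt hp hp0 (mul_ne_zero hζi ha) h2)]
      with z d1 d2 d3 d4 d5
    exact ((d1.const_mul _).add d2).sub ((d3.const_mul _).mul (d4.mul d5))
  have hpole1 : SimplePole F ζ⁻¹ 0 := by
    have hG : Gen p (ζ⁻¹ * ζ⁻¹) := by
      have := hg2.inv; rwa [pow_two, mul_inv] at this
    have k1 := al_mul_simplePole hp hp0 hs1 hζ (mul_inv_cancel₀ hζ)
    have k2 : SimplePole (fun z => al p (thc p (-ζ⁻¹)) (ζ⁻¹ * z)) ζ⁻¹ 0 :=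
      .of_differentiable (eventually_differentiableAt_comp_mul
        (al_eventually_differentiableAt hp hp0 hs2 (mul_ne_zero hζi hζi) fun n _ => hG n))
    have k3 := (inv_jt_mul_simplePole hp hζ (mul_inv_cancel₀ hζ)).mul_of_differentiable
      (eventually_differentiableAt_comp_mul
        (eventually_differentiableAt_inv_jt hp hp0 (mul_ne_zero hζi hζi) hG))
    have k4 := k3.mul_of_differentiable (g := fun z => A * jt p z)
      ((eventually_differentiableAt_jt hp hζi).mono fun z h => h.const_mul A)
    refine ((((k1.const_mul ζ).add k2).sub k4).of_eq ?_).congr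
      (.of_forall fun z => by simp only [hF]; ring)
    rw [thc_zero, ← mul_inv, ← pow_two, hji2, hji, hA]
    field_simp; ring
  have hpole2 : SimplePole F ζ 0 := by
    have hG : Gen p (ζ * ζ) := by rwa [← pow_two]
    have k1 := al_mul_simplePole hp hp0 hs2 hζi (inv_mul_cancel₀ hζ)
    have k2 : SimplePole (fun z => al p (thc p (-ζ)) (ζ * z)) ζ 0 :=
      .of_differentiable (eventually_differentiableAt_comp_mul
        (al_eventually_differentiableAt hp hp0 hs1 (mul_ne_zero hζ hζ) fun n _ => hG n))
    have k3 := (inv_jt_mul_simplePole hp hζi (inv_mul_cancel₀ hζ)).mul_of_differentiable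
      (eventually_differentiableAt_comp_mul
        (eventually_differentiableAt_inv_jt hp hp0 (mul_ne_zero hζ hζ) hG))
    have k4 := k3.mul_of_differentiable (g := fun z => A * jt p z)
      ((eventually_differentiableAt_jt hp hζ).mono fun z h => h.const_mul A)
    refine ((((k2.const_mul ζ).add k1).sub k4).of_eq ?_).congr
      (.of_forall fun z => by simp only [hF])
    rw [thc_zero, ← pow_two, hA]
    field_simp; ring
  have key := (hq.eq_zero hp hp0 (by norm_num) one_ne_zero (by fun_prop)
    (K := ‖-ths (p ^ 1) (-ζ * p ^ (-1 : ℤ)) - ζ * ths (p ^ 1) (-ζ⁻¹ * p ^ (-1 : ℤ))‖)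
    (fun z => by
      simp only [tsub_self, pow_zero]
      nlinarith [norm_nonneg (-ths (p ^ 1) (-ζ * p ^ (-1 : ℤ)) - ζ * ths (p ^ 1) (-ζ⁻¹ * p ^ (-1 : ℤ)))])
    fun a ha => ?_).1 z hz
  · have := eq_of_tendsto key (hreg z hz h1 h2).self_of_nhds.continuousAt
    exact sub_eq_zero.mp this
  · by_cases g1 : Gen p (ζ * a)
    · by_cases g2 : Gen p (ζ⁻¹ * a)
      · exact .of_differentiable (hreg a ha g1 g2)
      · obtain ⟨n, hn⟩ := not_gen_iff.mp g2
        rw [← hq.simplePole_zpow_iff hp0 (by norm_num) (by fun_prop) ha n]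
        rwa [show a * p ^ n = ζ by rw [mul_assoc, inv_mul_eq_one₀ hζ] at hn; exact hn.symm]
    · obtain ⟨n, hn⟩ := not_gen_iff.mp g1
      rw [← hq.simplePole_zpow_iff hp0 (by norm_num) (by fun_prop) ha n]
      rwa [show a * p ^ n = ζ⁻¹ by rw [mul_assoc] at hn; exact eq_inv_of_mul_eq_one_right hn]

end
end RankCrank

namespace RankCrank
open Filter Topology

section
variable {p a t z ζ : ℂ}

lemma range_three_sum (f : ℕ → ℂ) : ∑ i ∈ Finset.range 3, f i = f 0 + f 1 + f 2 := by
  simp [Finset.sum_range_succ]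

/-- The three-pole combination of Lambert series of level three, together with the vanishing of
its middle inhomogeneous coefficient, which is the quintuple product identity. -/
theorem al_triple_aux (hp : ‖p‖ < 1) (hp0 : p ≠ 0) (hζ : ζ ≠ 0) (hg : Gen p ζ)
    (hg2 : Gen p (ζ ^ 2)) :
    (∀ z, z ≠ 0 → Gen p z → Gen p (ζ * z) → Gen p (ζ⁻¹ * z) →
      ζ ^ 3 * al p (thc (p ^ 3) (-ζ ^ 3)) (ζ * z) + al p (thc (p ^ 3) (-(ζ⁻¹) ^ 3)) (ζ⁻¹ * z)
        - ζ * (jt p (ζ ^ 2) / jt p ζ) * al p (thc (p ^ 3) (-1)) z =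
      qp p p ^ 3 * jt p ζ * jt p (ζ ^ 2) *
        ((jt p z)⁻¹ * ((jt p (ζ * z))⁻¹ * (jt p (ζ⁻¹ * z))⁻¹))) ∧
    jt p (ζ ^ 2) / jt p ζ * ths (p ^ 3) (-1 * p ^ (-2 : ℤ)) =
      ths (p ^ 3) (-ζ ^ 3 * p ^ (-2 : ℤ)) + ζ * ths (p ^ 3) (-(ζ⁻¹) ^ 3 * p ^ (-2 : ℤ)) := by
  have hζi := inv_ne_zero hζ
  have hP : ‖p ^ 3‖ < 1 := by rw [norm_pow]; exact pow_lt_one₀ (norm_nonneg _) hp (by norm_num)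
  have hP0 : p ^ 3 ≠ 0 := pow_ne_zero 3 hp0
  have hw1 : -ζ ^ 3 ≠ 0 := neg_ne_zero.mpr (pow_ne_zero 3 hζ)
  have hw2 : -ζ⁻¹ ^ 3 ≠ 0 := neg_ne_zero.mpr (pow_ne_zero 3 hζi)
  have hw3 : (-1 : ℂ) ≠ 0 := by norm_num
  have hs1 := thc_summable hP hP0 hw1
  have hs2 := thc_summable hP hP0 hw2
  have hs3 := thc_summable hP hP0 hw3
  have hJ := qp_self_ne_zero hp
  have hj := hg.jt_ne_zero hp hp0 hζ
  have hj2 := hg2.jt_ne_zero hp hp0 (pow_ne_zero 2 hζ)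
  have hji : jt p ζ⁻¹ = -ζ⁻¹ * jt p ζ := jt_inv hp hζ
  have hji2 : jt p (ζ ^ 2)⁻¹ = -(ζ ^ 2)⁻¹ * jt p (ζ ^ 2) := jt_inv hp (pow_ne_zero 2 hζ)
  have hgi := hg.inv
  have hgii : Gen p (ζ⁻¹ * ζ⁻¹) := by
    have := hg2.inv; rwa [pow_two, mul_inv] at this
  have hgg : Gen p (ζ * ζ) := by rwa [← pow_two]
  set A := qp p p ^ 3 * jt p ζ * jt p (ζ ^ 2) with hA
  set β := jt p (ζ ^ 2) / jt p ζ with hβ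
  set F : ℂ → ℂ := fun z => ζ ^ 3 * al p (thc (p ^ 3) (-ζ ^ 3)) (ζ * z)
    + al p (thc (p ^ 3) (-ζ⁻¹ ^ 3)) (ζ⁻¹ * z) - ζ * β * al p (thc (p ^ 3) (-1)) z -
    A * ((jt p z)⁻¹ * ((jt p (ζ * z))⁻¹ * (jt p (ζ⁻¹ * z))⁻¹)) with hF
  set κ : ℕ → ℂ := fun i => -ζ ^ i * ths (p ^ 3) (-ζ ^ 3 * p ^ ((i : ℤ) - (3 : ℕ)))
    - ζ ^ 3 * ζ⁻¹ ^ i * ths (p ^ 3) (-ζ⁻¹ ^ 3 * p ^ ((i : ℤ) - (3 : ℕ)))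
    + ζ * β * ths (p ^ 3) (-1 * p ^ ((i : ℤ) - (3 : ℕ))) with hκ
  have hq : QuasiPeriodic p F (-1) 3 (fun z => κ 0 + κ 1 * z + κ 2 * z ^ 2) := by
    intro a ha
    filter_upwards [eventually_gen_mul hp hp0 ha hζ, eventually_gen_mul hp hp0 ha hζi,
      eventually_gen_mul hp hp0 ha one_ne_zero, eventually_ne_zero_punctured ha] with z h1 h2 h4 h3
    rw [one_mul] at h4
    have e1 := al_shift hp hp0 3 three_ne_zero hw1 (mul_ne_zero hζ h3) h1
    have e2 := al_shift hp hp0 3 three_ne_zero hw2 (mul_ne_zero hζi h3) h2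
    have e3 := al_shift hp hp0 3 three_ne_zero hw3 h3 h4
    rw [range_three_sum] at e1 e2 e3
    simp only [hF, hκ, ← mul_assoc]
    rw [e1, e2, e3, jt_mul_base hp hp0 h3, jt_mul_base hp hp0 (mul_ne_zero hζ h3),
      jt_mul_base hp hp0 (mul_ne_zero hζi h3)]
    have n1 := Gen.jt_ne_zero hp hp0 (mul_ne_zero hζ h3) h1
    have n2 := Gen.jt_ne_zero hp hp0 (mul_ne_zero hζi h3) h2
    have n3 := Gen.jt_ne_zero hp hp0 h3 h4
    generalize ths _ _ = t1
    generalize ths _ _ = t2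
    generalize ths _ _ = t3
    generalize ths _ _ = t4
    generalize ths _ _ = t5
    generalize ths _ _ = t6
    generalize ths _ _ = t7
    generalize ths _ _ = t8
    generalize ths _ _ = t9
    clear_value A β
    generalize jt p (ζ * z) = j1 at *
    generalize jt p (ζ⁻¹ * z) = j2 at *
    generalize al p _ _ = a1
    generalize al p _ _ = a2
    generalize al p _ _ = a3
    field_simp
    ring
  have hreg : ∀ a, a ≠ 0 → Gen p a → Gen p (ζ * a) → Gen p (ζ⁻¹ * a) →
      ∀ᶠ z in 𝓝 a, DifferentiableAt ℂ F z := by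
    intro a ha h3 h1 h2
    filter_upwards [
      eventually_differentiableAt_comp_mul (al_eventually_differentiableAt hp hp0 hs1
        (mul_ne_zero hζ ha) fun n _ => h1 n),
      eventually_differentiableAt_comp_mul (al_eventually_differentiableAt hp hp0 hs2
        (mul_ne_zero hζi ha) fun n _ => h2 n),
      al_eventually_differentiableAt hp hp0 hs3 ha fun n _ => h3 n,
      eventually_differentiableAt_inv_jt hp hp0 ha h3,
      eventually_differentiableAt_comp_mul
        (eventually_differentiableAt_inv_jt hp hp0 (mul_ne_zero hζ ha) h1),
      eventually_differentiableAt_comp_mul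
        (eventually_differentiableAt_inv_jt hp hp0 (mul_ne_zero hζi ha) h2)]
      with z d1 d2 d3 d4 d5 d6
    exact (((d1.const_mul _).add d2).sub (d3.const_mul _)).sub
      ((d4.mul (d5.mul d6)).const_mul _)
  have hpole1 : SimplePole F ζ⁻¹ 0 := by
    have k1 := al_mul_simplePole hp hp0 hs1 hζ (mul_inv_cancel₀ hζ)
    have k2 : SimplePole (fun z => al p (thc (p ^ 3) (-ζ⁻¹ ^ 3)) (ζ⁻¹ * z)) ζ⁻¹ 0 :=
      .of_differentiable (eventually_differentiableAt_comp_mul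
        (al_eventually_differentiableAt hp hp0 hs2 (mul_ne_zero hζi hζi) fun n _ => hgii n))
    have k3 := al_simplePole_regular hp hp0 hs3 hζi hgi
    have k4 := (inv_jt_mul_simplePole hp hζ (mul_inv_cancel₀ hζ)).mul_of_differentiable
      (eventually_differentiableAt_comp_mul
        (eventually_differentiableAt_inv_jt hp hp0 (mul_ne_zero hζi hζi) hgii))
    have k5 := k4.mul_of_differentiable (eventually_differentiableAt_inv_jt hp hp0 hζi hgi)
    refine ((((k1.const_mul (ζ ^ 3)).add k2).sub (k3.const_mul (ζ * β))).sub
      (k5.const_mul A)).of_eq ?_ |>.congr (.of_forall fun z => by simp only [hF]; ring)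
    rw [thc_zero, ← mul_inv, ← pow_two, hji2, hji, hA]
    field_simp; ring
  have hpole2 : SimplePole F ζ 0 := by
    have k1 := al_mul_simplePole hp hp0 hs2 hζi (inv_mul_cancel₀ hζ)
    have k2 : SimplePole (fun z => al p (thc (p ^ 3) (-ζ ^ 3)) (ζ * z)) ζ 0 :=
      .of_differentiable (eventually_differentiableAt_comp_mul
        (al_eventually_differentiableAt hp hp0 hs1 (mul_ne_zero hζ hζ) fun n _ => hgg n))
    have k3 := al_simplePole_regular hp hp0 hs3 hζ hg
    have k4 := (inv_jt_mul_simplePole hp hζi (inv_mul_cancel₀ hζ)).mul_of_differentiable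
      (eventually_differentiableAt_comp_mul
        (eventually_differentiableAt_inv_jt hp hp0 (mul_ne_zero hζ hζ) hgg))
    have k5 := k4.mul_of_differentiable (eventually_differentiableAt_inv_jt hp hp0 hζ hg)
    refine ((((k2.const_mul (ζ ^ 3)).add k1).sub (k3.const_mul (ζ * β))).sub
      (k5.const_mul A)).of_eq ?_ |>.congr (.of_forall fun z => by simp only [hF])
    rw [thc_zero, ← pow_two, hA]
    field_simp; ring
  have hpole3 : SimplePole F 1 0 := by
    have g1 : Gen p (ζ * 1) := by rwa [mul_one]
    have g2 : Gen p (ζ⁻¹ * 1) := by rwa [mul_one]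
    have k1 : SimplePole (fun z => al p (thc (p ^ 3) (-ζ ^ 3)) (ζ * z)) 1 0 :=
      .of_differentiable (eventually_differentiableAt_comp_mul
        (al_eventually_differentiableAt hp hp0 hs1 (mul_ne_zero hζ one_ne_zero) fun n _ => g1 n))
    have k2 : SimplePole (fun z => al p (thc (p ^ 3) (-ζ⁻¹ ^ 3)) (ζ⁻¹ * z)) 1 0 :=
      .of_differentiable (eventually_differentiableAt_comp_mul
        (al_eventually_differentiableAt hp hp0 hs2 (mul_ne_zero hζi one_ne_zero) fun n _ => g2 n))
    have k3 := al_simplePole hp hp0 hs3 (a := 1) (m := 0) (by simp)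
    have k4 := (inv_jt_simplePole hp).mul_of_differentiable (g := fun z => (jt p (ζ * z))⁻¹)
      (eventually_differentiableAt_comp_mul
        (eventually_differentiableAt_inv_jt hp hp0 (mul_ne_zero hζ one_ne_zero) g1))
    have k5 := k4.mul_of_differentiable (g := fun z => (jt p (ζ⁻¹ * z))⁻¹)
      (eventually_differentiableAt_comp_mul
        (eventually_differentiableAt_inv_jt hp hp0 (mul_ne_zero hζi one_ne_zero) g2))
    refine ((((k1.const_mul (ζ ^ 3)).add k2).sub (k3.const_mul (ζ * β))).sub
      (k5.const_mul A)).of_eq ?_ |>.congr (.of_forall fun z => by simp only [hF]; ring)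
    rw [thc_zero, mul_one, mul_one, hji, hA, hβ]
    field_simp; ring
  have key := hq.eq_zero hp hp0 (by norm_num) three_ne_zero (by fun_prop)
    (K := ‖κ 0‖ + ‖κ 1‖ + ‖κ 2‖)
    (fun z => by
      have h1 := norm_add₃_le (a := κ 0) (b := κ 1 * z) (c := κ 2 * z ^ 2)
      simp only [norm_mul, norm_pow] at h1
      refine h1.trans ?_
      have h2 := norm_nonneg (κ 0)
      have h3 := norm_nonneg (κ 1)
      have h4 := norm_nonneg (κ 2)
      have h5 := norm_nonneg z
      have h6 : ‖z‖ ≤ 1 + ‖z‖ ^ 2 := by nlinarith [sq_nonneg (‖z‖ - 1)]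
      have h7 := mul_le_mul_of_nonneg_left h6 h3
      have h8 : 0 ≤ ‖κ 0‖ * ‖z‖ ^ 2 := by positivity
      simp only [show 3 - 1 = 2 from rfl]
      nlinarith)
    fun a ha => by
      by_cases g1 : Gen p (ζ * a)
      · by_cases g2 : Gen p (ζ⁻¹ * a)
        · by_cases g3 : Gen p a
          · exact .of_differentiable (hreg a ha g3 g1 g2)
          · obtain ⟨n, hn⟩ := not_gen_iff.mp g3
            rw [← hq.simplePole_zpow_iff hp0 (by norm_num) (by fun_prop) ha n]
            rwa [hn]
        · obtain ⟨n, hn⟩ := not_gen_iff.mp g2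
          rw [← hq.simplePole_zpow_iff hp0 (by norm_num) (by fun_prop) ha n]
          rwa [show a * p ^ n = ζ by rw [mul_assoc, inv_mul_eq_one₀ hζ] at hn; exact hn.symm]
      · obtain ⟨n, hn⟩ := not_gen_iff.mp g1
        rw [← hq.simplePole_zpow_iff hp0 (by norm_num) (by fun_prop) ha n]
        rwa [show a * p ^ n = ζ⁻¹ by rw [mul_assoc] at hn; exact eq_inv_of_mul_eq_one_right hn]
  constructor
  · intro z hz g3 g1 g2
    have := eq_of_tendsto (key.1 z hz) (hreg z hz g3 g1 g2).self_of_nhds.continuousAt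
    exact sub_eq_zero.mp this
  · have k1 := key.2 1 one_ne_zero
    have k2 := key.2 (-1) (by norm_num)
    have k3 : κ 1 = 0 := by linear_combination (1 / 2) * k1 - (1 / 2) * k2
    simp only [hκ, show ((1 : ℕ) : ℤ) - (3 : ℕ) = -2 by norm_num] at k3
    have k4 : ζ ^ 3 * ζ⁻¹ ^ 1 = ζ ^ 2 := by field_simp
    rw [k4] at k3
    apply mul_left_cancel₀ hζ
    linear_combination k3

end
end RankCrank

namespace RankCrank
open Filter Topology

section
variable {p a t z ζ : ℂ}

/-- The logarithmic derivative `z j'(z) / j(z)` of the theta function. -/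
noncomputable def rh (p z : ℂ) : ℂ := z * deriv (jt p) z / jt p z

lemma rh_mul_base (hp : ‖p‖ < 1) (hp0 : p ≠ 0) (hz : z ≠ 0) (h : Gen p z) :
    rh p (z * p) = rh p z - 1 := by
  have hj := h.jt_ne_zero hp hp0 hz
  have hd := (jt_differentiableAt hp hz).hasDerivAt
  have hd1 := (jt_differentiableAt hp (mul_ne_zero hz hp0)).hasDerivAt
  have h1 : HasDerivAt (fun z => jt p (z * p)) (deriv (jt p) (z * p) * p) z := by
    simpa [Function.comp_def] using hd1.comp z ((hasDerivAt_id z).mul_const p)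
  have h2 : HasDerivAt (fun z => -z⁻¹ * jt p z)
      (-(-(z ^ 2)⁻¹) * jt p z + -z⁻¹ * deriv (jt p) z) z :=
    (hasDerivAt_inv hz).neg.mul hd
  have h3 := h1.unique (h2.congr_of_eventuallyEq
    (Filter.eventually_of_mem (isOpen_ne.mem_nhds hz) fun x hx => jt_mul_base hp hp0 hx))
  rw [rh, rh, jt_mul_base hp hp0 hz, mul_assoc, mul_comm p, h3]
  field_simp
  ring

lemma rh_inv (hp : ‖p‖ < 1) (hp0 : p ≠ 0) (hz : z ≠ 0) (h : Gen p z) :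
    rh p z⁻¹ = 1 - rh p z := by
  have hj := h.jt_ne_zero hp hp0 hz
  have hd := (jt_differentiableAt hp hz).hasDerivAt
  have hd1 := (jt_differentiableAt hp (inv_ne_zero hz)).hasDerivAt
  have h1 : HasDerivAt (fun z => jt p z⁻¹) (deriv (jt p) z⁻¹ * (-(z ^ 2)⁻¹)) z :=
    hd1.comp z (hasDerivAt_inv hz)
  have h2 : HasDerivAt (fun z => -z⁻¹ * jt p z)
      (-(-(z ^ 2)⁻¹) * jt p z + -z⁻¹ * deriv (jt p) z) z :=
    (hasDerivAt_inv hz).neg.mul hd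
  have h3 := h1.unique (h2.congr_of_eventuallyEq
    (Filter.eventually_of_mem (isOpen_ne.mem_nhds hz) fun x hx => jt_inv hp hx))
  have h4 : deriv (jt p) z⁻¹ = -z ^ 2 * (-(-(z ^ 2)⁻¹) * jt p z + -z⁻¹ * deriv (jt p) z) := by
    rw [← h3]; field_simp
  rw [rh, rh, jt_inv hp hz, h4]
  field_simp
  ring

lemma tendsto_div_one_sub {G : ℂ → ℂ} {g' : ℂ} (hG : HasDerivAt G g' 1) (h1 : G 1 = 1) :
    Tendsto (fun w => G w * (1 - w)⁻¹ - 1 / (1 - w)) (𝓝[≠] 1) (𝓝 (-g')) := by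
  have := (hasDerivAt_iff_tendsto_slope.mp hG).neg
  refine this.congr' ?_
  filter_upwards [self_mem_nhdsWithin] with w hw
  have : w - 1 ≠ 0 := sub_ne_zero.mpr hw
  have : 1 - w ≠ 0 := sub_ne_zero.mpr (Ne.symm hw)
  rw [slope_def_field, h1]
  field_simp
  ring

lemma al_finite_part_one {c : ℤ → ℂ} (hp : ‖p‖ < 1) (hp0 : p ≠ 0) (hc : Summable fun n => ‖c n‖)
    (h0 : c 0 = 1) : Tendsto (fun w => al p c w - 1 / (1 - w)) (𝓝[≠] 1) (𝓝 (al p c 1)) := by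
  have := al_finite_part hp hp0 hc (a := 1) (m := 0) (by simp)
  simpa [h0] using this

lemma al_tendsto_comp {c : ℤ → ℂ} (hp : ‖p‖ < 1) (hp0 : p ≠ 0) (hc : Summable fun n => ‖c n‖)
    (ht : t ≠ 0) (h : Gen p t) :
    Tendsto (fun w => al p c (t * w)) (𝓝[≠] 1) (𝓝 (al p c t)) := by
  have h1 := (eventually_differentiableAt_comp_mul (a := 1) (t := t)
    (al_eventually_differentiableAt hp hp0 hc (mul_ne_zero ht one_ne_zero)
      fun n _ => by rw [mul_one]; exact h n)).self_of_nhds.continuousAt.tendsto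
  rw [mul_one] at h1
  exact h1.mono_left nhdsWithin_le_nhds

lemma jt_comp_hasDerivAt (hp : ‖p‖ < 1) (ht : t ≠ 0) (hj : jt p t ≠ 0) :
    HasDerivAt (fun w => jt p (t * w)) (rh p t * jt p t) 1 := by
  have h := (jt_differentiableAt hp (mul_ne_zero ht one_ne_zero)).hasDerivAt
  have := h.comp (1 : ℂ) ((hasDerivAt_id (1 : ℂ)).const_mul t)
  simp only [mul_one] at this
  have e : rh p t * jt p t = deriv (jt p) t * t := by rw [rh]; field_simp
  rw [e]; exact this

/-- The degenerate case of the level three identity. -/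
theorem al_triple_pole (hp : ‖p‖ < 1) (hp0 : p ≠ 0) (hζ : ζ ≠ 0) (hg : Gen p ζ)
    (hg2 : Gen p (ζ ^ 2)) :
    ζ ^ 3 * al p (thc (p ^ 3) (-ζ ^ 3)) (ζ ^ 2) + al p (thc (p ^ 3) (-(ζ⁻¹) ^ 3)) 1
      - ζ * (jt p (ζ ^ 2) / jt p ζ) * al p (thc (p ^ 3) (-1)) ζ = rh p ζ + rh p (ζ ^ 2) := by
  have hζi := inv_ne_zero hζ
  have hζ2 := pow_ne_zero 2 hζ
  have hP : ‖p ^ 3‖ < 1 := by rw [norm_pow]; exact pow_lt_one₀ (norm_nonneg _) hp (by norm_num)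
  have hP0 : p ^ 3 ≠ 0 := pow_ne_zero 3 hp0
  have hs1 := thc_summable hP hP0 (neg_ne_zero.mpr (pow_ne_zero 3 hζ))
  have hs2 := thc_summable hP hP0 (neg_ne_zero.mpr (pow_ne_zero 3 hζi))
  have hs3 := thc_summable hP hP0 (neg_ne_zero.mpr (one_ne_zero (α := ℂ)))
  have hJ := qp_self_ne_zero hp
  have hj := hg.jt_ne_zero hp hp0 hζ
  have hj2 := hg2.jt_ne_zero hp hp0 hζ2
  have l1 := ((al_tendsto_comp hp hp0 hs1 hζ2 hg2).const_mul (ζ ^ 3)).add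
    ((al_finite_part_one hp hp0 hs2 thc_zero))
  have l2 := l1.sub ((al_tendsto_comp hp hp0 hs3 hζ hg).const_mul (ζ * (jt p (ζ ^ 2) / jt p ζ)))
  have hG := ((((jt_comp_hasDerivAt hp hζ hj).mul (jt_comp_hasDerivAt hp hζ2 hj2)).mul
    (jg_deriv_one hp)).inv (by
      simp only [Pi.mul_apply, mul_one, jg_one]
      exact mul_ne_zero (mul_ne_zero hj hj2) (pow_ne_zero 3 hJ))).const_mul
      (qp p p ^ 3 * jt p ζ * jt p (ζ ^ 2))
  have l3 := tendsto_div_one_sub hG (by simp [jg_one]; field_simp)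
  have l4 := tendsto_nhds_unique (l2.congr' ?_) l3
  · rw [l4]
    simp only [Pi.mul_apply, mul_one, jg_one]
    field_simp
    ring
  · filter_upwards [eventually_gen_mul hp hp0 one_ne_zero one_ne_zero,
      eventually_gen_mul hp hp0 one_ne_zero hζ, eventually_gen_mul hp hp0 one_ne_zero hζ2,
      eventually_ne_zero_punctured one_ne_zero] with w h1 h2 h3 h4
    have e1 : ζ * (ζ * w) = ζ ^ 2 * w := by ring
    have e2 : ζ⁻¹ * (ζ * w) = w := by field_simp
    rw [one_mul] at h1
    have := (al_triple_aux hp hp0 hζ hg hg2).1 (ζ * w) (mul_ne_zero hζ h4) h2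
      (by rwa [e1]) (by rwa [e2])
    rw [e1, e2, jt_eq_jg hp w] at this
    simp only [Pi.mul_apply, Pi.inv_apply, mul_inv] at this ⊢
    linear_combination this

/-- The degenerate case of the level one identity. -/
theorem al_pair_pole (hp : ‖p‖ < 1) (hp0 : p ≠ 0) (hζ : ζ ≠ 0) (hg : Gen p ζ)
    (hg2 : Gen p (ζ ^ 2)) :
    ζ * al p (thc p (-ζ)) (ζ ^ 2) + al p (thc p (-ζ⁻¹)) 1 = rh p (ζ ^ 2) - rh p ζ := by
  have hζi := inv_ne_zero hζ
  have hζ2 := pow_ne_zero 2 hζ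
  have hs1 := thc_summable hp hp0 (neg_ne_zero.mpr hζ)
  have hs2 := thc_summable hp hp0 (neg_ne_zero.mpr hζi)
  have hJ := qp_self_ne_zero hp
  have hj := hg.jt_ne_zero hp hp0 hζ
  have hj2 := hg2.jt_ne_zero hp hp0 hζ2
  have l2 := ((al_tendsto_comp hp hp0 hs1 hζ2 hg2).const_mul ζ).add
    ((al_finite_part_one hp hp0 hs2 thc_zero))
  have hG := ((jt_comp_hasDerivAt hp hζ hj).mul (((jt_comp_hasDerivAt hp hζ2 hj2).mul
    (jg_deriv_one hp)).inv (by
      simp only [Pi.mul_apply, mul_one, jg_one]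
      exact mul_ne_zero hj2 (pow_ne_zero 3 hJ)))).const_mul
      (qp p p ^ 3 * jt p (ζ ^ 2) / jt p ζ)
  have l3 := tendsto_div_one_sub hG (by simp [jg_one]; field_simp)
  have l4 := tendsto_nhds_unique (l2.congr' ?_) l3
  · rw [l4]
    simp only [Pi.mul_apply, Pi.inv_apply, mul_one, jg_one]
    field_simp
    ring
  · filter_upwards [eventually_gen_mul hp hp0 one_ne_zero one_ne_zero,
      eventually_gen_mul hp hp0 one_ne_zero hζ, eventually_gen_mul hp hp0 one_ne_zero hζ2,
      eventually_ne_zero_punctured one_ne_zero] with w h1 h2 h3 h4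
    have e1 : ζ * (ζ * w) = ζ ^ 2 * w := by ring
    have e2 : ζ⁻¹ * (ζ * w) = w := by field_simp
    rw [one_mul] at h1
    have := al_pair_eq hp hp0 hζ hg hg2 (mul_ne_zero hζ h4)
      (by rwa [e1]) (by rwa [e2])
    rw [e1, e2, jt_eq_jg hp w] at this
    simp only [Pi.mul_apply, Pi.inv_apply, mul_inv] at this ⊢
    linear_combination this

end
end RankCrank

namespace RankCrank
open Filter Topology

section
variable {p a b c d t x y z ζ : ℂ}

/-- The Weierstrass sigma-type product `a⁻¹ j(ab) j(a/b)`. -/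
noncomputable def wS (p a b : ℂ) : ℂ := a⁻¹ * jt p (b * a) * jt p (b⁻¹ * a)

lemma wS_anti (hp : ‖p‖ < 1) (ha : a ≠ 0) (hb : b ≠ 0) : wS p b a = -wS p a b := by
  have := jt_inv hp (mul_ne_zero (inv_ne_zero hb) ha)
  rw [mul_inv, inv_inv] at this
  rw [wS, wS, mul_comm a⁻¹ b, this, mul_comm a b]
  field_simp

lemma wS_self (ha : a ≠ 0) : wS p a a = 0 := by
  rw [wS, inv_mul_cancel₀ ha, jt_one, mul_zero]

lemma wS_inv (hp : ‖p‖ < 1) (ha : a ≠ 0) (hb : b ≠ 0) : wS p a⁻¹ b = wS p a b := by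
  have h1 := jt_inv hp (mul_ne_zero (inv_ne_zero hb) ha)
  have h2 := jt_inv hp (mul_ne_zero hb ha)
  rw [mul_inv] at h1 h2
  rw [inv_inv] at h1
  rw [wS, wS, h1, h2]
  field_simp

lemma wS_mul_base (hp : ‖p‖ < 1) (hp0 : p ≠ 0) (ha : a ≠ 0) (hb : b ≠ 0) :
    wS p (a * p) b = p⁻¹ * (a⁻¹) ^ 2 * wS p a b := by
  rw [wS, wS, ← mul_assoc, ← mul_assoc, jt_mul_base hp hp0 (mul_ne_zero hb ha),
    jt_mul_base hp hp0 (mul_ne_zero (inv_ne_zero hb) ha)]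
  field_simp

lemma wS_ne_zero (hp : ‖p‖ < 1) (hp0 : p ≠ 0) (ha : a ≠ 0) (hb : b ≠ 0) (h1 : Gen p (b * a))
    (h2 : Gen p (b⁻¹ * a)) : wS p a b ≠ 0 :=
  mul_ne_zero (mul_ne_zero (inv_ne_zero ha) (h1.jt_ne_zero hp hp0 (mul_ne_zero hb ha)))
    (h2.jt_ne_zero hp hp0 (mul_ne_zero (inv_ne_zero hb) ha))

lemma eventually_differentiableAt_wS (hp : ‖p‖ < 1) (ha : a ≠ 0) (hb : b ≠ 0) :
    ∀ᶠ z in 𝓝 a, DifferentiableAt ℂ (fun z => wS p z b) z := by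
  filter_upwards [isOpen_ne.mem_nhds ha,
    eventually_differentiableAt_comp_mul (eventually_differentiableAt_jt hp (mul_ne_zero hb ha)),
    eventually_differentiableAt_comp_mul
      (eventually_differentiableAt_jt hp (mul_ne_zero (inv_ne_zero hb) ha))] with z h1 h2 h3
  exact ((differentiableAt_inv h1).mul h2).mul h3

lemma eventually_differentiableAt_inv_wS (hp : ‖p‖ < 1) (hp0 : p ≠ 0) (ha : a ≠ 0) (hb : b ≠ 0)
    (h1 : Gen p (b * a)) (h2 : Gen p (b⁻¹ * a)) :
    ∀ᶠ z in 𝓝 a, DifferentiableAt ℂ (fun z => (wS p z b)⁻¹) z := by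
  have h := eventually_differentiableAt_wS hp ha hb
  filter_upwards [h, h.self_of_nhds.continuousAt.eventually_ne (wS_ne_zero hp hp0 ha hb h1 h2)]
    with z k1 k2
  exact k1.inv k2

lemma inv_wS_simplePole (hp : ‖p‖ < 1) (hp0 : p ≠ 0) (hd : d ≠ 0) (ha : a ≠ 0)
    (hg : Gen p (d * a)) (hda : d⁻¹ * a = 1) : ∃ r, SimplePole (fun z => (wS p z d)⁻¹) a r := by
  have h1 := inv_jt_mul_simplePole hp (inv_ne_zero hd) hda
  have h2 := h1.mul_of_differentiable (g := fun z => z * (jt p (d * z))⁻¹) (by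
    filter_upwards [eventually_differentiableAt_comp_mul
      (eventually_differentiableAt_inv_jt hp hp0 (mul_ne_zero hd ha) hg)] with z h
    exact differentiableAt_id.mul h)
  exact ⟨_, h2.congr (.of_forall fun z => by simp only [wS, mul_inv, inv_inv])⟩

lemma inv_wS_simplePole' (hp : ‖p‖ < 1) (hp0 : p ≠ 0) (hd : d ≠ 0) (ha : a ≠ 0)
    (hg : Gen p (d⁻¹ * a)) (hda : d * a = 1) : ∃ r, SimplePole (fun z => (wS p z d)⁻¹) a r := by
  have h1 := inv_jt_mul_simplePole hp hd hda
  have h2 := h1.mul_of_differentiable (g := fun z => z * (jt p (d⁻¹ * z))⁻¹) (by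
    filter_upwards [eventually_differentiableAt_comp_mul
      (eventually_differentiableAt_inv_jt hp hp0 (mul_ne_zero (inv_ne_zero hd) ha) hg)] with z h
    exact differentiableAt_id.mul h)
  exact ⟨_, h2.congr (.of_forall fun z => by simp only [wS, mul_inv, inv_inv]; ring)⟩

/-- The three-term identity of Weierstrass. -/
theorem wS_three_term (hp : ‖p‖ < 1) (hp0 : p ≠ 0) (ha : a ≠ 0) (hb : b ≠ 0) (hc : c ≠ 0)
    (hd : d ≠ 0) (hd2 : Gen p (d * d)) (h1 : Gen p (d * a)) (h2 : Gen p (d⁻¹ * a))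
    (h3 : Gen p (d * b)) (h4 : Gen p (d⁻¹ * b)) :
    wS p a b * wS p c d - wS p a c * wS p b d + wS p a d * wS p b c = 0 := by
  set N : ℂ → ℂ := fun z => wS p z b * wS p c d - wS p z c * wS p b d with hN
  set F : ℂ → ℂ := fun z => N z * (wS p z d)⁻¹ with hF
  have hdi := inv_ne_zero hd
  have hdN : ∀ a, a ≠ 0 → ∀ᶠ z in 𝓝 a, DifferentiableAt ℂ N z := by
    intro a ha
    filter_upwards [eventually_differentiableAt_wS hp ha hb, eventually_differentiableAt_wS hp ha hc]
      with z h1 h2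
    exact (h1.mul_const _).sub (h2.mul_const _)
  have hreg : ∀ a, a ≠ 0 → Gen p (d * a) → Gen p (d⁻¹ * a) →
      ∀ᶠ z in 𝓝 a, DifferentiableAt ℂ F z := by
    intro a ha h1 h2
    filter_upwards [hdN a ha, eventually_differentiableAt_inv_wS hp hp0 ha hd h1 h2] with z k1 k2
    exact k1.mul k2
  have hq : QuasiPeriodic p F 1 0 (fun _ => 0) := by
    intro a ha
    filter_upwards [eventually_ne_zero_punctured ha] with z hz
    simp only [hF, hN]
    rw [wS_mul_base hp hp0 hz hb, wS_mul_base hp hp0 hz hc, wS_mul_base hp hp0 hz hd, mul_inv]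
    field_simp
    ring
  have hNd : N d = 0 := by
    simp only [hN]
    rw [wS_anti hp hb hd, wS_anti hp hc hd]; ring
  have hNdi : N d⁻¹ = 0 := by
    rw [← hNd]; simp only [hN]
    rw [wS_inv hp hd hb, wS_inv hp hd hc]
  have hp1 : SimplePole F d 0 := by
    obtain ⟨r, hr⟩ := inv_wS_simplePole hp hp0 hd hd hd2 (inv_mul_cancel₀ hd)
    exact (hr.mul_of_differentiable (hdN d hd)).of_eq (by rw [hNd, zero_mul])
  have hp2 : SimplePole F d⁻¹ 0 := by
    have hg := hd2.inv
    rw [mul_inv] at hg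
    obtain ⟨r, hr⟩ := inv_wS_simplePole' hp hp0 hd hdi hg (mul_inv_cancel₀ hd)
    exact (hr.mul_of_differentiable (hdN _ hdi)).of_eq (by rw [hNdi, zero_mul])
  obtain ⟨k, hk⟩ := hq.exists_const hp hp0 fun a ha => by
    by_cases g1 : Gen p (d * a)
    · by_cases g2 : Gen p (d⁻¹ * a)
      · exact .of_differentiable (hreg a ha g1 g2)
      · obtain ⟨n, hn⟩ := not_gen_iff.mp g2
        rw [← hq.simplePole_zpow_iff hp0 (by norm_num) (by fun_prop) ha n]
        rwa [show a * p ^ n = d by rw [mul_assoc, inv_mul_eq_one₀ hd] at hn; exact hn.symm]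
    · obtain ⟨n, hn⟩ := not_gen_iff.mp g1
      rw [← hq.simplePole_zpow_iff hp0 (by norm_num) (by fun_prop) ha n]
      rwa [show a * p ^ n = d⁻¹ by rw [mul_assoc] at hn; exact eq_inv_of_mul_eq_one_right hn]
  have ea := eq_of_tendsto (hk a ha) (hreg a ha h1 h2).self_of_nhds.continuousAt
  have eb := eq_of_tendsto (hk b hb) (hreg b hb h3 h4).self_of_nhds.continuousAt
  have n1 := wS_ne_zero hp hp0 ha hd h1 h2
  have n2 := wS_ne_zero hp hp0 hb hd h3 h4
  have e := ea.trans eb.symm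
  simp only [hF, hN, wS_self hb] at e
  field_simp at e
  apply mul_left_cancel₀ n2
  linear_combination e

lemma rh_simplePole (hp : ‖p‖ < 1) : SimplePole (rh p) 1 1 := by
  have h := (inv_jt_simplePole hp).mul_of_differentiable (g := fun z => z * deriv (jt p) z) (by
    have hd : DifferentiableOn ℂ (jt p) {0}ᶜ := fun z hz => (jt_differentiableAt hp hz).differentiableWithinAt
    have hd' := hd.deriv isOpen_compl_singleton
    filter_upwards [isOpen_compl_singleton.mem_nhds (show (1 : ℂ) ∈ ({0}ᶜ : Set ℂ) by simp)] with z hz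
    exact differentiableAt_id.mul (hd'.differentiableAt (isOpen_compl_singleton.mem_nhds hz)))
  refine (h.of_eq ?_).congr (.of_forall fun z => by rw [rh, div_eq_mul_inv])
  have := qp_self_ne_zero hp
  rw [(jt_hasDerivAt_one hp).deriv]; field_simp

lemma eventually_differentiableAt_rh (hp : ‖p‖ < 1) (hp0 : p ≠ 0) (ha : a ≠ 0) (h : Gen p a) :
    ∀ᶠ z in 𝓝 a, DifferentiableAt ℂ (rh p) z := by
  have hd : DifferentiableOn ℂ (jt p) {0}ᶜ := fun z hz => (jt_differentiableAt hp hz).differentiableWithinAt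
  have hd' := hd.deriv isOpen_compl_singleton
  filter_upwards [isOpen_compl_singleton.mem_nhds (show a ∈ ({0}ᶜ : Set ℂ) from ha),
    eventually_differentiableAt_inv_jt hp hp0 ha h] with z hz h2
  have := (differentiableAt_id.mul (hd'.differentiableAt (isOpen_compl_singleton.mem_nhds hz))).mul h2
  exact this.congr_of_eventuallyEq (.of_forall fun z => by simp [rh, div_eq_mul_inv])

/-- The addition theorem for the logarithmic derivative of the theta function. -/
theorem rh_add (hp : ‖p‖ < 1) (hp0 : p ≠ 0) (hx : x ≠ 0) (hy : y ≠ 0) (hz : z ≠ 0)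
    (gx : Gen p x) (gy : Gen p y) (gxy : Gen p (x * y)) (gz : Gen p z) (gxyz : Gen p (x * y * z)) :
    rh p x + rh p y + rh p z - rh p (x * y * z) - 1 =
      -(qp p p ^ 3 * jt p (x * y) * jt p (x * z) * jt p (y * z) /
        (jt p x * jt p y * jt p z * jt p (x * y * z))) := by
  have hxy := mul_ne_zero hx hy
  have hJ := qp_self_ne_zero hp
  have jx := gx.jt_ne_zero hp hp0 hx
  have jy := gy.jt_ne_zero hp hp0 hy
  have jxy := gxy.jt_ne_zero hp hp0 hxy
  set A := qp p p ^ 3 * jt p (x * y) / (jt p x * jt p y) with hA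
  set F : ℂ → ℂ := fun z => rh p z - rh p (x * y * z)
    + A * (jt p (x * z) * jt p (y * z) * ((jt p z)⁻¹ * (jt p (x * y * z))⁻¹)) with hF
  have hq : QuasiPeriodic p F 1 0 (fun _ => 0) := by
    intro a ha
    filter_upwards [eventually_gen_mul hp hp0 ha one_ne_zero, eventually_gen_mul hp hp0 ha hxy,
      eventually_ne_zero_punctured ha] with z h1 h2 h3
    rw [one_mul] at h1
    simp only [hF, ← mul_assoc]
    rw [rh_mul_base hp hp0 h3 h1, rh_mul_base hp hp0 (mul_ne_zero hxy h3) h2,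
      jt_mul_base hp hp0 (mul_ne_zero hx h3), jt_mul_base hp hp0 (mul_ne_zero hy h3),
      jt_mul_base hp hp0 (mul_ne_zero hxy h3), jt_mul_base hp hp0 h3]
    have := h1.jt_ne_zero hp hp0 h3
    have := h2.jt_ne_zero hp hp0 (mul_ne_zero hxy h3)
    field_simp
    ring
  have hdj : ∀ t a, t ≠ 0 → a ≠ 0 → ∀ᶠ z in 𝓝 a, DifferentiableAt ℂ (fun z => jt p (t * z)) z :=
    fun t a ht ha => eventually_differentiableAt_comp_mul
      (eventually_differentiableAt_jt hp (mul_ne_zero ht ha))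
  have hreg : ∀ a, a ≠ 0 → Gen p a → Gen p (x * y * a) →
      ∀ᶠ z in 𝓝 a, DifferentiableAt ℂ F z := by
    intro a ha h1 h2
    filter_upwards [eventually_differentiableAt_rh hp hp0 ha h1,
      eventually_differentiableAt_comp_mul
        (eventually_differentiableAt_rh hp hp0 (mul_ne_zero hxy ha) h2), hdj x a hx ha,
      hdj y a hy ha, eventually_differentiableAt_inv_jt hp hp0 ha h1,
      eventually_differentiableAt_comp_mul
        (eventually_differentiableAt_inv_jt hp hp0 (mul_ne_zero hxy ha) h2)]
      with z k1 k2 k3 k4 k5 k6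
    exact (k1.sub k2).add (((k3.mul k4).mul (k5.mul k6)).const_mul A)
  have hp1 : SimplePole F 1 0 := by
    have g1 : Gen p (x * y * 1) := by rwa [mul_one]
    have k1 := rh_simplePole hp
    have k2 : SimplePole (fun z => rh p (x * y * z)) 1 0 := .of_differentiable
      (eventually_differentiableAt_comp_mul
        (eventually_differentiableAt_rh hp hp0 (mul_ne_zero hxy one_ne_zero) g1))
    have k3 := (inv_jt_simplePole hp).mul_of_differentiable
      (g := fun z => (jt p (x * z) * jt p (y * z)) * (jt p (x * y * z))⁻¹) (by
        filter_upwards [hdj x 1 hx one_ne_zero, hdj y 1 hy one_ne_zero,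
          eventually_differentiableAt_comp_mul
            (eventually_differentiableAt_inv_jt hp hp0 (mul_ne_zero hxy one_ne_zero) g1)]
          with z h1 h2 h3
        exact (h1.mul h2).mul h3)
    refine (((k1.sub k2).add (k3.const_mul A)).of_eq ?_).congr
      (.of_forall fun z => by simp only [hF]; ring)
    rw [mul_one, mul_one, mul_one, hA]
    field_simp; ring
  have hp2 : SimplePole F (x * y)⁻¹ 0 := by
    have hxyi := inv_ne_zero hxy
    have k1 : SimplePole (rh p) (x * y)⁻¹ 0 := .of_differentiable
      (eventually_differentiableAt_rh hp hp0 hxyi gxy.inv)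
    have k2 : SimplePole (fun z => rh p (x * y * z)) (x * y)⁻¹ (1 / (x * y)) :=
      SimplePole.comp_const_mul hxy (by rw [mul_inv_cancel₀ hxy]; exact rh_simplePole hp)
    have k3 := (inv_jt_mul_simplePole hp hxy (mul_inv_cancel₀ hxy)).mul_of_differentiable
      (g := fun z => (jt p (x * z) * jt p (y * z)) * (jt p z)⁻¹) (by
        filter_upwards [hdj x _ hx hxyi, hdj y _ hy hxyi,
          eventually_differentiableAt_inv_jt hp hp0 hxyi gxy.inv] with z h1 h2 h3
        exact (h1.mul h2).mul h3)
    refine (((k1.sub k2).add (k3.const_mul A)).of_eq ?_).congr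
      (.of_forall fun z => by simp only [hF]; ring)
    rw [show x * (x * y)⁻¹ = y⁻¹ by field_simp, show y * (x * y)⁻¹ = x⁻¹ by field_simp,
      jt_inv hp hx, jt_inv hp hy, jt_inv hp hxy, hA]
    field_simp; ring
  obtain ⟨k, hk⟩ := hq.exists_const hp hp0 fun a ha => by
    by_cases g1 : Gen p a
    · by_cases g2 : Gen p (x * y * a)
      · exact .of_differentiable (hreg a ha g1 g2)
      · obtain ⟨n, hn⟩ := not_gen_iff.mp g2
        rw [← hq.simplePole_zpow_iff hp0 (by norm_num) (by fun_prop) ha n]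
        rwa [show a * p ^ n = (x * y)⁻¹ by rw [mul_assoc] at hn; exact eq_inv_of_mul_eq_one_right hn]
    · obtain ⟨n, hn⟩ := not_gen_iff.mp g1
      rw [← hq.simplePole_zpow_iff hp0 (by norm_num) (by fun_prop) ha n]
      rwa [hn]
  have hxyx : x * y * x⁻¹ = y := by field_simp
  have ez := eq_of_tendsto (hk z hz) (hreg z hz gz gxyz).self_of_nhds.continuousAt
  have ex := eq_of_tendsto (hk x⁻¹ (inv_ne_zero hx)) (hreg x⁻¹ (inv_ne_zero hx) gx.inv
    (by rwa [hxyx])).self_of_nhds.continuousAt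
  have e := ez.trans ex.symm
  simp only [hF] at e
  rw [hxyx, mul_inv_cancel₀ hx, jt_one, rh_inv hp hp0 hx gx] at e
  have := gz.jt_ne_zero hp hp0 hz
  have := gxyz.jt_ne_zero hp hp0 (mul_ne_zero hxy hz)
  have e2 : qp p p ^ 3 * jt p (x * y) * jt p (x * z) * jt p (y * z) /
        (jt p x * jt p y * jt p z * jt p (x * y * z)) =
      A * (jt p (x * z) * jt p (y * z) * ((jt p z)⁻¹ * (jt p (x * y * z))⁻¹)) := by
    rw [hA]; field_simp
  rw [e2]
  linear_combination e

end
end RankCrank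

namespace RankCrank
open Filter Topology

section
variable {q : ℂ}

/-- The theta function with base `q ^ 11` at an integral power of `q`. -/
noncomputable def br (q : ℂ) (n : ℤ) : ℂ := jt (q ^ 11) (q ^ n)

lemma norm_pow_eleven (hq : ‖q‖ < 1) : ‖q ^ 11‖ < 1 := by
  rw [norm_pow]; exact pow_lt_one₀ (norm_nonneg _) hq (by norm_num)

lemma zpow_pow_eleven (q : ℂ) (n : ℤ) : (q ^ 11) ^ n = q ^ (11 * n) := by
  rw [zpow_mul]; norm_cast

lemma norm_zpow_ne_one (hq : ‖q‖ < 1) {n : ℤ} (hn : n ≠ 0) : ‖q‖ ^ n ≠ 1 := by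
  intro h
  rw [zpow_eq_one_iff_right₀ (norm_nonneg _) hq.ne] at h
  exact hn h

lemma gen_zpow (hq : ‖q‖ < 1) (h0 : q ≠ 0) {n : ℤ} (hn : ¬ (11 : ℤ) ∣ n) :
    Gen (q ^ 11) (q ^ n) := by
  intro m hm
  rw [zpow_pow_eleven, ← zpow_add₀ h0] at hm
  have := congrArg norm hm
  rw [norm_zpow, norm_one] at this
  exact norm_zpow_ne_one hq (by omega) this

lemma br_add (hq : ‖q‖ < 1) (h0 : q ≠ 0) (n : ℤ) : br q (n + 11) = -(q ^ n)⁻¹ * br q n := by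
  rw [br, br, zpow_add₀ h0]
  exact_mod_cast jt_mul_base (norm_pow_eleven hq) (pow_ne_zero 11 h0) (zpow_ne_zero n h0)

lemma br_neg (hq : ‖q‖ < 1) (h0 : q ≠ 0) (n : ℤ) : br q (-n) = -(q ^ n)⁻¹ * br q n := by
  rw [br, br, zpow_neg]
  exact jt_inv (norm_pow_eleven hq) (zpow_ne_zero n h0)

lemma br_compl (hq : ‖q‖ < 1) (h0 : q ≠ 0) (n : ℤ) : br q (11 - n) = br q n := by
  rw [show 11 - n = -n + 11 by ring, br_add hq h0, br_neg hq h0, zpow_neg, inv_inv]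
  have := zpow_ne_zero n h0
  field_simp

lemma br_ne_zero (hq : ‖q‖ < 1) (h0 : q ≠ 0) {n : ℤ} (hn : ¬ (11 : ℤ) ∣ n) : br q n ≠ 0 :=
  (gen_zpow hq h0 hn).jt_ne_zero (norm_pow_eleven hq) (pow_ne_zero 11 h0) (zpow_ne_zero n h0)

lemma br_six (hq : ‖q‖ < 1) (h0 : q ≠ 0) : br q 6 = br q 5 := br_compl hq h0 5
lemma br_seven (hq : ‖q‖ < 1) (h0 : q ≠ 0) : br q 7 = br q 4 := br_compl hq h0 4
lemma br_eight (hq : ‖q‖ < 1) (h0 : q ≠ 0) : br q 8 = br q 3 := br_compl hq h0 3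
lemma br_nine (hq : ‖q‖ < 1) (h0 : q ≠ 0) : br q 9 = br q 2 := br_compl hq h0 2
lemma br_ten (hq : ‖q‖ < 1) (h0 : q ≠ 0) : br q 10 = br q 1 := br_compl hq h0 1

lemma wS_zpow (h0 : q ≠ 0) (a b : ℤ) :
    wS (q ^ 11) (q ^ a) (q ^ b) = (q ^ a)⁻¹ * br q (a + b) * br q (a - b) := by
  rw [wS, br, br, ← zpow_add₀ h0, ← zpow_neg q b, ← zpow_add₀ h0, add_comm a b, sub_eq_neg_add]

lemma br_three_term (hq : ‖q‖ < 1) (h0 : q ≠ 0) (a b c d : ℤ) (hd : ¬ (11 : ℤ) ∣ d + d)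
    (h1 : ¬ (11 : ℤ) ∣ d + a) (h2 : ¬ (11 : ℤ) ∣ -d + a)
    (h3 : ¬ (11 : ℤ) ∣ d + b) (h4 : ¬ (11 : ℤ) ∣ -d + b) :
    q ^ b * (br q (a + b) * br q (a - b) * (br q (c + d) * br q (c - d)))
      - q ^ c * (br q (a + c) * br q (a - c) * (br q (b + d) * br q (b - d)))
      + q ^ c * (br q (a + d) * br q (a - d) * (br q (b + c) * br q (b - c))) = 0 := by
  have ha := zpow_ne_zero a h0
  have hb := zpow_ne_zero b h0
  have hc := zpow_ne_zero c h0
  have := wS_three_term (norm_pow_eleven hq) (pow_ne_zero 11 h0) ha hb hc (zpow_ne_zero d h0)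
    (by rw [← zpow_add₀ h0]; exact gen_zpow hq h0 hd)
    (by rw [← zpow_add₀ h0]; exact gen_zpow hq h0 h1)
    (by rw [← zpow_neg, ← zpow_add₀ h0]; exact gen_zpow hq h0 h2)
    (by rw [← zpow_add₀ h0]; exact gen_zpow hq h0 h3)
    (by rw [← zpow_neg, ← zpow_add₀ h0]; exact gen_zpow hq h0 h4)
  rw [wS_zpow h0, wS_zpow h0, wS_zpow h0, wS_zpow h0, wS_zpow h0, wS_zpow h0] at this
  field_simp at this
  linear_combination this

lemma theta_relation_one (hq : ‖q‖ < 1) (h0 : q ≠ 0) :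
    q * br q 1 ^ 2 * br q 2 * br q 5 - br q 2 ^ 2 * br q 3 * br q 5
      + br q 1 * br q 3 * br q 4 ^ 2 = 0 := by
  have := br_three_term hq h0 5 4 3 2 (by decide) (by decide) (by decide) (by decide) (by decide)
  norm_num [br_six hq h0, br_seven hq h0, br_eight hq h0, br_nine hq h0] at this
  apply mul_left_cancel₀ (pow_ne_zero 3 h0)
  linear_combination this

lemma theta_relation_two (hq : ‖q‖ < 1) (h0 : q ≠ 0) :
    q ^ 2 * br q 1 * br q 2 ^ 3 - br q 3 * br q 4 ^ 3 + br q 2 * br q 5 ^ 3 = 0 := by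
  have := br_three_term hq h0 0 5 4 2 (by decide) (by decide) (by decide) (by decide) (by decide)
  norm_num [br_six hq h0, br_seven hq h0, br_eight hq h0, br_nine hq h0, br_neg hq h0] at this
  norm_cast at this
  field_simp at this
  linear_combination -this

lemma theta_relation_three (hq : ‖q‖ < 1) (h0 : q ≠ 0) :
    q * br q 1 * br q 2 ^ 2 * br q 4 - br q 2 * br q 3 ^ 2 * br q 5
      + br q 1 * br q 4 ^ 2 * br q 5 = 0 := by
  have := br_three_term hq h0 5 4 3 1 (by decide) (by decide) (by decide) (by decide) (by decide)
  norm_num [br_six hq h0, br_seven hq h0, br_eight hq h0, br_nine hq h0] at this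
  apply mul_left_cancel₀ (pow_ne_zero 3 h0)
  linear_combination this

lemma theta_relation_four (hq : ‖q‖ < 1) (h0 : q ≠ 0) :
    q * br q 1 ^ 3 * br q 5 - br q 2 ^ 3 * br q 4 + br q 1 * br q 3 ^ 3 = 0 := by
  have := br_three_term hq h0 0 3 2 1 (by decide) (by decide) (by decide) (by decide) (by decide)
  norm_num [br_six hq h0, br_seven hq h0, br_eight hq h0, br_nine hq h0, br_neg hq h0] at this
  norm_cast at this
  field_simp at this
  linear_combination -this

end
end RankCrank

namespace RankCrank
open Filter Topology

section
variable {p a b c d t z : ℂ}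

lemma qp_mul_qp_neg (hp : ‖p‖ < 1) (z : ℂ) : qp p z * qp p (-z) = qp (p ^ 2) (z ^ 2) := by
  rw [qp, qp, ← (qp_multipliable hp z).tprod_mul (qp_multipliable hp (-z)), qp]
  congr 1; ext n; ring

lemma qp_sq_base (hp : ‖p‖ < 1) (z : ℂ) : qp (p ^ 2) z * qp (p ^ 2) (z * p) = qp p z := by
  have hp2 : ‖p ^ 2‖ < 1 := by rw [norm_pow]; exact pow_lt_one₀ (norm_nonneg _) hp (by norm_num)
  have h1 : (fun k => 1 - z * p ^ (2 * k)) = fun k => 1 - z * (p ^ 2) ^ k := by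
    ext k; rw [pow_mul]
  have h2 : (fun k => 1 - z * p ^ (2 * k + 1)) = fun k => 1 - z * p * (p ^ 2) ^ k := by
    ext k; rw [pow_succ, pow_mul]; ring
  have := tprod_even_mul_odd (f := fun n : ℕ => 1 - z * p ^ n) (by
    rw [h1]; exact qp_multipliable hp2 z) (by rw [h2]; exact qp_multipliable hp2 _)
  rw [h1, h2] at this
  exact this

lemma qp_four (hp : ‖p‖ < 1) (ht : t ^ 2 = p) (z : ℂ) :
    qp p z * qp p (-z) * (qp p (t * z) * qp p (-(t * z))) = qp p (z ^ 2) := by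
  rw [qp_mul_qp_neg hp, qp_mul_qp_neg hp, ← qp_sq_base hp, mul_pow, ht, mul_comm p]

lemma jt_four (hp : ‖p‖ < 1) (hp0 : p ≠ 0) (ht : t ^ 2 = p) (hz : z ≠ 0) :
    jt p z * jt p (-z) * (jt p (t * z) * jt p (-(t * z))) = jt p (z ^ 2) * qp p p ^ 3 := by
  have ht0 : t ≠ 0 := by rintro rfl; simp at ht; exact hp0 ht.symm
  have h1 := qp_four hp ht z
  have h2 := qp_four hp ht (t / z)
  have e1 : t * (t / z) = p / z := by rw [← ht]; ring
  have e2 : p / (t * z) = t / z := by rw [← ht]; field_simp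
  have e3 : (t / z) ^ 2 = p / z ^ 2 := by rw [div_pow, ht]
  rw [e1, e3] at h2
  simp only [jt, div_neg, e2]
  rw [← h1, ← h2]
  ring

lemma jt_half_periods (hp : ‖p‖ < 1) (hp0 : p ≠ 0) (ht : t ^ 2 = p) :
    jt p (-1) * jt p t * jt p (-t) = 2 * qp p p ^ 3 := by
  have hJ := pow_ne_zero 3 (qp_self_ne_zero hp)
  have hc (s : ℂ) (hs : s ≠ 0) : Tendsto (fun z => jt p (s * z)) (𝓝[≠] 1) (𝓝 (jt p s)) := by
    have := (jt_differentiableAt hp (mul_ne_zero hs one_ne_zero)).continuousAt.comp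
      (f := fun z => s * z) (x := 1) (by fun_prop)
    have h := this.tendsto
    simp only [Function.comp_def, mul_one] at h
    exact h.mono_left nhdsWithin_le_nhds
  have ht0 : t ≠ 0 := by rintro rfl; simp at ht; exact hp0 ht.symm
  have hg1 : Tendsto (jg p) (𝓝[≠] 1) (𝓝 (jg p 1)) :=
    (jg_differentiableAt hp one_ne_zero).continuousAt.tendsto.mono_left nhdsWithin_le_nhds
  have hg2 : Tendsto (fun z => jg p (z ^ 2)) (𝓝[≠] 1) (𝓝 (jg p 1)) := by
    have : ContinuousAt (fun z : ℂ => jg p (z ^ 2)) 1 := by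
      refine ContinuousAt.comp (g := jg p) ?_ (by fun_prop)
      rw [one_pow]; exact (jg_differentiableAt hp one_ne_zero).continuousAt
    have h := this.tendsto
    rw [one_pow] at h
    exact h.mono_left nhdsWithin_le_nhds
  have l1 := (hg1.mul (hc (-1) (by norm_num))).mul ((hc t ht0).mul (hc (-t) (neg_ne_zero.mpr ht0)))
  have l2 : Tendsto (fun z : ℂ => (1 + z) * jg p (z ^ 2) * qp p p ^ 3) (𝓝[≠] 1)
      (𝓝 ((1 + 1) * jg p 1 * qp p p ^ 3)) :=
    (((tendsto_id.mono_left nhdsWithin_le_nhds).const_add (1 : ℂ)).mul hg2).mul_const _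
  have := tendsto_nhds_unique (l1.congr' ?_) l2
  · rw [jg_one] at this
    apply mul_left_cancel₀ hJ
    linear_combination this
  · filter_upwards [self_mem_nhdsWithin, eventually_ne_zero_punctured one_ne_zero] with z h1 h0
    have h := jt_four hp hp0 ht h0
    rw [jt_eq_jg hp z, jt_eq_jg hp (z ^ 2)] at h
    have h2 : 1 - z ≠ 0 := sub_ne_zero.mpr (Ne.symm h1)
    apply mul_left_cancel₀ h2
    simp only [neg_mul, one_mul]
    linear_combination h

/-- The difference of two values of the Weierstrass function, up to normalization. -/
noncomputable def wD (p a b : ℂ) : ℂ := b * jt p (b * a) * jt p (b⁻¹ * a) / (jt p a ^ 2 * jt p b ^ 2)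

lemma wS_one (p a : ℂ) : wS p a 1 = a⁻¹ * jt p a ^ 2 := by
  rw [wS, inv_one, one_mul]; ring

lemma wD_sub (hp : ‖p‖ < 1) (hp0 : p ≠ 0) (ha : a ≠ 0) (hc : c ≠ 0) (hd : d ≠ 0)
    (ga : Gen p a) (gc : Gen p c) (gd : Gen p d) (gd2 : Gen p (d * d))
    (h1 : Gen p (d * a)) (h2 : Gen p (d⁻¹ * a)) :
    wD p d c - wD p d a = wD p a c := by
  have h := wS_three_term hp hp0 ha one_ne_zero hc hd gd2 h1 h2 (by rwa [mul_one])
    (by rw [mul_one]; exact gd.inv)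
  rw [wS_anti hp hd one_ne_zero, wS_anti hp hc one_ne_zero, wS_one, wS_one, wS_one,
    wS_anti hp hd hc] at h
  have ja := ga.jt_ne_zero hp hp0 ha
  have jc := gc.jt_ne_zero hp hp0 hc
  have jd := gd.jt_ne_zero hp hp0 hd
  have had := wS_anti hp hd ha
  rw [had] at h
  simp only [wS] at h
  rw [wD, wD, wD]
  field_simp at h ⊢
  linear_combination -h

lemma jt_neg_div (hp : ‖p‖ < 1) (hp0 : p ≠ 0) (ht : t ^ 2 = p) (ha : a ≠ 0) :
    jt p (t⁻¹ * a) = -(t⁻¹ * a) * jt p (t * a) := by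
  have ht0 : t ≠ 0 := by rintro rfl; simp at ht; exact hp0 ht.symm
  have h := jt_mul_base hp hp0 (mul_ne_zero (inv_ne_zero ht0) ha)
  rw [show t⁻¹ * a * p = t * a by rw [← ht]; field_simp] at h
  rw [h]; field_simp

lemma wD_half_prod (hp : ‖p‖ < 1) (hp0 : p ≠ 0) (ht : t ^ 2 = p) (ha : a ≠ 0) (ga : Gen p a) :
    wD p a (-1) * wD p a t * wD p a (-t) = -(a ^ 2 * jt p (a ^ 2) ^ 2) / (4 * jt p a ^ 8) := by
  have ht0 : t ≠ 0 := by rintro rfl; simp at ht; exact hp0 ht.symm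
  have hJ := qp_self_ne_zero hp
  have ja := ga.jt_ne_zero hp hp0 ha
  have h1 := jt_half_periods hp hp0 ht
  have h2 := jt_four hp hp0 ht ha
  have h3 : jt p (-1) * jt p t * jt p (-t) ≠ 0 := by
    rw [h1]; exact mul_ne_zero two_ne_zero (pow_ne_zero 3 hJ)
  have e1 := jt_neg_div hp hp0 ht ha
  have e2 := jt_neg_div hp hp0 (t := -t) (by rw [neg_sq, ht]) ha
  obtain ⟨h45, h6⟩ := mul_ne_zero_iff.mp h3
  obtain ⟨h4, h5⟩ := mul_ne_zero_iff.mp h45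
  have e3 : ((-1 : ℂ))⁻¹ = -1 := by norm_num
  have e4 : a ^ 2 * jt p (a ^ 2) ^ 2 / (4 * jt p a ^ 8) =
      a ^ 2 * (jt p a * jt p (-a) * (jt p (t * a) * jt p (-(t * a)))) ^ 2 /
        (jt p a ^ 8 * (jt p (-1) * jt p t * jt p (-t)) ^ 2) := by
    rw [h1, h2]; field_simp; norm_num
  rw [neg_div, e4, wD, wD, wD, e1, e2, e3]
  simp only [neg_mul, one_mul]
  field_simp

lemma wD_half_disc (hp : ‖p‖ < 1) (hp0 : p ≠ 0) (ht : t ^ 2 = p) :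
    wD p (-1) t * wD p (-1) (-t) * wD p t (-t) = -t / (4 * qp p p ^ 6) := by
  have ht0 : t ≠ 0 := by rintro rfl; simp at ht; exact hp0 ht.symm
  have hJ := qp_self_ne_zero hp
  have h1 := jt_half_periods hp hp0 ht
  have h3 : jt p (-1) * jt p t * jt p (-t) ≠ 0 := by
    rw [h1]; exact mul_ne_zero two_ne_zero (pow_ne_zero 3 hJ)
  obtain ⟨h45, h6⟩ := mul_ne_zero_iff.mp h3
  obtain ⟨h4, h5⟩ := mul_ne_zero_iff.mp h45
  have e1 := jt_inv hp (neg_ne_zero.mpr ht0)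
  have e2 := jt_inv hp ht0
  have e3 := jt_mul_base hp hp0 (neg_ne_zero.mpr (one_ne_zero (α := ℂ)))
  have e4 : (4 : ℂ) * qp p p ^ 6 = (jt p (-1) * jt p t * jt p (-t)) ^ 2 := by rw [h1]; ring
  rw [e4, wD, wD, wD, show t * -1 = -t by ring, show t⁻¹ * -1 = (-t)⁻¹ by field_simp,
    show -t * -1 = t by ring, show (-t)⁻¹ * -1 = t⁻¹ by field_simp,
    show -t * t = -1 * p by rw [← ht]; ring, show (-t)⁻¹ * t = -1 by field_simp, e1, e2, e3]
  field_simp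

end
end RankCrank

namespace RankCrank
open Filter Topology
section
variable {q t : ℂ}

lemma gen_of_sq (hq : ‖q‖ < 1) (h0 : q ≠ 0) {z : ℂ} {m : ℤ} (hz : z ^ 2 = q ^ m)
    (hm : ¬ (22 : ℤ) ∣ m) : Gen (q ^ 11) z := by
  intro n h
  have h1 : q ^ (m + 22 * n) = 1 := by
    have h2 : (z * (q ^ 11) ^ n) ^ 2 = 1 := by rw [h, one_pow]
    rw [mul_pow, hz, zpow_pow_eleven, ← zpow_natCast, ← zpow_mul] at h2
    rw [zpow_add₀ h0, ← h2]
    congr 2; push_cast; ring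
  refine norm_zpow_ne_one hq (n := m + 22 * n) (fun h3 => hm ⟨-n, by omega⟩) ?_
  rw [← norm_zpow, h1, norm_one]

lemma gen_neg_one (hq : ‖q‖ < 1) : Gen (q ^ 11) (-1) := by
  intro n h
  rw [zpow_pow_eleven] at h
  by_cases hn : n = 0
  · subst hn; norm_num at h
  · refine norm_zpow_ne_one hq (n := 11 * n) (by omega) ?_
    rw [← norm_zpow, show q ^ (11 * n) = -1 by linear_combination -h, norm_neg, norm_one]

lemma wD_zpow (h0 : q ≠ 0) (a b : ℤ) : wD (q ^ 11) (q ^ a) (q ^ b) =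
    q ^ b * br q (b + a) * br q (a - b) / (br q a ^ 2 * br q b ^ 2) := by
  rw [wD, br, br, br, br, zpow_add₀ h0, show a - b = -b + a by ring, zpow_add₀ h0, zpow_neg]

/-- The elementary symmetric functions of three numbers are determined by the values of the
monic cubic with these roots at `0`, `T₂` and `T₃`. -/
lemma cubic_disc {u₁ u₂ u₃ l b c : ℂ} (hl : l ≠ 0) (hb : b ≠ 0) (hc : c ≠ 0) (hbc : b - c ≠ 0)
    (f0 : u₁ * u₂ * u₃ = -(l ^ 3 * b ^ 2) / 4)
    (f2 : (u₁ - l * b) * (u₂ - l * b) * (u₃ - l * b) = -(l ^ 3 * (c * b) ^ 2) / 4)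
    (f3 : (u₁ - l * c) * (u₂ - l * c) * (u₃ - l * c) = -(l ^ 3 * (b - c - c ^ 2) ^ 2) / 4) :
    16 * ((u₂ - u₁) * (u₃ - u₁) * (u₃ - u₂)) ^ 2 =
      l ^ 6 * b ^ 3 * c * (16 * (b / c) ^ 2 * c - 8 * (b / c) * c ^ 2 - 20 * (b / c) * c + b / c +
        (c - 1) ^ 3) := by
  have g2 : (u₁ + u₂ + u₃) * (l * b) - (u₁ * u₂ + u₁ * u₃ + u₂ * u₃) =
      l ^ 2 * (b ^ 2 + b / 4 * (1 - c ^ 2)) := by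
    apply mul_left_cancel₀ (mul_ne_zero hl hb)
    linear_combination f2 - f0
  have g3 : (u₁ + u₂ + u₃) * (l * c) - (u₁ * u₂ + u₁ * u₃ + u₂ * u₃) =
      l ^ 2 * (c ^ 2 - (c * (1 + c) ^ 2 - 2 * b * (1 + c)) / 4) := by
    apply mul_left_cancel₀ (mul_ne_zero hl hc)
    linear_combination f3 - f0
  have e1 : u₁ + u₂ + u₃ = l * (b - (1 - c) ^ 2 / 4) := by
    apply mul_left_cancel₀ (mul_ne_zero hl hbc)
    linear_combination g2 - g3
  have e2 : u₁ * u₂ + u₁ * u₃ + u₂ * u₃ = l ^ 2 * (-(1 - c) * b / 2) := by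
    linear_combination e1 * (l * b) - g2
  have hd : ((u₂ - u₁) * (u₃ - u₁) * (u₃ - u₂)) ^ 2 =
      (u₁ + u₂ + u₃) ^ 2 * (u₁ * u₂ + u₁ * u₃ + u₂ * u₃) ^ 2
      - 4 * (u₁ * u₂ + u₁ * u₃ + u₂ * u₃) ^ 3 - 4 * (u₁ + u₂ + u₃) ^ 3 * (u₁ * u₂ * u₃)
      + 18 * (u₁ + u₂ + u₃) * (u₁ * u₂ + u₁ * u₃ + u₂ * u₃) * (u₁ * u₂ * u₃)
      - 27 * (u₁ * u₂ * u₃) ^ 2 := by ring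
  rw [hd, e1, e2, f0]
  field_simp
  ring

lemma discriminant_relation (hq : ‖q‖ < 1) (h0 : q ≠ 0) (l b c : ℂ)
    (hl : l = br q 2 ^ 6 / (br q 1 ^ 6 * br q 3 ^ 2))
    (hb : b = -(q * br q 3 ^ 3 * br q 1 ^ 5) / br q 2 ^ 8)
    (hc : c = -(q * br q 4 * br q 1 ^ 4) / br q 2 ^ 5) :
    qp (q ^ 11) (q ^ 11) ^ 12 * (l ^ 6 * b ^ 3 * c * (16 * (b / c) ^ 2 * c - 8 * (b / c) * c ^ 2
      - 20 * (b / c) * c + b / c + (c - 1) ^ 3)) = q ^ 11 := by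
  obtain ⟨t, ht⟩ := IsAlgClosed.exists_pow_nat_eq (q ^ 11) (n := 2) (by norm_num)
  have hp := norm_pow_eleven hq
  have hp0 : q ^ 11 ≠ 0 := pow_ne_zero 11 h0
  have ht0 : t ≠ 0 := by rintro rfl; simp at ht; exact hp0 ht.symm
  have hJ := qp_self_ne_zero hp
  have n1 := br_ne_zero hq h0 (n := 1) (by decide)
  have n2 := br_ne_zero hq h0 (n := 2) (by decide)
  have n3 := br_ne_zero hq h0 (n := 3) (by decide)
  have n4 := br_ne_zero hq h0 (n := 4) (by decide)
  have n5 := br_ne_zero hq h0 (n := 5) (by decide)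
  have hl0 : l ≠ 0 := by rw [hl]; simp [n1, n2, n3]
  have hb0 : b ≠ 0 := by rw [hb]; simp [n1, n2, n3, h0]
  have hc0 : c ≠ 0 := by rw [hc]; simp [n1, n2, n4, h0]
  have T2 : wD (q ^ 11) (q ^ (1 : ℤ)) (q ^ (2 : ℤ)) = l * b := by
    rw [wD_zpow h0, hl, hb]
    norm_num [br_neg hq h0]
    field_simp
  have T3 : wD (q ^ 11) (q ^ (1 : ℤ)) (q ^ (3 : ℤ)) = l * c := by
    rw [wD_zpow h0, hl, hc]
    norm_num [br_neg hq h0]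
    norm_cast
    field_simp
  have zg {n : ℤ} (hn : ¬ (11 : ℤ) ∣ n) : Gen (q ^ 11) (q ^ n) := gen_zpow hq h0 hn
  have g2 : Gen (q ^ 11) (q ^ (1 : ℤ) * q ^ (1 : ℤ)) := by
    rw [← zpow_add₀ h0]; exact zg (by decide)
  have hTT : b - c ≠ 0 := by
    have h := wD_sub hp hp0 (zpow_ne_zero 3 h0) (zpow_ne_zero 2 h0) (zpow_ne_zero 1 h0)
      (zg (by decide)) (zg (by decide)) (zg (by decide)) g2
      (by rw [← zpow_add₀ h0]; exact zg (by decide))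
      (by rw [← zpow_neg, ← zpow_add₀ h0]; exact zg (by decide))
    rw [T2, T3, wD_zpow h0] at h
    norm_num at h
    rintro hbc
    rw [← mul_sub, hbc, mul_zero, eq_comm] at h
    simp [n1, n2, n3, n5, h0] at h
  have ge {e : ℂ} (he : e ^ 2 = q ^ (0 : ℤ) ∨ e ^ 2 = q ^ (11 : ℤ)) {k : ℤ}
      (hk : ¬ (11 : ℤ) ∣ k) : Gen (q ^ 11) (q ^ k * e) := by
    rcases he with he | he
    · refine gen_of_sq hq h0 (m := 2 * k + 0) ?_ (by omega)
      rw [mul_pow, he, zpow_add₀ h0, two_mul, zpow_add₀ h0, sq]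
    · refine gen_of_sq hq h0 (m := 2 * k + 11) ?_ (by omega)
      rw [mul_pow, he, zpow_add₀ h0, two_mul, zpow_add₀ h0, sq]
  have gn := gen_neg_one hq
  have gt {e : ℂ} (he : e ^ 2 = q ^ 11) : Gen (q ^ 11) e :=
    gen_of_sq hq h0 (m := 11) (by rw [he]; norm_cast) (by decide)
  have gt1 := gt ht
  have gt2 := gt (e := -t) (by rw [neg_sq, ht])
  have s1 : (-1 : ℂ) ^ 2 = q ^ (0 : ℤ) ∨ (-1 : ℂ) ^ 2 = q ^ (11 : ℤ) := by left; norm_num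
  have s2 : t ^ 2 = q ^ (0 : ℤ) ∨ t ^ 2 = q ^ (11 : ℤ) := by right; rw [ht]; norm_cast
  have s3 : (-t) ^ 2 = q ^ (0 : ℤ) ∨ (-t) ^ 2 = q ^ (11 : ℤ) := by rwa [neg_sq]
  have sub_node {e : ℂ} (he0 : e ≠ 0) (gn : Gen (q ^ 11) e) {k : ℤ} (hk : ¬ (11 : ℤ) ∣ k)
      (hk1 : ¬ (11 : ℤ) ∣ 1 + k) (hk2 : ¬ (11 : ℤ) ∣ -1 + k) :
      wD (q ^ 11) (q ^ (1 : ℤ)) e - wD (q ^ 11) (q ^ (1 : ℤ)) (q ^ k) =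
        wD (q ^ 11) (q ^ k) e :=
    wD_sub hp hp0 (zpow_ne_zero _ h0) he0 (zpow_ne_zero _ h0) (zg hk) gn (zg (by decide)) g2
      (by rw [← zpow_add₀ h0]; exact zg hk1) (by rw [← zpow_neg, ← zpow_add₀ h0]; exact zg hk2)
  have sub_half {e f : ℂ} (he0 : e ≠ 0) (hf0 : f ≠ 0) (gn : Gen (q ^ 11) e) (gf : Gen (q ^ 11) f)
      (he : e ^ 2 = q ^ (0 : ℤ) ∨ e ^ 2 = q ^ (11 : ℤ)) :
      wD (q ^ 11) (q ^ (1 : ℤ)) f - wD (q ^ 11) (q ^ (1 : ℤ)) e = wD (q ^ 11) e f :=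
    wD_sub hp hp0 he0 hf0 (zpow_ne_zero _ h0) gn gf (zg (by decide)) g2
      (ge he (by decide)) (by rw [← zpow_neg]; exact ge he (by decide))
  have hprod {k : ℤ} (hk : ¬ (11 : ℤ) ∣ k) := wD_half_prod hp hp0 ht (zpow_ne_zero k h0) (zg hk)
  have hbr (k : ℤ) : jt (q ^ 11) (q ^ k) = br q k := rfl
  have hbr2 (k : ℤ) : jt (q ^ 11) ((q ^ k) ^ 2) = br q (2 * k) := by
    rw [br, two_mul, zpow_add₀ h0, sq]
  simp only [hbr, hbr2] at hprod
  have hm1 : (-1 : ℂ) ≠ 0 := by norm_num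
  have hnt : -t ≠ 0 := neg_ne_zero.mpr ht0
  have f0 := hprod (k := 1) (by decide)
  have f2 := hprod (k := 2) (by decide)
  have f3 := hprod (k := 3) (by decide)
  rw [← sub_node hm1 gn (by decide) (by decide) (by decide),
    ← sub_node ht0 gt1 (by decide) (by decide) (by decide),
    ← sub_node hnt gt2 (by decide) (by decide) (by decide)] at f2 f3
  have hd := wD_half_disc hp hp0 ht
  rw [← sub_half hm1 ht0 gn gt1 s1, ← sub_half hm1 hnt gn gt2 s1,
    ← sub_half ht0 hnt gt1 gt2 s2] at hd
  rw [T2] at f2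
  rw [T3] at f3
  have hv : b - c - c ^ 2 = q ^ 3 * br q 1 ^ 9 * br q 5 / (br q 2 ^ 9 * br q 3) := by
    have r1 := theta_relation_one hq h0
    have r4 := theta_relation_four hq h0
    rw [hb, hc]
    field_simp
    linear_combination -(br q 2 ^ 2 * br q 3) * r4 - q * br q 1 ^ 3 * r1
  have key := cubic_disc hl0 hb0 hc0 hTT (f0.trans ?_) (f2.trans ?_) (f3.trans ?_)
  · rw [← key, hd, div_pow, neg_sq, ht]
    field_simp
    norm_num
  · rw [hl, hb]; norm_num; field_simp
  · rw [hl, hb, hc]; norm_num; norm_cast; field_simp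
  · rw [hv, hl]; norm_num [br_six hq h0]; norm_cast; field_simp

end
end RankCrank

namespace RankCrank
open Filter Topology
section
variable {q : ℂ}

/-- Parameters on the modular curve of level eleven, satisfying `y ^ 2 + y = x ^ 3 - x ^ 2`. -/
noncomputable def ux (q : ℂ) : ℂ := -(q * br q 1 * br q 2 * br q 5) / (br q 3 * br q 4 ^ 2)

/-- See `ux`. -/
noncomputable def uy (q : ℂ) : ℂ := -(br q 2 * br q 5 ^ 3) / (br q 3 * br q 4 ^ 3)

lemma one_sub_ux (hq : ‖q‖ < 1) (h0 : q ≠ 0) :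
    1 - ux q = br q 2 ^ 2 * br q 5 / (br q 1 * br q 4 ^ 2) := by
  have n1 := br_ne_zero hq h0 (n := 1) (by decide)
  have n3 := br_ne_zero hq h0 (n := 3) (by decide)
  have n4 := br_ne_zero hq h0 (n := 4) (by decide)
  rw [ux]
  field_simp
  linear_combination theta_relation_one hq h0

lemma one_add_uy (hq : ‖q‖ < 1) (h0 : q ≠ 0) :
    1 + uy q = q ^ 2 * br q 1 * br q 2 ^ 3 / (br q 3 * br q 4 ^ 3) := by
  have n3 := br_ne_zero hq h0 (n := 3) (by decide)
  have n4 := br_ne_zero hq h0 (n := 4) (by decide)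
  rw [uy]
  field_simp
  linear_combination -theta_relation_two hq h0

lemma one_add_uy_sub_ux (hq : ‖q‖ < 1) (h0 : q ≠ 0) :
    1 + uy q - ux q = q * br q 2 ^ 2 * br q 3 * br q 5 / br q 4 ^ 4 := by
  have n3 := br_ne_zero hq h0 (n := 3) (by decide)
  have n4 := br_ne_zero hq h0 (n := 4) (by decide)
  rw [one_add_uy hq h0, ux]
  field_simp
  linear_combination br q 2 * theta_relation_three hq h0

lemma ux_uy_curve (hq : ‖q‖ < 1) (h0 : q ≠ 0) :
    uy q ^ 2 + uy q - ux q ^ 3 + ux q ^ 2 = 0 := by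
  have n1 := br_ne_zero hq h0 (n := 1) (by decide)
  have n3 := br_ne_zero hq h0 (n := 3) (by decide)
  have n4 := br_ne_zero hq h0 (n := 4) (by decide)
  have : uy q * (1 + uy q) + ux q ^ 2 * (1 - ux q) = 0 := by
    rw [one_add_uy hq h0, one_sub_ux hq h0, uy, ux]
    field_simp
    ring
  linear_combination this

/-- The discriminant of the Tate normal form, rewritten on the curve. -/
lemma tate_discriminant {x y : ℂ} (h : y ^ 2 + y - x ^ 3 + x ^ 2 = 0) (hw : 1 - x ≠ 0)
    (hu : 1 + y ≠ 0) (r c : ℂ) (hr : r = (1 + y - x) ^ 2 / ((1 + y) * (1 - x) ^ 2))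
    (hc : c = y * (1 + y - x) / (1 - x) ^ 4) :
    16 * r ^ 2 * c - 8 * r * c ^ 2 - 20 * r * c + r + (c - 1) ^ 3 =
      -(x ^ 3 * (1 + y - x) ^ 4 / (1 - x) ^ 12) *
        (-1 + 5 * x - 5 * x ^ 2 + x ^ 3 - 2 * y + 3 * x * y) := by
  rw [hr, hc]
  field_simp
  linear_combination ((-1 * x ^ 1 + 8 * x ^ 2 - 23 * x ^ 3 + 32 * x ^ 4 - 23 * x ^ 5 + 8 * x ^ 6 - 1 * x ^ 7) * y
    ^ 0 + (-11 * x ^ 1 + 57 * x ^ 2 - 104 * x ^ 3 + 68 * x ^ 4 + 21 * x ^ 5 - 56 * x ^ 6 + 33 *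
    x ^ 7 - 9 * x ^ 8 + 1 * x ^ 9) * y ^ 1 + (-1 * x ^ 0 - 23 * x ^ 1 + 106 * x ^ 2 - 153 * x ^
    3 + 65 * x ^ 4 + 44 * x ^ 5 - 63 * x ^ 6 + 33 * x ^ 7 - 9 * x ^ 8 + 1 * x ^ 9) * y ^ 2 + (-9
    * x ^ 0 + 9 * x ^ 1 + 49 * x ^ 2 - 116 * x ^ 3 + 115 * x ^ 4 - 65 * x ^ 5 + 18 * x ^ 6 - 1 *
    x ^ 7) * y ^ 3 + (-13 * x ^ 0 + 35 * x ^ 1 - 16 * x ^ 2 - 30 * x ^ 3 + 41 * x ^ 4 - 17 * x ^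
    5 + 1 * x ^ 6) * y ^ 4 + (-4 * x ^ 0 + 13 * x ^ 1 - 8 * x ^ 2 - 2 * x ^ 3 + 3 * x ^ 4) * y ^
    5 + (1 * x ^ 0) * y ^ 6) * h

/-- The product `J ^ 12`, expressed by theta functions. -/
lemma qp_pow_twelve (hq : ‖q‖ < 1) (h0 : q ≠ 0) :
    qp (q ^ 11) (q ^ 11) ^ 12 * (-1 + 5 * ux q - 5 * ux q ^ 2 + ux q ^ 3 - 2 * uy q
      + 3 * ux q * uy q) =
      br q 1 ^ 2 * br q 2 ^ 6 * br q 3 ^ 2 * br q 5 ^ 5 / br q 4 ^ 3 := by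
  have n1 := br_ne_zero hq h0 (n := 1) (by decide)
  have n2 := br_ne_zero hq h0 (n := 2) (by decide)
  have n3 := br_ne_zero hq h0 (n := 3) (by decide)
  have n4 := br_ne_zero hq h0 (n := 4) (by decide)
  have n5 := br_ne_zero hq h0 (n := 5) (by decide)
  have hw := one_sub_ux hq h0
  have hu := one_add_uy hq h0
  have hv := one_add_uy_sub_ux hq h0
  have hw0 : 1 - ux q ≠ 0 := by rw [hw]; simp [n1, n2, n4, n5]
  have hu0 : 1 + uy q ≠ 0 := by rw [hu]; simp [h0, n1, n2, n3, n4]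
  have h := discriminant_relation hq h0 _ _ _ rfl rfl rfl
  rw [tate_discriminant (ux_uy_curve hq h0) hw0 hu0 _ _ ?_ ?_] at h
  · rw [hw, hv] at h
    generalize (-1 + 5 * ux q - 5 * ux q ^ 2 + ux q ^ 3 - 2 * uy q + 3 * ux q * uy q) = Z at h ⊢
    rw [ux] at h
    apply mul_left_cancel₀ (pow_ne_zero 11 h0)
    field_simp at h ⊢
    linear_combination h
  · rw [hv, hu, hw]; field_simp
  · rw [hv, hw, uy]; field_simp
end
end RankCrank

namespace RankCrank
open Filter Topology
section
variable {q : ℂ}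

/-- The unit `1 - x` on the modular curve. -/
noncomputable def uw (q : ℂ) : ℂ := 1 - ux q

/-- The unit `1 + y` on the modular curve. -/
noncomputable def uu (q : ℂ) : ℂ := 1 + uy q

/-- The unit `1 + y - x` on the modular curve. -/
noncomputable def uv (q : ℂ) : ℂ := 1 + uy q - ux q

/-- The quotient of `J ^ 12` by a product of theta functions, on the modular curve. -/
noncomputable def uz (q : ℂ) : ℂ :=
  -1 + 5 * ux q - 5 * ux q ^ 2 + ux q ^ 3 - 2 * uy q + 3 * ux q * uy q

/-- The infinite product with base `q ^ 11`. -/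
noncomputable def bj (q : ℂ) : ℂ := qp (q ^ 11) (q ^ 11)

/-- Theta quotients carrying the eleven components of the generating functions. -/
noncomputable def hmon (q : ℂ) : ℕ → ℂ
  | 0 => bj q ^ 14 * br q 4 * q / (br q 1 ^ 2 * br q 2 ^ 6 * br q 3 * br q 5 ^ 5)
  | 1 => bj q ^ 14 * br q 4 ^ 3 / (br q 1 ^ 2 * br q 2 ^ 8 * br q 3 * br q 5 ^ 5)
  | 2 => bj q ^ 14 * br q 4 ^ 2 / (br q 1 ^ 3 * br q 2 ^ 6 * br q 3 * br q 5 ^ 5)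
  | 3 => bj q ^ 14 * br q 4 ^ 3 / (br q 1 ^ 3 * br q 2 ^ 6 * br q 3 * br q 5 ^ 6)
  | 4 => bj q ^ 14 * br q 4 ^ 3 / (br q 1 ^ 2 * br q 2 ^ 7 * br q 3 ^ 2 * br q 5 ^ 5)
  | 5 => bj q ^ 14 * br q 4 ^ 4 / (br q 1 ^ 2 * br q 2 ^ 7 * br q 3 ^ 2 * br q 5 ^ 6)
  | 6 => bj q ^ 14 * br q 4 ^ 2 / (br q 1 ^ 2 * br q 2 ^ 7 * br q 3 * br q 5 ^ 5)
  | 7 => bj q ^ 14 * br q 4 ^ 3 / (br q 1 ^ 2 * br q 2 ^ 7 * br q 3 * br q 5 ^ 6)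
  | 8 => bj q ^ 14 * br q 4 ^ 3 / (br q 1 ^ 3 * br q 2 ^ 7 * br q 3 * br q 5 ^ 5 * q)
  | 9 => bj q ^ 14 * br q 4 ^ 2 / (br q 1 ^ 2 * br q 2 ^ 6 * br q 3 ^ 2 * br q 5 ^ 5)
  | 10 => bj q ^ 14 * br q 4 ^ 4 / (br q 1 ^ 4 * br q 2 ^ 7 * br q 3 * br q 5 ^ 5 * q ^ 2)
  | _ => 0

lemma uw_eq (hq : ‖q‖ < 1) (h0 : q ≠ 0) : uw q = br q 2 ^ 2 * br q 5 / (br q 1 * br q 4 ^ 2) :=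
  one_sub_ux hq h0

lemma uu_eq (hq : ‖q‖ < 1) (h0 : q ≠ 0) :
    uu q = q ^ 2 * br q 1 * br q 2 ^ 3 / (br q 3 * br q 4 ^ 3) := one_add_uy hq h0

lemma uv_eq (hq : ‖q‖ < 1) (h0 : q ≠ 0) :
    uv q = q * br q 2 ^ 2 * br q 3 * br q 5 / br q 4 ^ 4 := one_add_uy_sub_ux hq h0

lemma bj_pow_twelve (hq : ‖q‖ < 1) (h0 : q ≠ 0) : bj q ^ 12 * uz q =
    br q 1 ^ 2 * br q 2 ^ 6 * br q 3 ^ 2 * br q 5 ^ 5 / br q 4 ^ 3 := qp_pow_twelve hq h0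

lemma br_ne_zero_all (hq : ‖q‖ < 1) (h0 : q ≠ 0) :
    br q 1 ≠ 0 ∧ br q 2 ≠ 0 ∧ br q 3 ≠ 0 ∧ br q 4 ≠ 0 ∧ br q 5 ≠ 0 :=
  ⟨br_ne_zero hq h0 (by decide), br_ne_zero hq h0 (by decide), br_ne_zero hq h0 (by decide),
    br_ne_zero hq h0 (by decide), br_ne_zero hq h0 (by decide)⟩

lemma component_zero (hq : ‖q‖ < 1) (h0 : q ≠ 0) (P : ℕ → ℂ) (k₀ k₁ k₂ k₃ k₄ : ℂ)
    (h : -uy q * uu q * uv q ^ 2 * P 0 + ux q * uw q ^ 3 * uv q * P 10 - ux q * uy q * uw q * uu q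
      * uv q * P 9 + ux q * uu q * uv q ^ 2 * P 7 - uy q * uu q * uv q ^ 2 * P 6 - uy q * uu q *
      uv q ^ 2 * P 4 =
      uz q * (-(-k₀) * (ux q * uw q ^ 4 * uu q) - (-k₁) * (ux q * uw q ^ 2 * uv q ^ 2) - (-k₂) * (ux q
        * uw q ^ 3 * uu q) - (-k₃) * (ux q * uw q * uv q ^ 2) - (-k₄) * (uy q * uw q ^ 2 * uu q
        * uv q))) :
    bj q * (br q 4 / br q 2 * (hmon q 0 * P 0) - br q 2 * q / br q 1 * (hmon q 10 * P 10) - br q 5 * q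
      / br q 3 * (hmon q 9 * P 9) - br q 1 * q ^ 2 / br q 5 * (hmon q 7 * P 7) + q * (hmon q 6 *
      P 6) + br q 3 * q / br q 4 * (hmon q 4 * P 4)) =
      bj q ^ 3 * ((-k₀) * (br q 2 ^ 3 / (br q 1 ^ 3 * br q 3)) + (-k₁) * (br q 3 ^ 2 / (br q 1 ^ 2 * br q
        4)) + (-k₂) * (br q 2 * br q 4 ^ 2 / (br q 1 ^ 2 * br q 3 * br q 5)) + (-k₃) * (br q 3 ^
        2 * br q 4 / (br q 1 * br q 2 ^ 2 * br q 5)) + (-k₄) * (br q 2 * br q 5 / (br q 1 ^ 2 *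
        br q 4))) := by
  obtain ⟨n1, n2, n3, n4, n5⟩ := br_ne_zero_all hq h0
  have hz := bj_pow_twelve hq h0
  simp only [uw_eq hq h0, uu_eq hq h0, uv_eq hq h0, ux, uy] at h
  simp only [hmon]
  linear_combination (norm := skip) bj q ^ 15 * (br q 4 ^ 16 / (br q 1 ^ 3 * br q 2 ^ 15 * br q 3 * br q 5 ^ 10 * q ^ 3)) * h +
    bj q ^ 3 * ((-k₀) * (br q 2 ^ 3 / (br q 1 ^ 3 * br q 3)) + (-k₁) * (br q 3 ^ 2 / (br q 1 ^ 2 * br q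
      4)) + (-k₂) * (br q 2 * br q 4 ^ 2 / (br q 1 ^ 2 * br q 3 * br q 5)) + (-k₃) * (br q 3 ^ 2
      * br q 4 / (br q 1 * br q 2 ^ 2 * br q 5)) + (-k₄) * (br q 2 * br q 5 / (br q 1 ^ 2 * br q
      4))) *
      br q 4 ^ 3 / (br q 1 ^ 2 * br q 2 ^ 6 * br q 3 ^ 2 * br q 5 ^ 5) * hz
  field_simp
  ring

lemma component_one (hq : ‖q‖ < 1) (h0 : q ≠ 0) (P : ℕ → ℂ) (a₂ c₀ : ℂ)
    (h : -uy q * uv q * P 1 + ux q * uw q ^ 2 * uv q * P 0 + uy q * uw q ^ 2 * P 10 + ux q * uw q *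
      uv q * P 8 - ux q * uw q * uv q * P 7 - ux q * uw q * uv q * P 5 =
      uz q * (-(-a₂ - c₀) * (uy q * uw q * uv q))) :
    bj q * (br q 4 / br q 2 * (hmon q 1 * P 1) - br q 2 / br q 1 * (hmon q 0 * P 0) - br q 5 * q / br
      q 3 * (hmon q 10 * P 10) - br q 1 * q ^ 2 / br q 5 * (hmon q 8 * P 8) + q * (hmon q 7 * P
      7) + br q 3 * q / br q 4 * (hmon q 5 * P 5)) =
      bj q ^ 3 * ((-a₂ - c₀) * (br q 3 * br q 5 / (br q 1 * br q 2 * br q 4))) := by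
  obtain ⟨n1, n2, n3, n4, n5⟩ := br_ne_zero_all hq h0
  have hz := bj_pow_twelve hq h0
  simp only [uw_eq hq h0, uv_eq hq h0, ux, uy] at h
  simp only [hmon]
  linear_combination (norm := skip) bj q ^ 15 * (br q 4 ^ 11 / (br q 1 ^ 2 * br q 2 ^ 12 * br q 3 * br q 5 ^ 9 * q)) * h +
    bj q ^ 3 * ((-a₂ - c₀) * (br q 3 * br q 5 / (br q 1 * br q 2 * br q 4))) *
      br q 4 ^ 3 / (br q 1 ^ 2 * br q 2 ^ 6 * br q 3 ^ 2 * br q 5 ^ 5) * hz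
  field_simp
  ring

lemma component_two (hq : ‖q‖ < 1) (h0 : q ≠ 0) (P : ℕ → ℂ) (a₃ c₁ : ℂ)
    (h : -ux q * uw q * uv q * P 2 + ux q * uw q * uv q * P 1 + uy q * uu q * uv q * P 0 + ux q *
      uu q * uv q * P 9 - ux q * uw q * uv q * P 8 - ux q * uv q ^ 2 * P 6 =
      uz q * (a₃ * (ux q * uy q * uu q) - (-c₁) * (uy q * uw q * uu q))) :
    bj q * (br q 4 / br q 2 * (hmon q 2 * P 2) - br q 2 / br q 1 * (hmon q 1 * P 1) - br q 5 / br q 3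
      * (hmon q 0 * P 0) - br q 1 * q ^ 2 / br q 5 * (hmon q 9 * P 9) + q * (hmon q 8 * P 8) +
      br q 3 * q / br q 4 * (hmon q 6 * P 6)) =
      bj q ^ 3 * (a₃ * (br q 1 * br q 5 * q / (br q 2 * br q 3 ^ 2)) + (-c₁) * (br q 5 / (br q 1 * br q
        3))) := by
  obtain ⟨n1, n2, n3, n4, n5⟩ := br_ne_zero_all hq h0
  have hz := bj_pow_twelve hq h0
  simp only [uw_eq hq h0, uu_eq hq h0, uv_eq hq h0, ux, uy] at h
  simp only [hmon]
  linear_combination (norm := skip) bj q ^ 15 * (br q 4 ^ 11 / (br q 1 ^ 3 * br q 2 ^ 12 * br q 3 * br q 5 ^ 8 * q ^ 2)) * h +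
    bj q ^ 3 * (a₃ * (br q 1 * br q 5 * q / (br q 2 * br q 3 ^ 2)) + (-c₁) * (br q 5 / (br q 1 * br q 3))) *
      br q 4 ^ 3 / (br q 1 ^ 2 * br q 2 ^ 6 * br q 3 ^ 2 * br q 5 ^ 5) * hz
  field_simp
  ring

lemma component_three (hq : ‖q‖ < 1) (h0 : q ≠ 0) (P : ℕ → ℂ) (a₁ a₂ c₀ c₁ : ℂ)
    (h : -uy q * uu q * uv q * P 3 + uy q * uw q * uu q * uv q * P 2 + ux q ^ 2 * uy q * uv q * P 1
      + uy q * uu q * uv q * P 10 + ux q * uy q * uu q * uv q * P 9 + ux q ^ 2 * uv q ^ 2 * P 7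
      =
      uz q * (-(-a₁) * (uy q * uu q * uv q) + (-a₂ + c₁) * (ux q * uy q * uu q * uv q) - c₀ * (ux q *
        uy q ^ 2 * uu q))) :
    bj q * (br q 4 / br q 2 * (hmon q 3 * P 3) - br q 2 / br q 1 * (hmon q 2 * P 2) - br q 5 / br q 3
      * (hmon q 1 * P 1) - br q 1 * q ^ 2 / br q 5 * (hmon q 10 * P 10) + q * (hmon q 9 * P 9) +
      br q 3 * q / br q 4 * (hmon q 7 * P 7)) =
      bj q ^ 3 * ((-a₁) * (br q 3 * br q 4 / (br q 1 * br q 2 * br q 5)) + (-a₂ + c₁) * (q / br q 4) + c₀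
        * (br q 5 ^ 2 / (br q 2 * br q 3 ^ 2))) := by
  obtain ⟨n1, n2, n3, n4, n5⟩ := br_ne_zero_all hq h0
  have hz := bj_pow_twelve hq h0
  simp only [uw_eq hq h0, uu_eq hq h0, uv_eq hq h0, ux, uy] at h
  simp only [hmon]
  linear_combination (norm := skip) bj q ^ 15 * (br q 4 ^ 14 / (br q 1 ^ 4 * br q 2 ^ 13 * br q 5 ^ 10 * q ^ 3)) * h +
    bj q ^ 3 * ((-a₁) * (br q 3 * br q 4 / (br q 1 * br q 2 * br q 5)) + (-a₂ + c₁) * (q / br q 4) + c₀ *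
      (br q 5 ^ 2 / (br q 2 * br q 3 ^ 2))) *
      br q 4 ^ 3 / (br q 1 ^ 2 * br q 2 ^ 6 * br q 3 ^ 2 * br q 5 ^ 5) * hz
  field_simp
  ring

lemma component_four (hq : ‖q‖ < 1) (h0 : q ≠ 0) (P : ℕ → ℂ) (a₄ c₀ : ℂ)
    (h : ux q * uy q * P 4 + ux q * uw q ^ 2 * P 3 - ux q * uy q * uw q * P 2 - ux q ^ 2 * uv q * P
      0 - uy q * uw q * P 10 - uy q * uv q * P 8 =
      uz q * (-(a₄ - c₀) * (uy q * uu q))) :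
    bj q * (br q 4 / br q 2 * (hmon q 4 * P 4) - br q 2 / br q 1 * (hmon q 3 * P 3) - br q 5 / br q 3
      * (hmon q 2 * P 2) - br q 1 * q / br q 5 * (hmon q 0 * P 0) + q * (hmon q 10 * P 10) + br
      q 3 * q / br q 4 * (hmon q 8 * P 8)) =
      bj q ^ 3 * ((a₄ - c₀) * (q / br q 5)) := by
  obtain ⟨n1, n2, n3, n4, n5⟩ := br_ne_zero_all hq h0
  have hz := bj_pow_twelve hq h0
  simp only [uw_eq hq h0, uu_eq hq h0, uv_eq hq h0, ux, uy] at h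
  simp only [hmon]
  linear_combination (norm := skip) bj q ^ 15 * (br q 4 ^ 9 / (br q 1 ^ 3 * br q 2 ^ 10 * br q 5 ^ 9 * q)) * h +
    bj q ^ 3 * ((a₄ - c₀) * (q / br q 5)) *
      br q 4 ^ 3 / (br q 1 ^ 2 * br q 2 ^ 6 * br q 3 ^ 2 * br q 5 ^ 5) * hz
  field_simp
  ring

lemma component_five (hq : ‖q‖ < 1) (h0 : q ≠ 0) (P : ℕ → ℂ) (a₃ a₄ c₁ : ℂ)
    (h : -uy q * uu q * P 5 + uy q * uw q * uu q * P 4 + uy q * uw q * uu q * P 3 - ux q ^ 2 * uv q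
      * P 1 - uy q * uu q * uv q * P 0 - uy q * uu q * uv q * P 9 =
      uz q * (-(-a₃) * (uy q * uw q * uu q) - (-a₄) * (uy q * uu q ^ 2) - c₁ * (uy q * uu q))) :
    bj q * (br q 4 / br q 2 * (hmon q 5 * P 5) - br q 2 / br q 1 * (hmon q 4 * P 4) - br q 5 / br q 3
      * (hmon q 3 * P 3) - br q 1 * q / br q 5 * (hmon q 1 * P 1) + (hmon q 0 * P 0) + br q 3 *
      q / br q 4 * (hmon q 9 * P 9)) =
      bj q ^ 3 * ((-a₃) * (1 / br q 1) + (-a₄) * (br q 1 * br q 2 * q ^ 2 / (br q 3 * br q 4 * br q 5)) +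
        c₁ * (br q 4 ^ 2 / (br q 2 ^ 2 * br q 5))) := by
  obtain ⟨n1, n2, n3, n4, n5⟩ := br_ne_zero_all hq h0
  have hz := bj_pow_twelve hq h0
  simp only [uw_eq hq h0, uu_eq hq h0, uv_eq hq h0, ux, uy] at h
  simp only [hmon]
  linear_combination (norm := skip) bj q ^ 15 * (br q 4 ^ 11 / (br q 1 ^ 3 * br q 2 ^ 12 * br q 5 ^ 9 * q ^ 2)) * h +
    bj q ^ 3 * ((-a₃) * (1 / br q 1) + (-a₄) * (br q 1 * br q 2 * q ^ 2 / (br q 3 * br q 4 * br q 5)) + c₁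
      * (br q 4 ^ 2 / (br q 2 ^ 2 * br q 5))) *
      br q 4 ^ 3 / (br q 1 ^ 2 * br q 2 ^ 6 * br q 3 ^ 2 * br q 5 ^ 5) * hz
  field_simp
  ring

lemma component_six (hq : ‖q‖ < 1) (h0 : q ≠ 0) (P : ℕ → ℂ) (a₂ a₄ c₀ : ℂ)
    (h : ux q ^ 2 * uv q * P 6 + ux q * uw q * uu q * P 5 - ux q * uy q * uu q * P 4 + ux q * uu q
      * uv q * P 2 + ux q ^ 2 * uv q * P 1 - ux q * uw q * uv q * P 10 =
      uz q * (-a₂ * (ux q * uw q * uu q) - (-a₄) * (uy q * uu q * uv q) + (-c₀) * (ux q * uy q * uu q))) :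
    bj q * (br q 4 / br q 2 * (hmon q 6 * P 6) - br q 2 / br q 1 * (hmon q 5 * P 5) - br q 5 / br q 3
      * (hmon q 4 * P 4) - br q 1 * q / br q 5 * (hmon q 2 * P 2) + (hmon q 1 * P 1) + br q 3 *
      q / br q 4 * (hmon q 10 * P 10)) =
      bj q ^ 3 * (a₂ * (br q 4 / (br q 1 * br q 5)) + (-a₄) * (br q 3 * br q 5 / (br q 1 * br q 4 ^ 2)) +
        (-c₀) * (br q 5 / (br q 2 * br q 3))) := by
  obtain ⟨n1, n2, n3, n4, n5⟩ := br_ne_zero_all hq h0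
  have hz := bj_pow_twelve hq h0
  simp only [uw_eq hq h0, uu_eq hq h0, uv_eq hq h0, ux, uy] at h
  simp only [hmon]
  linear_combination (norm := skip) bj q ^ 15 * (br q 4 ^ 11 / (br q 1 ^ 4 * br q 2 ^ 12 * br q 5 ^ 8 * q ^ 3)) * h +
    bj q ^ 3 * (a₂ * (br q 4 / (br q 1 * br q 5)) + (-a₄) * (br q 3 * br q 5 / (br q 1 * br q 4 ^ 2)) +
      (-c₀) * (br q 5 / (br q 2 * br q 3))) *
      br q 4 ^ 3 / (br q 1 ^ 2 * br q 2 ^ 6 * br q 3 ^ 2 * br q 5 ^ 5) * hz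
  field_simp
  ring

lemma component_seven (hq : ‖q‖ < 1) (h0 : q ≠ 0) (P : ℕ → ℂ) (a₁ : ℂ)
    (h : -ux q * uv q * P 7 + ux q * uw q * uv q * P 6 + uy q * uu q * P 5 - uu q * uv q * P 3 - ux
      q * uw q * uv q * P 2 - ux q * uv q ^ 2 * P 0 =
      uz q * (-(-a₁) * (ux q * uw q * uu q))) :
    bj q * (br q 4 / br q 2 * (hmon q 7 * P 7) - br q 2 / br q 1 * (hmon q 6 * P 6) - br q 5 / br q 3
      * (hmon q 5 * P 5) - br q 1 * q / br q 5 * (hmon q 3 * P 3) + (hmon q 2 * P 2) + br q 3 /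
      br q 4 * (hmon q 0 * P 0)) =
      bj q ^ 3 * ((-a₁) * (br q 2 * q / (br q 3 * br q 5))) := by
  obtain ⟨n1, n2, n3, n4, n5⟩ := br_ne_zero_all hq h0
  have hz := bj_pow_twelve hq h0
  simp only [uw_eq hq h0, uu_eq hq h0, uv_eq hq h0, ux, uy] at h
  simp only [hmon]
  linear_combination (norm := skip) bj q ^ 15 * (br q 4 ^ 10 / (br q 1 ^ 3 * br q 2 ^ 11 * br q 3 * br q 5 ^ 8 * q ^ 2)) * h +
    bj q ^ 3 * ((-a₁) * (br q 2 * q / (br q 3 * br q 5))) *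
      br q 4 ^ 3 / (br q 1 ^ 2 * br q 2 ^ 6 * br q 3 ^ 2 * br q 5 ^ 5) * hz
  field_simp
  ring

lemma component_eight (hq : ‖q‖ < 1) (h0 : q ≠ 0) (P : ℕ → ℂ) (a₁ a₄ : ℂ)
    (h : -uy q * uu q * P 8 + ux q * uw q * uu q * P 7 - ux q * uy q * uu q * P 6 - ux q ^ 2 * uu q
      * P 4 - ux q * uw q * uu q * P 3 + ux q ^ 2 * uv q * P 1 =
      uz q * (-a₁ * (ux q * uu q ^ 2) + a₄ * (ux q * uy q * uu q))) :
    bj q * (br q 4 / br q 2 * (hmon q 8 * P 8) - br q 2 / br q 1 * (hmon q 7 * P 7) - br q 5 / br q 3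
      * (hmon q 6 * P 6) - br q 1 * q / br q 5 * (hmon q 4 * P 4) + (hmon q 3 * P 3) + br q 3 /
      br q 4 * (hmon q 1 * P 1)) =
      bj q ^ 3 * (a₁ * (br q 1 * br q 2 * q ^ 2 / (br q 4 * br q 5 ^ 2)) + a₄ * (br q 5 / (br q 2 * br q
        4))) := by
  obtain ⟨n1, n2, n3, n4, n5⟩ := br_ne_zero_all hq h0
  have hz := bj_pow_twelve hq h0
  simp only [uw_eq hq h0, uu_eq hq h0, uv_eq hq h0, ux, uy] at h
  simp only [hmon]
  linear_combination (norm := skip) bj q ^ 15 * (br q 3 * br q 4 ^ 10 / (br q 1 ^ 4 * br q 2 ^ 12 * br q 5 ^ 8 * q ^ 3)) * h +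
    bj q ^ 3 * (a₁ * (br q 1 * br q 2 * q ^ 2 / (br q 4 * br q 5 ^ 2)) + a₄ * (br q 5 / (br q 2 * br q 4))) *
      br q 4 ^ 3 / (br q 1 ^ 2 * br q 2 ^ 6 * br q 3 ^ 2 * br q 5 ^ 5) * hz
  field_simp
  ring

lemma component_nine (hq : ‖q‖ < 1) (h0 : q ≠ 0) (P : ℕ → ℂ) (a₁ a₃ c₁ : ℂ)
    (h : ux q * uy q * uv q * P 9 + uy q * uw q * uv q * P 8 - ux q * uy q * uv q * P 7 - ux q ^ 2
      * uv q * P 5 + ux q * uy q * uv q * P 4 - uy q * uv q ^ 2 * P 2 =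
      uz q * (a₁ * (ux q * uy q * uv q) - (a₃ - c₁) * (uy q * uw q * uu q))) :
    bj q * (br q 4 / br q 2 * (hmon q 9 * P 9) - br q 2 / br q 1 * (hmon q 8 * P 8) - br q 5 / br q 3
      * (hmon q 7 * P 7) - br q 1 * q / br q 5 * (hmon q 5 * P 5) + (hmon q 4 * P 4) + br q 3 /
      br q 4 * (hmon q 2 * P 2)) =
      bj q ^ 3 * (a₁ * (1 / br q 2) + (a₃ - c₁) * (br q 2 * br q 4 / (br q 1 * br q 3 * br q 5))) := by
  obtain ⟨n1, n2, n3, n4, n5⟩ := br_ne_zero_all hq h0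
  have hz := bj_pow_twelve hq h0
  simp only [uw_eq hq h0, uu_eq hq h0, uv_eq hq h0, ux, uy] at h
  simp only [hmon]
  linear_combination (norm := skip) bj q ^ 15 * (br q 4 ^ 12 / (br q 1 ^ 3 * br q 2 ^ 11 * br q 3 * br q 5 ^ 10 * q ^ 2)) * h +
    bj q ^ 3 * (a₁ * (1 / br q 2) + (a₃ - c₁) * (br q 2 * br q 4 / (br q 1 * br q 3 * br q 5))) *
      br q 4 ^ 3 / (br q 1 ^ 2 * br q 2 ^ 6 * br q 3 ^ 2 * br q 5 ^ 5) * hz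
  field_simp
  ring

lemma component_ten (hq : ‖q‖ < 1) (h0 : q ≠ 0) (P : ℕ → ℂ) (a₂ a₃ c₀ c₁ : ℂ)
    (h : -uy q * uw q ^ 2 * uv q * P 10 + uy q * uw q ^ 2 * uu q * uv q * P 9 - ux q * uy q * uw q
      ^ 2 * uv q * P 8 + uy q * uu q * uv q ^ 2 * P 6 - uy q * uw q * uu q * uv q * P 5 - ux q *
      uw q ^ 2 * uv q ^ 2 * P 3 =
      uz q * (-a₂ * (uy q * uw q ^ 3 * uu q) + (-a₃) * (ux q * uy q * uw q * uu q * uv q) - c₀ * (uy q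
        * uw q ^ 2 * uu q * uv q) - c₁ * (uy q * uw q * uu q * uv q))) :
    bj q * (br q 4 / br q 2 * (hmon q 10 * P 10) - br q 2 / br q 1 * (hmon q 9 * P 9) - br q 5 / br q
      3 * (hmon q 8 * P 8) - br q 1 * q / br q 5 * (hmon q 6 * P 6) + (hmon q 5 * P 5) + br q 3
      / br q 4 * (hmon q 3 * P 3)) =
      bj q ^ 3 * (a₂ * (br q 2 * br q 4 / (br q 1 ^ 2 * br q 3 * q)) + (-a₃) * (br q 1 * q / (br q 3 * br
        q 4)) + c₀ * (br q 2 / (br q 1 * br q 4)) + c₁ * (br q 4 / (br q 2 * br q 5))) := by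
  obtain ⟨n1, n2, n3, n4, n5⟩ := br_ne_zero_all hq h0
  have hz := bj_pow_twelve hq h0
  simp only [uw_eq hq h0, uu_eq hq h0, uv_eq hq h0, ux, uy] at h
  simp only [hmon]
  linear_combination (norm := skip) bj q ^ 15 * (br q 4 ^ 16 / (br q 1 ^ 2 * br q 2 ^ 15 * br q 3 * br q 5 ^ 11 * q ^ 3)) * h +
    bj q ^ 3 * (a₂ * (br q 2 * br q 4 / (br q 1 ^ 2 * br q 3 * q)) + (-a₃) * (br q 1 * q / (br q 3 * br q
      4)) + c₀ * (br q 2 / (br q 1 * br q 4)) + c₁ * (br q 4 / (br q 2 * br q 5))) *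
      br q 4 ^ 3 / (br q 1 ^ 2 * br q 2 ^ 6 * br q 3 ^ 2 * br q 5 ^ 5) * hz
  field_simp
  ring

end
end RankCrank

namespace RankCrank
open Filter Topology Finset
section
variable {q s : ℂ}

/-- Multiplication of a six-term series in `s` by an eleven-term series, sorted by residues. -/
lemma residue_convolution (hs : s ^ 11 = q) {e₀ e₁ e₂ e₄ e₅ e₇ : ℂ} (h l : ℕ → ℂ)
    (l0 : e₀ * h 0 + e₁ * q * h 10 + e₂ * q * h 9 + e₄ * q * h 7 + e₅ * q * h 6 + e₇ * q * h 4 = l 0)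
    (l1 : e₀ * h 1 + e₁ * h 0 + e₂ * q * h 10 + e₄ * q * h 8 + e₅ * q * h 7 + e₇ * q * h 5 = l 1)
    (l2 : e₀ * h 2 + e₁ * h 1 + e₂ * h 0 + e₄ * q * h 9 + e₅ * q * h 8 + e₇ * q * h 6 = l 2)
    (l3 : e₀ * h 3 + e₁ * h 2 + e₂ * h 1 + e₄ * q * h 10 + e₅ * q * h 9 + e₇ * q * h 7 = l 3)
    (l4 : e₀ * h 4 + e₁ * h 3 + e₂ * h 2 + e₄ * h 0 + e₅ * q * h 10 + e₇ * q * h 8 = l 4)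
    (l5 : e₀ * h 5 + e₁ * h 4 + e₂ * h 3 + e₄ * h 1 + e₅ * h 0 + e₇ * q * h 9 = l 5)
    (l6 : e₀ * h 6 + e₁ * h 5 + e₂ * h 4 + e₄ * h 2 + e₅ * h 1 + e₇ * q * h 10 = l 6)
    (l7 : e₀ * h 7 + e₁ * h 6 + e₂ * h 5 + e₄ * h 3 + e₅ * h 2 + e₇ * h 0 = l 7)
    (l8 : e₀ * h 8 + e₁ * h 7 + e₂ * h 6 + e₄ * h 4 + e₅ * h 3 + e₇ * h 1 = l 8)
    (l9 : e₀ * h 9 + e₁ * h 8 + e₂ * h 7 + e₄ * h 5 + e₅ * h 4 + e₇ * h 2 = l 9)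
    (l10 : e₀ * h 10 + e₁ * h 9 + e₂ * h 8 + e₄ * h 6 + e₅ * h 5 + e₇ * h 3 = l 10) :
    (e₀ + s * e₁ + s ^ 2 * e₂ + s ^ 4 * e₄ + s ^ 5 * e₅ + s ^ 7 * e₇) *
      (∑ r ∈ range 11, s ^ r * h r) = ∑ r ∈ range 11, s ^ r * l r := by
  subst hs
  simp only [sum_range_succ, sum_range_zero, ← l0, ← l1, ← l2, ← l3, ← l4, ← l5, ← l6, ← l7,
    ← l8, ← l9, ← l10]
  ring

/-- The product `∏ (1 - s ^ n)` with `s ^ 11 = q`, split into residue classes. -/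
noncomputable def esix (q s : ℂ) : ℂ :=
  bj q * (br q 4 / br q 2 - s * (br q 2 / br q 1) - s ^ 2 * (br q 5 / br q 3)
    - s ^ 4 * (q * br q 1 / br q 5) + s ^ 5 + s ^ 7 * (br q 3 / br q 4))

/-- Theta part of a dissected Appell sum. -/
noncomputable def lamr₁ (q s : ℂ) : ℂ :=
  bj q ^ 3 * (s ^ 8 * (br q 1 * br q 2 * q ^ 2 / (br q 4 * br q 5 ^ 2)) - s ^ 7 * (br q 2 * q / (br q 3 *
    br q 5)) + s ^ 9 * (1 / br q 2) - s ^ 3 * (br q 3 * br q 4 / (br q 1 * br q 2 * br q 5)))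

/-- Theta part of a dissected Appell sum. -/
noncomputable def lamr₂ (q s : ℂ) : ℂ :=
  bj q ^ 3 * (s ^ 10 * (br q 2 * br q 4 / (br q 1 ^ 2 * br q 3 * q)) - s ^ 1 * (br q 3 * br q 5 / (br q 1
    * br q 2 * br q 4)) + s ^ 6 * (br q 4 / (br q 1 * br q 5)) - s ^ 3 * (q / br q 4))

/-- Theta part of a dissected Appell sum. -/
noncomputable def lamr₃ (q s : ℂ) : ℂ :=
  bj q ^ 3 * (-s ^ 10 * (br q 1 * q / (br q 3 * br q 4)) + s ^ 9 * (br q 2 * br q 4 / (br q 1 * br q 3 *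
    br q 5)) - s ^ 5 * (1 / br q 1) + s ^ 2 * (br q 1 * br q 5 * q / (br q 2 * br q 3 ^ 2)))

/-- Theta part of a dissected Appell sum. -/
noncomputable def lamr₄ (q s : ℂ) : ℂ :=
  bj q ^ 3 * (-s ^ 5 * (br q 1 * br q 2 * q ^ 2 / (br q 3 * br q 4 * br q 5)) + s ^ 4 * (q / br q 5) - s ^
    6 * (br q 3 * br q 5 / (br q 1 * br q 4 ^ 2)) + s ^ 8 * (br q 5 / (br q 2 * br q 4)))

/-- Theta part of a dissected Appell sum. -/
noncomputable def lamc₀ (q s : ℂ) : ℂ :=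
  bj q ^ 3 * (-s ^ 4 * (q / br q 5) + s ^ 10 * (br q 2 / (br q 1 * br q 4)) - s ^ 6 * (br q 5 / (br q 2 *
    br q 3)) + s ^ 3 * (br q 5 ^ 2 / (br q 2 * br q 3 ^ 2)) - s ^ 1 * (br q 3 * br q 5 / (br q 1
    * br q 2 * br q 4)))

/-- Theta part of a dissected Appell sum. -/
noncomputable def lamc₁ (q s : ℂ) : ℂ :=
  bj q ^ 3 * (s ^ 3 * (q / br q 4) - s ^ 9 * (br q 2 * br q 4 / (br q 1 * br q 3 * br q 5)) + s ^ 5 * (br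
    q 4 ^ 2 / (br q 2 ^ 2 * br q 5)) - s ^ 2 * (br q 5 / (br q 1 * br q 3)) + s ^ 10 * (br q 4 /
    (br q 2 * br q 5)))

lemma bj_ne_zero (hq : ‖q‖ < 1) : bj q ≠ 0 := qp_self_ne_zero (norm_pow_eleven hq)

lemma esix_mul (hq : ‖q‖ < 1) (h0 : q ≠ 0) (hs : s ^ 11 = q) (P : ℕ → ℂ)
    (a₁ a₂ a₃ a₄ c₀ c₁ k₀ k₁ k₂ k₃ k₄ : ℂ)
    (g0 : -uy q * uu q * uv q ^ 2 * P 0 + ux q * uw q ^ 3 * uv q * P 10 - ux q * uy q * uw q * uu q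
      * uv q * P 9 + ux q * uu q * uv q ^ 2 * P 7 - uy q * uu q * uv q ^ 2 * P 6 - uy q * uu q *
      uv q ^ 2 * P 4 =
      uz q * (-(-k₀) * (ux q * uw q ^ 4 * uu q) - (-k₁) * (ux q * uw q ^ 2 * uv q ^ 2) - (-k₂) * (ux q
        * uw q ^ 3 * uu q) - (-k₃) * (ux q * uw q * uv q ^ 2) - (-k₄) * (uy q * uw q ^ 2 * uu q
        * uv q)))
    (g1 : -uy q * uv q * P 1 + ux q * uw q ^ 2 * uv q * P 0 + uy q * uw q ^ 2 * P 10 + ux q * uw q *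
      uv q * P 8 - ux q * uw q * uv q * P 7 - ux q * uw q * uv q * P 5 =
      uz q * (-(-a₂ - c₀) * (uy q * uw q * uv q)))
    (g2 : -ux q * uw q * uv q * P 2 + ux q * uw q * uv q * P 1 + uy q * uu q * uv q * P 0 + ux q *
      uu q * uv q * P 9 - ux q * uw q * uv q * P 8 - ux q * uv q ^ 2 * P 6 =
      uz q * (a₃ * (ux q * uy q * uu q) - (-c₁) * (uy q * uw q * uu q)))
    (g3 : -uy q * uu q * uv q * P 3 + uy q * uw q * uu q * uv q * P 2 + ux q ^ 2 * uy q * uv q * P 1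
      + uy q * uu q * uv q * P 10 + ux q * uy q * uu q * uv q * P 9 + ux q ^ 2 * uv q ^ 2 * P 7
      =
      uz q * (-(-a₁) * (uy q * uu q * uv q) + (-a₂ + c₁) * (ux q * uy q * uu q * uv q) - c₀ * (ux q *
        uy q ^ 2 * uu q)))
    (g4 : ux q * uy q * P 4 + ux q * uw q ^ 2 * P 3 - ux q * uy q * uw q * P 2 - ux q ^ 2 * uv q * P
      0 - uy q * uw q * P 10 - uy q * uv q * P 8 =
      uz q * (-(a₄ - c₀) * (uy q * uu q)))
    (g5 : -uy q * uu q * P 5 + uy q * uw q * uu q * P 4 + uy q * uw q * uu q * P 3 - ux q ^ 2 * uv q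
      * P 1 - uy q * uu q * uv q * P 0 - uy q * uu q * uv q * P 9 =
      uz q * (-(-a₃) * (uy q * uw q * uu q) - (-a₄) * (uy q * uu q ^ 2) - c₁ * (uy q * uu q)))
    (g6 : ux q ^ 2 * uv q * P 6 + ux q * uw q * uu q * P 5 - ux q * uy q * uu q * P 4 + ux q * uu q
      * uv q * P 2 + ux q ^ 2 * uv q * P 1 - ux q * uw q * uv q * P 10 =
      uz q * (-a₂ * (ux q * uw q * uu q) - (-a₄) * (uy q * uu q * uv q) + (-c₀) * (ux q * uy q * uu q)))
    (g7 : -ux q * uv q * P 7 + ux q * uw q * uv q * P 6 + uy q * uu q * P 5 - uu q * uv q * P 3 - ux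
      q * uw q * uv q * P 2 - ux q * uv q ^ 2 * P 0 =
      uz q * (-(-a₁) * (ux q * uw q * uu q)))
    (g8 : -uy q * uu q * P 8 + ux q * uw q * uu q * P 7 - ux q * uy q * uu q * P 6 - ux q ^ 2 * uu q
      * P 4 - ux q * uw q * uu q * P 3 + ux q ^ 2 * uv q * P 1 =
      uz q * (-a₁ * (ux q * uu q ^ 2) + a₄ * (ux q * uy q * uu q)))
    (g9 : ux q * uy q * uv q * P 9 + uy q * uw q * uv q * P 8 - ux q * uy q * uv q * P 7 - ux q ^ 2
      * uv q * P 5 + ux q * uy q * uv q * P 4 - uy q * uv q ^ 2 * P 2 =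
      uz q * (a₁ * (ux q * uy q * uv q) - (a₃ - c₁) * (uy q * uw q * uu q)))
    (g10 : -uy q * uw q ^ 2 * uv q * P 10 + uy q * uw q ^ 2 * uu q * uv q * P 9 - ux q * uy q * uw q
      ^ 2 * uv q * P 8 + uy q * uu q * uv q ^ 2 * P 6 - uy q * uw q * uu q * uv q * P 5 - ux q *
      uw q ^ 2 * uv q ^ 2 * P 3 =
      uz q * (-a₂ * (uy q * uw q ^ 3 * uu q) + (-a₃) * (ux q * uy q * uw q * uu q * uv q) - c₀ * (uy q
        * uw q ^ 2 * uu q * uv q) - c₁ * (uy q * uw q * uu q * uv q))) :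
    esix q s * (∑ r ∈ range 11, s ^ r * (hmon q r * P r)) =
      a₁ * lamr₁ q s + a₂ * lamr₂ q s + a₃ * lamr₃ q s + a₄ * lamr₄ q s + c₀ * lamc₀ q s + c₁
        * lamc₁ q s + bj q ^ 3 * (k₀ * (-(br q 2 ^ 3 / (br q 1 ^ 3 * br q 3))) + k₁ * (-(br q 3
        ^ 2 / (br q 1 ^ 2 * br q 4))) + k₂ * (-(br q 2 * br q 4 ^ 2 / (br q 1 ^ 2 * br q 3 * br
        q 5))) + k₃ * (-(br q 3 ^ 2 * br q 4 / (br q 1 * br q 2 ^ 2 * br q 5))) + k₄ * (-(br q 2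
        * br q 5 / (br q 1 ^ 2 * br q 4)))) := by
  rw [esix, mul_assoc]
  have key := residue_convolution hs (e₀ := br q 4 / br q 2) (e₁ := -(br q 2 / br q 1))
    (e₂ := -(br q 5 / br q 3)) (e₄ := -(q * br q 1 / br q 5)) (e₅ := 1) (e₇ := br q 3 / br q 4)
    (fun r => hmon q r * P r) (fun r => bj q ^ 2 * [
      (-k₀) * (br q 2 ^ 3 / (br q 1 ^ 3 * br q 3)) + (-k₁) * (br q 3 ^ 2 / (br q 1 ^ 2 * br q
        4)) + (-k₂) * (br q 2 * br q 4 ^ 2 / (br q 1 ^ 2 * br q 3 * br q 5)) + (-k₃) * (br q 3 ^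
        2 * br q 4 / (br q 1 * br q 2 ^ 2 * br q 5)) + (-k₄) * (br q 2 * br q 5 / (br q 1 ^ 2 *
        br q 4)),
      (-a₂ - c₀) * (br q 3 * br q 5 / (br q 1 * br q 2 * br q 4)),
      a₃ * (br q 1 * br q 5 * q / (br q 2 * br q 3 ^ 2)) + (-c₁) * (br q 5 / (br q 1 * br q
        3)),
      (-a₁) * (br q 3 * br q 4 / (br q 1 * br q 2 * br q 5)) + (-a₂ + c₁) * (q / br q 4) + c₀
        * (br q 5 ^ 2 / (br q 2 * br q 3 ^ 2)),
      (a₄ - c₀) * (q / br q 5),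
      (-a₃) * (1 / br q 1) + (-a₄) * (br q 1 * br q 2 * q ^ 2 / (br q 3 * br q 4 * br q 5)) +
        c₁ * (br q 4 ^ 2 / (br q 2 ^ 2 * br q 5)),
      a₂ * (br q 4 / (br q 1 * br q 5)) + (-a₄) * (br q 3 * br q 5 / (br q 1 * br q 4 ^ 2)) +
        (-c₀) * (br q 5 / (br q 2 * br q 3)),
      (-a₁) * (br q 2 * q / (br q 3 * br q 5)),
      a₁ * (br q 1 * br q 2 * q ^ 2 / (br q 4 * br q 5 ^ 2)) + a₄ * (br q 5 / (br q 2 * br q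
        4)),
      a₁ * (1 / br q 2) + (a₃ - c₁) * (br q 2 * br q 4 / (br q 1 * br q 3 * br q 5)),
      a₂ * (br q 2 * br q 4 / (br q 1 ^ 2 * br q 3 * q)) + (-a₃) * (br q 1 * q / (br q 3 * br
        q 4)) + c₀ * (br q 2 / (br q 1 * br q 4)) + c₁ * (br q 4 / (br q 2 * br q 5))].getD r 0)
    (by
      apply mul_left_cancel₀ (bj_ne_zero hq)
      simp only [List.getD_cons_zero]
      linear_combination component_zero hq h0 P k₀ k₁ k₂ k₃ k₄ g0)
    (by
      apply mul_left_cancel₀ (bj_ne_zero hq)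
      simp only [List.getD_cons_zero, List.getD_cons_succ]
      linear_combination component_one hq h0 P a₂ c₀ g1)
    (by
      apply mul_left_cancel₀ (bj_ne_zero hq)
      simp only [List.getD_cons_zero, List.getD_cons_succ]
      linear_combination component_two hq h0 P a₃ c₁ g2)
    (by
      apply mul_left_cancel₀ (bj_ne_zero hq)
      simp only [List.getD_cons_zero, List.getD_cons_succ]
      linear_combination component_three hq h0 P a₁ a₂ c₀ c₁ g3)
    (by
      apply mul_left_cancel₀ (bj_ne_zero hq)
      simp only [List.getD_cons_zero, List.getD_cons_succ]
      linear_combination component_four hq h0 P a₄ c₀ g4)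
    (by
      apply mul_left_cancel₀ (bj_ne_zero hq)
      simp only [List.getD_cons_zero, List.getD_cons_succ]
      linear_combination component_five hq h0 P a₃ a₄ c₁ g5)
    (by
      apply mul_left_cancel₀ (bj_ne_zero hq)
      simp only [List.getD_cons_zero, List.getD_cons_succ]
      linear_combination component_six hq h0 P a₂ a₄ c₀ g6)
    (by
      apply mul_left_cancel₀ (bj_ne_zero hq)
      simp only [List.getD_cons_zero, List.getD_cons_succ]
      linear_combination component_seven hq h0 P a₁ g7)
    (by
      apply mul_left_cancel₀ (bj_ne_zero hq)
      simp only [List.getD_cons_zero, List.getD_cons_succ]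
      linear_combination component_eight hq h0 P a₁ a₄ g8)
    (by
      apply mul_left_cancel₀ (bj_ne_zero hq)
      simp only [List.getD_cons_zero, List.getD_cons_succ]
      linear_combination component_nine hq h0 P a₁ a₃ c₁ g9)
    (by
      apply mul_left_cancel₀ (bj_ne_zero hq)
      simp only [List.getD_cons_zero, List.getD_cons_succ]
      linear_combination component_ten hq h0 P a₂ a₃ c₀ c₁ g10)
  have expand : ∀ e₀ e₁ e₂ e₄ e₇ : ℂ, e₀ - s * e₁ - s ^ 2 * e₂ - s ^ 4 * e₄ + s ^ 5 + s ^ 7 * e₇ =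
      e₀ + s * -e₁ + s ^ 2 * -e₂ + s ^ 4 * -e₄ + s ^ 5 * 1 + s ^ 7 * e₇ := by intros; ring
  rw [expand, key]
  simp only [sum_range_succ, sum_range_zero, List.getD_cons_zero, List.getD_cons_succ]
  simp only [lamr₁, lamr₂, lamr₃, lamr₄, lamc₀, lamc₁]
  ring

end
end RankCrank

namespace RankCrank
open Filter Topology Finset
section
variable {q s : ℂ}

/-- Components of a dissected difference, as polynomials on the modular curve. -/
def polyA (x y : ℂ) : ℕ → ℂ
  | 0 => -11 * x + 11 * x ^ 2
  | 1 => -4 - 7 * y + 6 * x + 5 * x * y - 14 * x ^ 2 + 10 * x ^ 3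
  | 2 => -2 * y + 6 * x + 3 * x * y - x ^ 2 - x ^ 3
  | 3 => 2 * y - 4 * x + 5 * x * y + 12 * x ^ 2 - x ^ 2 * y - 9 * x ^ 3
  | 4 => 5 + 3 * y - 6 * x - 7 * x * y - 6 * x ^ 2 + x ^ 2 * y + 7 * x ^ 3
  | 5 => -2 - 2 * y + 3 * x + 10 * x * y + 2 * x ^ 2 - 5 * x ^ 2 * y - 3 * x ^ 3
  | 6 => -4 - 7 * y + 6 * x + 5 * x * y - 3 * x ^ 2 - x ^ 3
  | 7 => 4 + 3 * y - 13 * x - 9 * x * y + x ^ 2 + 4 * x ^ 2 * y + 6 * x ^ 3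
  | 8 => 2 + 2 * y + 2 * x * y - 2 * x ^ 2 - 2 * x ^ 2 * y - x ^ 3
  | 9 => 2 - y + 5 * x + 7 * x * y - 9 * x ^ 2 + x ^ 3
  | 10 => -8 * x - 10 * x * y + 11 * x ^ 2 + 4 * x ^ 2 * y - 4 * x ^ 3
  | _ => 0

/-- Components of a dissected difference, as polynomials on the modular curve. -/
def polyB (x y : ℂ) : ℕ → ℂ
  | 0 => -11 * y - 11 * x ^ 2
  | 1 => 1 - 2 * y - 6 * x - 5 * x * y + 3 * x ^ 2 + x ^ 2 * y - 4 * x ^ 3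
  | 2 => 3 + y - 11 * x - 7 * x * y - 4 * x ^ 2
  | 3 => -3 * y - 2 * x - x * y + 4 * x ^ 2 + 4 * x ^ 3
  | 4 => 2 + 3 * y - 12 * x + 3 * x * y + 26 * x ^ 2 - 3 * x ^ 2 * y - 16 * x ^ 3
  | 5 => -6 * y - x - x * y - 3 * x ^ 2 + 4 * x ^ 2 * y + 4 * x ^ 3
  | 6 => 1 - y - 7 * x + 7 * x * y + 9 * x ^ 2 + 3 * x ^ 3
  | 7 => -1 - 7 * y + 4 * x + 7 * x * y - 2 * x ^ 2 - 3 * x ^ 2 * y - 4 * x ^ 3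
  | 8 => -1 - y + 2 * x + 7 * x * y + 12 * x ^ 2 - 4 * x ^ 3
  | 9 => 2 - 3 * y - 11 * x - x * y + 12 * x ^ 2
  | 10 => -3 - 3 * y + 14 * x + 20 * x * y - 8 * x ^ 2 - 4 * x ^ 2 * y + 3 * x ^ 3
  | _ => 0

/-- Components of a dissected difference, as polynomials on the modular curve. -/
def polyC (x y : ℂ) : ℕ → ℂ
  | 0 => 11 * x * y + 11 * x ^ 2
  | 1 => 2 + 2 * y - 7 * x - 4 * x * y + 9 * x ^ 2 + 7 * x ^ 2 * y + x ^ 3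
  | 2 => -1 - y + 2 * x + 7 * x * y + x ^ 2 + 7 * x ^ 3
  | 3 => -2 * y + 3 * x + 2 * x * y - 12 * x ^ 2 - 4 * x ^ 2 * y + 3 * x ^ 3
  | 4 => 1 - 9 * x - 7 * x * y + 4 * x ^ 2 + 5 * x ^ 2 * y + 4 * x ^ 3
  | 5 => 3 + 5 * y - 17 * x - 11 * x * y + 31 * x ^ 2 + 8 * x ^ 2 * y - 17 * x ^ 3
  | 6 => 2 - 2 * y - 3 * x - 8 * x * y - 15 * x ^ 2 + 6 * x ^ 3
  | 7 => -2 - 4 * y + 9 * x + 13 * x * y - 10 * x ^ 2 - 5 * x ^ 2 * y + 7 * x ^ 3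
  | 8 => 1 + y - 8 * x - 9 * x * y + 10 * x ^ 2 + 3 * x ^ 2 * y - 10 * x ^ 3
  | 9 => -3 * y - 2 * x - x * y - 7 * x ^ 2 + 4 * x ^ 3
  | 10 => 1 + y + x * y - 12 * x ^ 2 - 12 * x ^ 2 * y + 5 * x ^ 3
  | _ => 0

/-- Components of a dissected difference, as polynomials on the modular curve. -/
def polyD (x y : ℂ) : ℕ → ℂ
  | 0 => 11 + 11 * y - 11 * x - 11 * x * y
  | 1 => 14 + 17 * y - 8 * x - 3 * x * y + 4 * x ^ 2 - 9 * x ^ 2 * y - 5 * x ^ 3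
  | 2 => -5 - 3 * y - 7 * x - x * y + 17 * x ^ 2 - 8 * x ^ 3
  | 3 => -y + 8 * x + 5 * x * y + 5 * x ^ 2 + 3 * x ^ 2 * y - 9 * x ^ 3
  | 4 => -22 - 25 * y + 38 * x + 38 * x * y - 7 * x ^ 2 - 9 * x ^ 2 * y - 9 * x ^ 3
  | 5 => 6 + 5 * y + x * y - 23 * x ^ 2 - 10 * x ^ 2 * y + 17 * x ^ 3
  | 6 => 14 + 19 * y - 21 * x - 12 * x * y + 27 * x ^ 2 - 13 * x ^ 3
  | 7 => -3 - y - 8 * x - 3 * x * y + 26 * x ^ 2 + 4 * x ^ 2 * y - 15 * x ^ 3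
  | 8 => -8 - 8 * y + 4 * x + 8 * x * y - 3 * x ^ 2 - 5 * x ^ 2 * y + 6 * x ^ 3
  | 9 => -13 - 14 * y + 7 * x + 10 * x * y + 7 * x ^ 2 - 3 * x ^ 3
  | 10 => 5 + 5 * y - 3 * x - 7 * x * y + 17 * x ^ 2 + 13 * x ^ 2 * y - 15 * x ^ 3
  | _ => 0

lemma esix_mul_polyA (hq : ‖q‖ < 1) (h0 : q ≠ 0) (hs : s ^ 11 = q) :
    esix q s * (∑ r ∈ range 11, s ^ r * (hmon q r * polyA (ux q) (uy q) r)) =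
      (4) * lamr₁ q s + (-2) * lamr₂ q s + (1) * lamr₃ q s + (-1) * lamr₄ q s + (-3) * lamc₀ q
        s + (1) * lamc₁ q s + bj q ^ 3 * ((-2) * (-(br q 2 ^ 3 / (br q 1 ^ 3 * br q 3))) + (4) *
        (-(br q 3 ^ 2 / (br q 1 ^ 2 * br q 4))) + (-3) * (-(br q 2 * br q 4 ^ 2 / (br q 1 ^ 2 *
        br q 3 * br q 5))) + (-3) * (-(br q 3 ^ 2 * br q 4 / (br q 1 * br q 2 ^ 2 * br q 5))) +
        (2) * (-(br q 2 * br q 5 / (br q 1 ^ 2 * br q 4)))) := by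
  have hc := ux_uy_curve hq h0
  apply esix_mul hq h0 hs (polyA (ux q) (uy q)) (4) (-2) (1) (-1) (-3) (1) (-2) (4) (-3) (-3) (2)
  all_goals simp only [polyA, uw, uu, uv, uz]
  · linear_combination (1 + 8 * uy q + 11 * uy q ^ 2 + 4 * uy q ^ 3 - ux q - 3 * ux q * uy q - 3 * ux q * uy q ^ 2
      + 2 * ux q * uy q ^ 3 - 24 * ux q ^ 2 - 31 * ux q ^ 2 * uy q - 9 * ux q ^ 2 * uy q ^ 2 -
      ux q ^ 2 * uy q ^ 3 + 51 * ux q ^ 3 + 23 * ux q ^ 3 * uy q + ux q ^ 3 * uy q ^ 2 - 33 * ux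
      q ^ 4 + 3 * ux q ^ 4 * uy q + 6 * ux q ^ 5 - 2 * ux q ^ 5 * uy q) * hc
  · linear_combination (-1 - 3 * uy q + 18 * ux q + 20 * ux q * uy q - 32 * ux q ^ 2 - 15 * ux q ^ 2 * uy q + 15 *
      ux q ^ 3) * hc
  · linear_combination (1 + 2 * uy q - 11 * ux q - 8 * ux q * uy q + 22 * ux q ^ 2 + 13 * ux q ^ 2 * uy q - 13 *
      ux q ^ 3) * hc
  · linear_combination (4 + 8 * uy q + 4 * uy q ^ 2 - 17 * ux q - 31 * ux q * uy q - 11 * ux q * uy q ^ 2 + 14 *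
      ux q ^ 2 - 9 * ux q ^ 2 * uy q ^ 2 + 5 * ux q ^ 3 + 18 * ux q ^ 3 * uy q - 6 * ux q ^ 4) * hc
  · linear_combination (-4 - 6 * uy q + 27 * ux q + 4 * ux q * uy q - 32 * ux q ^ 2 + 2 * ux q ^ 2 * uy q + 9 * ux
      q ^ 3) * hc
  · linear_combination (4 + 3 * uy q - uy q ^ 2 - 6 * ux q - 13 * ux q * uy q - 4 * ux q * uy q ^ 2 + 14 * ux q ^
      2 + 10 * ux q ^ 2 * uy q - 10 * ux q ^ 3) * hc
  · linear_combination (-1 - 3 * uy q - 2 * uy q ^ 2 + 4 * ux q + 11 * ux q * uy q + 3 * ux q * uy q ^ 2 - 8 * ux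
      q ^ 2 - 7 * ux q ^ 2 * uy q + 5 * ux q ^ 3) * hc
  · linear_combination (-4 - 4 * uy q + 4 * ux q + 5 * ux q * uy q + 3 * ux q ^ 2 - 4 * ux q ^ 2 * uy q) * hc
  · linear_combination (-2 - 2 * uy q - 8 * ux q - 5 * ux q * uy q + 8 * ux q ^ 2 + 12 * ux q ^ 2 * uy q + 10 * ux
      q ^ 3) * hc
  · linear_combination (2 + 4 * uy q + 2 * uy q ^ 2 - 3 * ux q - 6 * ux q * uy q - 3 * ux q * uy q ^ 2 - 2 * ux q
      ^ 2 + 3 * ux q ^ 3) * hc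
  · linear_combination (4 - 13 * uy q ^ 2 - 7 * uy q ^ 3 - 24 * ux q - 19 * ux q * uy q + 9 * ux q * uy q ^ 2 + 5
      * ux q * uy q ^ 3 + 57 * ux q ^ 2 + 54 * ux q ^ 2 * uy q + 13 * ux q ^ 2 * uy q ^ 2 - 67 *
      ux q ^ 3 - 53 * ux q ^ 3 * uy q - 11 * ux q ^ 3 * uy q ^ 2 + 39 * ux q ^ 4 + 18 * ux q ^ 4
      * uy q - 9 * ux q ^ 5) * hc

lemma esix_mul_polyB (hq : ‖q‖ < 1) (h0 : q ≠ 0) (hs : s ^ 11 = q) :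
    esix q s * (∑ r ∈ range 11, s ^ r * (hmon q r * polyB (ux q) (uy q) r)) =
      (-1) * lamr₁ q s + (6) * lamr₂ q s + (-3) * lamr₃ q s + (3) * lamr₄ q s + (-3) * lamc₀ q
        s + (1) * lamc₁ q s + bj q ^ 3 * ((1) * (-(br q 2 ^ 3 / (br q 1 ^ 3 * br q 3))) + (0) *
        (-(br q 3 ^ 2 / (br q 1 ^ 2 * br q 4))) + (0) * (-(br q 2 * br q 4 ^ 2 / (br q 1 ^ 2 *
        br q 3 * br q 5))) + (3) * (-(br q 3 ^ 2 * br q 4 / (br q 1 * br q 2 ^ 2 * br q 5))) +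
        (2) * (-(br q 2 * br q 5 / (br q 1 ^ 2 * br q 4)))) := by
  have hc := ux_uy_curve hq h0
  apply esix_mul hq h0 hs (polyB (ux q) (uy q)) (-1) (6) (-3) (3) (-3) (1) (1) (0) (0) (3) (2)
  all_goals simp only [polyB, uw, uu, uv, uz]
  · linear_combination (-1 + 9 * uy q + 19 * uy q ^ 2 + 9 * uy q ^ 3 + 6 * ux q - 24 * ux q * uy q - 37 * ux q *
      uy q ^ 2 - 10 * ux q * uy q ^ 3 - 10 * ux q ^ 2 + 24 * ux q ^ 2 * uy q + 23 * ux q ^ 2 *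
      uy q ^ 2 + 3 * ux q ^ 2 * uy q ^ 3 + ux q ^ 3 - 12 * ux q ^ 3 * uy q - 3 * ux q ^ 3 * uy q
      ^ 2 + 6 * ux q ^ 4 - ux q ^ 4 * uy q - 2 * ux q ^ 5 + ux q ^ 5 * uy q) * hc
  · linear_combination (-1 + 8 * uy q + 7 * ux q - 10 * ux q * uy q + ux q ^ 2 + 8 * ux q ^ 2 * uy q - 7 * ux q ^
      3) * hc
  · linear_combination (1 - 9 * uy q - 11 * uy q ^ 2 - 12 * ux q - 2 * ux q * uy q + 11 * ux q ^ 2 - 7 * ux q ^ 2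
      * uy q + 3 * ux q ^ 3) * hc
  · linear_combination (-1 - 2 * uy q - uy q ^ 2 + 5 * ux q + 11 * ux q * uy q + 9 * ux q * uy q ^ 2 - 6 * ux q ^
      2 - 6 * ux q ^ 2 * uy q + 8 * ux q ^ 2 * uy q ^ 2 - 2 * ux q ^ 3 - 9 * ux q ^ 3 * uy q + 4
      * ux q ^ 4) * hc
  · linear_combination (-2 - 11 * uy q + 6 * ux q + 11 * ux q * uy q + 11 * ux q ^ 2 - 4 * ux q ^ 3) * hc
  · linear_combination (-1 + 19 * uy q + 20 * uy q ^ 2 + 6 * ux q - 5 * ux q * uy q - 8 * ux q * uy q ^ 2 - 3 * ux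
      q ^ 2 - 5 * ux q ^ 2 * uy q + 4 * ux q ^ 3) * hc
  · linear_combination (3 + 9 * uy q + 6 * uy q ^ 2 - 28 * ux q - 26 * ux q * uy q - 9 * ux q * uy q ^ 2 + 11 * ux
      q ^ 2 + 5 * ux q ^ 2 * uy q + 2 * ux q ^ 3) * hc
  · linear_combination (3 - 3 * uy q + 13 * ux q + 11 * ux q * uy q - 16 * ux q ^ 2 + 4 * ux q ^ 2 * uy q - 3 * ux
      q ^ 3) * hc
  · linear_combination (1 + uy q - ux q + 2 * ux q * uy q - 21 * ux q ^ 2 - 19 * ux q ^ 2 * uy q - 4 * ux q ^ 3) * hc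
  · linear_combination (3 * uy q - uy q ^ 2 + ux q + 13 * ux q * uy q + 7 * ux q * uy q ^ 2 + 3 * ux q ^ 2 - 7 *
      ux q ^ 2 * uy q - 4 * ux q ^ 3) * hc
  · linear_combination (2 + 3 * uy q + 6 * uy q ^ 2 - uy q ^ 3 - 10 * ux q - 18 * ux q * uy q - ux q * uy q ^ 2 +
      7 * ux q * uy q ^ 3 + 14 * ux q ^ 2 + 29 * ux q ^ 2 * uy q - 5 * ux q ^ 2 * uy q ^ 2 - 2 *
      ux q ^ 3 - 10 * ux q ^ 3 * uy q + 6 * ux q ^ 3 * uy q ^ 2 - 8 * ux q ^ 4 - 4 * ux q ^ 4 *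
      uy q + 4 * ux q ^ 5) * hc

lemma esix_mul_polyC (hq : ‖q‖ < 1) (h0 : q ≠ 0) (hs : s ^ 11 = q) :
    esix q s * (∑ r ∈ range 11, s ^ r * (hmon q r * polyC (ux q) (uy q) r)) =
      (-2) * lamr₁ q s + (1) * lamr₂ q s + (5) * lamr₃ q s + (-5) * lamr₄ q s + (0) * lamc₀ q
        s + (0) * lamc₁ q s + bj q ^ 3 * ((-1) * (-(br q 2 ^ 3 / (br q 1 ^ 3 * br q 3))) + (5) *
        (-(br q 3 ^ 2 / (br q 1 ^ 2 * br q 4))) + (-1) * (-(br q 2 * br q 4 ^ 2 / (br q 1 ^ 2 *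
        br q 3 * br q 5))) + (-2) * (-(br q 3 ^ 2 * br q 4 / (br q 1 * br q 2 ^ 2 * br q 5))) +
        (0) * (-(br q 2 * br q 5 / (br q 1 ^ 2 * br q 4)))) := by
  have hc := ux_uy_curve hq h0
  apply esix_mul hq h0 hs (polyC (ux q) (uy q)) (-2) (1) (5) (-5) (0) (0) (-1) (5) (-1) (-2) (0)
  all_goals simp only [polyC, uw, uu, uv, uz]
  · linear_combination (-3 - 4 * uy q + uy q ^ 2 + 2 * uy q ^ 3 + 16 * ux q + 29 * ux q * uy q + 15 * ux q * uy q
      ^ 2 + 4 * ux q * uy q ^ 3 - 23 * ux q ^ 2 - 22 * ux q ^ 2 * uy q - 7 * ux q ^ 2 * uy q ^ 2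
      - 5 * ux q ^ 2 * uy q ^ 3 + 13 * ux q ^ 3 - 14 * ux q ^ 3 * uy q - 6 * ux q ^ 3 * uy q ^ 2
      - 2 * ux q ^ 4 + 16 * ux q ^ 4 * uy q - ux q ^ 5 - ux q ^ 5 * uy q) * hc
  · linear_combination (-ux q * uy q - 11 * ux q ^ 2 - 4 * ux q ^ 2 * uy q + 11 * ux q ^ 3) * hc
  · linear_combination (4 * ux q + 20 * ux q * uy q + 11 * ux q * uy q ^ 2 - 11 * ux q ^ 2 - 8 * ux q ^ 2 * uy q +
      2 * ux q ^ 3) * hc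
  · linear_combination (-2 - 4 * uy q - 2 * uy q ^ 2 + 11 * ux q + 19 * ux q * uy q + 8 * ux q * uy q ^ 2 - 19 *
      ux q ^ 2 - 31 * ux q ^ 2 * uy q - 13 * ux q ^ 2 * uy q ^ 2 + 17 * ux q ^ 3 + 20 * ux q ^ 3
      * uy q - 7 * ux q ^ 4) * hc
  · linear_combination (3 + 9 * uy q - 15 * ux q - 6 * ux q * uy q + 4 * ux q ^ 2 - 3 * ux q ^ 2 * uy q - 3 * ux q
      ^ 3) * hc
  · linear_combination (-2 - 9 * uy q - 7 * uy q ^ 2 + 7 * ux q + 12 * ux q * uy q + 5 * ux q * uy q ^ 2 - 9 * ux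
      q ^ 2 - 6 * ux q ^ 2 * uy q - ux q ^ 3) * hc
  · linear_combination (-5 - 15 * uy q - 10 * uy q ^ 2 + 29 * ux q + 49 * ux q * uy q + 15 * ux q * uy q ^ 2 - 32
      * ux q ^ 2 - 26 * ux q ^ 2 * uy q + 12 * ux q ^ 3) * hc
  · linear_combination (5 + 7 * uy q - 25 * ux q - 13 * ux q * uy q + 21 * ux q ^ 2 + ux q ^ 2 * uy q + ux q ^ 3) * hc
  · linear_combination (-1 - uy q + 5 * ux q + 5 * ux q * uy q + 17 * ux q ^ 2 + 14 * ux q ^ 2 * uy q + ux q ^ 3) * hc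
  · linear_combination (-3 - 7 * uy q + uy q ^ 2 + 17 * ux q + ux q * uy q - 7 * ux q * uy q ^ 2 - 31 * ux q ^ 2 -
      5 * ux q ^ 2 * uy q + 17 * ux q ^ 3) * hc
  · linear_combination (-3 - 12 * uy q - 10 * uy q ^ 2 - 2 * uy q ^ 3 + 21 * ux q + 29 * ux q * uy q - 4 * ux q *
      uy q ^ 2 - 8 * ux q * uy q ^ 3 - 48 * ux q ^ 2 - 32 * ux q ^ 2 * uy q + 6 * ux q ^ 2 * uy
      q ^ 2 + 48 * ux q ^ 3 + 15 * ux q ^ 3 * uy q - 2 * ux q ^ 3 * uy q ^ 2 - 21 * ux q ^ 4 + 3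
      * ux q ^ 5) * hc

lemma esix_mul_polyD (hq : ‖q‖ < 1) (h0 : q ≠ 0) (hs : s ^ 11 = q) :
    esix q s * (∑ r ∈ range 11, s ^ r * (hmon q r * polyD (ux q) (uy q) r)) =
      (-3) * lamr₁ q s + (-4) * lamr₂ q s + (2) * lamr₃ q s + (9) * lamr₄ q s + (3) * lamc₀ q
        s + (-1) * lamc₁ q s + bj q ^ 3 * ((8) * (-(br q 2 ^ 3 / (br q 1 ^ 3 * br q 3))) + (-12)
        * (-(br q 3 ^ 2 / (br q 1 ^ 2 * br q 4))) + (-2) * (-(br q 2 * br q 4 ^ 2 / (br q 1 ^ 2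
        * br q 3 * br q 5))) + (4) * (-(br q 3 ^ 2 * br q 4 / (br q 1 * br q 2 ^ 2 * br q 5))) +
        (-2) * (-(br q 2 * br q 5 / (br q 1 ^ 2 * br q 4)))) := by
  have hc := ux_uy_curve hq h0
  apply esix_mul hq h0 hs (polyD (ux q) (uy q)) (-3) (-4) (2) (9) (3) (-1) (8) (-12) (-2) (4) (-2)
  all_goals simp only [polyD, uw, uu, uv, uz]
  · linear_combination (-5 - 17 * uy q - 17 * uy q ^ 2 - 5 * uy q ^ 3 + 15 * ux q + 27 * ux q * uy q + ux q * uy q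
      ^ 2 - 15 * ux q * uy q ^ 3 - 25 * ux q ^ 2 - 57 * ux q ^ 2 * uy q - 15 * ux q ^ 2 * uy q ^
      2 + 9 * ux q ^ 2 * uy q ^ 3 + 36 * ux q ^ 3 + 105 * ux q ^ 3 * uy q + 24 * ux q ^ 3 * uy q
      ^ 2 - 32 * ux q ^ 4 - 66 * ux q ^ 4 * uy q + 11 * ux q ^ 5 + 8 * ux q ^ 5 * uy q) * hc
  · linear_combination (-10 - 19 * uy q + 15 * ux q + 8 * ux q * uy q - ux q ^ 2 + 6 * ux q ^ 2 * uy q - 4 * ux q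
      ^ 3) * hc
  · linear_combination (10 + 20 * uy q + 11 * uy q ^ 2 - 46 * ux q - 57 * ux q * uy q - 11 * ux q * uy q ^ 2 + 44
      * ux q ^ 2 + 24 * ux q ^ 2 * uy q - 10 * ux q ^ 3) * hc
  · linear_combination (-3 - 6 * uy q - 3 * uy q ^ 2 - 5 * ux q - 17 * ux q * uy q - 15 * ux q * uy q ^ 2 + 34 *
      ux q ^ 2 + 65 * ux q ^ 2 * uy q + 21 * ux q ^ 2 * uy q ^ 2 - 41 * ux q ^ 3 - 39 * ux q ^ 3
      * uy q + 15 * ux q ^ 4) * hc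
  · linear_combination (-3 - 4 * uy q + 8 * ux q + 10 * ux q * uy q - 14 * ux q ^ 2 + 5 * ux q ^ 2 * uy q + 9 * ux
      q ^ 3) * hc
  · linear_combination (-14 + 7 * uy q + 21 * uy q ^ 2 + 8 * ux q - 15 * ux q * uy q - 26 * ux q * uy q ^ 2 - 4 *
      ux q ^ 2 + 4 * ux q ^ 2 * uy q + 5 * ux q ^ 3) * hc
  · linear_combination (9 + 27 * uy q + 18 * uy q ^ 2 - 35 * ux q - 74 * ux q * uy q - 27 * ux q * uy q ^ 2 + 68 *
      ux q ^ 2 + 42 * ux q ^ 2 * uy q - 33 * ux q ^ 3) * hc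
  · linear_combination (7 + 6 * uy q - 19 * ux q - 15 * ux q * uy q + 3 * ux q ^ 2 - 2 * ux q ^ 2 * uy q + 5 * ux
      q ^ 3) * hc
  · linear_combination (8 + 8 * uy q - 3 * ux q * uy q - 11 * ux q ^ 2 - 19 * ux q ^ 2 * uy q - 5 * ux q ^ 3) * hc
  · linear_combination (-6 - 6 * uy q + 3 * uy q ^ 2 - 11 * ux q * uy q + ux q * uy q ^ 2 + 23 * ux q ^ 2 + 19 *
      ux q ^ 2 * uy q - 17 * ux q ^ 3) * hc
  · linear_combination (-8 + 6 * uy q + 29 * uy q ^ 2 + 19 * uy q ^ 3 + 19 * ux q - ux q * uy q - 29 * ux q * uy q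
      ^ 2 - 12 * ux q * uy q ^ 3 + 6 * ux q ^ 2 * uy q + 17 * ux q ^ 2 * uy q ^ 2 - 34 * ux q ^
      3 - 26 * ux q ^ 3 * uy q - 10 * ux q ^ 3 * uy q ^ 2 + 32 * ux q ^ 4 + 15 * ux q ^ 4 * uy q
      - 9 * ux q ^ 5) * hc

end
end RankCrank

namespace RankCrank
open Filter Topology Finset
section
variable {q : ℂ}

lemma hmon_zero_polyA (hq : ‖q‖ < 1) (h0 : q ≠ 0) :
    hmon q 0 * polyA (ux q) (uy q) 0 = 11 * (q ^ 2 * bj q ^ 14 /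
      (br q 1 ^ 2 * br q 2 ^ 3 * br q 3 ^ 2 * br q 4 ^ 3 * br q 5 ^ 3)) := by
  obtain ⟨h1, h2, h3, h4, h5⟩ := br_ne_zero_all hq h0
  have e : polyA (ux q) (uy q) 0 = -11 * (ux q * uw q) := by simp only [polyA, uw]; ring
  rw [e, uw_eq hq h0, ux, hmon]
  field_simp

lemma hmon_zero_polyB (hq : ‖q‖ < 1) (h0 : q ≠ 0) :
    hmon q 0 * polyB (ux q) (uy q) 0 = 11 * (q * bj q ^ 14 /
      (br q 1 ^ 2 * br q 2 ^ 4 * br q 3 ^ 4 * br q 4 ^ 2 * br q 5)) := by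
  obtain ⟨h1, h2, h3, h4, h5⟩ := br_ne_zero_all hq h0
  have hv : uv q ≠ 0 := by rw [uv_eq hq h0]; positivity
  have e : polyB (ux q) (uy q) 0 = 11 * (ux q * uy q * uw q / uv q) := by
    rw [mul_div_assoc', eq_div_iff hv]
    simp only [polyB, uw, uv]
    linear_combination -11 * ux_uy_curve hq h0
  rw [e, uw_eq hq h0, uv_eq hq h0, ux, uy, hmon]
  field_simp

lemma hmon_zero_polyC (hq : ‖q‖ < 1) (h0 : q ≠ 0) :
    hmon q 0 * polyC (ux q) (uy q) 0 = 11 * (q ^ 2 * bj q ^ 14 /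
      (br q 1 ^ 2 * br q 2 ^ 2 * br q 3 ^ 4 * br q 4 ^ 3 * br q 5 ^ 2)) := by
  obtain ⟨h1, h2, h3, h4, h5⟩ := br_ne_zero_all hq h0
  have hv : uv q ≠ 0 := by rw [uv_eq hq h0]; positivity
  have e : polyC (ux q) (uy q) 0 = 11 * (ux q ^ 2 * uw q ^ 2 / uv q) := by
    rw [mul_div_assoc', eq_div_iff hv]
    simp only [polyC, uw, uv]
    linear_combination 11 * ux q * ux_uy_curve hq h0
  rw [e, uw_eq hq h0, uv_eq hq h0, ux, hmon]
  field_simp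

lemma hmon_zero_polyD (hq : ‖q‖ < 1) (h0 : q ≠ 0) :
    hmon q 0 * polyD (ux q) (uy q) 0 = 11 * (q ^ 3 * bj q ^ 14 /
      (br q 1 ^ 2 * br q 2 * br q 3 ^ 2 * br q 4 ^ 4 * br q 5 ^ 4)) := by
  obtain ⟨h1, h2, h3, h4, h5⟩ := br_ne_zero_all hq h0
  have e : polyD (ux q) (uy q) 0 = 11 * (uw q * uu q) := by simp only [polyD, uw, uu]; ring
  rw [e, uw_eq hq h0, uu_eq hq h0, hmon]
  field_simp

end
end RankCrank

namespace RankCrank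
open Filter Topology Finset
section
variable {s : ℂ}

lemma norm_prod_one_sub_pow_le (hs : ‖s‖ < 1) (k n : ℕ) :
    ‖∏ i ∈ range n, (1 - s ^ (k + i + 1))‖ ≤ Real.exp (1 - ‖s‖)⁻¹ := by
  rw [norm_prod]
  calc ∏ i ∈ range n, ‖1 - s ^ (k + i + 1)‖ ≤ ∏ i ∈ range n, Real.exp (‖s‖ ^ i) := by
        refine prod_le_prod (fun _ _ => norm_nonneg _) fun i _ => ?_
        have h1 : ‖s ^ (k + i + 1)‖ ≤ ‖s‖ ^ i := by
          rw [norm_pow]; exact pow_le_pow_of_le_one (norm_nonneg _) hs.le (by omega)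
        have h2 := norm_sub_le (1 : ℂ) (s ^ (k + i + 1))
        rw [norm_one] at h2
        linarith [Real.add_one_le_exp (‖s‖ ^ i)]
    _ = Real.exp (∑ i ∈ range n, ‖s‖ ^ i) := (Real.exp_sum _ _).symm
    _ ≤ Real.exp (1 - ‖s‖)⁻¹ := by
        rw [← tsum_geometric_of_lt_one (norm_nonneg _) hs]
        exact Real.exp_le_exp.mpr ((summable_geometric_of_lt_one (norm_nonneg _) hs).sum_le_tsum _
          fun i _ => by positivity)

lemma ths_pentagonal (hs : ‖s‖ < 1) (h0 : s ≠ 0) : ths (s ^ 3) (-s⁻¹) = qp s s := by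
  have hP : ‖s ^ 3‖ < 1 := by rw [norm_pow]; exact pow_lt_one₀ (norm_nonneg _) hs (by norm_num)
  have hsum := (thc_summable hP (pow_ne_zero 3 h0) (w := -s⁻¹)
    (neg_ne_zero.mpr (inv_ne_zero h0))).of_norm
  have hterm (n : ℤ) : thc (s ^ 3) (-s⁻¹) n = (-1) ^ n * s ^ pentagonal (-n) := by
    have e : ((pentagonal (-n) : ℕ) : ℤ) = 3 * (n * (n + 1) / 2) - n := by
      have h2 := Int.even_mul_succ_self n
      obtain ⟨m, hm⟩ := h2
      rw [pentagonal_neg, Int.toNat_of_nonneg (by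
        apply Int.ediv_nonneg _ (by norm_num)
        rcases le_or_gt 0 n with h | h
        · positivity
        · nlinarith), hm, show n * (3 * n + 1) = (3 * m - n) * 2 by linarith, ← two_mul]
      omega
    rw [thc, ← zpow_natCast s (pentagonal (-n)), e, ← zpow_natCast s 3, ← zpow_mul,
      neg_eq_neg_one_mul, mul_zpow, zpow_sub₀ h0, inv_zpow]
    push_cast
    ring
  have hcomp : Summable fun k : ℕ => (-1 : ℂ) ^ k * (s ^ pentagonal (-k) - s ^ pentagonal (k + 1)) := by
    have h1 := hsum.comp_injective (Nat.cast_injective (R := ℤ))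
    have h2 := hsum.comp_injective (i := fun k : ℕ => (-((k : ℤ) + 1))) (fun a b h => by simpa using h)
    refine (h1.add h2).congr fun k => ?_
    simp only [Function.comp, hterm, neg_neg]
    rw [zpow_neg, ← inv_zpow, inv_neg_one, zpow_add_one₀ (by norm_num), zpow_natCast]
    ring
  have hbound (k n : ℕ) : ‖s ^ ((k + 1) * n) * ∏ i ∈ range (n + 1), (1 - s ^ (k + i + 1))‖ ≤
      ‖s‖ ^ n * Real.exp (1 - ‖s‖)⁻¹ := by
    rw [norm_mul, norm_pow]
    exact mul_le_mul (pow_le_pow_of_le_one (norm_nonneg _) hs.le (by nlinarith))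
      (norm_prod_one_sub_pow_le hs k _) (norm_nonneg _) (by positivity)
  have hgeo : Summable fun n : ℕ => ‖s‖ ^ n * Real.exp (1 - ‖s‖)⁻¹ :=
    (summable_geometric_of_lt_one (norm_nonneg _) hs).mul_right _
  have key := Pentagonal.tprod_one_sub_pow (x := s) (tendsto_pow_atTop_nhds_zero_of_norm_lt_one hs)
    (fun k => .of_norm_bounded hgeo (hbound k)) (fun k => ?_) hcomp ?_
  · have e1 : qp s s = ∏' n : ℕ, (1 - s ^ (n + 1)) := by
      simp only [qp, pow_succ']
    have h1 := hsum.comp_injective (Nat.cast_injective (R := ℤ))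
    have h2 := hsum.comp_injective (i := fun k : ℕ => (-((k : ℤ) + 1))) (fun a b h => by simpa using h)
    rw [e1, key, ths, (h1.hasSum.of_nat_of_neg_add_one h2.hasSum).tsum_eq, ← h1.tsum_add h2]
    refine tsum_congr fun k => ?_
    simp only [Function.comp, hterm, neg_neg]
    rw [zpow_neg, ← inv_zpow, inv_neg_one, zpow_add_one₀ (by norm_num), zpow_natCast]
    ring
  · simpa [pow_succ', pow_add, mul_assoc, mul_comm, mul_left_comm] using
      qp_multipliable hs (s ^ (k + 1))
  · refine squeeze_zero_norm (a := fun k : ℕ => ‖s‖ ^ k * ∑' n : ℕ, ‖s‖ ^ n * Real.exp (1 - ‖s‖)⁻¹)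
      (fun k => ?_) ?_
    · rw [norm_mul, norm_mul, norm_pow, norm_neg, norm_one, one_pow, one_mul, norm_pow]
      refine mul_le_mul (pow_le_pow_of_le_one (norm_nonneg _) hs.le ?_)
        (tsum_of_norm_bounded hgeo.hasSum (hbound k)) (norm_nonneg _) (by positivity)
      rw [Nat.le_div_iff_mul_le two_pos]; nlinarith
    · simpa using (tendsto_pow_atTop_nhds_zero_of_lt_one (norm_nonneg _) hs).mul_const
        (∑' n : ℕ, ‖s‖ ^ n * Real.exp (1 - ‖s‖)⁻¹)

end
end RankCrank

namespace RankCrank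
open Filter Topology Finset
section
variable {q P w : ℂ}

lemma tsum_eq_sum_residues {f : ℤ → ℂ} (hf : Summable f) :
    ∑' n, f n = ∑ b ∈ range 11, ∑' m : ℤ, f (11 * m + b) := by
  have hinj (b : ℤ) : Function.Injective fun m : ℤ => 11 * m + b := fun x y h => by
    simp only at h; omega
  have h := ((Int.divModEquiv 11).symm.summable_iff.mpr hf).tsum_prod
  rw [Function.comp_def, Equiv.tsum_eq] at h
  rw [h]
  simp only [Int.divModEquiv_symm_apply, tsum_fintype]
  rw [Summable.tsum_finsetSum, ← Fin.sum_univ_eq_sum_range (fun b => ∑' m : ℤ, f (11 * m + b))]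
  · push_cast; simp only [mul_comm]
  · intro b _
    have := hf.comp_injective (hinj b)
    push_cast
    simpa only [Function.comp_def, mul_comm] using this

lemma tsum_residue_periodic (f : ℤ → ℂ) (b : ℤ) :
    ∑' m : ℤ, f (11 * m + (b + 11)) = ∑' m : ℤ, f (11 * m + b) := by
  rw [← (Equiv.addRight (1 : ℤ)).tsum_eq fun m : ℤ => f (11 * m + b)]
  refine tsum_congr fun m => ?_
  simp only [Equiv.coe_addRight]
  ring_nf

lemma tsum_eq_centred {f : ℤ → ℂ} (hf : Summable f) (b : ℤ) {g : ℤ → ℂ}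
    (hg : ∀ b, ∑' m : ℤ, f (11 * m + b) = g b) :
    ∑' n, f n = g b + (g (b + 1) + g (b - 1)) + (g (b + 2) + g (b - 2)) + (g (b + 3) + g (b - 3))
      + (g (b + 4) + g (b - 4)) + (g (b + 5) + g (b - 5)) := by
  have h := tsum_eq_sum_residues ((Equiv.addRight (b - 5)).summable_iff.mpr hf)
  rw [Function.comp_def, (Equiv.addRight (b - 5)).tsum_eq] at h
  rw [h]
  simp only [Equiv.coe_addRight, add_assoc, hg, sum_range_succ, sum_range_zero]
  push_cast
  ring_nf

lemma thc_eleven_mul (hP : P ≠ 0) (hw : w ≠ 0) (b m : ℤ) :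
    thc P w (11 * m + b) =
      thc P w b * thc (P ^ 121) (w ^ 11 * P ^ (11 * (b - 5))) m := by
  have e : (11 * m + b) * (11 * m + b + 1) / 2 =
      b * (b + 1) / 2 + (121 * (m * (m + 1) / 2) + 11 * (b - 5) * m) := by
    obtain ⟨u, hu⟩ := Int.even_mul_succ_self b
    obtain ⟨v, hv⟩ := Int.even_mul_succ_self m
    have : (11 * m + b) * (11 * m + b + 1) = (u + 121 * v + 11 * (b - 5) * m) * 2 := by
      linear_combination hu + 121 * hv
    rw [this, hu, hv, Int.mul_ediv_cancel _ two_ne_zero]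
    have h1 : (u + u) / 2 = u := by omega
    have h2 : (v + v) / 2 = v := by omega
    rw [h1, h2]; ring
  rw [thc, thc, thc, e, zpow_add₀ hw, zpow_add₀ hP, zpow_add₀ hP, mul_zpow, ← zpow_natCast w 11,
    ← zpow_natCast P 121, ← zpow_mul, ← zpow_mul, ← zpow_mul]
  push_cast
  ring

lemma al_residue (hP : P ≠ 0) (hw : w ≠ 0) (h0 : q ≠ 0) (b : ℤ) :
    ∑' m : ℤ, thc P w (11 * m + b) / (1 - 1 * q ^ (11 * m + b)) =
      thc P w b * al (q ^ 11) (thc (P ^ 121) (w ^ 11 * P ^ (11 * (b - 5)))) (q ^ b) := by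
  rw [al, ← tsum_mul_left]
  refine tsum_congr fun m => ?_
  have e : q ^ (11 * m + b) = q ^ b * (q ^ 11) ^ m := by
    rw [zpow_add₀ h0, zpow_mul, mul_comm]; rfl
  rw [thc_eleven_mul hP hw, e, one_mul, mul_div_assoc]

end
end RankCrank

namespace RankCrank
open Filter Topology Finset
section
variable {q s : ℂ}

lemma thc_pow_neg_zpow (h0 : s ≠ 0) (d : ℕ) (k n : ℤ) :
    thc (s ^ d) (-s ^ k) n = (-1) ^ n * s ^ (k * n + d * (n * (n + 1) / 2)) := by
  rw [thc, neg_eq_neg_one_mul, mul_zpow, zpow_add₀ h0, ← zpow_mul, ← zpow_natCast s d, ← zpow_mul]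
  ring

lemma thc_centred (h0 : s ≠ 0) (hs : s ^ 11 = q) (d : ℕ) (k b c : ℤ)
    (hk : 2 * k + d * (2 * b + 1) = 11 * d) :
    thc (s ^ d) (-s ^ k) (b + c) = (q ^ c) ^ d * thc (s ^ d) (-s ^ k) (b - c) := by
  have e : (b + c) * (b + c + 1) / 2 = (b - c) * (b - c + 1) / 2 + (2 * b + 1) * c := by
    rw [show (b + c) * (b + c + 1) = (b - c) * (b - c + 1) + (2 * b + 1) * c * 2 by ring,
      Int.add_mul_ediv_right _ _ two_ne_zero]
  have e1 : (-1 : ℂ) ^ (b + c) = (-1) ^ (b - c) := by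
    rw [show b + c = b - c + 2 * c by ring, zpow_add₀ (by norm_num), zpow_mul]; simp
  rw [thc_pow_neg_zpow h0, thc_pow_neg_zpow h0, e, e1, ← hs, ← zpow_natCast s 11, ← zpow_mul,
    ← zpow_natCast (s ^ _) d, ← zpow_mul, mul_left_comm, ← zpow_add₀ h0]
  congr 2
  push_cast
  linear_combination c * hk

lemma thc_modulus (h0 : s ≠ 0) (hs : s ^ 11 = q) (d : ℕ) (k b b' : ℤ) (hk : k + d * (b - 5) = 0) :
    (-s ^ k) ^ 11 * (s ^ d) ^ (11 * (b' - 5)) = -q ^ (d * (b' - b)) := by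
  rw [Odd.neg_pow (by decide), ← zpow_natCast s d, ← zpow_natCast (s ^ k) 11, ← zpow_mul, ← zpow_mul,
    ← hs, ← zpow_natCast s 11, ← zpow_mul, neg_mul, ← zpow_add₀ h0]
  congr 2
  push_cast
  linear_combination 11 * hk

/-- A residue class of the dissected Appell sum of level `d` centred at `b`. -/
noncomputable def alres (d : ℕ) (b : ℤ) (q s : ℂ) (b' : ℤ) : ℂ :=
  thc (s ^ d) (-s ^ (d * (5 - b))) b' *
    al (q ^ 11) (thc ((q ^ 11) ^ d) (-q ^ (d * (b' - b)))) (q ^ b')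

lemma tsum_eq_alres (h0 : s ≠ 0) (hs : s ^ 11 = q) (d : ℕ) (b b' : ℤ) :
    ∑' m : ℤ, thc (s ^ d) (-s ^ (d * (5 - b))) (11 * m + b') / (1 - 1 * q ^ (11 * m + b')) =
      alres d b q s b' := by
  have hq0 : q ≠ 0 := by rw [← hs]; exact pow_ne_zero _ h0
  rw [al_residue (pow_ne_zero _ h0) (neg_ne_zero.mpr (zpow_ne_zero _ h0)) hq0,
    thc_modulus h0 hs d _ b b' (by ring), alres, ← hs]
  congr 3
  ring

lemma alres_periodic (h0 : s ≠ 0) (hs : s ^ 11 = q) (d : ℕ) (b b' : ℤ) :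
    alres d b q s (b' + 11) = alres d b q s b' := by
  rw [← tsum_eq_alres h0 hs, ← tsum_eq_alres h0 hs]
  exact tsum_residue_periodic (fun n => thc (s ^ d) (-s ^ (d * (5 - b))) n / (1 - 1 * q ^ n)) b'

lemma al_eq_alres (hn : ‖s‖ < 1) (h0 : s ≠ 0) (hs : s ^ 11 = q) {d : ℕ} (hd : d ≠ 0) (b : ℤ) :
    al q (thc (s ^ d) (-s ^ (d * (5 - b)))) 1 = alres d b q s b
      + (alres d b q s (b + 1) + alres d b q s (b - 1))
      + (alres d b q s (b + 2) + alres d b q s (b - 2))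
      + (alres d b q s (b + 3) + alres d b q s (b - 3))
      + (alres d b q s (b + 4) + alres d b q s (b - 4))
      + (alres d b q s (b + 5) + alres d b q s (b - 5)) := by
  have hq0 : q ≠ 0 := by rw [← hs]; exact pow_ne_zero _ h0
  have hq : ‖q‖ < 1 := by
    rw [← hs, norm_pow]; exact pow_lt_one₀ (norm_nonneg _) hn (by norm_num)
  refine tsum_eq_centred (al_summable hq hq0 (thc_summable ?_ (pow_ne_zero _ h0)
    (neg_ne_zero.mpr (zpow_ne_zero _ h0))) one_ne_zero) b (tsum_eq_alres h0 hs d b)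
  rw [norm_pow]; exact pow_lt_one₀ (norm_nonneg _) hn hd

lemma alres_three_pair (hq : ‖q‖ < 1) (h0 : s ≠ 0) (hs : s ^ 11 = q) {b c : ℤ}
    (hc : ¬ (11 : ℤ) ∣ c) (hb : ¬ (11 : ℤ) ∣ b) (hbc : ¬ (11 : ℤ) ∣ b + c)
    (hbc' : ¬ (11 : ℤ) ∣ b - c) :
    alres 3 b q s (b + c) + alres 3 b q s (b - c) = thc (s ^ 3) (-s ^ (3 * (5 - b))) (b - c) *
      (q ^ c * (br q (2 * c) / br q c) * al (q ^ 11) (thc ((q ^ 11) ^ 3) (-1)) (q ^ b) +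
        bj q ^ 3 * (br q c * br q (2 * c) / (br q b * br q (b + c) * br q (b - c)))) := by
  have hq0 : q ≠ 0 := by rw [← hs]; exact pow_ne_zero _ h0
  have hz (n : ℤ) : q ^ n ≠ 0 := zpow_ne_zero _ hq0
  have e2 : q ^ (2 * c) = (q ^ c) ^ 2 := by rw [mul_comm, zpow_mul]; rfl
  have e3 : q ^ (3 * c) = (q ^ c) ^ 3 := by rw [mul_comm, zpow_mul]; rfl
  have ep : q ^ (b + c) = q ^ c * q ^ b := by rw [add_comm, zpow_add₀ hq0]
  have em : q ^ (b - c) = (q ^ c)⁻¹ * q ^ b := by rw [sub_eq_neg_add, zpow_add₀ hq0, zpow_neg]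
  have h2 := gen_zpow hq hq0 (n := 2 * c) (by omega)
  rw [e2] at h2
  have key := (al_triple_aux (norm_pow_eleven hq) (pow_ne_zero 11 hq0) (hz c) (gen_zpow hq hq0 hc)
    h2).1 (q ^ b) (hz b) (gen_zpow hq hq0 hb) (ep ▸ gen_zpow hq hq0 hbc) (em ▸ gen_zpow hq hq0 hbc')
  have ez : q ^ (3 * (b - c - b)) = (q ^ c)⁻¹ ^ 3 := by
    rw [show 3 * (b - c - b) = -(3 * c) by ring, zpow_neg, e3, inv_pow]
  have ez' : q ^ (3 * (b + c - b)) = (q ^ c) ^ 3 := by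
    rw [show 3 * (b + c - b) = 3 * c by ring, e3]
  simp only [alres, br, bj, Nat.cast_ofNat]
  rw [thc_centred h0 hs 3 _ b c (by push_cast; ring), ez, ez', e2, ep, em]
  linear_combination thc (s ^ 3) (-s ^ (3 * (5 - b))) (b - c) * key

lemma alres_three_pole (hq : ‖q‖ < 1) (h0 : s ≠ 0) (hs : s ^ 11 = q) {c : ℤ}
    (hc : ¬ (11 : ℤ) ∣ c) :
    alres 3 c q s (c + c) + alres 3 c q s (c - c) =
      q ^ c * (br q (2 * c) / br q c) * al (q ^ 11) (thc ((q ^ 11) ^ 3) (-1)) (q ^ c) +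
        (rh (q ^ 11) (q ^ c) + rh (q ^ 11) (q ^ (2 * c))) := by
  have hq0 : q ≠ 0 := by rw [← hs]; exact pow_ne_zero _ h0
  have e2 : q ^ (2 * c) = (q ^ c) ^ 2 := by rw [mul_comm, zpow_mul]; rfl
  have e3 : q ^ (3 * c) = (q ^ c) ^ 3 := by rw [mul_comm, zpow_mul]; rfl
  have h2 := gen_zpow hq hq0 (n := 2 * c) (by omega)
  rw [e2] at h2
  have key := al_triple_pole (norm_pow_eleven hq) (pow_ne_zero 11 hq0) (zpow_ne_zero c hq0)
    (gen_zpow hq hq0 hc) h2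
  have ez : q ^ (3 * (c - c - c)) = (q ^ c)⁻¹ ^ 3 := by
    rw [show 3 * (c - c - c) = -(3 * c) by ring, zpow_neg, e3, inv_pow]
  have ez' : q ^ (3 * (c + c - c)) = (q ^ c) ^ 3 := by
    rw [show 3 * (c + c - c) = 3 * c by ring, e3]
  simp only [alres, br, Nat.cast_ofNat]
  rw [thc_centred h0 hs 3 _ c c (by push_cast; ring), ez, ez', sub_self, thc_zero, zpow_zero,
    ← two_mul, e2]
  linear_combination key

lemma alres_one_pair (hq : ‖q‖ < 1) (h0 : s ≠ 0) (hs : s ^ 11 = q) {b c : ℤ}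
    (hc : ¬ (11 : ℤ) ∣ c) (hb : ¬ (11 : ℤ) ∣ b) (hbc : ¬ (11 : ℤ) ∣ b + c)
    (hbc' : ¬ (11 : ℤ) ∣ b - c) :
    alres 1 b q s (b + c) + alres 1 b q s (b - c) = thc (s ^ 1) (-s ^ (1 * (5 - b))) (b - c) *
      (bj q ^ 3 * (br q b * br q (2 * c) / (br q c * br q (b + c) * br q (b - c)))) := by
  have hq0 : q ≠ 0 := by rw [← hs]; exact pow_ne_zero _ h0
  have hz (n : ℤ) : q ^ n ≠ 0 := zpow_ne_zero _ hq0
  have e2 : q ^ (2 * c) = (q ^ c) ^ 2 := by rw [mul_comm, zpow_mul]; rfl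
  have ep : q ^ (b + c) = q ^ c * q ^ b := by rw [add_comm, zpow_add₀ hq0]
  have em : q ^ (b - c) = (q ^ c)⁻¹ * q ^ b := by rw [sub_eq_neg_add, zpow_add₀ hq0, zpow_neg]
  have h2 := gen_zpow hq hq0 (n := 2 * c) (by omega)
  rw [e2] at h2
  have key := al_pair_eq (norm_pow_eleven hq) (pow_ne_zero 11 hq0) (hz c) (gen_zpow hq hq0 hc)
    h2 (hz b) (ep ▸ gen_zpow hq hq0 hbc) (em ▸ gen_zpow hq hq0 hbc')
  have ez : q ^ (1 * (b - c - b)) = (q ^ c)⁻¹ := by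
    rw [show 1 * (b - c - b) = -c by ring, zpow_neg]
  have ez' : q ^ (1 * (b + c - b)) = q ^ c := by
    rw [show 1 * (b + c - b) = c by ring]
  simp only [alres, br, bj, Nat.cast_one]
  rw [thc_centred h0 hs 1 _ b c (by push_cast; ring), ez, ez', e2, ep, em, pow_one (q ^ 11)]
  linear_combination thc (s ^ 1) (-s ^ (1 * (5 - b))) (b - c) * key

lemma alres_one_pole (hq : ‖q‖ < 1) (h0 : s ≠ 0) (hs : s ^ 11 = q) {c : ℤ}
    (hc : ¬ (11 : ℤ) ∣ c) :
    alres 1 c q s (c + c) + alres 1 c q s (c - c) =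
      rh (q ^ 11) (q ^ (2 * c)) - rh (q ^ 11) (q ^ c) := by
  have hq0 : q ≠ 0 := by rw [← hs]; exact pow_ne_zero _ h0
  have e2 : q ^ (2 * c) = (q ^ c) ^ 2 := by rw [mul_comm, zpow_mul]; rfl
  have h2 := gen_zpow hq hq0 (n := 2 * c) (by omega)
  rw [e2] at h2
  have key := al_pair_pole (norm_pow_eleven hq) (pow_ne_zero 11 hq0) (zpow_ne_zero c hq0)
    (gen_zpow hq hq0 hc) h2
  have ez : q ^ (1 * (c - c - c)) = (q ^ c)⁻¹ := by
    rw [show 1 * (c - c - c) = -c by ring, zpow_neg]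
  have ez' : q ^ (1 * (c + c - c)) = q ^ c := by
    rw [show 1 * (c + c - c) = c by ring]
  simp only [alres, Nat.cast_one]
  rw [thc_centred h0 hs 1 _ c c (by push_cast; ring), ez, ez', sub_self, thc_zero, zpow_zero,
    ← two_mul, e2, pow_one (q ^ 11)]
  linear_combination key

lemma alres_one_centre (hq : ‖q‖ < 1) (h0 : q ≠ 0) {b : ℤ} (hb : ¬ (11 : ℤ) ∣ b) :
    alres 1 b q s b = thc (s ^ 1) (-s ^ (1 * (5 - b))) b * (bj q ^ 3 / br q b) := by
  have key := al_one_eq (norm_pow_eleven hq) (pow_ne_zero 11 h0) (zpow_ne_zero b h0)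
    (gen_zpow hq h0 hb)
  simp only [alres, br, bj, Nat.cast_one, sub_self, mul_zero, zpow_zero, pow_one, key]

end
end RankCrank

namespace RankCrank
open Filter Topology Finset
section
variable {q s P w : ℂ}

lemma ths_reflect (hP : P ≠ 0) : ths P (w⁻¹ * P⁻¹) = ths P w := by
  rw [ths, ths, ← (Equiv.neg ℤ).tsum_eq (thc P w)]
  refine tsum_congr fun n => ?_
  have e : -n * (-n + 1) / 2 = n * (n + 1) / 2 + -n := by
    rw [show -n * (-n + 1) = n * (n + 1) + -n * 2 by ring, Int.add_mul_ediv_right _ _ two_ne_zero]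
  rw [Equiv.neg_apply, thc, thc, e, zpow_add₀ hP, mul_zpow, inv_zpow, inv_zpow, zpow_neg, zpow_neg]
  ring

lemma ths_pentagonal_reflect (hs : ‖s‖ < 1) (h0 : s ≠ 0) :
    ths (s ^ 3) (-1 * s ^ (-2 : ℤ)) = qp s s := by
  rw [← ths_pentagonal hs h0, ← ths_reflect (pow_ne_zero 3 h0)]
  congr 1
  rw [zpow_neg, show s ^ (2 : ℤ) = s ^ 2 from rfl]
  field_simp

/-- A residue class of the dissected pentagonal series. -/
noncomputable def pentres (q s : ℂ) (b : ℤ) : ℂ :=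
  thc (s ^ 3) (-s ^ (-1 : ℤ)) b * ths ((q ^ 11) ^ 3) (-q ^ (3 * (b + 2)) * (q ^ 11) ^ (-2 : ℤ))

lemma tsum_eq_pentres (h0 : s ≠ 0) (hs : s ^ 11 = q) (b : ℤ) :
    ∑' m : ℤ, thc (s ^ 3) (-s ^ (-1 : ℤ)) (11 * m + b) = pentres q s b := by
  have e : (-s ^ (-1 : ℤ)) ^ 11 * (s ^ 3) ^ (11 * (b - 5)) =
      -q ^ (3 * (b + 2)) * (q ^ 11) ^ (-2 : ℤ) := by
    rw [Odd.neg_pow (by decide), ← hs, ← zpow_natCast (s ^ 11) 11, ← zpow_natCast s 3,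
      ← zpow_natCast s 11, ← zpow_natCast (s ^ (-1 : ℤ)) 11, ← zpow_mul, ← zpow_mul, ← zpow_mul,
      ← zpow_mul, ← zpow_mul, neg_mul, ← zpow_add₀ h0,
      neg_mul (s ^ _) (s ^ _), ← zpow_add₀ h0]
    congr 2
    push_cast
    ring
  rw [pentres, ths, ← tsum_mul_left, ← e]
  refine tsum_congr fun m => ?_
  rw [thc_eleven_mul (pow_ne_zero _ h0) (neg_ne_zero.mpr (zpow_ne_zero _ h0)), ← hs]
  congr 2
  ring

lemma pentres_pair (hq : ‖q‖ < 1) (h0 : s ≠ 0) (hs : s ^ 11 = q) {c : ℤ} (hc : ¬ (11 : ℤ) ∣ c) :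
    pentres q s (-2 + c) + pentres q s (-2 - c) =
      thc (s ^ 3) (-s ^ (-1 : ℤ)) (-2 - c) * q ^ (-c) * (br q (2 * c) / br q c) * bj q := by
  have hq0 : q ≠ 0 := by rw [← hs]; exact pow_ne_zero _ h0
  have e2 : q ^ (2 * c) = (q ^ c) ^ 2 := by rw [mul_comm, zpow_mul]; rfl
  have e3 : q ^ (3 * c) = (q ^ c) ^ 3 := by rw [mul_comm, zpow_mul]; rfl
  have h2 := gen_zpow hq hq0 (n := 2 * c) (by omega)
  rw [e2] at h2
  have key := (al_triple_aux (norm_pow_eleven hq) (pow_ne_zero 11 hq0) (zpow_ne_zero c hq0)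
    (gen_zpow hq hq0 hc) h2).2
  rw [ths_pentagonal_reflect (norm_pow_eleven hq) (pow_ne_zero 11 hq0)] at key
  have ez : q ^ (3 * (-2 - c + 2)) = (q ^ c)⁻¹ ^ 3 := by
    rw [show 3 * (-2 - c + 2) = -(3 * c) by ring, zpow_neg, e3, inv_pow]
  have ez' : q ^ (3 * (-2 + c + 2)) = (q ^ c) ^ 3 := by
    rw [show 3 * (-2 + c + 2) = 3 * c by ring, e3]
  have et : thc (s ^ 3) (-s ^ (-1 : ℤ)) (-2 + c) = q ^ (-c) * thc (s ^ 3) (-s ^ (-1 : ℤ)) (-2 - c) := by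
    have e : (-2 + c) * (-2 + c + 1) / 2 = (-2 - c) * (-2 - c + 1) / 2 + -3 * c := by
      rw [show (-2 + c) * (-2 + c + 1) = (-2 - c) * (-2 - c + 1) + -3 * c * 2 by ring,
        Int.add_mul_ediv_right _ _ two_ne_zero]
    have e1 : (-1 : ℂ) ^ (-2 + c) = (-1) ^ (-2 - c) := by
      rw [show -2 + c = -2 - c + 2 * c by ring, zpow_add₀ (by norm_num), zpow_mul]; simp
    rw [thc_pow_neg_zpow h0, thc_pow_neg_zpow h0, e, e1, ← hs, ← zpow_natCast s 11, ← zpow_mul,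
      mul_left_comm, ← zpow_add₀ h0]
    congr 2
    push_cast
    ring
  have hz : q ^ c ≠ 0 := zpow_ne_zero c hq0
  simp only [pentres, br, bj]
  rw [et, ez, ez', e2, zpow_neg q c]
  have hh : (q ^ c)⁻¹ * q ^ c = 1 := inv_mul_cancel₀ hz
  linear_combination (-thc (s ^ 3) (-s ^ (-1 : ℤ)) (-2 - c) * (q ^ c)⁻¹) * key +
    thc (s ^ 3) (-s ^ (-1 : ℤ)) (-2 - c) *
    ths ((q ^ 11) ^ 3) (-((q ^ c)⁻¹ ^ 3) * (q ^ 11) ^ (-2 : ℤ)) * -hh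

lemma esix_eq (hn : ‖s‖ < 1) (h0 : s ≠ 0) (hs : s ^ 11 = q) : esix q s = qp s s := by
  have hq0 : q ≠ 0 := by rw [← hs]; exact pow_ne_zero _ h0
  have hq : ‖q‖ < 1 := by
    rw [← hs, norm_pow]; exact pow_lt_one₀ (norm_nonneg _) hn (by norm_num)
  have hP : ‖s ^ 3‖ < 1 := by rw [norm_pow]; exact pow_lt_one₀ (norm_nonneg _) hn (by norm_num)
  have hsum := (thc_summable hP (pow_ne_zero 3 h0) (w := -s ^ (-1 : ℤ))
    (neg_ne_zero.mpr (zpow_ne_zero _ h0))).of_norm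
  have key := tsum_eq_centred hsum (-2) (tsum_eq_pentres h0 hs)
  rw [← ths, zpow_neg_one, ths_pentagonal hn h0, pentres_pair hq h0 hs (by decide),
    pentres_pair hq h0 hs (by decide), pentres_pair hq h0 hs (by decide),
    pentres_pair hq h0 hs (by decide), pentres_pair hq h0 hs (by decide), pentres] at key
  have ec : ths ((q ^ 11) ^ 3) (-q ^ (3 * (-2 + 2) : ℤ) * (q ^ 11) ^ (-2 : ℤ)) = bj q := by
    rw [bj, ← ths_pentagonal_reflect (norm_pow_eleven hq) (pow_ne_zero 11 hq0)]
    simp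
  rw [key, ec]
  simp only [thc_pow_neg_zpow h0]
  obtain ⟨h1, h2, h3, h4, h5⟩ := br_ne_zero_all hq hq0
  norm_num only
  rw [br_six hq hq0, br_eight hq hq0, br_ten hq hq0, esix, ← hs]
  have z (x : ℂ) (k : ℕ) : x ^ (-(k : ℤ)) = (x ^ k)⁻¹ := by rw [zpow_neg, zpow_natCast]
  rw [show (s ^ 11) ^ (-1 : ℤ) = _ from z _ 1, show (s ^ 11) ^ (-2 : ℤ) = _ from z _ 2,
    show (s ^ 11) ^ (-3 : ℤ) = _ from z _ 3, show (s ^ 11) ^ (-4 : ℤ) = _ from z _ 4,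
    show (s ^ 11) ^ (-5 : ℤ) = _ from z _ 5]
  rw [← hs] at h1 h2 h3 h4 h5
  simp only [zpow_ofNat]
  field_simp
  ring

end
end RankCrank

namespace RankCrank
open Filter Topology Finset
section
variable {q s : ℂ}

/-- The Appell sum of level three occurring in the dissection, normalised. -/
noncomputable def av (q : ℂ) (b : ℤ) : ℂ := al (q ^ 11) (thc ((q ^ 11) ^ 3) (-1)) (q ^ b) / bj q

lemma rh_compl (hq : ‖q‖ < 1) (h0 : q ≠ 0) {b : ℤ} (hb : ¬ (11 : ℤ) ∣ b) :
    rh (q ^ 11) (q ^ (11 - b)) = -rh (q ^ 11) (q ^ b) := by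
  have hz := zpow_ne_zero b h0
  have hg := gen_zpow hq h0 hb
  have hi : Gen (q ^ 11) (q ^ b)⁻¹ := by
    rw [← zpow_neg]; exact gen_zpow hq h0 (by omega)
  rw [sub_eq_neg_add, zpow_add₀ h0, zpow_neg, show q ^ (11 : ℤ) = q ^ 11 from rfl,
    rh_mul_base (norm_pow_eleven hq) (pow_ne_zero 11 h0) (inv_ne_zero hz) hi,
    rh_inv (norm_pow_eleven hq) (pow_ne_zero 11 h0) hz hg]
  ring

lemma alres_centre (b : ℤ) :
    alres 3 b q s b = thc (s ^ 3) (-s ^ (3 * (5 - b))) b *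
      al (q ^ 11) (thc ((q ^ 11) ^ 3) (-1)) (q ^ b) := by
  simp [alres]

lemma al_rank_one (hn : ‖s‖ < 1) (h0 : s ≠ 0) (hs : s ^ 11 = q) :
    al q (thc (s ^ 3) (-s ^ (0 : ℤ))) 1 = lamr₁ q s + (rh (q ^ 11) (q ^ (5 : ℤ)) - rh (q ^ 11) (q ^ (1 : ℤ)))
      - s ^ 40 * av q 5 * esix q s := by
  have hq0 : q ≠ 0 := by rw [← hs]; exact pow_ne_zero _ h0
  have hq : ‖q‖ < 1 := by
    rw [← hs, norm_pow]; exact pow_lt_one₀ (norm_nonneg _) hn (by norm_num)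
  have hJ := bj_ne_zero hq
  obtain ⟨h1, h2, h3, h4, h5⟩ := br_ne_zero_all hq hq0
  have key := al_eq_alres hn h0 hs (d := 3) (by norm_num) 5
  rw [alres_three_pole hq h0 hs (by decide),
    alres_three_pair hq h0 hs (c := 1) (by decide) (by decide) (by decide) (by decide),
    alres_three_pair hq h0 hs (c := 2) (by decide) (by decide) (by decide) (by decide),
    alres_three_pair hq h0 hs (c := 3) (by decide) (by decide) (by decide) (by decide),
    alres_three_pair hq h0 hs (c := 4) (by decide) (by decide) (by decide) (by decide),
    alres_centre] at key
  have e : rh (q ^ 11) (q ^ (10 : ℤ)) = -rh (q ^ 11) (q ^ (1 : ℤ)) := rh_compl hq hq0 (b := 1) (by decide)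
  simp only [thc_pow_neg_zpow h0] at key
  norm_num only at key
  simp only [br_six hq hq0, br_seven hq hq0, br_eight hq hq0, br_nine hq hq0, br_ten hq hq0, e] at key
  rw [key, lamr₁, av, esix]
  generalize al (q ^ 11) (thc ((q ^ 11) ^ 3) (-1)) (q ^ (5 : ℤ)) = A at *
  generalize rh (q ^ 11) (q ^ (5 : ℤ)) = r5 at *
  generalize rh (q ^ 11) (q ^ (1 : ℤ)) = r1 at *
  clear key
  rw [← hs] at *
  simp only [zpow_ofNat]
  field_simp
  ring

lemma al_rank_four (hn : ‖s‖ < 1) (h0 : s ≠ 0) (hs : s ^ 11 = q) :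
    al q (thc (s ^ 3) (-s ^ (3 : ℤ))) 1 = lamr₄ q s + (rh (q ^ 11) (q ^ (4 : ℤ)) - rh (q ^ 11) (q ^ (3 : ℤ)))
      + s ^ 37 * av q 4 * esix q s := by
  have hq0 : q ≠ 0 := by rw [← hs]; exact pow_ne_zero _ h0
  have hq : ‖q‖ < 1 := by
    rw [← hs, norm_pow]; exact pow_lt_one₀ (norm_nonneg _) hn (by norm_num)
  have hJ := bj_ne_zero hq
  obtain ⟨h1, h2, h3, h4, h5⟩ := br_ne_zero_all hq hq0
  have key := al_eq_alres hn h0 hs (d := 3) (by norm_num) 4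
  rw [alres_three_pole hq h0 hs (by decide),
    alres_three_pair hq h0 hs (c := 1) (by decide) (by decide) (by decide) (by decide),
    alres_three_pair hq h0 hs (c := 2) (by decide) (by decide) (by decide) (by decide),
    alres_three_pair hq h0 hs (c := 3) (by decide) (by decide) (by decide) (by decide),
    alres_three_pair hq h0 hs (c := 5) (by decide) (by decide) (by decide) (by decide),
    alres_centre] at key
  have e : rh (q ^ 11) (q ^ (8 : ℤ)) = -rh (q ^ 11) (q ^ (3 : ℤ)) := rh_compl hq hq0 (b := 3) (by decide)
  have n1 : br q (-1) = -(q ^ 1)⁻¹ * br q 1 := br_neg hq hq0 1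
  simp only [thc_pow_neg_zpow h0] at key
  norm_num only at key
  simp only [br_six hq hq0, br_seven hq hq0, br_eight hq hq0, br_nine hq hq0, br_ten hq hq0, e, n1] at key
  rw [key, lamr₄, av, esix]
  generalize al (q ^ 11) (thc ((q ^ 11) ^ 3) (-1)) (q ^ (4 : ℤ)) = A at *
  generalize rh (q ^ 11) (q ^ (4 : ℤ)) = r4 at *
  generalize rh (q ^ 11) (q ^ (3 : ℤ)) = r3 at *
  clear key
  rw [← hs] at *
  simp only [zpow_neg, zpow_ofNat]
  field_simp
  ring

lemma al_rank_thirteen (hn : ‖s‖ < 1) (h0 : s ≠ 0) (hs : s ^ 11 = q) :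
    al q (thc (s ^ 3) (-s ^ (12 : ℤ))) 1 = lamr₂ q s + (rh (q ^ 11) (q ^ (1 : ℤ)) + rh (q ^ 11) (q ^ (2 : ℤ)))
      - s ^ 10 * av q 1 * esix q s := by
  have hq0 : q ≠ 0 := by rw [← hs]; exact pow_ne_zero _ h0
  have hq : ‖q‖ < 1 := by
    rw [← hs, norm_pow]; exact pow_lt_one₀ (norm_nonneg _) hn (by norm_num)
  have hJ := bj_ne_zero hq
  obtain ⟨h1, h2, h3, h4, h5⟩ := br_ne_zero_all hq hq0
  have key := al_eq_alres hn h0 hs (d := 3) (by norm_num) 1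
  rw [alres_three_pole hq h0 hs (by decide),
    alres_three_pair hq h0 hs (c := 2) (by decide) (by decide) (by decide) (by decide),
    alres_three_pair hq h0 hs (c := 3) (by decide) (by decide) (by decide) (by decide),
    alres_three_pair hq h0 hs (c := 4) (by decide) (by decide) (by decide) (by decide),
    alres_three_pair hq h0 hs (c := 5) (by decide) (by decide) (by decide) (by decide),
    alres_centre] at key
  have n1 : br q (-1) = -(q ^ 1)⁻¹ * br q 1 := br_neg hq hq0 1
  have n2 : br q (-2) = -(q ^ 2)⁻¹ * br q 2 := br_neg hq hq0 2
  have n3 : br q (-3) = -(q ^ 3)⁻¹ * br q 3 := br_neg hq hq0 3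
  have n4 : br q (-4) = -(q ^ 4)⁻¹ * br q 4 := br_neg hq hq0 4
  simp only [thc_pow_neg_zpow h0] at key
  norm_num only at key
  simp only [br_six hq hq0, br_eight hq hq0, br_ten hq hq0, n1, n2, n3, n4] at key
  rw [key, lamr₂, av, esix]
  generalize al (q ^ 11) (thc ((q ^ 11) ^ 3) (-1)) (q ^ (1 : ℤ)) = A at *
  generalize rh (q ^ 11) (q ^ (1 : ℤ)) = r1 at *
  generalize rh (q ^ 11) (q ^ (2 : ℤ)) = r2 at *
  clear key
  rw [← hs] at *
  simp only [zpow_neg, zpow_ofNat]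
  field_simp
  ring

lemma al_rank_neg_eight (hn : ‖s‖ < 1) (h0 : s ≠ 0) (hs : s ^ 11 = q) :
    al q (thc (s ^ 3) (-s ^ (-9 : ℤ))) 1 = lamr₃ q s + (rh (q ^ 11) (q ^ (5 : ℤ)) - rh (q ^ 11) (q ^ (3 : ℤ)) - 1)
      + s ^ 31 * av q 8 * esix q s := by
  have hq0 : q ≠ 0 := by rw [← hs]; exact pow_ne_zero _ h0
  have hq : ‖q‖ < 1 := by
    rw [← hs, norm_pow]; exact pow_lt_one₀ (norm_nonneg _) hn (by norm_num)
  have hJ := bj_ne_zero hq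
  obtain ⟨h1, h2, h3, h4, h5⟩ := br_ne_zero_all hq hq0
  have key := al_eq_alres hn h0 hs (d := 3) (by norm_num) 8
  have e11 : alres 3 8 q s (8 + 3) = alres 3 8 q s (8 - 8) := alres_periodic h0 hs 3 8 0
  have e5 : alres 3 8 q s (8 - 3) = alres 3 8 q s (8 + 8) := (alres_periodic h0 hs 3 8 5).symm
  rw [e11, e5, add_comm (alres 3 8 q s (8 - 8))] at key
  rw [alres_three_pole hq h0 hs (by decide),
    alres_three_pair hq h0 hs (c := 1) (by decide) (by decide) (by decide) (by decide),
    alres_three_pair hq h0 hs (c := 2) (by decide) (by decide) (by decide) (by decide),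
    alres_three_pair hq h0 hs (c := 4) (by decide) (by decide) (by decide) (by decide),
    alres_three_pair hq h0 hs (c := 5) (by decide) (by decide) (by decide) (by decide),
    alres_centre] at key
  have e : rh (q ^ 11) (q ^ (8 : ℤ)) = -rh (q ^ 11) (q ^ (3 : ℤ)) := rh_compl hq hq0 (b := 3) (by decide)
  have e' : rh (q ^ 11) (q ^ (16 : ℤ)) = rh (q ^ 11) (q ^ (5 : ℤ)) - 1 := by
    rw [show (16 : ℤ) = 5 + 11 by norm_num, zpow_add₀ hq0, show q ^ (11 : ℤ) = q ^ 11 from rfl,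
      rh_mul_base (norm_pow_eleven hq) (pow_ne_zero 11 hq0) (zpow_ne_zero 5 hq0)
        (gen_zpow hq hq0 (by decide))]
  have a1 : br q 12 = -(q ^ 1)⁻¹ * br q 1 := br_add hq hq0 1
  have a2 : br q 13 = -(q ^ 2)⁻¹ * br q 2 := br_add hq hq0 2
  have a5 : br q 16 = -(q ^ 5)⁻¹ * br q 5 := br_add hq hq0 5
  simp only [thc_pow_neg_zpow h0] at key
  norm_num only at key
  simp only [br_six hq hq0, br_seven hq hq0, br_eight hq hq0, br_nine hq hq0, br_ten hq hq0, e, e', a1, a2, a5] at key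
  rw [key, lamr₃, av, esix]
  generalize al (q ^ 11) (thc ((q ^ 11) ^ 3) (-1)) (q ^ (8 : ℤ)) = A at *
  generalize rh (q ^ 11) (q ^ (5 : ℤ)) = r5 at *
  generalize rh (q ^ 11) (q ^ (3 : ℤ)) = r3 at *
  clear key
  rw [← hs] at *
  simp only [zpow_neg, zpow_ofNat]
  field_simp
  ring

lemma al_crank_zero (hn : ‖s‖ < 1) (h0 : s ≠ 0) (hs : s ^ 11 = q) :
    al q (thc (s ^ 1) (-s ^ (0 : ℤ))) 1 = lamc₀ q s + (-rh (q ^ 11) (q ^ (1 : ℤ)) - rh (q ^ 11) (q ^ (5 : ℤ))) := by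
  have hq0 : q ≠ 0 := by rw [← hs]; exact pow_ne_zero _ h0
  have hq : ‖q‖ < 1 := by
    rw [← hs, norm_pow]; exact pow_lt_one₀ (norm_nonneg _) hn (by norm_num)
  have hJ := bj_ne_zero hq
  obtain ⟨h1, h2, h3, h4, h5⟩ := br_ne_zero_all hq hq0
  have key := al_eq_alres hn h0 hs (d := 1) (by norm_num) 5
  rw [alres_one_pole hq h0 hs (by decide),
    alres_one_pair hq h0 hs (c := 1) (by decide) (by decide) (by decide) (by decide),
    alres_one_pair hq h0 hs (c := 2) (by decide) (by decide) (by decide) (by decide),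
    alres_one_pair hq h0 hs (c := 3) (by decide) (by decide) (by decide) (by decide),
    alres_one_pair hq h0 hs (c := 4) (by decide) (by decide) (by decide) (by decide),
    alres_one_centre hq hq0 (by decide)] at key
  have e : rh (q ^ 11) (q ^ (10 : ℤ)) = -rh (q ^ 11) (q ^ (1 : ℤ)) := rh_compl hq hq0 (b := 1) (by decide)
  simp only [thc_pow_neg_zpow h0] at key
  norm_num only at key
  simp only [br_six hq hq0, br_seven hq hq0, br_eight hq hq0, br_nine hq hq0, e] at key
  rw [key, lamc₀]
  generalize rh (q ^ 11) (q ^ (1 : ℤ)) = r1 at *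
  generalize rh (q ^ 11) (q ^ (5 : ℤ)) = r5 at *
  clear key
  rw [← hs] at *
  simp only [zpow_ofNat]
  field_simp
  ring

lemma al_crank_one (hn : ‖s‖ < 1) (h0 : s ≠ 0) (hs : s ^ 11 = q) :
    al q (thc (s ^ 1) (-s ^ (1 : ℤ))) 1 = lamc₁ q s + (-rh (q ^ 11) (q ^ (3 : ℤ)) - rh (q ^ 11) (q ^ (4 : ℤ))) := by
  have hq0 : q ≠ 0 := by rw [← hs]; exact pow_ne_zero _ h0
  have hq : ‖q‖ < 1 := by
    rw [← hs, norm_pow]; exact pow_lt_one₀ (norm_nonneg _) hn (by norm_num)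
  have hJ := bj_ne_zero hq
  obtain ⟨h1, h2, h3, h4, h5⟩ := br_ne_zero_all hq hq0
  have key := al_eq_alres hn h0 hs (d := 1) (by norm_num) 4
  rw [alres_one_pole hq h0 hs (by decide),
    alres_one_pair hq h0 hs (c := 1) (by decide) (by decide) (by decide) (by decide),
    alres_one_pair hq h0 hs (c := 2) (by decide) (by decide) (by decide) (by decide),
    alres_one_pair hq h0 hs (c := 3) (by decide) (by decide) (by decide) (by decide),
    alres_one_pair hq h0 hs (c := 5) (by decide) (by decide) (by decide) (by decide),
    alres_one_centre hq hq0 (by decide)] at key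
  have e : rh (q ^ 11) (q ^ (8 : ℤ)) = -rh (q ^ 11) (q ^ (3 : ℤ)) := rh_compl hq hq0 (b := 3) (by decide)
  have n1 : br q (-1) = -(q ^ 1)⁻¹ * br q 1 := br_neg hq hq0 1
  simp only [thc_pow_neg_zpow h0] at key
  norm_num only at key
  simp only [br_six hq hq0, br_seven hq hq0, br_nine hq hq0, br_ten hq hq0, e, n1] at key
  rw [key, lamc₁]
  generalize rh (q ^ 11) (q ^ (3 : ℤ)) = r3 at *
  generalize rh (q ^ 11) (q ^ (4 : ℤ)) = r4 at *
  clear key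
  rw [← hs] at *
  simp only [zpow_neg, zpow_ofNat]
  field_simp
  ring

end
end RankCrank

namespace RankCrank
open Filter Topology Finset
section
variable {q s P w : ℂ}

lemma ths_mul_base (hP : P ≠ 0) (hw : w ≠ 0) : ths P (w * P) = (w * P)⁻¹ * ths P w := by
  rw [ths, ths, ← (Equiv.addRight (1 : ℤ)).tsum_eq (thc P w), ← tsum_mul_left]
  refine tsum_congr fun n => ?_
  rw [Equiv.coe_addRight, thc_add_one hP hw, ← thc_mul_zpow, zpow_add_one₀ hP]
  field_simp

lemma ths_neg_one (P : ℂ) : ths P (-1) = 0 := by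
  have h : ths P (-1) = -ths P (-1) := by
    conv_lhs => rw [ths, ← (Equiv.neg ℤ).tsum_eq, ← (Equiv.addRight (1 : ℤ)).tsum_eq]
    rw [ths, ← tsum_neg]
    refine tsum_congr fun n => ?_
    rw [Equiv.neg_apply, Equiv.coe_addRight, thc_neg_add_one (by norm_num)]
    norm_num
  exact CharZero.eq_neg_self_iff.mp h

lemma al_sub_al_mul_base (hq : ‖q‖ < 1) (h0 : q ≠ 0) (hP : ‖P‖ < 1) (hP0 : P ≠ 0) (hw : w ≠ 0) :
    al q (thc P w) 1 - al q (thc P (w * q)) 1 = ths P w - 1 := by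
  have h1 := al_summable hq h0 (thc_summable hP hP0 hw) one_ne_zero
  have h2 := al_summable hq h0 (thc_summable hP hP0 (mul_ne_zero hw h0)) one_ne_zero
  have h3 := (thc_summable hP hP0 hw).of_norm
  rw [al, al, ← h1.tsum_sub h2, ths, h3.tsum_eq_add_tsum_ite 0, thc_zero, add_sub_cancel_left]
  refine tsum_congr fun n => ?_
  split_ifs with hn
  · simp [hn]
  · have : 1 - 1 * q ^ n ≠ 0 := by
      rw [one_mul, sub_ne_zero]
      intro h
      have := (zpow_eq_one_iff_right₀ (norm_nonneg q) hq.ne).mp (by rw [← norm_zpow, ← h, norm_one])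
      exact hn this
    rw [one_mul] at this ⊢
    rw [← thc_mul_zpow]
    field_simp

/-- The level three Appell sum attached to ranks. -/
noncomputable def lr (s : ℂ) (k : ℤ) : ℂ := al (s ^ 11) (thc (s ^ 3) (-s ^ k)) 1

/-- The level one Appell sum attached to cranks. -/
noncomputable def lk (s : ℂ) (k : ℤ) : ℂ := al (s ^ 11) (thc (s ^ 1) (-s ^ k)) 1

lemma lr_sub (hn : ‖s‖ < 1) (h0 : s ≠ 0) (k : ℤ) :
    lr s k - lr s (k + 11) = ths (s ^ 3) (-s ^ k) - 1 := by
  have h1 (m : ℕ) (hm : m ≠ 0) : ‖s ^ m‖ < 1 := by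
    rw [norm_pow]; exact pow_lt_one₀ (norm_nonneg _) hn hm
  rw [lr, lr, ← al_sub_al_mul_base (h1 11 (by norm_num)) (pow_ne_zero _ h0) (h1 3 (by norm_num))
    (pow_ne_zero _ h0) (neg_ne_zero.mpr (zpow_ne_zero k h0)), zpow_add₀ h0, neg_mul]
  rfl

lemma lr_one (hn : ‖s‖ < 1) (h0 : s ≠ 0) : lr s 1 = lr s 12 - s⁻¹ * qp s s - 1 := by
  have h := lr_sub hn h0 1
  have e : ths (s ^ 3) (-s ^ (1 : ℤ)) = -s⁻¹ * qp s s := by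
    rw [← ths_pentagonal_reflect hn h0, show -s ^ (1 : ℤ) = -1 * s ^ (-2 : ℤ) * s ^ 3 by
      rw [mul_assoc, ← zpow_natCast s 3, ← zpow_add₀ h0]; norm_num,
      ths_mul_base (pow_ne_zero 3 h0) (by simp [h0])]
    congr 1
    rw [mul_assoc, ← zpow_natCast s 3, ← zpow_add₀ h0]; norm_num
  rw [e] at h
  norm_num at h
  linear_combination h

lemma lr_two (hn : ‖s‖ < 1) (h0 : s ≠ 0) : lr s 2 = lr s (-9) + 1 := by
  have h := lr_sub hn h0 (-9)
  have h3 := pow_ne_zero 3 h0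
  have e (k : ℤ) : ths (s ^ 3) (-s ^ (k - 3)) = 0 ↔ ths (s ^ 3) (-s ^ k) = 0 := by
    have hk := neg_ne_zero.mpr (zpow_ne_zero (k - 3) h0)
    rw [show -s ^ k = -s ^ (k - 3) * s ^ 3 by
      rw [neg_mul, ← zpow_natCast s 3, ← zpow_add₀ h0]; norm_num, ths_mul_base h3 hk]
    rw [mul_eq_zero, inv_eq_zero, or_iff_right (mul_ne_zero hk h3)]
  have e9 : ths (s ^ 3) (-s ^ (-9 : ℤ)) = 0 := by
    rw [show (-9 : ℤ) = 0 - 3 - 3 - 3 by norm_num, e, e, e, zpow_zero, ths_neg_one]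
  rw [e9] at h
  norm_num at h
  linear_combination -h

/-- Correction of the dissection coefficients in residue classes other than `0`. -/
noncomputable def corr (q l₁ l₂ l₃ l₄ : ℂ) (r : ℕ) : ℂ :=
  if r = 7 then -l₁ * q ^ 3 * av q 5 else if r = 4 then l₄ * q ^ 3 * av q 4
  else if r = 10 then -l₂ * (av q 1 + q⁻¹) else if r = 9 then l₃ * q ^ 2 * av q 8 else 0

lemma rank_crank_dissection (hn : ‖s‖ < 1) (h0 : s ≠ 0) (hs : s ^ 11 = q)
    {l₁ l₂ l₃ l₄ c₀ c₁ T : ℂ} {F : ℕ → ℂ}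
    (hF : esix q s * ∑ r ∈ range 11, s ^ r * F r = l₁ * lamr₁ q s + l₂ * lamr₂ q s +
      l₃ * lamr₃ q s + l₄ * lamr₄ q s + c₀ * lamc₀ q s + c₁ * lamc₁ q s + T)
    (hT : T = l₁ * (rh (q ^ 11) (q ^ (5 : ℤ)) - rh (q ^ 11) (q ^ (1 : ℤ))) +
      l₂ * (rh (q ^ 11) (q ^ (1 : ℤ)) + rh (q ^ 11) (q ^ (2 : ℤ)) - 1) +
      l₃ * (rh (q ^ 11) (q ^ (5 : ℤ)) - rh (q ^ 11) (q ^ (3 : ℤ))) +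
      l₄ * (rh (q ^ 11) (q ^ (4 : ℤ)) - rh (q ^ 11) (q ^ (3 : ℤ))) +
      c₀ * (-rh (q ^ 11) (q ^ (1 : ℤ)) - rh (q ^ 11) (q ^ (5 : ℤ))) +
      c₁ * (-rh (q ^ 11) (q ^ (3 : ℤ)) - rh (q ^ 11) (q ^ (4 : ℤ)))) :
    l₁ * lr s 0 + l₂ * lr s 1 + l₃ * lr s 2 + l₄ * lr s 3 + c₀ * lk s 0 + c₁ * lk s 1 =
      qp s s * ∑ r ∈ range 11, s ^ r * (F r + corr q l₁ l₂ l₃ l₄ r) := by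
  have e : ∑ r ∈ range 11, s ^ r * corr q l₁ l₂ l₃ l₄ r = -l₁ * s ^ 40 * av q 5 +
      l₄ * s ^ 37 * av q 4 - l₂ * (s ^ 10 * av q 1 + s⁻¹) + l₃ * s ^ 31 * av q 8 := by
    simp only [sum_range_succ, range_zero, sum_empty, corr, ← hs]
    norm_num
    field_simp
    ring
  simp_rw [mul_add, sum_add_distrib, mul_add]
  rw [e, ← esix_eq hn h0 hs, hF, hT, lr_one hn h0, lr_two hn h0, ← esix_eq hn h0 hs]
  simp only [lr, lk, hs]
  rw [al_rank_one hn h0 hs, al_rank_four hn h0 hs, al_rank_thirteen hn h0 hs,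
    al_rank_neg_eight hn h0 hs, al_crank_zero hn h0 hs, al_crank_one hn h0 hs]
  ring
end
end RankCrank

namespace RankCrank
open Filter Topology Finset
section
variable {q s : ℂ}

lemma rh_triple (hq : ‖q‖ < 1) (h0 : q ≠ 0) {a b c : ℤ} (ha : ¬ (11 : ℤ) ∣ a) (hb : ¬ (11 : ℤ) ∣ b)
    (hc : ¬ (11 : ℤ) ∣ c) (hab : ¬ (11 : ℤ) ∣ a + b) (habc : ¬ (11 : ℤ) ∣ a + b + c) :
    rh (q ^ 11) (q ^ a) + rh (q ^ 11) (q ^ b) + rh (q ^ 11) (q ^ c)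
      - rh (q ^ 11) (q ^ (a + b + c)) - 1 = -(bj q ^ 3 * br q (a + b) * br q (a + c) * br q (b + c) /
        (br q a * br q b * br q c * br q (a + b + c))) := by
  have g {n : ℤ} (hn : ¬ (11 : ℤ) ∣ n) := gen_zpow hq h0 hn
  simp only [br, bj]
  rw [zpow_add₀ h0 (a + b), zpow_add₀ h0 a b, zpow_add₀ h0 a c, zpow_add₀ h0 b c]
  refine rh_add (norm_pow_eleven hq) (pow_ne_zero 11 h0) (zpow_ne_zero a h0) (zpow_ne_zero b h0)
    (zpow_ne_zero c h0) (g ha) (g hb) ?_ (g hc) ?_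
  · rw [← zpow_add₀ h0]; exact g hab
  · rw [← zpow_add₀ h0, ← zpow_add₀ h0]; exact g habc

lemma theta_monomials (hq : ‖q‖ < 1) (h0 : q ≠ 0) :
    bj q ^ 3 * -(br q 2 ^ 3 / (br q 1 ^ 3 * br q 3)) = rh (q ^ 11) (q ^ (1 : ℤ)) + rh (q ^ 11) (q ^ (1 : ℤ)) +
      rh (q ^ 11) (q ^ (1 : ℤ)) - rh (q ^ 11) (q ^ (3 : ℤ)) - 1 ∧
    bj q ^ 3 * -(br q 3 ^ 2 / (br q 1 ^ 2 * br q 4)) = rh (q ^ 11) (q ^ (1 : ℤ)) + rh (q ^ 11) (q ^ (1 : ℤ)) +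
      rh (q ^ 11) (q ^ (2 : ℤ)) - rh (q ^ 11) (q ^ (4 : ℤ)) - 1 ∧
    bj q ^ 3 * -(br q 2 * br q 4 ^ 2 / (br q 1 ^ 2 * br q 3 * br q 5)) = rh (q ^ 11) (q ^ (1 : ℤ)) + rh (q ^ 11) (q ^ (1 : ℤ)) +
      rh (q ^ 11) (q ^ (3 : ℤ)) - rh (q ^ 11) (q ^ (5 : ℤ)) - 1 ∧
    bj q ^ 3 * -(br q 3 ^ 2 * br q 4 / (br q 1 * br q 2 ^ 2 * br q 5)) = rh (q ^ 11) (q ^ (1 : ℤ)) + rh (q ^ 11) (q ^ (2 : ℤ)) +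
      rh (q ^ 11) (q ^ (2 : ℤ)) - rh (q ^ 11) (q ^ (5 : ℤ)) - 1 ∧
    bj q ^ 3 * -(br q 2 * br q 5 / (br q 1 ^ 2 * br q 4)) = rh (q ^ 11) (q ^ (1 : ℤ)) + rh (q ^ 11) (q ^ (1 : ℤ)) +
      rh (q ^ 11) (q ^ (4 : ℤ)) - -rh (q ^ 11) (q ^ (5 : ℤ)) - 1 := by
  obtain ⟨h1, h2, h3, h4, h5⟩ := br_ne_zero_all hq h0
  have e0 := rh_triple hq h0 (a := 1) (b := 1) (c := 1) (by decide) (by decide)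
    (by decide) (by decide) (by decide)
  have e1 := rh_triple hq h0 (a := 1) (b := 1) (c := 2) (by decide) (by decide)
    (by decide) (by decide) (by decide)
  have e2 := rh_triple hq h0 (a := 1) (b := 1) (c := 3) (by decide) (by decide)
    (by decide) (by decide) (by decide)
  have e3 := rh_triple hq h0 (a := 1) (b := 2) (c := 2) (by decide) (by decide)
    (by decide) (by decide) (by decide)
  have e4 := rh_triple hq h0 (a := 1) (b := 1) (c := 4) (by decide) (by decide)
    (by decide) (by decide) (by decide)
  have e : rh (q ^ 11) (q ^ (6 : ℤ)) = -rh (q ^ 11) (q ^ (5 : ℤ)) := rh_compl hq h0 (b := 5) (by decide)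
  norm_num only at e0 e1 e2 e3 e4
  rw [e, br_six hq h0] at e4
  refine ⟨?_, ?_, ?_, ?_, ?_⟩
  · rw [e0]; field_simp
  · rw [e1]; field_simp
  · rw [e2]; field_simp
  · rw [e3]; field_simp
  · rw [e4]; field_simp

lemma dissection_polyA (hn : ‖s‖ < 1) (h0 : s ≠ 0) (hs : s ^ 11 = q) :
    (4) * lr s 0 + (-2) * lr s 1 + (1) * lr s 2 + (-1) * lr s 3 + (-3) * lk s 0 + (1) * lk s 1 =
      qp s s * ∑ r ∈ range 11, s ^ r * (hmon q r * polyA (ux q) (uy q) r +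
        corr q (4) (-2) (1) (-1) r) := by
  have hq0 : q ≠ 0 := by rw [← hs]; exact pow_ne_zero _ h0
  have hq : ‖q‖ < 1 := by
    rw [← hs, norm_pow]; exact pow_lt_one₀ (norm_nonneg _) hn (by norm_num)
  obtain ⟨e0, e1, e2, e3, e4⟩ := theta_monomials hq hq0
  refine rank_crank_dissection hn h0 hs (esix_mul_polyA hq hq0 hs) ?_
  linear_combination (-2) * e0 + (4) * e1 + (-3) * e2 + (-3) * e3 + (2) * e4

lemma dissection_polyB (hn : ‖s‖ < 1) (h0 : s ≠ 0) (hs : s ^ 11 = q) :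
    (-1) * lr s 0 + (6) * lr s 1 + (-3) * lr s 2 + (3) * lr s 3 + (-3) * lk s 0 + (1) * lk s 1 =
      qp s s * ∑ r ∈ range 11, s ^ r * (hmon q r * polyB (ux q) (uy q) r +
        corr q (-1) (6) (-3) (3) r) := by
  have hq0 : q ≠ 0 := by rw [← hs]; exact pow_ne_zero _ h0
  have hq : ‖q‖ < 1 := by
    rw [← hs, norm_pow]; exact pow_lt_one₀ (norm_nonneg _) hn (by norm_num)
  obtain ⟨e0, e1, e2, e3, e4⟩ := theta_monomials hq hq0
  refine rank_crank_dissection hn h0 hs (esix_mul_polyB hq hq0 hs) ?_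
  linear_combination (1) * e0 + (0) * e1 + (0) * e2 + (3) * e3 + (2) * e4

lemma dissection_polyC (hn : ‖s‖ < 1) (h0 : s ≠ 0) (hs : s ^ 11 = q) :
    (-2) * lr s 0 + (1) * lr s 1 + (5) * lr s 2 + (-5) * lr s 3 + (0) * lk s 0 + (0) * lk s 1 =
      qp s s * ∑ r ∈ range 11, s ^ r * (hmon q r * polyC (ux q) (uy q) r +
        corr q (-2) (1) (5) (-5) r) := by
  have hq0 : q ≠ 0 := by rw [← hs]; exact pow_ne_zero _ h0
  have hq : ‖q‖ < 1 := by
    rw [← hs, norm_pow]; exact pow_lt_one₀ (norm_nonneg _) hn (by norm_num)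
  obtain ⟨e0, e1, e2, e3, e4⟩ := theta_monomials hq hq0
  refine rank_crank_dissection hn h0 hs (esix_mul_polyC hq hq0 hs) ?_
  linear_combination (-1) * e0 + (5) * e1 + (-1) * e2 + (-2) * e3 + (0) * e4

lemma dissection_polyD (hn : ‖s‖ < 1) (h0 : s ≠ 0) (hs : s ^ 11 = q) :
    (-3) * lr s 0 + (-4) * lr s 1 + (2) * lr s 2 + (9) * lr s 3 + (3) * lk s 0 + (-1) * lk s 1 =
      qp s s * ∑ r ∈ range 11, s ^ r * (hmon q r * polyD (ux q) (uy q) r +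
        corr q (-3) (-4) (2) (9) r) := by
  have hq0 : q ≠ 0 := by rw [← hs]; exact pow_ne_zero _ h0
  have hq : ‖q‖ < 1 := by
    rw [← hs, norm_pow]; exact pow_lt_one₀ (norm_nonneg _) hn (by norm_num)
  obtain ⟨e0, e1, e2, e3, e4⟩ := theta_monomials hq hq0
  refine rank_crank_dissection hn h0 hs (esix_mul_polyD hq hq0 hs) ?_
  linear_combination (8) * e0 + (-12) * e1 + (-2) * e2 + (4) * e3 + (-2) * e4

end
end RankCrank

namespace RankCrank
open Filter Topology Finset
section
variable {s : ℂ}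

/-- The size of the partition whose parts are the elements of `m` increased by one. -/
def wt (m : Multiset ℕ) : ℕ := m.sum + m.card

lemma sum_map_succ (m : Multiset ℕ) : (m.map Nat.succ).sum = wt m := by
  induction m using Multiset.induction_on with
  | empty => rfl
  | cons a m ih => rw [Multiset.map_cons, Multiset.sum_cons, ih, wt, wt]; simp; omega

lemma map_succ_map_pred {m : Multiset ℕ} (h : ∀ i ∈ m, 0 < i) :
    (m.map Nat.pred).map Nat.succ = m := by
  rw [Multiset.map_map]
  conv_rhs => rw [← Multiset.map_id m]
  exact Multiset.map_congr rfl fun i hi => Nat.succ_pred_eq_of_pos (h i hi)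

lemma map_pred_map_succ (m : Multiset ℕ) : (m.map Nat.succ).map Nat.pred = m := by
  rw [Multiset.map_map]; simp

/-- Partitions of all sizes correspond to multisets of natural numbers. -/
def partitionEquiv : (Σ n, Nat.Partition n) ≃ Multiset ℕ where
  toFun p := p.2.parts.map Nat.pred
  invFun m := ⟨wt m, ⟨m.map Nat.succ, fun h => by
    obtain ⟨a, _, rfl⟩ := Multiset.mem_map.mp h; exact a.succ_pos, sum_map_succ m⟩⟩
  left_inv := by
    rintro ⟨n, ⟨m, hm, rfl⟩⟩
    have h := map_succ_map_pred (m := m) fun i hi => hm hi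
    have h' : wt (m.map Nat.pred) = m.sum := by rw [← sum_map_succ, h]
    ext : 1
    · exact h'
    · have (n : ℕ) (hn : wt (m.map Nat.pred) = n) (p : Nat.Partition n) (hp : p.parts = m) (P) (PS) :
        HEq (⟨(m.map Nat.pred).map Nat.succ, P, PS⟩ : Nat.Partition (wt (m.map Nat.pred))) p := by
        subst hn
        rw [heq_iff_eq]
        ext1
        exact h.trans hp.symm
      exact this m.sum h' _ rfl _ _
  right_inv m := map_pred_map_succ m

lemma wt_partitionEquiv {n : ℕ} (p : Nat.Partition n) : wt (partitionEquiv ⟨n, p⟩) = n := by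
  rw [← sum_map_succ]
  change ((p.parts.map Nat.pred).map Nat.succ).sum = n
  rw [map_succ_map_pred fun i hi => p.parts_pos hi, p.parts_sum]

lemma card_partition_le (n : ℕ) : Fintype.card (Nat.Partition n) ≤ 2 ^ n := by
  refine (Fintype.card_le_of_surjective _ Nat.Partition.ofComposition_surj).trans ?_
  rw [composition_card]
  exact Nat.pow_le_pow_right two_pos (Nat.sub_le n 1)

lemma summable_pow_wt (hs : ‖s‖ < 1 / 2) : Summable fun m : Multiset ℕ => ‖s‖ ^ wt m := by
  rw [← partitionEquiv.summable_iff, summable_sigma_of_nonneg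
    (f := (fun m => ‖s‖ ^ wt m) ∘ partitionEquiv) fun _ => pow_nonneg (norm_nonneg s) _]
  refine ⟨fun n => (hasSum_fintype _).summable, ?_⟩
  simp only [Function.comp_apply, wt_partitionEquiv, tsum_fintype, sum_const, nsmul_eq_mul]
  refine Summable.of_nonneg_of_le (fun n => by positivity) (fun n => ?_)
    (summable_geometric_of_lt_one (r := 2 * ‖s‖) (by positivity) (by linarith))
  rw [mul_pow, card_univ]
  gcongr
  exact_mod_cast card_partition_le n

lemma summable_weight (hs : ‖s‖ < 1 / 2) {g : Multiset ℕ → ℂ} (hg : ∀ m, ‖g m‖ ≤ 1) :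
    Summable fun m => g m * s ^ wt m :=
  (summable_pow_wt hs).of_norm_bounded fun m => by
    rw [norm_mul, norm_pow]
    exact mul_le_of_le_one_left (by positivity) (hg m)

lemma hasSum_weight (hs : ‖s‖ < 1 / 2) {g : Multiset ℕ → ℂ} (hg : ∀ m, ‖g m‖ ≤ 1) :
    HasSum (fun n => (∑ p : Nat.Partition n, g (p.parts.map Nat.pred)) * s ^ n)
      (∑' m, g m * s ^ wt m) := by
  have h := (summable_weight hs hg).hasSum
  rw [← partitionEquiv.hasSum_iff] at h
  convert h.sigma (fun n => hasSum_fintype _) using 2 with n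
  rw [sum_mul]
  refine sum_congr rfl fun p _ => ?_
  rw [Function.comp_apply, wt_partitionEquiv]
  rfl

end
end RankCrank

namespace RankCrank
open Filter Topology Finset
section
variable {s : ℂ} {y : ℕ → ℂ}

/-- The sum over all multisets of the products of the weights of their elements. -/
noncomputable def wsum (y : ℕ → ℂ) : ℂ := ∑' m : Multiset ℕ, (m.map y).prod

lemma norm_prod_map_le (hy : ∀ i, ‖y i‖ ≤ ‖s‖ ^ (i + 1)) (m : Multiset ℕ) :
    ‖(m.map y).prod‖ ≤ ‖s‖ ^ wt m := by
  induction m using Multiset.induction_on with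
  | empty => simp [wt]
  | cons a m ih =>
    rw [Multiset.map_cons, Multiset.prod_cons, norm_mul,
      show wt (a ::ₘ m) = (a + 1) + wt m by simp [wt]; omega, pow_add]
    exact mul_le_mul (hy a) ih (norm_nonneg _) (by positivity)

lemma prod_map_summable (hs : ‖s‖ < 1 / 2) (hy : ∀ i, ‖y i‖ ≤ ‖s‖ ^ (i + 1)) :
    Summable fun m : Multiset ℕ => (m.map y).prod :=
  (summable_pow_wt hs).of_norm_bounded (norm_prod_map_le hy)

lemma norm_update_zero_le (hy : ∀ i, ‖y i‖ ≤ ‖s‖ ^ (i + 1)) (N i : ℕ) :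
    ‖Function.update y N 0 i‖ ≤ ‖s‖ ^ (i + 1) := by
  rcases eq_or_ne i N with rfl | h
  · simp
  · rw [Function.update_of_ne h]; exact hy i

lemma wsum_mul_one_sub (hs : ‖s‖ < 1 / 2) (hy : ∀ i, ‖y i‖ ≤ ‖s‖ ^ (i + 1)) (N : ℕ) :
    wsum y * (1 - y N) = wsum (Function.update y N 0) := by
  have h1 := prod_map_summable hs hy
  have h2 := prod_map_summable hs (norm_update_zero_le hy N)
  have h3 : ∑' m : Multiset ℕ, ((m.map y).prod - (m.map (Function.update y N 0)).prod)
      = y N * wsum y := by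
    rw [wsum, ← tsum_mul_left, ← (show Function.Injective (Multiset.cons N) from
      fun a b h => (Multiset.cons_inj_right N).mp h).tsum_eq (f := fun m =>
      (m.map y).prod - (m.map (Function.update y N 0)).prod)]
    · simp
    · intro m hm
      by_contra hN
      refine hm (sub_eq_zero.mpr (congrArg _ (Multiset.map_congr rfl fun i hi => ?_)))
      rw [Function.update_of_ne]
      rintro rfl
      exact hN ⟨m.erase i, Multiset.cons_erase hi⟩
  rw [h1.tsum_sub h2] at h3
  rw [wsum, wsum] at *
  linear_combination h3

lemma wsum_mul_prod (hs : ‖s‖ < 1 / 2) (hy : ∀ i, ‖y i‖ ≤ ‖s‖ ^ (i + 1)) (n : ℕ) :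
    wsum y * ∏ i ∈ range n, (1 - y i) = wsum fun i => if i < n then 0 else y i := by
  induction n with
  | zero => simp
  | succ n ih =>
    have hy' : ∀ i, ‖if i < n then 0 else y i‖ ≤ ‖s‖ ^ (i + 1) := fun i => by
      split_ifs
      · simp
      · exact hy i
    have := wsum_mul_one_sub hs hy' n
    rw [if_neg (lt_irrefl n)] at this
    rw [prod_range_succ, ← mul_assoc, ih, this]
    congr 1
    ext i
    rcases eq_or_ne i n with rfl | h
    · simp
    · rw [Function.update_of_ne h]
      exact if_congr (by omega) rfl rfl

lemma wsum_zero : wsum (fun _ => 0) = 1 := by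
  rw [wsum, tsum_eq_single 0]
  · simp
  · intro m hm
    obtain ⟨a, ha⟩ := Multiset.exists_mem_of_ne_zero hm
    exact Multiset.prod_eq_zero (Multiset.mem_map.mpr ⟨a, ha, rfl⟩)

lemma wsum_mul_prod_eq_one (hs : ‖s‖ < 1 / 2) (hy : ∀ i, ‖y i‖ ≤ ‖s‖ ^ (i + 1)) {n : ℕ}
    (hn : ∀ i, n ≤ i → y i = 0) : wsum y * ∏ i ∈ range n, (1 - y i) = 1 := by
  rw [wsum_mul_prod hs hy, ← wsum_zero]
  congr 1
  ext i
  split_ifs with h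
  · rfl
  · exact hn i (not_lt.mp h)

lemma wsum_mul_tprod (hs : ‖s‖ < 1 / 2) (hy : ∀ i, ‖y i‖ ≤ ‖s‖ ^ (i + 1)) :
    wsum y * ∏' i, (1 - y i) = 1 := by
  have hm : Multipliable fun i => 1 - y i := by
    simp_rw [sub_eq_add_neg]
    refine multipliable_one_add_of_summable ?_
    simp_rw [norm_neg]
    refine Summable.of_nonneg_of_le (fun _ => norm_nonneg _) hy ?_
    exact (summable_nat_add_iff 1).mpr (summable_geometric_of_lt_one (norm_nonneg s) (by linarith))
  refine tendsto_nhds_unique (hm.hasProd.tendsto_prod_nat.const_mul (wsum y)) ?_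
  simp_rw [wsum_mul_prod hs hy]
  rw [← wsum_zero]
  refine tendsto_tsum_of_dominated_convergence (summable_pow_wt hs) (fun m => ?_)
    (Eventually.of_forall fun n => norm_prod_map_le fun i => ?_)
  · refine tendsto_const_nhds.congr' ?_
    filter_upwards [eventually_gt_atTop m.sup] with n hn
    refine congrArg _ (Multiset.map_congr rfl fun i hi => ?_)
    rw [if_pos ((Multiset.le_sup hi).trans_lt hn)]
  · split_ifs
    · simp
    · exact hy i

lemma prod_map_mul_pow (x : ℕ → ℂ) (m : Multiset ℕ) :
    (m.map fun i => x i * s ^ (i + 1)).prod = (m.map x).prod * s ^ wt m := by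
  induction m using Multiset.induction_on with
  | empty => simp [wt]
  | cons a m ih =>
    rw [Multiset.map_cons, Multiset.prod_cons, ih, Multiset.map_cons, Multiset.prod_cons,
      show wt (a ::ₘ m) = (a + 1) + wt m by simp [wt]; omega, pow_add]
    ring

lemma norm_mul_pow_le {x : ℕ → ℂ} (hx : ∀ i, ‖x i‖ ≤ 1) (i : ℕ) :
    ‖x i * s ^ (i + 1)‖ ≤ ‖s‖ ^ (i + 1) := by
  rw [norm_mul, norm_pow]
  exact mul_le_of_le_one_left (by positivity) (hx i)

/-- Euler's product for the partition generating function. -/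
lemma tsum_pow_wt_mul (hs : ‖s‖ < 1 / 2) : (∑' m : Multiset ℕ, s ^ wt m) * qp s s = 1 := by
  have h := wsum_mul_tprod hs (norm_mul_pow_le (s := s) (x := fun _ => 1) fun _ => by simp)
  simp only [wsum, prod_map_mul_pow] at h
  simpa [qp, pow_succ'] using h

end
end RankCrank

namespace RankCrank
open Filter Topology Finset
section
variable {s : ℂ}

/-- The rank of the partition whose parts are the elements of `m` increased by one. -/
def rk (m : Multiset ℕ) : ℤ := ((m.map Nat.succ).sup : ℤ) - (Multiset.card m : ℤ)

/-- Discard the zeros of a multiset and decrease the other elements by one. -/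
def dropZeros (m : Multiset ℕ) : Multiset ℕ := (m.filter (· ≠ 0)).map Nat.pred

lemma map_succ_dropZeros (m : Multiset ℕ) : (dropZeros m).map Nat.succ = m.filter (· ≠ 0) :=
  map_succ_map_pred fun _ hi => Nat.pos_of_ne_zero (Multiset.mem_filter.mp hi).2

lemma filter_ne_zero_add_replicate (m : Multiset ℕ) :
    m.filter (· ≠ 0) + Multiset.replicate (m.card - (m.filter (· ≠ 0)).card) 0 = m := by
  have h := Multiset.filter_add_not (· ≠ 0) m
  have h2 : m.filter (fun a => ¬ a ≠ 0) = Multiset.replicate (m.filter (fun a => ¬ a ≠ 0)).card 0 :=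
    Multiset.eq_replicate_card.mpr fun b hb => not_not.mp (Multiset.mem_filter.mp hb).2
  have h3 := congrArg Multiset.card h
  rw [Multiset.card_add] at h3
  rw [show m.card - (m.filter (· ≠ 0)).card = (m.filter (fun a => ¬ a ≠ 0)).card by omega, ← h2, h]

lemma sum_filter_ne_zero (m : Multiset ℕ) : (m.filter (· ≠ 0)).sum = m.sum := by
  conv_rhs => rw [← filter_ne_zero_add_replicate m]
  simp

lemma wt_dropZeros (m : Multiset ℕ) : wt (dropZeros m) = m.sum := by
  rw [← sum_map_succ, map_succ_dropZeros, sum_filter_ne_zero]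

lemma sup_filter_ne_zero (m : Multiset ℕ) : (m.filter (· ≠ 0)).sup = m.sup := by
  conv_rhs => rw [← filter_ne_zero_add_replicate m, Multiset.sup_add]
  have : (Multiset.replicate (m.card - (m.filter (· ≠ 0)).card) 0).sup = 0 :=
    le_antisymm (Multiset.sup_le.mpr fun b hb => (Multiset.eq_of_mem_replicate hb).le) (Nat.zero_le _)
  rw [this]; simp

lemma sup_mem_of_ne_zero {m : Multiset ℕ} (h : m ≠ 0) : m.sup ∈ m := by
  induction m using Multiset.induction_on with
  | empty => exact absurd rfl h
  | cons a m ih =>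
    rw [Multiset.sup_cons]
    rcases eq_or_ne m 0 with rfl | h0
    · simp
    · rcases le_total a m.sup with h1 | h1
      · rw [sup_eq_right.mpr h1]; exact Multiset.mem_cons_of_mem (ih h0)
      · rw [sup_eq_left.mpr h1]; exact Multiset.mem_cons_self a m

lemma sup_map_succ {m : Multiset ℕ} (h : m ≠ 0) : (m.map Nat.succ).sup = m.sup + 1 := by
  refine le_antisymm (Multiset.sup_le.mpr fun b hb => ?_) (Multiset.le_sup ?_)
  · obtain ⟨a, ha, rfl⟩ := Multiset.mem_map.mp hb
    exact Nat.succ_le_succ (Multiset.le_sup ha)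
  · exact Multiset.mem_map_of_mem Nat.succ (sup_mem_of_ne_zero h)

/-- Dyson's adjoint map. -/
def dyson (r : ℤ) (m : Multiset ℕ) : Multiset ℕ := dropZeros ((m.card + r).toNat ::ₘ m)

/-- The inverse of Dyson's adjoint map. -/
def dysonInv (r : ℤ) (m : Multiset ℕ) : Multiset ℕ :=
  (m.map Nat.succ).erase (m.map Nat.succ).sup + Multiset.replicate
    (((m.map Nat.succ).sup - r).toNat - ((m.map Nat.succ).erase (m.map Nat.succ).sup).card) 0

/-- The domain of Dyson's adjoint map. -/
def dysonDom (r : ℤ) : Set (Multiset ℕ) := {m | (m.sup : ℤ) ≤ m.card + r}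

/-- The image of Dyson's adjoint map. -/
def dysonRange (r : ℤ) : Set (Multiset ℕ) :=
  {m | ((m.card - 1 : ℕ) : ℤ) ≤ ((m.map Nat.succ).sup : ℤ) - r}

lemma wt_dyson {r : ℤ} {m : Multiset ℕ} (hm : m ∈ dysonDom r) : (wt (dyson r m) : ℤ) = wt m + r := by
  have : (m.sup : ℤ) ≤ m.card + r := hm
  rw [dyson, wt_dropZeros, Multiset.sum_cons, wt]
  push_cast
  omega

lemma sup_dyson {r : ℤ} {m : Multiset ℕ} (hm : m ∈ dysonDom r) :
    ((dyson r m).map Nat.succ).sup = (m.card + r).toNat := by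
  have : (m.sup : ℤ) ≤ m.card + r := hm
  rw [dyson, map_succ_dropZeros, sup_filter_ne_zero, Multiset.sup_cons]
  refine sup_eq_left.mpr ?_
  omega

lemma card_erase_sup (m : Multiset ℕ) :
    ((m.map Nat.succ).erase (m.map Nat.succ).sup).card = m.card - 1 := by
  rcases eq_or_ne m 0 with rfl | h
  · simp
  · rw [Multiset.card_erase_of_mem (sup_mem_of_ne_zero (by simpa using h)), Multiset.card_map]
    rfl

lemma dyson_bijOn (r : ℤ) : Set.BijOn (dyson r) (dysonDom r) (dysonRange r) := by
  refine Set.InvOn.bijOn (f' := dysonInv r) ⟨?_, ?_⟩ ?_ ?_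
  · intro m hm
    have h0 : (m.sup : ℤ) ≤ m.card + r := hm
    have h1 : ((dyson r m).map Nat.succ).erase (m.card + r).toNat = m.filter (· ≠ 0) := by
      rw [dyson, map_succ_dropZeros]
      rcases eq_or_ne (m.card + r).toNat 0 with h | h
      · rw [Multiset.filter_cons_of_neg _ (by simpa using h), h]
        exact Multiset.erase_of_notMem (by simp)
      · rw [Multiset.filter_cons_of_pos (p := (· ≠ 0)) _ h, Multiset.erase_cons_head]
    rw [dysonInv, sup_dyson hm, h1, show ((((m.card + r).toNat : ℕ) : ℤ) - r).toNat = m.card by omega]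
    exact filter_ne_zero_add_replicate m
  · intro m hm
    have h0 : ((m.card - 1 : ℕ) : ℤ) ≤ ((m.map Nat.succ).sup : ℤ) - r := hm
    have hc : ((dysonInv r m).card : ℤ) + r = (m.map Nat.succ).sup := by
      rw [dysonInv, Multiset.card_add, Multiset.card_replicate, card_erase_sup]
      omega
    rw [dyson, hc, Int.toNat_natCast, dysonInv, dropZeros]
    rcases eq_or_ne m 0 with rfl | h
    · simp only [Multiset.map_eq_zero, Multiset.filter_eq_nil]
      simp only [Multiset.map_zero, Multiset.sup_zero, Multiset.erase_zero, zero_add]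
      intro a ha
      rcases Multiset.mem_cons.mp ha with rfl | ha
      · simp
      · exact not_not.mpr (Multiset.eq_of_mem_replicate ha)
    · rw [← Multiset.cons_add, Multiset.cons_erase (sup_mem_of_ne_zero (by simpa using h)),
        Multiset.filter_add, Multiset.filter_eq_self.mpr, Multiset.filter_eq_nil.mpr, add_zero,
        map_pred_map_succ]
      · intro a ha; simpa using Multiset.eq_of_mem_replicate ha
      · intro a ha
        obtain ⟨b, _, rfl⟩ := Multiset.mem_map.mp ha
        exact b.succ_ne_zero
  · intro m hm
    have h0 : (m.sup : ℤ) ≤ m.card + r := hm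
    change (((dyson r m).card - 1 : ℕ) : ℤ) ≤ _
    rw [sup_dyson hm]
    have : (dyson r m).card ≤ m.card + 1 := by
      rw [dyson, dropZeros, Multiset.card_map, ← Multiset.card_cons (m.card + r).toNat m]
      exact Multiset.card_le_card (Multiset.filter_le _ _)
    omega
  · intro m hm
    have h0 : ((m.card - 1 : ℕ) : ℤ) ≤ ((m.map Nat.succ).sup : ℤ) - r := hm
    change ((dysonInv r m).sup : ℤ) ≤ (dysonInv r m).card + r
    have hc : ((dysonInv r m).card : ℤ) + r = (m.map Nat.succ).sup := by
      rw [dysonInv, Multiset.card_add, Multiset.card_replicate, card_erase_sup]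
      omega
    rw [hc, Nat.cast_le]
    refine Multiset.sup_le.mpr fun b hb => ?_
    rcases Multiset.mem_add.mp hb with hb | hb
    · exact Multiset.le_sup (Multiset.mem_of_mem_erase hb)
    · rw [Multiset.eq_of_mem_replicate hb]; exact Nat.zero_le _

end
end RankCrank

namespace RankCrank
open Filter Topology Finset
section
variable {s : ℂ}

lemma tsum_dyson (r : ℤ) (f : Multiset ℕ → ℂ) :
    ∑' m, (dysonRange r).indicator f m = ∑' m, (dysonDom r).indicator (fun m => f (dyson r m)) m := by
  rw [← _root_.tsum_subtype, ← _root_.tsum_subtype, ← (dyson_bijOn r).equiv.tsum_eq]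
  rfl

/-- The generating function of all partitions. -/
noncomputable def pgf (s : ℂ) : ℂ := ∑' m : Multiset ℕ, s ^ wt m

open Classical in
/-- The generating function of the partitions satisfying a condition. -/
noncomputable def cgf (p : Multiset ℕ → Prop) (s : ℂ) : ℂ :=
  ∑' m : Multiset ℕ, if p m then s ^ wt m else 0

open Classical in
lemma cgf_summable (hs : ‖s‖ < 1 / 2) (p : Multiset ℕ → Prop) :
    Summable fun m : Multiset ℕ => if p m then s ^ wt m else 0 :=
  (summable_pow_wt hs).of_norm_bounded fun m => by
    split_ifs
    · rw [norm_pow]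
    · simp

lemma norm_cgf_le (hs : ‖s‖ < 1 / 2) (p : Multiset ℕ → Prop) :
    ‖cgf p s‖ ≤ ∑' m : Multiset ℕ, ‖s‖ ^ wt m := by
  classical
  refine tsum_of_norm_bounded (summable_pow_wt hs).hasSum fun m => ?_
  split_ifs
  · rw [norm_pow]
  · simp

lemma cgf_not (hs : ‖s‖ < 1 / 2) (p : Multiset ℕ → Prop) :
    cgf (fun m => ¬ p m) s = pgf s - cgf p s := by
  classical
  rw [eq_sub_iff_add_eq, cgf, cgf, pgf, ← (cgf_summable hs _).tsum_add (cgf_summable hs _)]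
  refine tsum_congr fun m => ?_
  by_cases h : p m <;> simp [h]

lemma cgf_or (hs : ‖s‖ < 1 / 2) {p p' : Multiset ℕ → Prop} (h : ∀ m, p m → ¬ p' m) :
    cgf (fun m => p m ∨ p' m) s = cgf p s + cgf p' s := by
  classical
  rw [cgf, cgf, cgf, ← (cgf_summable hs _).tsum_add (cgf_summable hs _)]
  refine tsum_congr fun m => ?_
  by_cases h1 : p m
  · simp [h1, h m h1]
  · simp [h1]

lemma cgf_congr {p p' : Multiset ℕ → Prop} (h : ∀ m, p m ↔ p' m) : cgf p s = cgf p' s :=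
  congrArg (cgf · s) (funext fun m => propext (h m))

lemma cgf_eq_zero (p : Prop) [Decidable p] :
    cgf (fun m => p ∧ m = 0) s = if p then 1 else 0 := by
  classical
  rw [cgf, tsum_eq_single 0]
  · simp [wt]
  · intro m hm
    simp [hm]

lemma rk_zero : rk 0 = 0 := by simp [rk]

lemma rk_of_ne_zero {m : Multiset ℕ} (h : m ≠ 0) : rk m = m.sup + 1 - m.card := by
  rw [rk, sup_map_succ h]; push_cast; ring

lemma cgf_rk_ge (hs : ‖s‖ < 1 / 2) (t : ℕ) :
    cgf (fun m => (t : ℤ) ≤ rk m) s = (if t = 0 then 1 else 0)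
      + s ^ (t + 1) * (pgf s - cgf (fun m => ((t + 3 : ℕ) : ℤ) ≤ rk m) s) := by
  classical
  have h1 : cgf (fun m => (t : ℤ) ≤ rk m) s
      = cgf (fun m => t = 0 ∧ m = 0) s + cgf (fun m => m ∈ dysonRange (t + 1)) s := by
    rw [← cgf_or hs]
    · refine cgf_congr fun m => ?_
      rcases eq_or_ne m 0 with rfl | h
      · simp [rk_zero, dysonRange]; omega
      · simp only [h, and_false, false_or, dysonRange, Set.mem_ofPred_eq, sup_map_succ h,
          rk_of_ne_zero h]
        have := Multiset.card_pos.mpr h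
        omega
    · rintro m ⟨rfl, rfl⟩
      simp [dysonRange]
  have h2 : cgf (fun m => m ∈ dysonRange (t + 1)) s
      = s ^ (t + 1) * cgf (fun m => ¬ ((t + 3 : ℕ) : ℤ) ≤ rk m) s := by
    have := tsum_dyson (t + 1) fun m => s ^ wt m
    simp only [Set.indicator_apply] at this
    rw [cgf, this, cgf, ← tsum_mul_left]
    refine tsum_congr fun m => ?_
    rw [mul_ite, mul_zero]
    have h3 : m ∈ dysonDom (t + 1) ↔ ¬ ((t + 3 : ℕ) : ℤ) ≤ rk m := by
      rcases eq_or_ne m 0 with rfl | h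
      · simp [rk_zero, dysonDom]; omega
      · simp only [dysonDom, Set.mem_ofPred_eq, rk_of_ne_zero h]
        push_cast
        omega
    by_cases h : m ∈ dysonDom (t + 1)
    · rw [if_pos h, if_pos (h3.mp h), ← pow_add]
      congr 1
      have := wt_dyson h
      omega
    · rw [if_neg h, if_neg (mt h3.mpr h)]
  rw [h1, h2, cgf_eq_zero, cgf_not hs]

lemma cgf_rk_le (hs : ‖s‖ < 1 / 2) (t : ℕ) :
    cgf (fun m => rk m ≤ -(t : ℤ)) s = (if t = 0 then 1 else 0)
      + s ^ (t + 1) * (pgf s - cgf (fun m => rk m ≤ -((t + 3 : ℕ) : ℤ)) s) := by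
  classical
  have h1 : cgf (fun m => rk m ≤ -(t : ℤ)) s
      = cgf (fun m => t = 0 ∧ m = 0) s + cgf (fun m => m ∈ dysonDom (-(t + 1))) s := by
    rw [← cgf_or hs]
    · refine cgf_congr fun m => ?_
      rcases eq_or_ne m 0 with rfl | h
      · simp [rk_zero, dysonDom]; omega
      · simp only [h, and_false, false_or, dysonDom, Set.mem_ofPred_eq, rk_of_ne_zero h]
        omega
    · rintro m ⟨rfl, rfl⟩
      simp [dysonDom]
  have h2 : cgf (fun m => m ∈ dysonDom (-(t + 1))) s
      = s ^ (t + 1) * cgf (fun m => ¬ rk m ≤ -((t + 3 : ℕ) : ℤ)) s := by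
    have := tsum_dyson (-(t + 1)) fun m => s ^ (t + 1) * s ^ wt m
    simp only [Set.indicator_apply] at this
    rw [cgf, cgf, ← tsum_mul_left]
    convert this.symm using 1
    · refine tsum_congr fun m => ?_
      by_cases h : m ∈ dysonDom (-(t + 1))
      · rw [if_pos h, if_pos h, ← pow_add]
        congr 1
        have := wt_dyson h
        omega
      · rw [if_neg h, if_neg h]
    · refine tsum_congr fun m => ?_
      rw [mul_ite, mul_zero]
      have h3 : ¬ rk m ≤ -((t + 3 : ℕ) : ℤ) ↔ m ∈ dysonRange (-(t + 1)) := by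
        rcases eq_or_ne m 0 with rfl | h
        · simp [rk_zero, dysonRange]; omega
        · simp only [dysonRange, Set.mem_ofPred_eq, sup_map_succ h, rk_of_ne_zero h]
          have := Multiset.card_pos.mpr h
          push_cast
          omega
      by_cases h : m ∈ dysonRange (-(t + 1))
      · rw [if_pos h, if_pos (h3.mpr h)]
      · rw [if_neg h, if_neg (mt h3.mp h)]
  rw [h1, h2, cgf_eq_zero, cgf_not hs]

end
end RankCrank

namespace RankCrank
open Filter Topology Finset
section
variable {s : ℂ}

/-- A signed partial theta series attached to the rank. -/
noncomputable def rkS (s : ℂ) (t : ℤ) : ℂ := -∑' n : ℕ, thc (s ^ 3) (-s ^ (t - 2)) (n + 1)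

/-- A one-sided Appell sum attached to the rank. -/
noncomputable def rkU (s : ℂ) (t : ℤ) : ℂ :=
  -∑' n : ℕ, thc (s ^ 3) (-s ^ (t - 2)) (n + 1) / (1 - 1 * (s ^ 11) ^ ((n : ℤ) + 1))

lemma norm_pow_lt_one (hn : ‖s‖ < 1) {k : ℕ} (hk : k ≠ 0) : ‖s ^ k‖ < 1 := by
  rw [norm_pow]; exact pow_lt_one₀ (norm_nonneg _) hn hk

lemma natCast_add_one_injective : Function.Injective fun n : ℕ => (n : ℤ) + 1 :=
  fun a b h => by simpa using h

lemma rkS_summable (hn : ‖s‖ < 1) (h0 : s ≠ 0) (t : ℤ) :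
    Summable fun n : ℕ => ‖thc (s ^ 3) (-s ^ (t - 2)) (n + 1)‖ :=
  (thc_summable (norm_pow_lt_one hn three_ne_zero) (pow_ne_zero 3 h0)
    (neg_ne_zero.mpr (zpow_ne_zero (t - 2) h0))).comp_injective natCast_add_one_injective

lemma rkU_summable (hn : ‖s‖ < 1) (h0 : s ≠ 0) (t : ℤ) :
    Summable fun n : ℕ => thc (s ^ 3) (-s ^ (t - 2)) (n + 1) / (1 - 1 * (s ^ 11) ^ ((n : ℤ) + 1)) :=
  (al_summable (norm_pow_lt_one hn (by norm_num)) (pow_ne_zero 11 h0)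
    (thc_summable (norm_pow_lt_one hn three_ne_zero) (pow_ne_zero 3 h0)
      (neg_ne_zero.mpr (zpow_ne_zero (t - 2) h0))) one_ne_zero).comp_injective
        natCast_add_one_injective

lemma one_sub_pow_ne_zero (hn : ‖s‖ < 1) (n : ℕ) : 1 - 1 * (s ^ 11) ^ ((n : ℤ) + 1) ≠ 0 := by
  intro h
  have h1 : (s ^ 11) ^ (n + 1) = 1 := by
    rw [one_mul] at h; exact_mod_cast (sub_eq_zero.mp h).symm
  have := norm_pow_lt_one (norm_pow_lt_one hn (k := 11) (by norm_num)) n.succ_ne_zero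
  rw [h1, norm_one] at this
  exact lt_irrefl _ this

lemma thc_shift (h0 : s ≠ 0) (t u n : ℤ) :
    thc (s ^ 3) (-s ^ (t + u - 2)) n = thc (s ^ 3) (-s ^ (t - 2)) n * s ^ (u * n) := by
  rw [zpow_mul, thc_mul_zpow, neg_mul, ← zpow_add₀ h0]
  congr 3; ring

lemma rkU_sub (hn : ‖s‖ < 1) (h0 : s ≠ 0) (t : ℤ) : rkU s t - rkU s (t + 11) = rkS s t := by
  rw [rkU, rkU, rkS, neg_sub_neg, ← (rkU_summable hn h0 (t + 11)).tsum_sub (rkU_summable hn h0 t),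
    ← tsum_neg]
  refine tsum_congr fun n => ?_
  have := one_sub_pow_ne_zero hn n
  rw [thc_shift h0, zpow_mul]
  rw [show s ^ (11 : ℤ) = s ^ 11 from by norm_cast, ← sub_div, div_eq_iff this]
  ring

lemma rkS_eq (hn : ‖s‖ < 1) (h0 : s ≠ 0) (t : ℕ) :
    rkS s t = s ^ (t + 1) * (1 - rkS s ((t + 3 : ℕ) : ℤ)) := by
  have hw : -s ^ ((t : ℤ) - 2) ≠ 0 := neg_ne_zero.mpr (zpow_ne_zero _ h0)
  have h3 : s ^ 3 ≠ 0 := pow_ne_zero 3 h0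
  have hp : -s ^ ((t : ℤ) - 2) * s ^ 3 = -s ^ (t + 1) := by
    rw [neg_mul, ← zpow_natCast s 3, ← zpow_add₀ h0, ← zpow_natCast]
    congr 2; push_cast; ring
  rw [rkS, rkS, (rkS_summable hn h0 t).of_norm.tsum_eq_zero_add]
  have h : ∀ n : ℕ, thc (s ^ 3) (-s ^ ((t : ℤ) - 2)) ((n + 1 : ℕ) + 1)
      = -s ^ (t + 1) * thc (s ^ 3) (-s ^ (((t + 3 : ℕ) : ℤ) - 2)) (n + 1) := fun n => by
    rw [show ((t + 3 : ℕ) : ℤ) = (t : ℤ) + 3 by push_cast; rfl, show ((n + 1 : ℕ) : ℤ) = n + 1 by push_cast; rfl, thc_add_one h3 hw, thc_shift h0, zpow_add_one₀ h3, zpow_mul,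
      ← hp]
    rw [show s ^ (3 : ℤ) = s ^ 3 from by norm_cast]
    ring
  simp_rw [h]
  rw [tsum_mul_left, Nat.cast_zero, thc_add_one h3 hw, thc_zero, zero_add, zpow_one, hp]
  ring

lemma norm_thc_le (hn : ‖s‖ < 1) (h0 : s ≠ 0) (t n : ℕ) :
    ‖thc (s ^ 3) (-s ^ ((t : ℤ) - 2)) (n + 1)‖ ≤ ‖thc (s ^ 3) (-s ^ ((0 : ℤ) - 2)) (n + 1)‖ := by
  have := thc_shift h0 0 t (n + 1)
  rw [zero_add] at this
  rw [this, norm_mul]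
  refine mul_le_of_le_one_right (norm_nonneg _) ?_
  rw [show (t : ℤ) * (n + 1) = ((t * (n + 1) : ℕ) : ℤ) by push_cast; ring, zpow_natCast, norm_pow]
  exact pow_le_one₀ (norm_nonneg _) hn.le

lemma norm_rkS_le (hn : ‖s‖ < 1) (h0 : s ≠ 0) (t : ℕ) :
    ‖rkS s t‖ ≤ ∑' n : ℕ, ‖thc (s ^ 3) (-s ^ ((0 : ℤ) - 2)) (n + 1)‖ := by
  rw [rkS, norm_neg]
  exact tsum_of_norm_bounded (rkS_summable hn h0 0).hasSum fun n => norm_thc_le hn h0 t n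

lemma rkU_tendsto (hn : ‖s‖ < 1) (h0 : s ≠ 0) :
    Tendsto (fun t : ℕ => rkU s t) atTop (𝓝 0) := by
  have h : Tendsto (fun t : ℕ => ∑' n : ℕ, thc (s ^ 3) (-s ^ ((t : ℤ) - 2)) (n + 1) /
      (1 - 1 * (s ^ 11) ^ ((n : ℤ) + 1))) atTop (𝓝 (∑' _ : ℕ, 0)) := by
    refine tendsto_tsum_of_dominated_convergence (rkU_summable hn h0 0).norm (fun n => ?_)
      (Eventually.of_forall fun t n => ?_)
    · have h1 : ∀ t : ℕ, thc (s ^ 3) (-s ^ ((t : ℤ) - 2)) (n + 1) /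
          (1 - 1 * (s ^ 11) ^ ((n : ℤ) + 1)) = thc (s ^ 3) (-s ^ ((0 : ℤ) - 2)) (n + 1) /
          (1 - 1 * (s ^ 11) ^ ((n : ℤ) + 1)) * (s ^ (n + 1)) ^ t := fun t => by
        have := thc_shift h0 0 t (n + 1)
        rw [zero_add] at this
        rw [this, ← pow_mul, ← zpow_natCast s ((n + 1) * t)]
        push_cast
        rw [mul_comm (t : ℤ)]
        ring
      simp_rw [h1]
      have := (tendsto_pow_atTop_nhds_zero_of_norm_lt_one
        (norm_pow_lt_one hn n.succ_ne_zero)).const_mul (thc (s ^ 3) (-s ^ ((0 : ℤ) - 2)) (n + 1) /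
          (1 - 1 * (s ^ 11) ^ ((n : ℤ) + 1)))
      rwa [mul_zero] at this
    · rw [norm_div, norm_div]
      gcongr
      exact norm_thc_le hn h0 t n
  simpa [rkU] using h.neg

lemma thc_reflect (h0 : s ≠ 0) (k n : ℤ) :
    thc (s ^ 3) (-s ^ (10 - k - 2)) (n + 1)
      = (s ^ 11) ^ (n + 1) * thc (s ^ 3) (-s ^ k) (-(n + 1)) := by
  have h3 : s ^ 3 ≠ 0 := pow_ne_zero 3 h0
  have hk : -s ^ k ≠ 0 := neg_ne_zero.mpr (zpow_ne_zero k h0)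
  have h4 := thc_shift h0 (2 - k) 8 (n + 1)
  rw [show 2 - k + 8 - 2 = 10 - k - 2 by ring, show 2 - k - 2 = -k by ring, zpow_neg,
    ← inv_neg, thc_add_one h3 (inv_ne_zero hk)] at h4
  rw [h4, thc_neg_add_one hk, zpow_mul, show s ^ (8 : ℤ) = s ^ 8 from by norm_cast,
    show s ^ 11 = s ^ 3 * s ^ 8 by ring, mul_zpow]
  ring

lemma div_one_sub_inv {a b x : ℂ} (hx : x ≠ 0) (h : 1 - 1 * x ≠ 0) (hb : b = x * a) :
    a / (1 - 1 * x⁻¹) = -(b / (1 - 1 * x)) := by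
  have h5 : 1 - 1 * x⁻¹ ≠ 0 := by
    intro h'
    apply h
    linear_combination -x * h' - mul_inv_cancel₀ hx
  rw [← neg_div, div_eq_div_iff h5 h, hb]
  linear_combination -a * mul_inv_cancel₀ hx

lemma lr_eq (hn : ‖s‖ < 1) (h0 : s ≠ 0) (k : ℤ) : lr s k = rkU s (10 - k) - rkU s (k + 2) := by
  have h11 : s ^ 11 ≠ 0 := pow_ne_zero 11 h0
  have hneg : ∀ n : ℕ, thc (s ^ 3) (-s ^ k) (-((n : ℤ) + 1)) /
      (1 - 1 * (s ^ 11) ^ (-((n : ℤ) + 1)))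
      = -(thc (s ^ 3) (-s ^ (10 - k - 2)) ((n : ℤ) + 1) / (1 - 1 * (s ^ 11) ^ ((n : ℤ) + 1))) := by
    intro n
    rw [zpow_neg]
    exact div_one_sub_inv (zpow_ne_zero _ h11) (one_sub_pow_ne_zero hn n) (thc_reflect h0 k n)
  have hS := al_summable (norm_pow_lt_one hn (k := 11) (by norm_num)) h11
    (thc_summable (norm_pow_lt_one hn three_ne_zero) (pow_ne_zero 3 h0)
      (neg_ne_zero.mpr (zpow_ne_zero k h0))) one_ne_zero
  have hf1 : Summable fun n : ℕ => thc (s ^ 3) (-s ^ k) ((n : ℤ) + 1) /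
      (1 - 1 * (s ^ 11) ^ ((n : ℤ) + 1)) := hS.comp_injective natCast_add_one_injective
  have hf2 : Summable fun n : ℕ => thc (s ^ 3) (-s ^ k) (-((n : ℤ) + 1)) /
      (1 - 1 * (s ^ 11) ^ (-((n : ℤ) + 1))) :=
    hS.comp_injective (neg_injective.comp natCast_add_one_injective)
  have h := tsum_of_add_one_of_neg_add_one
    (f := fun n : ℤ => thc (s ^ 3) (-s ^ k) n / (1 - 1 * (s ^ 11) ^ n)) hf1 hf2
  rw [tsum_congr hneg, tsum_neg] at h
  rw [lr, al, h, rkU, rkU, add_sub_cancel_right, zpow_zero, one_mul, sub_self, div_zero]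
  ring

end
end RankCrank

namespace RankCrank
open Filter Topology Finset
section
variable {s : ℂ}

lemma eq_zero_of_backward_recurrence (hs : ‖s‖ < 1 / 2) {X : ℕ → ℂ} {C : ℝ}
    (hC : ∀ t, ‖X t‖ ≤ C) (h : ∀ t, X t = -(s ^ (t + 1) * X (t + 3))) (t : ℕ) : X t = 0 := by
  have key (n : ℕ) : ∀ t, ‖X t‖ ≤ ‖s‖ ^ n * C := by
    induction n with
    | zero => simpa using hC
    | succ n ih =>
      intro t
      rw [h t, norm_neg, norm_mul, norm_pow, pow_succ' ‖s‖ n, mul_assoc]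
      refine mul_le_mul ?_ (ih _) (norm_nonneg _) (norm_nonneg _)
      exact pow_le_of_le_one (norm_nonneg _) (by linarith) t.succ_ne_zero
  have hl := (tendsto_pow_atTop_nhds_zero_of_lt_one (norm_nonneg s) (by linarith)).mul_const C
  rw [zero_mul] at hl
  exact norm_le_zero_iff.mp (ge_of_tendsto' hl fun n => key n t)

lemma cgf_eq_rkS (hs : ‖s‖ < 1 / 2) (h0 : s ≠ 0) {p : ℕ → Multiset ℕ → Prop}
    (h : ∀ t, cgf (p t) s = (if t = 0 then 1 else 0) + s ^ (t + 1) * (pgf s - cgf (p (t + 3)) s))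
    (t : ℕ) : cgf (p t) s = (if t = 0 then 1 else 0) + pgf s * rkS s t := by
  have hn : ‖s‖ < 1 := by linarith
  have := eq_zero_of_backward_recurrence hs
    (X := fun t => cgf (p t) s - (if t = 0 then 1 else 0) - pgf s * rkS s t)
    (C := (∑' m : Multiset ℕ, ‖s‖ ^ wt m) + 1
      + ‖pgf s‖ * ∑' n : ℕ, ‖thc (s ^ 3) (-s ^ ((0 : ℤ) - 2)) (n + 1)‖) (fun t => ?_) (fun t => ?_) t
  · linear_combination this
  · refine (norm_sub_le _ _).trans (add_le_add ((norm_sub_le _ _).trans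
      (add_le_add (norm_cgf_le hs _) ?_)) ?_)
    · split_ifs <;> simp
    · rw [norm_mul]
      exact mul_le_mul_of_nonneg_left (norm_rkS_le hn h0 t) (norm_nonneg _)
  · rw [h t, rkS_eq hn h0 t, if_neg (show t + 3 ≠ 0 by omega)]
    ring

lemma cgf_arith (hs : ‖s‖ < 1 / 2) (h0 : s ≠ 0) {ρ : Multiset ℕ → ℤ}
    (h : ∀ t : ℕ, cgf (fun m => (t : ℤ) ≤ ρ m) s = (if t = 0 then 1 else 0) + pgf s * rkS s t)
    (t : ℕ) : cgf (fun m => (t : ℤ) ≤ ρ m ∧ 11 ∣ ρ m - t) s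
      = (if t = 0 then 1 else 0) + pgf s * (rkU s t - rkU s (t + 1)) := by
  classical
  have hn : ‖s‖ < 1 := by linarith
  set D : ℕ → ℂ := fun t => cgf (fun m => (t : ℤ) ≤ ρ m ∧ 11 ∣ ρ m - t) s
    - pgf s * (rkU s t - rkU s (t + 1)) with hD
  have h1 (t : ℕ) : D t = (if t = 0 then 1 else 0) + D (t + 11) := by
    have e1 : cgf (fun m => (t : ℤ) ≤ ρ m) s
        = cgf (fun m => ((t + 1 : ℕ) : ℤ) ≤ ρ m) s + cgf (fun m => ρ m = t) s := by
      rw [← cgf_or hs fun m _ => by omega]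
      exact cgf_congr fun m => by omega
    have e2 : cgf (fun m => (t : ℤ) ≤ ρ m ∧ 11 ∣ ρ m - t) s = cgf (fun m => ρ m = t) s
        + cgf (fun m => ((t + 11 : ℕ) : ℤ) ≤ ρ m ∧ 11 ∣ ρ m - ((t + 11 : ℕ) : ℤ)) s := by
      rw [← cgf_or hs fun m _ => by omega]
      exact cgf_congr fun m => by omega
    rw [h t, h (t + 1), if_neg t.succ_ne_zero, ← rkU_sub hn h0, ← rkU_sub hn h0] at e1
    simp only [hD]
    rw [e2]
    push_cast at e1 ⊢
    rw [show (t : ℤ) + 11 + 1 = t + 1 + 11 by ring]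
    linear_combination -e1
  have h2 : Tendsto D atTop (𝓝 0) := by
    have hU := rkU_tendsto hn h0
    have hU' := hU.comp (tendsto_add_atTop_nat 1)
    have hc : Tendsto (fun t : ℕ => cgf (fun m => (t : ℤ) ≤ ρ m ∧ 11 ∣ ρ m - t) s) atTop
        (𝓝 (∑' _ : Multiset ℕ, 0)) := by
      refine tendsto_tsum_of_dominated_convergence (summable_pow_wt hs) (fun m => ?_)
        (Eventually.of_forall fun t m => ?_)
      · refine tendsto_const_nhds.congr' ?_
        filter_upwards [eventually_gt_atTop (ρ m).toNat] with t ht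
        rw [if_neg]
        omega
      · split_ifs
        · rw [norm_pow]
        · simp
    have := hc.sub ((hU.sub hU').const_mul (pgf s))
    simpa [hD, Function.comp_def] using this
  have h3 (t n : ℕ) : D t = (if t = 0 then 1 else 0) + D (t + 11 * (n + 1)) := by
    induction n with
    | zero => exact h1 t
    | succ n ih => rw [ih, h1 (t + 11 * (n + 1)), if_neg (show t + 11 * (n + 1) ≠ 0 by omega), zero_add]; rfl
  have h4 : D t = (if t = 0 then 1 else 0) := by
    refine tendsto_nhds_unique (tendsto_const_nhds (x := D t) (f := atTop (α := ℕ))) ?_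
    refine Tendsto.congr (fun n => (h3 t n).symm) ?_
    have hi : Tendsto (fun n => t + 11 * (n + 1)) atTop atTop :=
      tendsto_atTop_mono (fun n => show n ≤ t + 11 * (n + 1) by omega) tendsto_id
    have := (h2.comp hi).const_add (if t = 0 then (1 : ℂ) else 0)
    rw [add_zero] at this
    exact this
  linear_combination h4

lemma cgf_rk_arith (hs : ‖s‖ < 1 / 2) (h0 : s ≠ 0) (t : ℕ) :
    cgf (fun m => (t : ℤ) ≤ rk m ∧ 11 ∣ rk m - t) s
      = (if t = 0 then 1 else 0) + pgf s * (rkU s t - rkU s (t + 1)) :=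
  cgf_arith hs h0 (cgf_eq_rkS hs h0 (cgf_rk_ge hs)) t

lemma cgf_neg_rk_arith (hs : ‖s‖ < 1 / 2) (h0 : s ≠ 0) (t : ℕ) :
    cgf (fun m => (t : ℤ) ≤ -rk m ∧ 11 ∣ -rk m - t) s
      = (if t = 0 then 1 else 0) + pgf s * (rkU s t - rkU s (t + 1)) := by
  refine cgf_arith hs h0 (fun t => ?_) t
  rw [← cgf_eq_rkS hs h0 (cgf_rk_le hs) t]
  exact cgf_congr fun m => le_neg

/-- The generating function of the partitions with rank in a residue class modulo 11. -/
noncomputable def rankGF (a : ℤ) (s : ℂ) : ℂ := cgf (fun m => rk m % 11 = a) s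

lemma pgf_mul_qp (hs : ‖s‖ < 1 / 2) : pgf s * qp s s = 1 := tsum_pow_wt_mul hs

lemma rankGF_eq (hs : ‖s‖ < 1 / 2) (h0 : s ≠ 0) {a : ℕ} (ha : 0 < a) (ha' : a < 11) :
    rankGF a s * qp s s = lr s (a - 1) - lr s (a - 2) := by
  have hn : ‖s‖ < 1 := by linarith
  have h1 : rankGF a s = cgf (fun m => (a : ℤ) ≤ rk m ∧ 11 ∣ rk m - a) s
      + cgf (fun m => ((11 - a : ℕ) : ℤ) ≤ -rk m ∧ 11 ∣ -rk m - ((11 - a : ℕ) : ℤ)) s := by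
    rw [← cgf_or hs fun m _ => by omega]
    exact cgf_congr fun m => by omega
  rw [h1, cgf_rk_arith hs h0, cgf_neg_rk_arith hs h0, if_neg (by omega), if_neg (by omega),
    lr_eq hn h0, lr_eq hn h0, Nat.cast_sub ha'.le]
  push_cast
  rw [show (10 : ℤ) - (a - 1) = 11 - a by ring, show (10 : ℤ) - (a - 2) = 11 - a + 1 by ring,
    show (a : ℤ) - 1 + 2 = a + 1 by ring, show (a : ℤ) - 2 + 2 = a by ring]
  linear_combination (rkU s a - rkU s (a + 1) + rkU s (11 - a) - rkU s (11 - a + 1))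
    * pgf_mul_qp hs

lemma rankGF_zero_eq (hs : ‖s‖ < 1 / 2) (h0 : s ≠ 0) :
    rankGF 0 s * qp s s = 2 * lr s (-1) + 1 := by
  have hn : ‖s‖ < 1 := by linarith
  have h1 : rankGF 0 s = cgf (fun m => ((0 : ℕ) : ℤ) ≤ rk m ∧ 11 ∣ rk m - (0 : ℕ)) s
      + cgf (fun m => ((11 : ℕ) : ℤ) ≤ -rk m ∧ 11 ∣ -rk m - ((11 : ℕ) : ℤ)) s := by
    rw [← cgf_or hs fun m _ => by omega]
    exact cgf_congr fun m => by omega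
  have h2 : pgf s = cgf (fun m => ((0 : ℕ) : ℤ) ≤ rk m) s
      + cgf (fun m => rk m ≤ -((1 : ℕ) : ℤ)) s := by
    have := cgf_not hs fun m => ((0 : ℕ) : ℤ) ≤ rk m
    rw [← sub_eq_iff_eq_add', ← this]
    exact cgf_congr fun m => by omega
  rw [cgf_eq_rkS hs h0 (cgf_rk_ge hs) 0, cgf_eq_rkS hs h0 (cgf_rk_le hs) 1, ← rkU_sub hn h0,
    ← rkU_sub hn h0] at h2
  rw [h1, cgf_rk_arith hs h0, cgf_neg_rk_arith hs h0, lr_eq hn h0]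
  norm_num at h2 ⊢
  have h3 := pgf_mul_qp hs
  linear_combination (rkU s 11 - rkU s 12 + rkU s 0 - rkU s 1) * h3 - qp s s * h2 + h3
    - (rkU s 0 - rkU s 11 + rkU s 1 - rkU s 12) * h3

end
end RankCrank

namespace RankCrank
open Filter Topology Finset
section
variable {s a t : ℂ}

/-- The coefficients of the `q`-binomial series. -/
noncomputable def qbc (s a : ℂ) (w : ℕ) : ℂ :=
  (∏ i ∈ range w, (1 - a * s ^ i)) / ∏ i ∈ range w, (1 - s * s ^ i)

/-- The `q`-binomial series. -/
noncomputable def qbs (s a t : ℂ) : ℂ := ∑' w, t ^ w * qbc s a w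

lemma one_sub_mul_pow_ne_zero (hn : ‖s‖ < 1) (w : ℕ) : 1 - s * s ^ w ≠ 0 := by
  intro h
  have := norm_pow_lt_one hn w.succ_ne_zero
  rw [pow_succ', ← sub_eq_zero.mp h, norm_one] at this
  exact lt_irrefl _ this

lemma qbc_zero : qbc s a 0 = 1 := by simp [qbc]

lemma qbc_succ (hn : ‖s‖ < 1) (w : ℕ) :
    qbc s a (w + 1) * (1 - s * s ^ w) = qbc s a w * (1 - a * s ^ w) := by
  have := one_sub_mul_pow_ne_zero hn w
  rw [qbc, qbc, prod_range_succ, prod_range_succ, mul_div_mul_comm, mul_assoc,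
    div_mul_cancel₀ _ this]

lemma tendsto_prod_range (hn : ‖s‖ < 1) (z : ℂ) :
    Tendsto (fun n => ∏ i ∈ range n, (1 - z * s ^ i)) atTop (𝓝 (qp s z)) :=
  (qp_multipliable hn z).hasProd.tendsto_prod_nat

lemma exists_norm_qbc_le (hn : ‖s‖ < 1) (a : ℂ) : ∃ K, ∀ w, ‖qbc s a w‖ ≤ K := by
  obtain ⟨K, hK⟩ := (Metric.isBounded_range_of_tendsto _ ((tendsto_prod_range hn a).div
    (tendsto_prod_range hn s) (qp_self_ne_zero hn))).exists_norm_le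
  exact ⟨K, fun w => hK _ ⟨w, rfl⟩⟩

lemma norm_qbs_term_le {K : ℝ} (hK : ∀ w, ‖qbc s a w‖ ≤ K) (w : ℕ) :
    ‖t ^ w * qbc s a w‖ ≤ ‖t‖ ^ w * K := by
  rw [norm_mul, norm_pow]
  exact mul_le_mul_of_nonneg_left (hK w) (by positivity)

lemma qbs_summable (hn : ‖s‖ < 1) (ht : ‖t‖ < 1) : Summable fun w => t ^ w * qbc s a w := by
  obtain ⟨K, hK⟩ := exists_norm_qbc_le hn a
  exact ((summable_geometric_of_lt_one (norm_nonneg t) ht).mul_right K).of_norm_bounded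
    (norm_qbs_term_le hK)

lemma norm_mul_lt_one (hn : ‖s‖ < 1) (ht : ‖t‖ < 1) : ‖t * s‖ < 1 := by
  rw [norm_mul]
  exact mul_lt_one_of_nonneg_of_lt_one_left (norm_nonneg _) ht hn.le

lemma qbs_functional (hn : ‖s‖ < 1) (ht : ‖t‖ < 1) :
    (1 - t) * qbs s a t = (1 - a * t) * qbs s a (t * s) := by
  have h1 := qbs_summable (a := a) hn ht
  have h2 := qbs_summable (a := a) hn (norm_mul_lt_one hn ht)
  have h : qbs s a t - qbs s a (t * s) = t * qbs s a t - a * t * qbs s a (t * s) := by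
    rw [qbs, qbs, ← h1.tsum_sub h2, (h1.sub h2).tsum_eq_zero_add, ← tsum_mul_left, ← tsum_mul_left,
      ← (h1.mul_left _).tsum_sub (h2.mul_left _)]
    rw [pow_zero, pow_zero, sub_self, zero_add]
    refine tsum_congr fun w => ?_
    have := qbc_succ (a := a) hn w
    linear_combination t ^ (w + 1) * this
  linear_combination h

lemma qbs_iterate (hn : ‖s‖ < 1) (ht : ‖t‖ < 1) (n : ℕ) :
    qbs s a t * ∏ i ∈ range n, (1 - t * s ^ i)
      = qbs s a (t * s ^ n) * ∏ i ∈ range n, (1 - a * t * s ^ i) := by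
  induction n with
  | zero => simp
  | succ n ih =>
    have hlt : ‖t * s ^ n‖ < 1 := by
      rw [norm_mul, norm_pow]
      exact mul_lt_one_of_nonneg_of_lt_one_left (norm_nonneg _) ht
        (pow_le_one₀ (norm_nonneg _) hn.le)
    have := qbs_functional (a := a) hn hlt
    rw [prod_range_succ, prod_range_succ, ← mul_assoc, ih, pow_succ, ← mul_assoc t]
    linear_combination (∏ i ∈ range n, (1 - a * t * s ^ i)) * this

/-- The `q`-binomial theorem. -/
lemma qbs_mul_qp (hn : ‖s‖ < 1) (ht : ‖t‖ < 1) : qbs s a t * qp s t = qp s (a * t) := by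
  obtain ⟨K, hK⟩ := exists_norm_qbc_le hn a
  have h1 : Tendsto (fun n => qbs s a (t * s ^ n)) atTop
      (𝓝 (∑' w : ℕ, if w = 0 then 1 else 0)) := by
    refine tendsto_tsum_of_dominated_convergence
      ((summable_geometric_of_lt_one (norm_nonneg t) ht).mul_right K) (fun w => ?_)
      (Eventually.of_forall fun n w => (norm_qbs_term_le hK w).trans ?_)
    · rcases eq_or_ne w 0 with rfl | hw
      · simp [qbc_zero]
      · have := ((tendsto_pow_atTop_nhds_zero_of_norm_lt_one (norm_pow_lt_one hn hw)).const_mul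
          (t ^ w)).mul_const (qbc s a w)
        rw [mul_zero, zero_mul] at this
        rw [if_neg hw]
        refine this.congr fun n => ?_
        rw [mul_pow, ← pow_mul, ← pow_mul, mul_comm w]
    · refine mul_le_mul_of_nonneg_right ?_ ((norm_nonneg _).trans (hK 0))
      refine pow_le_pow_left₀ (norm_nonneg _) ?_ w
      rw [norm_mul, norm_pow]
      exact mul_le_of_le_one_right (norm_nonneg _) (pow_le_one₀ (norm_nonneg _) hn.le)
  rw [tsum_ite_eq] at h1
  have h2 := h1.mul (tendsto_prod_range hn (a * t))
  rw [one_mul] at h2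
  exact tendsto_nhds_unique ((tendsto_prod_range hn t).const_mul _)
    (h2.congr fun n => (qbs_iterate hn ht n).symm)

end
end RankCrank

namespace RankCrank
open Filter Topology Finset
section
variable {s z : ℂ}

/-- The crank of the partition whose parts are the elements of `m` increased by one. -/
def ck (m : Multiset ℕ) : ℤ :=
  if m.count 0 = 0 then ((m.map Nat.succ).sup : ℤ)
  else ((m.filter (m.count 0 ≤ ·)).card : ℤ) - m.count 0

/-- A multiset is determined by the number of its zeros and its other elements. -/
def zerosEquiv : ℕ × Multiset ℕ ≃ Multiset ℕ where
  toFun p := Multiset.replicate p.1 0 + p.2.map Nat.succ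
  invFun m := (m.count 0, dropZeros m)
  left_inv p := by
    have h : ∀ i ∈ p.2.map Nat.succ, i ≠ 0 := fun i hi => by
      obtain ⟨a, _, rfl⟩ := Multiset.mem_map.mp hi
      exact a.succ_ne_zero
    ext1
    · simp only [Multiset.count_add, Multiset.count_replicate_self]
      rw [Multiset.count_eq_zero.mpr fun h0 => h 0 h0 rfl, add_zero]
    · simp only [dropZeros, Multiset.filter_add]
      rw [Multiset.filter_eq_self.mpr h, Multiset.filter_eq_nil.mpr, zero_add, map_pred_map_succ]
      exact fun a ha => not_not.mpr (Multiset.eq_of_mem_replicate ha)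
  right_inv m := by
    simp only [map_succ_dropZeros]
    conv_rhs => rw [← Multiset.filter_add_not (· = 0) m]
    rw [Multiset.filter_eq' m 0]

lemma zerosEquiv_apply (w : ℕ) (m : Multiset ℕ) :
    zerosEquiv (w, m) = Multiset.replicate w 0 + m.map Nat.succ := rfl

lemma count_zerosEquiv (w : ℕ) (m : Multiset ℕ) : (zerosEquiv (w, m)).count 0 = w :=
  congrArg Prod.fst (zerosEquiv.left_inv (w, m))

lemma wt_zerosEquiv (w : ℕ) (m : Multiset ℕ) : wt (zerosEquiv (w, m)) = w + (wt m + m.card) := by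
  rw [zerosEquiv_apply, wt, Multiset.sum_add, sum_map_succ]
  simp
  omega

lemma ck_zerosEquiv_zero (m : Multiset ℕ) :
    ck (zerosEquiv (0, m)) = (((m.map Nat.succ).map Nat.succ).sup : ℤ) := by
  rw [ck, if_pos (count_zerosEquiv 0 m)]
  simp [zerosEquiv_apply]

lemma ck_zerosEquiv_succ (v : ℕ) (m : Multiset ℕ) :
    ck (zerosEquiv (v + 1, m)) = ((m.filter (v ≤ ·)).card : ℤ) - (v + 1 : ℕ) := by
  rw [ck, count_zerosEquiv, if_neg v.succ_ne_zero, zerosEquiv_apply, Multiset.filter_add,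
    Multiset.filter_eq_nil.mpr, zero_add, Multiset.filter_map, Multiset.card_map]
  · simp
  · intro a ha
    rw [Multiset.eq_of_mem_replicate ha]
    omega

lemma prod_map_shift (x : ℕ → ℂ) (m : Multiset ℕ) :
    (m.map fun i => x i * s ^ (i + 2)).prod = (m.map x).prod * s ^ (wt m + m.card) := by
  induction m using Multiset.induction_on with
  | empty => simp [wt]
  | cons a m ih =>
    rw [Multiset.map_cons, Multiset.prod_cons, ih, Multiset.map_cons, Multiset.prod_cons,
      show wt (a ::ₘ m) + (a ::ₘ m).card = (a + 2) + (wt m + m.card) by simp [wt]; omega, pow_add]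
    ring

lemma prod_map_ite (v : ℕ) (m : Multiset ℕ) :
    (m.map fun i => if v ≤ i then z else 1).prod = z ^ (m.filter (v ≤ ·)).card := by
  induction m using Multiset.induction_on with
  | empty => simp
  | cons a m ih =>
    rw [Multiset.map_cons, Multiset.prod_cons, ih]
    by_cases h : v ≤ a
    · rw [if_pos h, Multiset.filter_cons_of_pos (p := (v ≤ ·)) _ h, Multiset.card_cons, pow_succ']
    · rw [if_neg h, Multiset.filter_cons_of_neg (p := (v ≤ ·)) _ h, one_mul]

lemma norm_mul_pow_add_two_le (hn : ‖s‖ < 1) {x : ℂ} (hx : ‖x‖ ≤ 1) (i : ℕ) :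
    ‖x * s ^ (i + 2)‖ ≤ ‖s‖ ^ (i + 1) := by
  rw [norm_mul, norm_pow]
  refine (mul_le_of_le_one_left (by positivity) hx).trans ?_
  exact pow_le_pow_of_le_one (norm_nonneg _) hn.le (by omega)

lemma qp_split (hn : ‖s‖ < 1) (x : ℂ) (n : ℕ) :
    qp s x = (∏ i ∈ range n, (1 - x * s ^ i)) * qp s (x * s ^ n) := by
  induction n with
  | zero => simp
  | succ n ih => rw [prod_range_succ, mul_assoc, pow_succ, ← mul_assoc x, ← qp_eq_mul hn]; exact ih

lemma wsum_crank (hs : ‖s‖ < 1 / 2) (hz : ‖z‖ = 1) (v : ℕ) :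
    wsum (fun i => (if v ≤ i then z else 1) * s ^ (i + 2)) * qp s (z * s)
      = (1 - s) * qbc s (z * s) (v + 1) := by
  have hn : ‖s‖ < 1 := by linarith
  have h1 := wsum_mul_tprod hs (y := fun i => (if v ≤ i then z else 1) * s ^ (i + 2)) fun i =>
    norm_mul_pow_add_two_le hn (by split_ifs <;> simp [hz]) i
  have e (i : ℕ) : (1 - (if v ≤ i + v then z else 1) * s ^ (i + v + 2))
      = 1 - z * s * s ^ (v + 1) * s ^ i := by
    rw [if_pos (by omega)]; ring
  have h2 : (∏ i ∈ range v, (1 - s * s ^ (i + 1))) * qp s (z * s * s ^ (v + 1))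
      = ∏' i, (1 - (if v ≤ i then z else 1) * s ^ (i + 2)) := by
    rw [← Multipliable.prod_mul_tprod_nat_mul' (k := v)]
    · simp_rw [e]
      refine congrArg (· * _) (prod_congr rfl fun i hi => ?_)
      rw [if_neg (by simpa using hi), pow_succ' s (i + 1), one_mul]
    · simp_rw [e]
      exact qp_multipliable hn _
  rw [← h2] at h1
  have h3 : ∏ i ∈ range (v + 1), (1 - s * s ^ i)
      = (∏ i ∈ range v, (1 - s * s ^ (i + 1))) * (1 - s) := by
    rw [prod_range_succ']; simp
  have h4 : (1 - s) ≠ 0 := by simpa using one_sub_mul_pow_ne_zero hn 0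
  have h5 : ∏ i ∈ range v, (1 - s * s ^ (i + 1)) ≠ 0 :=
    prod_ne_zero_iff.mpr fun i _ => one_sub_mul_pow_ne_zero hn (i + 1)
  rw [qbc, h3, qp_split hn (z * s) (v + 1), mul_div_assoc', eq_div_iff (mul_ne_zero h5 h4)]
  linear_combination (1 - s) * (∏ i ∈ range (v + 1), (1 - z * s * s ^ i)) * h1

/-- The two-variable crank generating function. -/
noncomputable def ckgf (s z : ℂ) : ℂ := ∑' m : Multiset ℕ, z ^ ck m * s ^ wt m

lemma norm_zpow_le_one (hz : ‖z‖ = 1) (k : ℤ) : ‖z ^ k‖ ≤ 1 := by simp [hz]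

lemma ckgf_split (hs : ‖s‖ < 1 / 2) (hz : ‖z‖ = 1) :
    ckgf s z = ∑' m : Multiset ℕ, z ^ ((m.map Nat.succ).map Nat.succ).sup * s ^ (wt m + m.card)
      + ∑' v : ℕ, (s / z) ^ (v + 1)
        * wsum (fun i => (if v ≤ i then z else 1) * s ^ (i + 2)) := by
  have hz0 : z ≠ 0 := norm_ne_zero_iff.mp (by rw [hz]; exact one_ne_zero)
  have h1 := summable_weight hs (g := fun m => z ^ ck m) fun m => norm_zpow_le_one hz _
  have h2 (v : ℕ) (m : Multiset ℕ) : z ^ ck (zerosEquiv (v + 1, m)) * s ^ wt (zerosEquiv (v + 1, m))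
      = (s / z) ^ (v + 1)
        * (m.map fun i => (if v ≤ i then z else 1) * s ^ (i + 2)).prod := by
    rw [ck_zerosEquiv_succ, wt_zerosEquiv, prod_map_shift, prod_map_ite, zpow_sub₀ hz0,
      zpow_natCast, zpow_natCast, pow_add s (v + 1), div_pow]
    ring
  have h3 (m : Multiset ℕ) : z ^ ck (zerosEquiv (0, m)) * s ^ wt (zerosEquiv (0, m))
      = z ^ ((m.map Nat.succ).map Nat.succ).sup * s ^ (wt m + m.card) := by
    rw [ck_zerosEquiv_zero, wt_zerosEquiv, zero_add, zpow_natCast]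
  generalize zerosEquiv = e at h2 h3
  have h4 : Summable fun p : ℕ × Multiset ℕ => z ^ ck (e p) * s ^ wt (e p) :=
    e.summable_iff.mpr h1
  have h5 : ckgf s z = ∑' p : ℕ × Multiset ℕ, z ^ ck (e p) * s ^ wt (e p) :=
    (e.tsum_eq fun m => z ^ ck m * s ^ wt m).symm
  rw [h5, h4.tsum_prod, h4.prod.tsum_eq_zero_add]
  simp_rw [h2, h3, tsum_mul_left]
  rfl

end
end RankCrank

namespace RankCrank
open Filter Topology Finset
section
variable {s z : ℂ}

lemma sup_map_succ_le (m : Multiset ℕ) (n : ℕ) :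
    (m.map Nat.succ).sup ≤ n ↔ ∀ i ∈ m, i < n := by
  simp [Multiset.sup_le]

lemma sup_map_succ_succ (m : Multiset ℕ) : ((m.map Nat.succ).map Nat.succ).sup
    = if (m.map Nat.succ).sup = 0 then 0 else (m.map Nat.succ).sup + 1 := by
  rcases eq_or_ne m 0 with rfl | h
  · simp
  · have h1 : m.map Nat.succ ≠ 0 := by simpa using h
    rw [sup_map_succ h1, if_neg]
    rw [sup_map_succ h]
    omega

/-- The generating function of partitions without ones and with parts at most `n + 1`. -/
noncomputable def gbd (s : ℂ) (n : ℕ) : ℂ := wsum fun i => if i < n then s ^ (i + 2) else 0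

lemma gbd_eq (n : ℕ) : gbd s n
    = ∑' m : Multiset ℕ, if (m.map Nat.succ).sup ≤ n then s ^ (wt m + m.card) else 0 := by
  refine tsum_congr fun m => ?_
  have := prod_map_shift (s := s) (fun i => if i < n then 1 else 0) m
  simp only [ite_mul, one_mul, zero_mul] at this
  rw [this]
  simp only [sup_map_succ_le]
  split_ifs with h
  · rw [Multiset.map_congr rfl fun i hi => if_pos (h i hi)]
    simp
  · push Not at h
    obtain ⟨i, hi, hin⟩ := h
    rw [Multiset.prod_eq_zero, zero_mul]
    exact Multiset.mem_map.mpr ⟨i, hi, if_neg (by omega)⟩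

lemma gbd_mul_prod (hs : ‖s‖ < 1 / 2) (n : ℕ) :
    gbd s n * ∏ i ∈ range n, (1 - s * s ^ (i + 1)) = 1 := by
  have h := wsum_mul_prod_eq_one (n := n) hs (y := fun i => if i < n then s ^ (i + 2) else 0) ?_ ?_
  · refine Eq.trans (congrArg (gbd s n * ·) (prod_congr rfl fun i hi => ?_)) h
    rw [if_pos (by simpa using hi), ← pow_succ' s (i + 1)]
  · intro i
    have := norm_mul_pow_add_two_le (s := s) (by linarith)
      (x := if i < n then 1 else 0) (by split_ifs <;> simp) i
    simpa using this
  · exact fun i hi => if_neg (by omega)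

lemma gbd_eq_qbc (hs : ‖s‖ < 1 / 2) (n : ℕ) : gbd s n = (1 - s) * qbc s 0 (n + 1) := by
  have hn : ‖s‖ < 1 := by linarith
  have h1 := gbd_mul_prod hs n
  have h4 : 1 - s ≠ 0 := by simpa using one_sub_mul_pow_ne_zero hn 0
  have h5 : ∏ i ∈ range n, (1 - s * s ^ (i + 1)) ≠ 0 :=
    prod_ne_zero_iff.mpr fun i _ => one_sub_mul_pow_ne_zero hn (i + 1)
  have h3 : ∏ i ∈ range (n + 1), (1 - s * s ^ i)
      = (∏ i ∈ range n, (1 - s * s ^ (i + 1))) * (1 - s) := by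
    rw [prod_range_succ']; simp
  rw [qbc, h3, mul_div_assoc', eq_div_iff (mul_ne_zero h5 h4)]
  simp only [zero_mul, sub_zero, prod_const_one]
  linear_combination (1 - s) * h1

lemma gbd_succ (hs : ‖s‖ < 1 / 2) (n : ℕ) : gbd s (n + 1) * (1 - s * s ^ (n + 1)) = gbd s n := by
  rw [gbd_eq_qbc hs, mul_assoc, qbc_succ (by linarith), gbd_eq_qbc hs]
  ring

lemma tsum_fiber_nat {F : Multiset ℕ → ℂ} (hF : Summable F) (N : Multiset ℕ → ℕ) :
    ∑' m, F m = ∑' n, ∑' m, if N m = n then F m else 0 := by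
  rw [← (hF.hasSum.tsum_fiberwise N).tsum_eq]
  refine tsum_congr fun n => ?_
  rw [_root_.tsum_subtype (N ⁻¹' {n}) F]
  refine tsum_congr fun m => ?_
  split_ifs with h
  · exact Set.indicator_of_mem (s := N ⁻¹' {n}) h F
  · exact Set.indicator_of_notMem (s := N ⁻¹' {n}) h F

lemma tsum_no_ones (hs : ‖s‖ < 1 / 2) (hz : ‖z‖ = 1) :
    ∑' m : Multiset ℕ, z ^ ((m.map Nat.succ).map Nat.succ).sup * s ^ (wt m + m.card)
      = s - z * s + (1 - s) * qbs s 0 (z * s) := by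
  have hn : ‖s‖ < 1 := by linarith
  have hg (g : Multiset ℕ → ℂ) (hg : ∀ m, ‖g m‖ ≤ 1) :
      Summable fun m : Multiset ℕ => g m * s ^ (wt m + m.card) := by
    have := summable_weight hs (g := fun m => g m * s ^ m.card) fun m => by
      rw [norm_mul, norm_pow]
      exact mul_le_one₀ (hg m) (by positivity) (pow_le_one₀ (norm_nonneg _) hn.le)
    refine this.congr fun m => ?_
    rw [pow_add]; ring
  have hF := hg (fun m => z ^ ((m.map Nat.succ).map Nat.succ).sup) fun m => by simp [hz]
  have hfib (n : ℕ) : (∑' m : Multiset ℕ, if (m.map Nat.succ).sup = n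
      then z ^ ((m.map Nat.succ).map Nat.succ).sup * s ^ (wt m + m.card) else 0)
      = z ^ (if n = 0 then 0 else n + 1) * ∑' m : Multiset ℕ,
        if (m.map Nat.succ).sup = n then s ^ (wt m + m.card) else 0 := by
    rw [← tsum_mul_left]
    refine tsum_congr fun m => ?_
    split_ifs with h1 h2 h2
    · rw [sup_map_succ_succ, if_pos (h1.trans h2)]
    · rw [sup_map_succ_succ, if_neg (h1 ▸ h2), h1]
    · simp
    · simp
  have hle (n : ℕ) : Summable fun m : Multiset ℕ =>
      if (m.map Nat.succ).sup ≤ n then s ^ (wt m + m.card) else 0 := by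
    have := hg (fun m => if (m.map Nat.succ).sup ≤ n then 1 else 0)
      fun m => by split_ifs <;> simp
    simpa using this
  have hstep (n : ℕ) : (∑' m : Multiset ℕ,
      if (m.map Nat.succ).sup = n + 1 then s ^ (wt m + m.card) else 0)
      = s ^ (n + 2) * ((1 - s) * qbc s 0 (n + 2)) := by
    have : gbd s (n + 1) - gbd s n = ∑' m : Multiset ℕ,
        if (m.map Nat.succ).sup = n + 1 then s ^ (wt m + m.card) else 0 := by
      rw [gbd_eq, gbd_eq, ← (hle _).tsum_sub (hle _)]
      refine tsum_congr fun m => ?_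
      rcases lt_trichotomy (m.map Nat.succ).sup (n + 1) with h | h | h
      · rw [if_pos (by omega), if_pos (by omega), if_neg (by omega), sub_self]
      · rw [if_pos (by omega), if_neg (by omega), if_pos (by omega), sub_zero]
      · rw [if_neg (by omega), if_neg (by omega), if_neg (by omega), sub_zero]
    rw [← this, ← gbd_succ hs n, ← gbd_eq_qbc hs (n + 1)]
    ring
  have hzero : (∑' m : Multiset ℕ,
      if (m.map Nat.succ).sup = 0 then s ^ (wt m + m.card) else 0) = 1 := by
    have h0 := gbd_mul_prod hs 0
    rw [gbd_eq] at h0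
    simpa using h0
  have hq := qbs_summable (a := 0) hn (t := z * s) (by rw [norm_mul, hz, one_mul]; exact hn)
  have hq1 := (summable_nat_add_iff 1).mpr hq
  have h4 : 1 - s ≠ 0 := by simpa using one_sub_mul_pow_ne_zero hn 0
  have hc : (1 - s) * qbc s 0 1 = 1 := by simp [qbc, h4]
  rw [tsum_fiber_nat hF (fun m => (m.map Nat.succ).sup)]
  simp_rw [hfib]
  have key (n : ℕ) : z ^ (if n + 1 = 0 then 0 else n + 1 + 1) * ∑' m : Multiset ℕ,
        (if (m.map Nat.succ).sup = n + 1 then s ^ (wt m + m.card) else 0)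
      = (1 - s) * ((z * s) ^ (n + 1 + 1) * qbc s 0 (n + 1 + 1)) := by
    rw [hstep, if_neg n.succ_ne_zero]
    ring
  rw [Summable.tsum_eq_zero_add]
  · simp_rw [key]
    rw [tsum_mul_left, hzero, qbs, hq.tsum_eq_zero_add, hq1.tsum_eq_zero_add, qbc_zero]
    simp only [if_true, zero_add, pow_zero, pow_one]
    linear_combination (-z * s) * hc
  · refine (summable_nat_add_iff 1).mp ?_
    simp_rw [key]
    exact ((summable_nat_add_iff 1).mpr hq1).mul_left _

lemma tsum_with_ones (hs : ‖s‖ < 1 / 2) (hz : ‖z‖ = 1) :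
    (∑' v : ℕ, (s / z) ^ (v + 1) * wsum (fun i => (if v ≤ i then z else 1) * s ^ (i + 2)))
      * qp s (z * s) = (1 - s) * (qbs s (z * s) (s / z) - 1) := by
  have hn : ‖s‖ < 1 := by linarith
  have hq := qbs_summable (a := z * s) hn (t := s / z) (by rw [norm_div, hz, div_one]; exact hn)
  rw [qbs, hq.tsum_eq_zero_add, qbc_zero, pow_zero, one_mul, add_sub_cancel_left,
    ← tsum_mul_right, ← tsum_mul_left]
  refine tsum_congr fun v => ?_
  rw [mul_assoc, wsum_crank hs hz]
  ring

/-- The crank generating function as an infinite product. -/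
lemma ckgf_mul_jg (hs : ‖s‖ < 1 / 2) (hz : ‖z‖ = 1) :
    (ckgf s z + (z - 1) * s) * jg s z = qp s s ^ 2 := by
  have hn : ‖s‖ < 1 := by linarith
  have hz0 : z ≠ 0 := norm_ne_zero_iff.mp (by rw [hz]; exact one_ne_zero)
  have h1 := tsum_with_ones hs hz
  have h2 := qbs_mul_qp (a := z * s) hn (t := s / z) (by rw [norm_div, hz, div_one]; exact hn)
  have h3 := qbs_mul_qp (a := 0) hn (t := z * s) (by rw [norm_mul, hz, one_mul]; exact hn)
  have h0 : qp s 0 = 1 := by simp [qp]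
  rw [zero_mul, h0] at h3
  rw [show z * s * (s / z) = s * s by field_simp] at h2
  rw [ckgf_split hs hz, tsum_no_ones hs hz, jg]
  have h5 : qp s s = (1 - s) * qp s (s * s) := qp_eq_mul hn s
  linear_combination qp s s * qp s (s / z) * h1 + qp s s * (1 - s) * h2
    + qp s s * (1 - s) * qp s (s / z) * h3 - qp s s * h5

end
end RankCrank

namespace RankCrank
open Filter Topology Finset
section
variable {s z : ℂ}

lemma thc_neg (hP : s ≠ 0) (n : ℤ) : thc s (-1) (-n) = thc s (-1) n * (s ^ n)⁻¹ := by
  obtain ⟨m, rfl⟩ : ∃ m, n = m + 1 := ⟨n - 1, by ring⟩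
  have hm : s ^ (m + 1) ≠ 0 := zpow_ne_zero _ hP
  rw [thc_neg_add_one (by norm_num), thc_add_one hP (by norm_num)]
  field_simp

lemma thc_lk (k n : ℤ) : thc (s ^ 1) (-s ^ k) n = thc s (-1) n * (s ^ k) ^ n := by
  rw [thc_mul_zpow, pow_one, neg_one_mul]

lemma zpow_ne_one (hn : ‖s‖ < 1) {n : ℤ} (h : n ≠ 0) : s ^ n ≠ 1 := fun h1 => by
  have := congrArg norm h1
  rw [norm_zpow, norm_one, zpow_eq_one_iff_right₀ (norm_nonneg s) hn.ne] at this
  exact h this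

lemma pow_eleven_zpow_ne_one (hn : ‖s‖ < 1) {n : ℤ} (h : n ≠ 0) : (s ^ 11) ^ n ≠ 1 :=
  zpow_ne_one (norm_pow_lt_one hn (by norm_num)) h

lemma lk_ten (hn : ‖s‖ < 1) (h0 : s ≠ 0) : lk s 10 = -lk s 0 := by
  rw [lk, lk, al, al, ← tsum_neg, ← (Equiv.neg ℤ).tsum_eq]
  refine tsum_congr fun n => ?_
  rcases eq_or_ne n 0 with rfl | h
  · simp
  have hx : (s ^ 11) ^ n ≠ 0 := zpow_ne_zero n (pow_ne_zero 11 h0)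
  rw [Equiv.neg_apply, zpow_neg]
  refine div_one_sub_inv hx ?_ ?_
  · rw [one_mul]
    exact sub_ne_zero.mpr (pow_eleven_zpow_ne_one hn h).symm
  · have e : (s ^ 11) ^ n = (s ^ (10 : ℤ)) ^ n * s ^ n := by
      rw [← mul_zpow]
      norm_cast
    have h1 : (s ^ (10 : ℤ)) ^ n ≠ 0 := zpow_ne_zero n (zpow_ne_zero 10 h0)
    have h2 : s ^ n ≠ 0 := zpow_ne_zero n h0
    rw [thc_lk, thc_lk, thc_neg h0, e, zpow_zero, one_zpow, zpow_neg]
    field_simp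

lemma one_sub_inv_eq_sum (hz : z ^ 11 = 1) {y : ℂ} (hy : y ^ 11 ≠ 1) :
    (1 - z * y)⁻¹ = ∑ j ∈ range 11, z ^ j * y ^ j / (1 - y ^ 11) := by
  have h := mul_neg_geom_sum (z * y) 11
  rw [mul_pow, hz, one_mul] at h
  have h1 : 1 - y ^ 11 ≠ 0 := sub_ne_zero.mpr hy.symm
  rw [← sum_div, eq_div_iff h1, ← h, ← mul_assoc, inv_mul_cancel₀, one_mul]
  · exact sum_congr rfl fun j _ => mul_pow _ _ _
  · exact left_ne_zero_of_mul (h ▸ h1)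

lemma lk_summable (hn : ‖s‖ < 1) (h0 : s ≠ 0) (k : ℤ) :
    Summable fun n => thc (s ^ 1) (-s ^ k) n / (1 - 1 * (s ^ 11) ^ n) :=
  al_summable (norm_pow_lt_one hn (by norm_num)) (pow_ne_zero 11 h0)
    (thc_summable (norm_pow_lt_one hn one_ne_zero) (pow_ne_zero 1 h0)
      (neg_ne_zero.mpr (zpow_ne_zero k h0))) one_ne_zero

lemma al_eq_sum_lk (hn : ‖s‖ < 1) (h0 : s ≠ 0) (hz : z ^ 11 = 1) :
    al s (thc s (-1)) z = (1 - z)⁻¹ + ∑ j ∈ range 11, z ^ j * lk s j := by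
  have h1 (j : ℕ) : Summable fun n : ℤ =>
      z ^ j * (thc (s ^ 1) (-s ^ (j : ℤ)) n / (1 - 1 * (s ^ 11) ^ n)) :=
    (lk_summable hn h0 j).mul_left _
  have h2 : ∑ j ∈ range 11, z ^ j * lk s j = ∑' n : ℤ, ∑ j ∈ range 11,
      z ^ j * (thc (s ^ 1) (-s ^ (j : ℤ)) n / (1 - 1 * (s ^ 11) ^ n)) := by
    rw [Summable.tsum_finsetSum fun j _ => h1 j]
    exact sum_congr rfl fun j _ => tsum_mul_left.symm
  have h3 (n : ℤ) : thc s (-1) n / (1 - z * s ^ n) = (if n = 0 then (1 - z)⁻¹ else 0)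
      + ∑ j ∈ range 11, z ^ j * (thc (s ^ 1) (-s ^ (j : ℤ)) n / (1 - 1 * (s ^ 11) ^ n)) := by
    rcases eq_or_ne n 0 with rfl | h
    · simp
    have e : (s ^ n) ^ 11 = (s ^ 11) ^ n := by
      rw [← zpow_natCast, ← zpow_natCast, zpow_comm]
    rw [if_neg h, zero_add, div_eq_mul_inv, one_sub_inv_eq_sum hz, mul_sum, e]
    · refine sum_congr rfl fun j _ => ?_
      have e2 : (s ^ n) ^ j = (s ^ (j : ℤ)) ^ n := by rw [← zpow_natCast (s ^ n), zpow_comm]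
      rw [thc_lk, one_mul, e2]
      ring
    · rw [e]
      exact pow_eleven_zpow_ne_one hn h
  rw [h2, al]
  simp_rw [h3]
  rw [Summable.tsum_add (summable_of_ne_finset_zero (s := {0}) fun n hn => if_neg (by simpa using hn))
    (summable_sum fun j _ => h1 j), tsum_ite_eq]

lemma gen_of_norm_one (hn : ‖s‖ < 1) (hz : ‖z‖ = 1) (hz1 : z ≠ 1) : Gen s z := fun n h => by
  rcases eq_or_ne n 0 with rfl | h0
  · simp [hz1] at h
  · have := congrArg norm h
    rw [norm_mul, norm_zpow, norm_one, hz, one_mul,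
      zpow_eq_one_iff_right₀ (norm_nonneg s) hn.ne] at this
    exact h0 this

lemma ckgf_eq_sum_lk (hs : ‖s‖ < 1 / 2) (h0 : s ≠ 0) (hz : z ^ 11 = 1) :
    (ckgf s z + (z - 1) * s) * qp s s = 1 + (1 - z) * ∑ j ∈ range 11, z ^ j * lk s j := by
  have hn : ‖s‖ < 1 := by linarith
  have hz1 : ‖z‖ = 1 := Complex.norm_eq_one_of_pow_eq_one hz (by norm_num)
  have hz0 : z ≠ 0 := norm_ne_zero_iff.mp (by rw [hz1]; exact one_ne_zero)
  have hE := qp_self_ne_zero hn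
  have h1 := ckgf_mul_jg hs hz1
  rcases eq_or_ne z 1 with rfl | hz2
  · rw [jg_one] at h1
    rw [sub_self, zero_mul, add_zero]
    apply mul_right_cancel₀ (pow_ne_zero 2 hE)
    linear_combination h1
  · have h2 := al_one_eq hn h0 hz0 (gen_of_norm_one hn hz1 hz2)
    rw [al_eq_sum_lk hn h0 hz, jt_eq_jg hn] at h2
    have h3 : 1 - z ≠ 0 := sub_ne_zero.mpr hz2.symm
    have h4 : jg s z ≠ 0 := fun h => by
      rw [h, mul_zero] at h1
      exact pow_ne_zero 2 hE h1.symm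
    have h5 : (1 - z) * ((1 - z)⁻¹ + ∑ j ∈ range 11, z ^ j * lk s j) * jg s z = qp s s ^ 3 := by
      rw [h2]
      field_simp
    rw [mul_add, mul_inv_cancel₀ h3] at h5
    apply mul_right_cancel₀ h4
    linear_combination qp s s * h1 - h5

end
end RankCrank

namespace RankCrank
open Filter Topology Finset
section
variable {s z : ℂ}

/-- The generating function of partitions with crank congruent to `a` modulo eleven. -/
noncomputable def crankGF (a : ℤ) (s : ℂ) : ℂ := cgf (fun m => ck m % 11 = a) s

lemma zpow_eq_pow_mod (hz : z ^ 11 = 1) (k : ℤ) {a : ℕ} (h : k % 11 = a) : z ^ k = z ^ a := by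
  have : z ^ (11 : ℤ) = 1 := by exact_mod_cast hz
  have hz0 : z ≠ 0 := by rintro rfl; norm_num at hz
  rw [← Int.emod_add_mul_ediv k 11, h, zpow_add₀ hz0, zpow_mul, this, one_zpow, mul_one,
    zpow_natCast]

lemma ckgf_eq_sum_crankGF (hs : ‖s‖ < 1 / 2) (hz : z ^ 11 = 1) :
    ckgf s z = ∑ a ∈ range 11, z ^ a * crankGF a s := by
  classical
  have h1 (a : ℕ) := (cgf_summable hs fun m => ck m % 11 = a).mul_left (z ^ a)
  rw [ckgf]
  simp_rw [crankGF, cgf, ← tsum_mul_left]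
  rw [← Summable.tsum_finsetSum fun a _ => h1 a]
  refine tsum_congr fun m => ?_
  have hk : ck m % 11 = ((ck m % 11).toNat : ℕ) := by omega
  rw [sum_eq_single (ck m % 11).toNat]
  · rw [if_pos hk, zpow_eq_pow_mod hz _ hk]
  · intro b _ hb
    rw [if_neg (by omega), mul_zero]
  · intro h
    exact absurd (mem_range.mpr (by omega)) h

lemma eq_zero_of_sum_pow_eq_zero {v : ℕ → ℂ}
    (h : ∀ z : ℂ, z ^ 11 = 1 → ∑ a ∈ range 11, z ^ a * v a = 0) {a : ℕ} (ha : a < 11) :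
    v a = 0 := by
  have hp := Complex.isPrimitiveRoot_exp 11 (by norm_num)
  set ζ := Complex.exp (2 * Real.pi * Complex.I / (11 : ℕ))
  have hf : Function.Injective fun j : Fin 11 => ζ ^ (j : ℕ) := fun i j hij =>
    Fin.ext (hp.pow_inj i.2 j.2 hij)
  have := Matrix.eq_zero_of_forall_index_sum_pow_mul_eq_zero (v := fun j : Fin 11 => v j) hf
    fun j => by
      rw [← h (ζ ^ (j : ℕ)) (by rw [← pow_mul, mul_comm, pow_mul, hp.pow_eq_one, one_pow])]
      exact Fin.sum_univ_eq_sum_range (fun i => (ζ ^ (j : ℕ)) ^ i * v i) 11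
  exact congrFun this ⟨a, ha⟩

lemma crankGF_residue (hs : ‖s‖ < 1 / 2) (h0 : s ≠ 0) {a : ℕ} (ha : a < 11) :
    (crankGF a s + (if a = 1 then s else 0) - (if a = 0 then s else 0)) * qp s s
      = (if a = 0 then 1 else 0) + lk s a - lk s (if a = 0 then 10 else a - 1) := by
  rw [← sub_eq_zero]
  refine eq_zero_of_sum_pow_eq_zero (v := fun a : ℕ =>
    (crankGF a s + (if a = 1 then s else 0) - (if a = 0 then s else 0)) * qp s s
      - ((if a = 0 then 1 else 0) + lk s a - lk s (if a = 0 then 10 else a - 1)))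
    (fun z hz => ?_) ha
  have h := ckgf_eq_sum_lk hs h0 hz
  rw [ckgf_eq_sum_crankGF hs hz] at h
  simp only [sum_range_succ, range_zero, sum_empty] at h ⊢
  norm_num at h ⊢
  linear_combination h - lk s 10 * hz

/-- The generating function of the crank residue zero, with the usual correction at `n = 1`. -/
lemma crankGF_zero_eq (hs : ‖s‖ < 1 / 2) (h0 : s ≠ 0) :
    (crankGF 0 s - s) * qp s s = 2 * lk s 0 + 1 := by
  have h := crankGF_residue hs h0 (a := 0) (by norm_num)
  norm_num [lk_ten (by linarith) h0] at h
  linear_combination h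

lemma crankGF_one_eq (hs : ‖s‖ < 1 / 2) (h0 : s ≠ 0) :
    (crankGF 1 s + s) * qp s s = lk s 1 - lk s 0 := by
  have h := crankGF_residue hs h0 (a := 1) (by norm_num)
  norm_num at h
  linear_combination h

end
end RankCrank

namespace RankCrank
open Filter Topology Finset
section
variable {s : ℂ}

lemma exists_parts_eq {n : ℕ} (π : Nat.Partition n) :
    π.parts = (π.parts.map Nat.pred).map Nat.succ :=
  (map_succ_map_pred fun _ hi => π.parts_pos hi).symm

lemma partitionRank_eq {n : ℕ} (π : Nat.Partition n) :
    partitionRank π = rk (π.parts.map Nat.pred) := by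
  rw [rk, partitionRank, ← exists_parts_eq, Multiset.card_map]

lemma partitionCrank_eq {n : ℕ} (π : Nat.Partition n) :
    partitionCrank π = ck (π.parts.map Nat.pred) := by
  rw [partitionCrank, ck]
  have h := exists_parts_eq π
  generalize π.parts.map Nat.pred = m at h
  have hc : (m.map Nat.succ).count 1 = m.count 0 :=
    Multiset.count_map_eq_count' Nat.succ m Nat.succ_injective 0
  rw [h, hc, Multiset.filter_map, Multiset.card_map]
  simp

lemma hasSum_cgf (hs : ‖s‖ < 1 / 2) (p : Multiset ℕ → Prop) [DecidablePred p] :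
    HasSum (fun n => ((univ.filter fun π : Nat.Partition n => p (π.parts.map Nat.pred)).card : ℂ)
      * s ^ n) (cgf p s) := by
  have h := hasSum_weight hs (g := fun m => if p m then 1 else 0)
    fun m => by split_ifs <;> simp
  simp only [sum_boole, ite_mul, one_mul, zero_mul] at h
  convert h using 1
  rw [cgf]
  exact tsum_congr fun m => by congr

lemma hasSum_rankCount (hs : ‖s‖ < 1 / 2) {a : ℤ} (ha : a % 11 = a) :
    HasSum (fun n => (rankCount a 11 n : ℂ) * s ^ n) (rankGF a s) := by
  have h := hasSum_cgf hs fun m => rk m % 11 = a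
  rw [rankGF]
  simpa only [rankCount, partitionRank_eq, ha] using h

lemma crankCount_eq (a : ℤ) (n : ℕ) (ha : a = 0 ∨ a = 1) :
    crankCount a n = ((univ.filter fun π : Nat.Partition n =>
      ck (π.parts.map Nat.pred) % 11 = a).card : ℤ) + if n = 1 then 2 * a - 1 else 0 := by
  have h11 : a % 11 = a := by omega
  rw [crankCount, h11]
  split_ifs with h1 h2 h3
  all_goals try simp only [partitionCrank_eq, add_zero]
  all_goals
    subst h1
    have hc : (univ.filter fun π : Nat.Partition 1 => ck (π.parts.map Nat.pred) % 11 = a) = ∅ := by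
      refine filter_eq_empty_iff.mpr fun π _ => ?_
      have : π.parts = {1} := by
        rw [Unique.eq_default π]
        rfl
      rw [this]
      simp [ck, Multiset.filter_singleton]
      omega
    rw [hc]
    simp
    omega

lemma hasSum_crankCount (hs : ‖s‖ < 1 / 2) {a : ℤ} (ha : a = 0 ∨ a = 1) :
    HasSum (fun n => (crankCount a n : ℂ) * s ^ n) (crankGF a s + (2 * a - 1) * s) := by
  have h := (hasSum_cgf hs fun m => ck m % 11 = a).add
    (hasSum_ite_eq 1 ((2 * (a : ℂ) - 1) * s ^ 1))
  rw [pow_one] at h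
  rw [crankGF]
  convert h using 2 with n
  rw [crankCount_eq a n ha]
  split_ifs with h1
  · subst h1
    push_cast
    ring
  · push_cast
    ring

end
end RankCrank

namespace RankCrank
open Filter Topology Finset
section
variable {q s : ℂ}

lemma hasSum_of_eq {f g : ℕ → ℂ} {a b : ℂ} (h : HasSum f a) (hf : ∀ n, g n = f n) (hab : b = a) :
    HasSum g b := by
  rwa [hab, funext hf]

lemma sum_pow_mul_eq_ite {ζ : ℂ} (hζ : IsPrimitiveRoot ζ 11) (n : ℕ) :
    ∑ j ∈ range 11, (ζ ^ j) ^ n = if 11 ∣ n then 11 else 0 := by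
  have e (j : ℕ) : (ζ ^ j) ^ n = (ζ ^ n) ^ j := by rw [← pow_mul, ← pow_mul, mul_comm]
  simp_rw [e]
  split_ifs with h
  · simp [(hζ.pow_eq_one_iff_dvd n).mpr h]
  · have h1 : ζ ^ n ≠ 1 := fun h1 => h ((hζ.pow_eq_one_iff_dvd n).mp h1)
    have h2 := mul_geom_sum (ζ ^ n) 11
    rw [← pow_mul, mul_comm n, pow_mul, hζ.pow_eq_one, one_pow, sub_self] at h2
    exact (mul_eq_zero.mp h2).resolve_left (sub_ne_zero.mpr h1)

/-- Averaging over the eleventh roots extracts the coefficients of index divisible by eleven. -/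
lemma hasSum_of_dissection {h G : ℕ → ℂ} (h0 : s ^ 11 = q)
    (H : ∀ t, t ^ 11 = q → HasSum (fun n => h n * t ^ n) (∑ r ∈ range 11, t ^ r * G r)) :
    HasSum (fun n => h (11 * n) * q ^ n) (G 0) := by
  have hζ := Complex.isPrimitiveRoot_exp 11 (by norm_num)
  set ζ := Complex.exp (2 * Real.pi * Complex.I / (11 : ℕ))
  have h1 : HasSum (fun n => ∑ j ∈ range 11, h n * (ζ ^ j * s) ^ n)
      (∑ j ∈ range 11, ∑ r ∈ range 11, (ζ ^ j * s) ^ r * G r) := by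
    refine hasSum_sum fun j _ => H _ ?_
    rw [mul_pow, ← pow_mul, mul_comm j, pow_mul, hζ.pow_eq_one, one_pow, one_mul, h0]
  have e1 (n : ℕ) : ∑ j ∈ range 11, h n * (ζ ^ j * s) ^ n
      = 11 * (if 11 ∣ n then h n * s ^ n else 0) := by
    have := sum_pow_mul_eq_ite hζ n
    simp_rw [mul_pow, mul_left_comm (h n)]
    rw [← sum_mul, this]
    split_ifs <;> simp
  have e2 : ∑ j ∈ range 11, ∑ r ∈ range 11, (ζ ^ j * s) ^ r * G r = 11 * G 0 := by
    rw [sum_comm, sum_eq_single 0]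
    · simp
    · intro r hr hr0
      have := sum_pow_mul_eq_ite hζ r
      rw [if_neg (fun hd => hr0 (Nat.eq_zero_of_dvd_of_lt hd (mem_range.mp hr)))] at this
      simp_rw [mul_pow, mul_assoc]
      rw [← sum_mul, this, zero_mul]
    · simp
  simp_rw [e1] at h1
  rw [e2, hasSum_mul_left_iff (by norm_num)] at h1
  have hinj : Function.Injective fun n : ℕ => 11 * n := fun a b hab => by simpa using hab
  rw [← hinj.hasSum_iff] at h1
  · refine hasSum_of_eq h1 (fun n => ?_) rfl
    rw [Function.comp_apply, if_pos (dvd_mul_right 11 n), pow_mul, h0]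
  · intro x hx
    refine if_neg fun ⟨k, hk⟩ => hx ⟨k, hk.symm⟩

lemma norm_lt_of_pow_eleven (hq : ‖q‖ < (1 / 2) ^ 11) (hs : s ^ 11 = q) : ‖s‖ < 1 / 2 := by
  rw [← hs, norm_pow] at hq
  exact lt_of_pow_lt_pow_left₀ 11 (by norm_num) hq

lemma lr_four (hs : ‖s‖ < 1 / 2) (h0 : s ≠ 0) : lr s 4 = 0 := by
  rw [lr_eq (by linarith) h0]
  norm_num

/-- A linear combination of rank and crank counts. -/
def comb (m x₂ x₃ x₄ x₅ : ℤ) (n : ℕ) : ℤ :=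
  m * (rankCount 0 11 n + 2 * rankCount 1 11 n + crankCount 1 n - crankCount 0 n)
    + x₂ * rankCount 2 11 n + x₃ * rankCount 3 11 n + x₄ * rankCount 4 11 n
    + x₅ * rankCount 5 11 n

/-- The generating function of a linear combination in terms of Appell sums. -/
lemma hasSum_comb (hs : ‖s‖ < 1 / 2) (h0 : s ≠ 0) {m x₂ x₃ x₄ x₅ : ℤ} {T : ℂ}
    (hT : (2 * m - x₂ : ℂ) * lr s 0 + (x₂ - x₃) * lr s 1 + (x₃ - x₄) * lr s 2
      + (x₄ - x₅) * lr s 3 + (-3 * m) * lk s 0 + m * lk s 1 = qp s s * T) :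
    HasSum (fun n => (comb m x₂ x₃ x₄ x₅ n : ℂ) * s ^ n) T := by
  have r (a : ℤ) (ha : a % 11 = a) := hasSum_rankCount hs ha
  have c (a : ℤ) (ha : a = 0 ∨ a = 1) := hasSum_crankCount hs ha
  have H := (((((((r 0 rfl).add ((r 1 rfl).mul_left 2)).add (c 1 (by simp))).sub
    (c 0 (by simp))).mul_left (m : ℂ)).add ((r 2 rfl).mul_left (x₂ : ℂ))).add
    ((r 3 rfl).mul_left (x₃ : ℂ))).add ((r 4 rfl).mul_left (x₄ : ℂ)) |>.add
    ((r 5 rfl).mul_left (x₅ : ℂ))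
  refine hasSum_of_eq H (fun n => ?_) ?_
  · simp only [comb]
    push_cast
    ring
  · have e0 := rankGF_zero_eq hs h0
    have e1 := rankGF_eq hs h0 (a := 1) (by norm_num) (by norm_num)
    have e2 := rankGF_eq hs h0 (a := 2) (by norm_num) (by norm_num)
    have e3 := rankGF_eq hs h0 (a := 3) (by norm_num) (by norm_num)
    have e4 := rankGF_eq hs h0 (a := 4) (by norm_num) (by norm_num)
    have e5 := rankGF_eq hs h0 (a := 5) (by norm_num) (by norm_num)
    have k0 := crankGF_zero_eq hs h0
    have k1 := crankGF_one_eq hs h0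
    norm_num [lr_four hs h0] at e0 e1 e2 e3 e4 e5
    apply mul_left_cancel₀ (qp_self_ne_zero (by linarith : ‖s‖ < 1))
    rw [← hT]
    push_cast
    linear_combination -m * (e0 + 2 * e1 + k1 - k0) - x₂ * e2 - x₃ * e3 - x₄ * e4 - x₅ * e5

lemma exists_pow_eleven_eq (q : ℂ) : ∃ s, s ^ 11 = q :=
  IsAlgClosed.exists_pow_nat_eq q (by norm_num)

lemma hasSum_comb_eleven_mul (hq : ‖q‖ < (1 / 2) ^ 11) (h0 : q ≠ 0) {m x₂ x₃ x₄ x₅ : ℤ}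
    {G : ℕ → ℂ} (hG : ∀ s, ‖s‖ < 1 → s ≠ 0 → s ^ 11 = q →
      (2 * m - x₂ : ℂ) * lr s 0 + (x₂ - x₃) * lr s 1 + (x₃ - x₄) * lr s 2
      + (x₄ - x₅) * lr s 3 + (-3 * m) * lk s 0 + m * lk s 1
      = qp s s * ∑ r ∈ range 11, s ^ r * G r) :
    HasSum (fun n => (comb m x₂ x₃ x₄ x₅ (11 * n) : ℂ) * q ^ n) (G 0) := by
  obtain ⟨s, hs⟩ := exists_pow_eleven_eq q
  refine hasSum_of_dissection (h := fun n => (comb m x₂ x₃ x₄ x₅ n : ℂ)) hs fun t ht => ?_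
  have ht1 := norm_lt_of_pow_eleven hq ht
  have ht0 : t ≠ 0 := by
    rintro rfl
    exact h0 (by rw [← ht]; norm_num)
  exact hasSum_comb ht1 ht0 (hG t (by linarith) ht0 ht)

lemma hasSum_combA (hq : ‖q‖ < (1 / 2) ^ 11) (h0 : q ≠ 0) :
    HasSum (fun n => (comb 1 (-2) 0 (-1) 0 (11 * n) : ℂ) * q ^ n)
      (11 * (q ^ 2 * bj q ^ 14 /
        (br q 1 ^ 2 * br q 2 ^ 3 * br q 3 ^ 2 * br q 4 ^ 3 * br q 5 ^ 3))) := by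
  have h1 : ‖q‖ < 1 := hq.trans (by norm_num)
  refine hasSum_of_eq (hasSum_comb_eleven_mul hq h0
    (G := fun r => hmon q r * polyA (ux q) (uy q) r + corr q 4 (-2) 1 (-1) r)
    fun s hn h0 hs => ?_) (fun _ => rfl) ?_
  · rw [← dissection_polyA hn h0 hs]
    push_cast
    ring
  · simp [corr, hmon_zero_polyA h1 h0]

lemma hasSum_combB (hq : ‖q‖ < (1 / 2) ^ 11) (h0 : q ≠ 0) :
    HasSum (fun n => (comb 1 3 (-3) 0 (-3) (11 * n) : ℂ) * q ^ n)
      (11 * (q * bj q ^ 14 /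
        (br q 1 ^ 2 * br q 2 ^ 4 * br q 3 ^ 4 * br q 4 ^ 2 * br q 5))) := by
  have h1 : ‖q‖ < 1 := hq.trans (by norm_num)
  refine hasSum_of_eq (hasSum_comb_eleven_mul hq h0
    (G := fun r => hmon q r * polyB (ux q) (uy q) r + corr q (-1) 6 (-3) 3 r)
    fun s hn h0 hs => ?_) (fun _ => rfl) ?_
  · rw [← dissection_polyB hn h0 hs]
    push_cast
    ring
  · simp [corr, hmon_zero_polyB h1 h0]

lemma hasSum_combC (hq : ‖q‖ < (1 / 2) ^ 11) (h0 : q ≠ 0) :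
    HasSum (fun n => (comb 0 2 1 (-4) 1 (11 * n) : ℂ) * q ^ n)
      (11 * (q ^ 2 * bj q ^ 14 /
        (br q 1 ^ 2 * br q 2 ^ 2 * br q 3 ^ 4 * br q 4 ^ 3 * br q 5 ^ 2))) := by
  have h1 : ‖q‖ < 1 := hq.trans (by norm_num)
  refine hasSum_of_eq (hasSum_comb_eleven_mul hq h0
    (G := fun r => hmon q r * polyC (ux q) (uy q) r + corr q (-2) 1 5 (-5) r)
    fun s hn h0 hs => ?_) (fun _ => rfl) ?_
  · rw [← dissection_polyC hn h0 hs]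
    push_cast
    ring
  · simp [corr, hmon_zero_polyC h1 h0]

lemma hasSum_combD (hq : ‖q‖ < (1 / 2) ^ 11) (h0 : q ≠ 0) :
    HasSum (fun n => (comb (-1) 1 5 3 (-6) (11 * n) : ℂ) * q ^ n)
      (11 * (q ^ 3 * bj q ^ 14 /
        (br q 1 ^ 2 * br q 2 * br q 3 ^ 2 * br q 4 ^ 4 * br q 5 ^ 4))) := by
  have h1 : ‖q‖ < 1 := hq.trans (by norm_num)
  refine hasSum_of_eq (hasSum_comb_eleven_mul hq h0
    (G := fun r => hmon q r * polyD (ux q) (uy q) r + corr q (-3) (-4) 2 9 r)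
    fun s hn h0 hs => ?_) (fun _ => rfl) ?_
  · rw [← dissection_polyD hn h0 hs]
    push_cast
    ring
  · simp [corr, hmon_zero_polyD h1 h0]

end
end RankCrank

namespace RankCrank
open Filter Topology Finset
section
variable {f g : ℝ → ℝ}

/-- The function is given on the unit interval by a power series with nonnegative coefficients. -/
def NonnegCoeff (f : ℝ → ℝ) : Prop :=
  ∃ c : ℕ → ℝ, (∀ n, 0 ≤ c n) ∧ ∀ q, 0 < q → q < 1 → HasSum (fun n => c n * q ^ n) (f q)

/-- The function differs from one by a power series with nonnegative coefficients. -/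
def OnePlus (f : ℝ → ℝ) : Prop := NonnegCoeff fun q => f q - 1

lemma NonnegCoeff.congr (hf : NonnegCoeff f) (h : ∀ q, 0 < q → q < 1 → g q = f q) :
    NonnegCoeff g := by
  obtain ⟨c, hc, H⟩ := hf
  exact ⟨c, hc, fun q h0 h1 => by rw [h q h0 h1]; exact H q h0 h1⟩

lemma NonnegCoeff.nonneg (hf : NonnegCoeff f) {q : ℝ} (h0 : 0 < q) (h1 : q < 1) : 0 ≤ f q := by
  obtain ⟨c, hc, H⟩ := hf
  exact (H q h0 h1).nonneg fun n => mul_nonneg (hc n) (pow_nonneg h0.le n)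

lemma nonnegCoeff_pow (k : ℕ) : NonnegCoeff fun q => q ^ k := by
  refine ⟨fun n => if n = k then 1 else 0, fun n => by dsimp only; split_ifs <;> norm_num, fun q _ _ => ?_⟩
  simpa [ite_mul] using hasSum_single (f := fun n => (if n = k then 1 else 0) * q ^ n) k
    fun n hn => by simp [hn]

lemma nonnegCoeff_one : NonnegCoeff fun _ => 1 := by simpa using nonnegCoeff_pow 0

lemma NonnegCoeff.add (hf : NonnegCoeff f) (hg : NonnegCoeff g) :
    NonnegCoeff fun q => f q + g q := by
  obtain ⟨c, hc, H⟩ := hf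
  obtain ⟨d, hd, K⟩ := hg
  refine ⟨fun n => c n + d n, fun n => add_nonneg (hc n) (hd n), fun q h0 h1 => ?_⟩
  simpa only [add_mul] using (H q h0 h1).add (K q h0 h1)

lemma NonnegCoeff.mul (hf : NonnegCoeff f) (hg : NonnegCoeff g) :
    NonnegCoeff fun q => f q * g q := by
  obtain ⟨c, hc, H⟩ := hf
  obtain ⟨d, hd, K⟩ := hg
  refine ⟨fun n => ∑ k ∈ range (n + 1), c k * d (n - k),
    fun n => sum_nonneg fun k _ => mul_nonneg (hc _) (hd _), fun q h0 h1 => ?_⟩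
  have h := (H q h0 h1).summable.norm
  have k := (K q h0 h1).summable.norm
  have e := tsum_mul_tsum_eq_tsum_sum_range_of_summable_norm h k
  rw [(H q h0 h1).tsum_eq, (K q h0 h1).tsum_eq] at e
  beta_reduce
  rw [e]
  have e2 (n : ℕ) : (∑ i ∈ range (n + 1), c i * d (n - i)) * q ^ n
      = ∑ i ∈ range (n + 1), c i * q ^ i * (d (n - i) * q ^ (n - i)) := by
    rw [sum_mul]
    refine sum_congr rfl fun i hi => ?_
    rw [← Nat.add_sub_of_le (Nat.lt_succ_iff.mp (mem_range.mp hi)), pow_add,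
      Nat.add_sub_cancel_left]
    ring
  simp_rw [e2]
  exact (summable_norm_sum_mul_range_of_summable_norm h k).of_norm.hasSum

lemma NonnegCoeff.of_hasSum {d : ℕ → ℝ → ℝ} (hd : ∀ m, NonnegCoeff (d m))
    (h : ∀ q, 0 < q → q < 1 → HasSum (fun m => d m q) (f q)) : NonnegCoeff f := by
  choose c hc H using hd
  refine ⟨fun n => ∑' m, c m n, fun n => tsum_nonneg fun m => hc m n, fun q h0 h1 => ?_⟩
  have hs : Summable fun x : ℕ × ℕ => c x.1 x.2 * q ^ x.2 := by
    refine (summable_prod_of_nonneg fun x => mul_nonneg (hc _ _) (pow_nonneg h0.le _)).mpr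
      ⟨fun m => (H m q h0 h1).summable, ?_⟩
    refine (h q h0 h1).summable.congr fun m => ?_
    exact (H m q h0 h1).tsum_eq.symm
  have h2 := hs.hasSum
  rw [(h2.prod_fiberwise fun m => H m q h0 h1).unique (h q h0 h1)] at h2
  rw [← (Equiv.prodComm ℕ ℕ).hasSum_iff] at h2
  convert h2.prod_fiberwise fun n => (h2.summable.prod_factor n).hasSum using 2 with n
  exact tsum_mul_right.symm

lemma OnePlus.nonnegCoeff (hf : OnePlus f) : NonnegCoeff f :=
  (NonnegCoeff.add hf nonnegCoeff_one).congr fun q _ _ => by ring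

lemma onePlus_one : OnePlus fun _ => 1 :=
  ⟨fun _ => 0, fun _ => le_rfl, fun q _ _ => by simp⟩

lemma OnePlus.mul (hf : OnePlus f) (hg : OnePlus g) : OnePlus fun q => f q * g q :=
  (NonnegCoeff.add (NonnegCoeff.mul hf hg.nonnegCoeff) hg).congr fun q _ _ => by ring

lemma OnePlus.pow (hf : OnePlus f) (k : ℕ) : OnePlus fun q => f q ^ k := by
  induction k with
  | zero => simpa using onePlus_one
  | succ k ih => simpa only [pow_succ] using ih.mul hf

lemma onePlus_prod {F : ℕ → ℝ → ℝ} (hF : ∀ m, OnePlus (F m)) (N : ℕ) :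
    OnePlus fun q => ∏ m ∈ range N, F m q := by
  induction N with
  | zero => simpa using onePlus_one
  | succ N ih => simpa only [prod_range_succ] using ih.mul (hF N)

lemma OnePlus.of_tendsto_prod {F : ℕ → ℝ → ℝ} (hF : ∀ m, OnePlus (F m))
    (h : ∀ q, 0 < q → q < 1 → Tendsto (fun N => ∏ m ∈ range N, F m q) atTop (𝓝 (f q))) :
    OnePlus f := by
  have hd (N : ℕ) : NonnegCoeff fun q => (∏ m ∈ range N, F m q) * (F N q - 1) :=
    (onePlus_prod hF N).nonnegCoeff.mul (hF N)
  refine NonnegCoeff.of_hasSum hd fun q h0 h1 => ?_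
  rw [hasSum_iff_tendsto_nat_of_nonneg fun N => (hd N).nonneg h0 h1]
  refine ((h q h0 h1).sub_const 1).congr fun N => ?_
  have e (N : ℕ) : (∏ m ∈ range N, F m q) * (F N q - 1)
      = (∏ m ∈ range (N + 1), F m q) - ∏ m ∈ range N, F m q := by
    rw [prod_range_succ]; ring
  simp_rw [e]
  rw [sum_range_sub fun N => ∏ m ∈ range N, F m q]
  simp

lemma nonnegCoeff_geometric {k : ℕ} (hk : k ≠ 0) : NonnegCoeff fun q => q ^ k / (1 - q ^ k) := by
  refine NonnegCoeff.of_hasSum (d := fun m q => q ^ k * q ^ (k * m))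
    (fun m => (nonnegCoeff_pow k).mul (nonnegCoeff_pow _)) fun q h0 h1 => ?_
  simp_rw [pow_mul, div_eq_mul_inv]
  exact (hasSum_geometric_of_lt_one (pow_nonneg h0.le k) (pow_lt_one₀ h0.le h1 hk)).mul_left _

lemma one_sub_pow_pos {q : ℝ} (h0 : 0 < q) (h1 : q < 1) {k : ℕ} (hk : k ≠ 0) : 0 < 1 - q ^ k :=
  sub_pos.mpr (pow_lt_one₀ h0.le h1 hk)

lemma onePlus_inv {k : ℕ} (hk : k ≠ 0) : OnePlus fun q => (1 - q ^ k)⁻¹ :=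
  (nonnegCoeff_geometric hk).congr fun q h0 h1 => by
    have := (one_sub_pow_pos h0 h1 hk).ne'
    field_simp
    ring

lemma onePlus_pair {a b : ℕ} (ha : a ≠ 0) (hb : b ≠ 0) :
    OnePlus fun q => (1 - q ^ (a + b)) / ((1 - q ^ a) * (1 - q ^ b)) :=
  ((nonnegCoeff_geometric ha).add (nonnegCoeff_geometric hb)).congr fun q h0 h1 => by
    have h2 := (one_sub_pow_pos h0 h1 ha).ne'
    have h3 := (one_sub_pow_pos h0 h1 hb).ne'
    field_simp
    ring

end
end RankCrank

namespace RankCrank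
open Filter Topology Finset
section
variable {q : ℝ}

/-- The infinite `q`-Pochhammer symbol `(z; p)_∞` over the reals. -/
noncomputable def rqp (p z : ℝ) : ℝ := ∏' n : ℕ, (1 - z * p ^ n)

lemma rqp_multipliable {p : ℝ} (hp : ‖p‖ < 1) (z : ℝ) :
    Multipliable fun n : ℕ => 1 - z * p ^ n := by
  have : Summable fun n : ℕ => ‖-(z * p ^ n)‖ := by
    simp only [norm_neg, norm_mul, norm_pow]
    exact (summable_geometric_of_lt_one (norm_nonneg _) hp).mul_left _
  simpa only [sub_eq_add_neg] using multipliable_one_add_of_summable this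

lemma ofReal_rqp {p : ℝ} (hp : ‖p‖ < 1) (z : ℝ) : ((rqp p z : ℝ) : ℂ) = qp p z := by
  have h := (rqp_multipliable hp z).map_tprod Complex.ofRealHom Complex.continuous_ofReal
  rw [rqp, qp]
  simpa using h

lemma tendsto_rqp {p : ℝ} (hp : ‖p‖ < 1) (z : ℝ) :
    Tendsto (fun N => ∏ n ∈ range N, (1 - z * p ^ n)) atTop (𝓝 (rqp p z)) :=
  (rqp_multipliable hp z).hasProd.tendsto_prod_nat

lemma norm_pow_eleven_lt_one (h0 : 0 < q) (h1 : q < 1) : ‖q ^ 11‖ < 1 := by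
  rw [Real.norm_of_nonneg (by positivity)]
  exact pow_lt_one₀ h0.le h1 (by norm_num)

lemma rqp_ne_zero (h0 : 0 < q) (h1 : q < 1) {i : ℕ} (hi : i ≠ 0) : rqp (q ^ 11) (q ^ i) ≠ 0 := by
  have hp := norm_pow_eleven_lt_one h0 h1
  rw [← Complex.ofReal_ne_zero, ofReal_rqp hp]
  refine qp_ne_zero (by simpa using hp) fun n h => ?_
  have h2 : q ^ (i + 11 * n) = 1 := by
    rw [pow_add, pow_mul]
    exact_mod_cast h
  exact (pow_lt_one₀ h0.le h1 (by omega)).ne h2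

/-- The base `q ^ 11` symbols `(q ^ i; q ^ 11)_∞`. -/
noncomputable def aq (i : ℕ) (q : ℝ) : ℝ := rqp (q ^ 11) (q ^ i)

lemma tendsto_aq (h0 : 0 < q) (h1 : q < 1) (i : ℕ) :
    Tendsto (fun N => ∏ m ∈ range N, (1 - q ^ (11 * m + i))) atTop (𝓝 (aq i q)) := by
  refine (tendsto_rqp (norm_pow_eleven_lt_one h0 h1) (q ^ i)).congr fun N => ?_
  refine prod_congr rfl fun m _ => ?_
  rw [pow_add, pow_mul, mul_comm]

lemma aq_ne_zero (h0 : 0 < q) (h1 : q < 1) {i : ℕ} (hi : i ≠ 0) : aq i q ≠ 0 :=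
  rqp_ne_zero h0 h1 hi

lemma onePlus_inv_aq {i : ℕ} (hi : i ≠ 0) : OnePlus fun q => (aq i q)⁻¹ :=
  OnePlus.of_tendsto_prod (F := fun m q => (1 - q ^ (11 * m + i))⁻¹)
    (fun m => onePlus_inv (by omega)) fun q h0 h1 => by
      simpa only [prod_inv_distrib] using (tendsto_aq h0 h1 i).inv₀ (aq_ne_zero h0 h1 hi)

lemma prod_pair_eq (h0 : 0 < q) (h1 : q < 1) (N : ℕ) :
    ∏ m ∈ range N, ((1 - q ^ (11 * m + 1 + (11 * m + 10))) /
        ((1 - q ^ (11 * m + 1)) * (1 - q ^ (11 * m + 10))) *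
      ((1 - q ^ (11 * m + 12 + (11 * m + 10))) /
        ((1 - q ^ (11 * m + 12)) * (1 - q ^ (11 * m + 10)))))
    = (∏ k ∈ range (2 * N), (1 - q ^ (11 * k + 11))) * (1 - q) /
      ((∏ m ∈ range N, (1 - q ^ (11 * m + 1))) ^ 2 *
        (∏ m ∈ range N, (1 - q ^ (11 * m + 10))) ^ 2 * (1 - q ^ (11 * N + 1))) := by
  have hne {k : ℕ} (hk : k ≠ 0) : 1 - q ^ k ≠ 0 := (one_sub_pow_pos h0 h1 hk).ne'
  induction N with
  | zero =>
    have := hne one_ne_zero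
    rw [pow_one] at this
    simp [this]
  | succ N ih =>
    have ha := prod_ne_zero_iff.mpr fun m (_ : m ∈ range N) => hne (k := 11 * m + 1) (by omega)
    have hb := prod_ne_zero_iff.mpr fun m (_ : m ∈ range N) => hne (k := 11 * m + 10) (by omega)
    have hx := hne (k := 11 * N + 1) (by omega)
    have hy := hne (k := 11 * N + 10) (by omega)
    have hz := hne (k := 11 * N + 12) (by omega)
    rw [prod_range_succ, ih, mul_add_one, prod_range_succ _ (2 * N + 1), prod_range_succ _ (2 * N),
      prod_range_succ _ N, prod_range_succ _ N, show 11 * (N + 1) + 1 = 11 * N + 12 by ring,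
      show 11 * N + 1 + (11 * N + 10) = 11 * (2 * N) + 11 by ring,
      show 11 * N + 12 + (11 * N + 10) = 11 * (2 * N + 1) + 11 by ring]
    generalize (∏ m ∈ range N, (1 - q ^ (11 * m + 1))) = a at *
    generalize (∏ m ∈ range N, (1 - q ^ (11 * m + 10))) = b at *
    generalize 1 - q ^ (11 * N + 1) = x at *
    generalize 1 - q ^ (11 * N + 10) = y at *
    generalize 1 - q ^ (11 * N + 12) = z at *
    field_simp

lemma onePlus_aq_quotient : OnePlus fun q => aq 11 q * (1 - q) / (aq 1 q ^ 2 * aq 10 q ^ 2) := by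
  refine OnePlus.of_tendsto_prod (fun m => (onePlus_pair (a := 11 * m + 1) (b := 11 * m + 10)
    (by omega) (by omega)).mul (onePlus_pair (a := 11 * m + 12) (b := 11 * m + 10)
    (by omega) (by omega))) fun q h0 h1 => ?_
  simp_rw [prod_pair_eq h0 h1]
  have hx : Tendsto (fun N => 1 - q ^ (11 * N + 1)) atTop (𝓝 1) := by
    have := ((tendsto_pow_atTop_nhds_zero_of_lt_one h0.le h1).comp
      (tendsto_atTop_mono (fun N : ℕ => (by omega : N ≤ 11 * N + 1)) tendsto_id)).const_sub 1
    simpa using this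
  have h2 : Tendsto (fun N : ℕ => 2 * N) atTop atTop :=
    tendsto_atTop_mono (fun N : ℕ => (by omega : N ≤ 2 * N)) tendsto_id
  have ha := aq_ne_zero h0 h1 one_ne_zero
  have hb := aq_ne_zero h0 h1 (i := 10) (by norm_num)
  have := (((tendsto_aq h0 h1 11).comp h2).mul_const (1 - q)).div
    ((((tendsto_aq h0 h1 1).pow 2).mul ((tendsto_aq h0 h1 10).pow 2)).mul hx)
    (mul_ne_zero (mul_ne_zero (pow_ne_zero 2 ha) (pow_ne_zero 2 hb)) one_ne_zero)
  simpa [Pi.div_def] using this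

/-- The theta products `(q ^ i; q ^ 11)_∞ (q ^ (11 - i); q ^ 11)_∞`. -/
noncomputable def tq (i : ℕ) (q : ℝ) : ℝ := aq i q * aq (11 - i) q

lemma onePlus_inv_tq {i : ℕ} (hi : i ≠ 0) (h : i < 11) : OnePlus fun q => (tq i q)⁻¹ := by
  simpa only [tq, mul_inv] using (onePlus_inv_aq hi).mul (onePlus_inv_aq (i := 11 - i) (by omega))

lemma nonnegCoeff_theta_quotient (k e₂ e₃ e₄ e₅ : ℕ) :
    NonnegCoeff fun q => q ^ k * (aq 11 q / tq 1 q ^ 2) *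
      ((tq 2 q)⁻¹ ^ e₂ * (tq 3 q)⁻¹ ^ e₃ * (tq 4 q)⁻¹ ^ e₄ * (tq 5 q)⁻¹ ^ e₅) := by
  have h (i e : ℕ) (hi : i ≠ 0) (h : i < 11) := (onePlus_inv_tq hi h).pow e
  refine (((nonnegCoeff_pow k).mul (onePlus_aq_quotient.mul
    (onePlus_inv one_ne_zero)).nonnegCoeff).mul ((((h 2 e₂ (by norm_num) (by norm_num)).mul
      (h 3 e₃ (by norm_num) (by norm_num))).mul (h 4 e₄ (by norm_num) (by norm_num))).mul
      (h 5 e₅ (by norm_num) (by norm_num))).nonnegCoeff).congr fun q h0 h1 => ?_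
  have := (sub_pos.mpr h1).ne'
  congr 2
  simp only [tq, pow_one]
  field_simp

lemma ofReal_br (h0 : 0 < q) (h1 : q < 1) {i : ℕ} (hi : i ≤ 11) :
    br (q : ℂ) i = ((tq i q * aq 11 q : ℝ) : ℂ) := by
  have hp := norm_pow_eleven_lt_one h0 h1
  have e : (q : ℂ) ^ 11 / (q : ℂ) ^ (i : ℤ) = (q : ℂ) ^ (11 - i) := by
    rw [zpow_natCast, div_eq_iff (pow_ne_zero _ (by exact_mod_cast h0.ne')), ← pow_add,
      Nat.sub_add_cancel hi]
  rw [br, jt, e, tq, aq, aq, aq, Complex.ofReal_mul, Complex.ofReal_mul, ofReal_rqp hp,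
    ofReal_rqp hp, ofReal_rqp hp]
  push_cast
  rw [zpow_natCast]

lemma ofReal_bj (h0 : 0 < q) (h1 : q < 1) : bj (q : ℂ) = ((aq 11 q : ℝ) : ℂ) := by
  rw [bj, aq, ofReal_rqp (norm_pow_eleven_lt_one h0 h1)]
  push_cast
  rfl

lemma coeff_eq_zero_of_hasSum {d : ℕ → ℝ} {r : ℝ} (hr : 0 < r)
    (h : ∀ q, 0 < q → q < r → HasSum (fun n => d n * q ^ n) 0) (n : ℕ) : d n = 0 := by
  have hs {x : ℝ} (hx : ‖x‖ < r / 2) : Summable fun n => d n * x ^ n := by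
    refine Summable.of_norm_bounded (h (r / 2) (by linarith) (by linarith)).summable.norm
      fun n => ?_
    simp only [norm_mul, norm_pow]
    rw [Real.norm_of_nonneg (by linarith : 0 ≤ r / 2)]
    gcongr
  have hp : HasFPowerSeriesAt (fun x => ∑' n, d n * x ^ n)
      (FormalMultilinearSeries.ofScalars ℝ d) 0 := by
    rw [hasFPowerSeriesAt_iff]
    filter_upwards [Metric.ball_mem_nhds (0 : ℝ) (by linarith : 0 < r / 2)] with x hx
    simpa [FormalMultilinearSeries.coeff_ofScalars, mul_comm] using
      (hs (mem_ball_zero_iff.mp hx)).hasSum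
  have hz : ∃ᶠ x in 𝓝[≠] (0 : ℝ), ∑' n, d n * x ^ n = 0 := by
    have : ∀ᶠ x in 𝓝[>] (0 : ℝ), ∑' n, d n * x ^ n = 0 := by
      filter_upwards [Ioo_mem_nhdsGT hr] with x hx
      exact (h x hx.1 hx.2).tsum_eq
    exact this.frequently.filter_mono (nhdsWithin_mono _ fun x hx => ne_of_gt hx)
  have := hp.eq_zero_of_eventually (hp.analyticAt.frequently_zero_iff_eventually_zero.mp hz)
  rw [FormalMultilinearSeries.ofScalars_series_eq_zero] at this
  exact congrFun this n

lemma NonnegCoeff.coeff_nonneg {a : ℕ → ℤ} {f : ℝ → ℝ} {r : ℝ} (hr : 0 < r) (hr' : r ≤ 1)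
    (hf : NonnegCoeff f) (h : ∀ q : ℝ, 0 < q → q < r →
      HasSum (fun n => (a n : ℂ) * (q : ℂ) ^ n) (11 * (f q : ℂ))) (n : ℕ) : 0 ≤ a n := by
  obtain ⟨c, hc, H⟩ := hf
  have hd := coeff_eq_zero_of_hasSum (d := fun n => a n - 11 * c n) hr (fun q h0 h1 => ?_) n
  · have : (a n : ℝ) = 11 * c n := sub_eq_zero.mp hd
    have h2 := hc n
    exact_mod_cast (by linarith : (0 : ℝ) ≤ a n)
  · have h2 : HasSum (fun n => (a n : ℝ) * q ^ n) (11 * f q) := by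
      rw [← Complex.hasSum_ofReal]
      simpa using h q h0 h1
    simpa [sub_mul, mul_assoc] using h2.sub ((H q h0 (h1.trans_le hr')).mul_left 11)

lemma comb_nonneg_of_hasSum {m x₂ x₃ x₄ x₅ : ℤ} (k e₂ e₃ e₄ e₅ : ℕ)
    (he : e₂ + e₃ + e₄ + e₅ = 11)
    (h : ∀ q : ℂ, ‖q‖ < (1 / 2) ^ 11 → q ≠ 0 →
      HasSum (fun n => (comb m x₂ x₃ x₄ x₅ (11 * n) : ℂ) * q ^ n)
        (11 * (q ^ k * bj q ^ 14 / (br q 1 ^ 2 * br q 2 ^ e₂ * br q 3 ^ e₃ * br q 4 ^ e₄ *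
          br q 5 ^ e₅)))) (n : ℕ) : 0 ≤ comb m x₂ x₃ x₄ x₅ (11 * n) := by
  refine (nonnegCoeff_theta_quotient k e₂ e₃ e₄ e₅).coeff_nonneg
    (a := fun n => comb m x₂ x₃ x₄ x₅ (11 * n)) (r := (1 / 2) ^ 11) (by norm_num) (by norm_num)
    (fun q h0 h1 => ?_) n
  have hq : q < 1 := h1.trans (by norm_num)
  refine hasSum_of_eq (h q ?_ (by exact_mod_cast h0.ne')) (fun _ => rfl) ?_
  · rwa [Complex.norm_real, Real.norm_of_nonneg h0.le]
  have b (i : ℕ) (hi : i ≤ 11) := ofReal_br h0 hq hi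
  have b1 := b 1 (by norm_num)
  have b2 := b 2 (by norm_num)
  have b3 := b 3 (by norm_num)
  have b4 := b 4 (by norm_num)
  have b5 := b 5 (by norm_num)
  push_cast at b1 b2 b3 b4 b5
  rw [b1, b2, b3, b4, b5, ofReal_bj h0 hq]
  congr 1
  norm_cast
  have hj := aq_ne_zero h0 hq (i := 11) (by norm_num)
  generalize aq 11 q = j at *
  have e : j ^ 14 = j * (j ^ 2 * j ^ e₂ * j ^ e₃ * j ^ e₄ * j ^ e₅) := by
    simp only [← pow_add, ← pow_succ']
    congr 1
    omega
  rw [e]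
  simp only [mul_pow, inv_pow]
  field_simp

end
end RankCrank

namespace RankCrank

lemma comb_A_nonneg (n : ℕ) : 0 ≤ comb 1 (-2) 0 (-1) 0 (11 * n) :=
  comb_nonneg_of_hasSum 2 3 2 3 3 rfl (fun _ hq h0 => hasSum_combA hq h0) n

lemma comb_B_nonneg (n : ℕ) : 0 ≤ comb 1 3 (-3) 0 (-3) (11 * n) :=
  comb_nonneg_of_hasSum 1 4 4 2 1 rfl (fun _ hq h0 => by simpa using hasSum_combB hq h0) n

lemma comb_C_nonneg (n : ℕ) : 0 ≤ comb 0 2 1 (-4) 1 (11 * n) :=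
  comb_nonneg_of_hasSum 2 2 4 3 2 rfl (fun _ hq h0 => hasSum_combC hq h0) n

lemma comb_D_nonneg (n : ℕ) : 0 ≤ comb (-1) 1 5 3 (-6) (11 * n) :=
  comb_nonneg_of_hasSum 3 1 2 4 4 rfl (fun _ hq h0 => by simpa using hasSum_combD hq h0) n

end RankCrank

/-- Rank-crank inequalities for the residue 0 modulo 11. -/
theorem rank_crank_inequalities_residue_zero (n : ℕ) :
    ((rankCount 0 11 (11  *  n) : ℤ)  +  2 * (rankCount 1 11 (11  *  n) : ℤ)  +  crankCount 1 (11  *  n) ≥ 2 * (rankCount 2 11 (11  *  n) : ℤ)  +  (rankCount 4 11 (11  *  n) : ℤ)  +  crankCount 0 (11  *  n))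
    ∧ ((rankCount 0 11 (11  *  n) : ℤ)  +  2 * (rankCount 1 11 (11  *  n) : ℤ)  +  3 * (rankCount 2 11 (11  *  n) : ℤ)  +  crankCount 1 (11  *  n) ≥ 3 * (rankCount 3 11 (11  *  n) : ℤ)  +  3 * (rankCount 5 11 (11  *  n) : ℤ)  +  crankCount 0 (11  *  n))
    ∧ (2 * (rankCount 2 11 (11  *  n) : ℤ)  +  (rankCount 3 11 (11  *  n) : ℤ)  +  (rankCount 5 11 (11  *  n) : ℤ) ≥ 4 * (rankCount 4 11 (11  *  n) : ℤ))
    ∧ ((rankCount 2 11 (11  *  n) : ℤ)  +  5 * (rankCount 3 11 (11  *  n) : ℤ)  +  3 * (rankCount 4 11 (11  *  n) : ℤ)  +  crankCount 0 (11  *  n) ≥ (rankCount 0 11 (11  *  n) : ℤ)  +  2 * (rankCount 1 11 (11  *  n) : ℤ)  +  6 * (rankCount 5 11 (11  *  n) : ℤ)  +  crankCount 1 (11  *  n)) := by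
  have a := RankCrank.comb_A_nonneg n
  have b := RankCrank.comb_B_nonneg n
  have c := RankCrank.comb_C_nonneg n
  have d := RankCrank.comb_D_nonneg n
  unfold RankCrank.comb at a b c d
  refine ⟨?_, ?_, ?_, ?_⟩ <;> linarith
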